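/- For every μ ∈ [0, 0.5] and every c ∈ [2.1, 2.1 + 10⁻⁶], there exist a transversely non-degenerate retrograde symmetric periodic orbit γ^r_{μ,c} and a transversely non-degenerate direct symmetric periodic orbit γ^d_{μ,c} on Σ_{μ,c} such that the Conley–Zehnder index of the reduced monodromy path of γ^r_{μ,c} over its minimal period equals 3, and the Conley–Zehnder index of the reduced monodromy path of γ^d_{μ,c} over its minimal period equals 5. -/

import Mathlib

open Matrix Set

noncomputable section

/-- Phase space ℝ⁴. -/
abbrev V4 := Fin 4 → ℝ

/-- 2×2 real matrices. -/
abbrev M2 := Matrix (Fin 2) (Fin 2) ℝ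

/-- Euclidean norm on ℝ⁴. -/
def enorm4 (v : V4) : ℝ := Real.sqrt (∑ i, (v i)^2)

/-- The gradient of `H : ℝ⁴ → ℝ` with respect to the standard Euclidean structure. -/
def gradient4 (H : V4 → ℝ) (x : V4) : V4 := fun i => fderiv ℝ H x (Pi.single i (1:ℝ))

/-- The Hamiltonian vector field of `H` with respect to the symplectic form `dw ∧ dz`
in coordinates `(z₁, z₂, w₁, w₂)`:  ż = ∂H/∂w, ẇ = -∂H/∂z  (i.e. X_H = I₄∇H). -/
def symplGrad (H : V4 → ℝ) (x : V4) : V4 :=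
  ![fderiv ℝ H x (Pi.single (2:Fin 4) (1:ℝ)), fderiv ℝ H x (Pi.single (3:Fin 4) (1:ℝ)),
    -fderiv ℝ H x (Pi.single (0:Fin 4) (1:ℝ)), -fderiv ℝ H x (Pi.single (1:Fin 4) (1:ℝ))]

/-- `γ : ℝ → ℝ⁴` is a solution of Hamilton's equations for `H` staying in the domain `D`. -/
def IsOrbit (H : V4 → ℝ) (D : Set V4) (γ : ℝ → V4) : Prop :=
  ∀ t : ℝ, γ t ∈ D ∧ HasDerivAt γ (symplGrad H (γ t)) t

/-- The Jacobi Hamiltonian of the planar restricted three-body problem, in coordinates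
`(q₁, q₂, p₁, p₂)`:  H = ½|p|² + q₁p₂ - q₂p₁ - (1-μ)/|q-(-μ,0)| - μ/|q-(1-μ,0)|. -/
def JacobiH (μ : ℝ) (x : V4) : ℝ :=
  (1/2) * ((x 2)^2 + (x 3)^2) + x 0 * x 3 - x 1 * x 2
    - (1 - μ) / Real.sqrt ((x 0 + μ)^2 + (x 1)^2)
    - μ / Real.sqrt ((x 0 - (1 - μ))^2 + (x 1)^2)

/-- The domain of the Jacobi Hamiltonian: `q ∉ {(-μ,0), (1-μ,0)}`. -/
def JacobiDom (μ : ℝ) : Set V4 :=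
  {x | (x 0, x 1) ≠ (-μ, 0) ∧ (x 0, x 1) ≠ (1 - μ, 0)}

/-- The set of critical values of the Jacobi Hamiltonian. -/
def JacobiCritVals (μ : ℝ) : Set ℝ :=
  {v | ∃ x ∈ JacobiDom μ, fderiv ℝ (JacobiH μ) x = 0 ∧ JacobiH μ x = v}

/-- The first critical energy `c₁(μ) = -H(L₁)`, where `H(L₁)` is the smallest critical
value of the Jacobi Hamiltonian. -/
def firstCritEnergy (μ : ℝ) : ℝ := -sInf (JacobiCritVals μ)

/-- `|2z² - 1|` as a function of `(z₁, z₂)`, where `z = z₁ + i z₂`. -/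
def lcAbs (z1 z2 : ℝ) : ℝ := Real.sqrt ((2*(z1^2 - z2^2) - 1)^2 + (4*z1*z2)^2)

/-- The domain of the Levi-Civita Hamiltonian: `2z² ≠ 1`. -/
def LCDom : Set V4 := {x | lcAbs (x 0) (x 1) ≠ 0}

/-- The Levi-Civita Hamiltonian `K_{μ,c}` in coordinates `(z₁, z₂, w₁, w₂)`. -/
def Kham (μ c : ℝ) (x : V4) : ℝ :=
  (1/2) * ((x 2)^2 + (x 3)^2) + c * ((x 0)^2 + (x 1)^2) - (1 - μ)/2
    + 2 * ((x 0)^2 + (x 1)^2) * (x 0 * x 3 - x 1 * x 2)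
    - μ * (x 0 * x 3 + x 1 * x 2)
    - μ * ((x 0)^2 + (x 1)^2) / lcAbs (x 0) (x 1)

/-- `Σ_{μ,c}`: the connected component of `K_{μ,c}⁻¹(0)` containing the circle
`{(0,w) : |w|² = 1-μ}` (we use the point `(0,0,√(1-μ),0)` of that circle). -/
def SigmaLC (μ c : ℝ) : Set V4 :=
  connectedComponentIn {x : V4 | x ∈ LCDom ∧ Kham μ c x = 0} ![0, 0, Real.sqrt (1 - μ), 0]

/-- The anti-symplectic involution `R₊(z,w) = (z̄, -w̄)`. -/
def Rplus (x : V4) : V4 := ![x 0, -x 1, -x 2, x 3]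

/-- The anti-symplectic involution `R₋(z,w) = (-z̄, w̄)`. -/
def Rminus (x : V4) : V4 := ![-x 0, x 1, x 2, -x 3]

/-- A `T`-periodic orbit of the Levi-Civita Hamiltonian flow lying on `Σ_{μ,c}`. -/
def IsClosedOrbit (μ c T : ℝ) (γ : ℝ → V4) : Prop :=
  0 < T ∧ IsOrbit (Kham μ c) LCDom γ ∧ (∀ t, γ (t + T) = γ t) ∧ ∀ t, γ t ∈ SigmaLC μ c

/-- A `T`-periodic orbit is symmetric if, after a time shift, `γ(t) = R₊(γ(T-t))` for all `t`
or `γ(t) = R₋(γ(T-t))` for all `t`. -/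
def IsSymmetricOrbit (T : ℝ) (γ : ℝ → V4) : Prop :=
  ∃ s : ℝ, (∀ t, γ (s + t) = Rplus (γ (s + (T - t))))
         ∨ (∀ t, γ (s + t) = Rminus (γ (s + (T - t))))

/-- An orbit `(z(t),w(t))` is retrograde if `z₁w₂ - z₂w₁ > μ(z₁² - z₂²)` along it. -/
def IsRetrograde (μ : ℝ) (γ : ℝ → V4) : Prop :=
  ∀ t : ℝ, μ * ((γ t 0)^2 - (γ t 1)^2) < γ t 0 * γ t 3 - γ t 1 * γ t 2

/-- An orbit `(z(t),w(t))` is direct if `z₁w₂ - z₂w₁ < μ(z₁² - z₂²)` along it. -/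
def IsDirect (μ : ℝ) (γ : ℝ → V4) : Prop :=
  ∀ t : ℝ, γ t 0 * γ t 3 - γ t 1 * γ t 2 < μ * ((γ t 0)^2 - (γ t 1)^2)

/-- The crossing number of a `T`-periodic orbit: `#{t ∈ [0,T) : z₁(t) = 0 or z₂(t) = 0}`. -/
def crossingNumber (T : ℝ) (γ : ℝ → V4) : ℕ :=
  {t ∈ Set.Ico (0:ℝ) T | γ t 0 = 0 ∨ γ t 1 = 0}.ncard

/-- `γ'` is a reparametrization (time shift) of `γ`. -/
def IsTimeShift (γ γ' : ℝ → V4) : Prop := ∃ s : ℝ, ∀ t, γ' t = γ (t + s)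

/-- The action `𝒜(γ) = ∫₀ᵀ (w·ż - z·ẇ) dt` of a `T`-periodic Levi-Civita orbit. -/
def orbitAction (μ c T : ℝ) (γ : ℝ → V4) : ℝ :=
  ∫ t in (0:ℝ)..T,
    (γ t 2 * symplGrad (Kham μ c) (γ t) 0 + γ t 3 * symplGrad (Kham μ c) (γ t) 1
      - γ t 0 * symplGrad (Kham μ c) (γ t) 2 - γ t 1 * symplGrad (Kham μ c) (γ t) 3)

/-- Transverse non-degeneracy of a `T`-periodic orbit `γ` of `X_H` on a regular level set:
any `T`-periodic solution of the variational equation along `γ` starting tangent to the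
level set is a multiple of the Hamiltonian vector field. -/
def TransverseNondeg (H : V4 → ℝ) (T : ℝ) (γ : ℝ → V4) : Prop :=
  ∀ v : ℝ → V4,
    (∀ t : ℝ, HasDerivAt v (fderiv ℝ (symplGrad H) (γ t) (v t)) t) →
    v T = v 0 →
    fderiv ℝ H (γ 0) (v 0) = 0 →
    ∃ a : ℝ, v 0 = a • symplGrad H (γ 0)

/-- `T` is the minimal period of `γ`. -/
def IsMinimalPeriod (T : ℝ) (γ : ℝ → V4) : Prop :=
  0 < T ∧ (∀ t, γ (t + T) = γ t) ∧ ∀ T' : ℝ, 0 < T' → (∀ t, γ (t + T') = γ t) → T ≤ T'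

/-- The quaternionic matrix `I₄`. -/
def I4 : Matrix (Fin 4) (Fin 4) ℝ := !![0,0,1,0; 0,0,0,1; -1,0,0,0; 0,-1,0,0]

/-- The quaternionic matrix `J₄`. -/
def J4 : Matrix (Fin 4) (Fin 4) ℝ := !![0,1,0,0; -1,0,0,0; 0,0,0,-1; 0,0,1,0]

/-- The quaternionic matrix `K₄`. -/
def K4 : Matrix (Fin 4) (Fin 4) ℝ := !![0,0,0,-1; 0,0,1,0; 0,-1,0,0; 1,0,0,0]

/-- `Ω₂ = [[0,1],[-1,0]]`. -/
def Omega2 : M2 := !![0,1; -1,0]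

/-- `Ω₄ = -I₄`. -/
def Omega4 : Matrix (Fin 4) (Fin 4) ℝ := -I4

/-- The 4×2 frame matrix `F(x) = [U(x) V(x)]` with `U = J₄∇H/‖∇H‖`, `V = K₄∇H/‖∇H‖`. -/
def frameF (H : V4 → ℝ) (x : V4) : Matrix (Fin 4) (Fin 2) ℝ :=
  Matrix.of fun i j =>
    (if j = 0 then J4.mulVec (gradient4 H x) i else K4.mulVec (gradient4 H x) i)
      / enorm4 (gradient4 H x)

/-- `M` is the linearized flow `t ↦ dFl_t(γ(0))` along the orbit `γ` of `X_H`: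
`M(0) = id` and each column solves the variational equation. -/
def IsLinearizedFlow (H : V4 → ℝ) (γ : ℝ → V4) (M : ℝ → Matrix (Fin 4) (Fin 4) ℝ) : Prop :=
  M 0 = 1 ∧ ∀ j : Fin 4, ∀ t : ℝ,
    HasDerivAt (fun s => fun i => M s i j)
      (fderiv ℝ (symplGrad H) (γ t) (fun i => M t i j)) t

/-- The reduced monodromy path `Ψ(t) = Ω₂ᵀ F(γ(t))ᵀ Ω₄ M(t) F(γ(0))`. -/
def reducedMonodromy (H : V4 → ℝ) (γ : ℝ → V4)
    (M : ℝ → Matrix (Fin 4) (Fin 4) ℝ) (t : ℝ) : M2 :=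
  Omega2ᵀ * (frameF H (γ t))ᵀ * Omega4 * M t * frameF H (γ 0)

/-- The retraction `ρ(Ψ) = (ΨΨᵀ)^{-1/2}Ψ` of `SL(2,ℝ)` onto `SO(2)`, written explicitly. -/
def rho (Ψ : M2) : M2 :=
  (1 / Real.sqrt ((Ψ 0 0 + Ψ 1 1)^2 + (Ψ 0 1 - Ψ 1 0)^2)) •
    !![Ψ 0 0 + Ψ 1 1, Ψ 0 1 - Ψ 1 0; -(Ψ 0 1 - Ψ 1 0), Ψ 0 0 + Ψ 1 1]

/-- The rotation by angle `θ`. -/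
def rotMat (θ : ℝ) : M2 := !![Real.cos θ, -Real.sin θ; Real.sin θ, Real.cos θ]

/-- The Conley-Zehnder index of the path `ψ : [0,T] → SL(2,ℝ)` equals `k`: there is a
continuous angle `θ` with `θ(0) = 0` lifting `t ↦ ρ(ψ(t))`, and `k` is the even integer
closest to `θ(T)/π` if `tr ψ(T) > 2`, the odd integer closest to `θ(T)/π` if `tr ψ(T) < 2`. -/
def CZIndexIs (T : ℝ) (ψ : ℝ → M2) (k : ℤ) : Prop :=
  ∃ θ : ℝ → ℝ, ContinuousOn θ (Set.Icc 0 T) ∧ θ 0 = 0 ∧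
    (∀ t ∈ Set.Icc (0:ℝ) T, rho (ψ t) = rotMat (θ t)) ∧
    (((2:ℝ) < (ψ T).trace ∧ Even k) ∨ ((ψ T).trace < 2 ∧ Odd k)) ∧
    |θ T / Real.pi - (k:ℝ)| < 1

end
noncomputable section

namespace LCHill

/-! ### The reduced vector field -/

/-- The inverse distance to the second primary, as a function of `ρ = 2|z|²` and `C = cos θ`. -/
def invDist (ρ C : ℝ) : ℝ := (√(1 - 2 * ρ * C + ρ ^ 2))⁻¹

/-- `|z|²|ż|²` on the zero energy level. -/
def angSq (μ c ρ C : ℝ) : ℝ :=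
  ((1 - μ) * ρ + μ * (ρ ^ 2 * invDist ρ C)
    + (ρ ^ 4 - 2 * (μ * (ρ ^ 3 * C)) + μ ^ 2 * ρ ^ 2) / 2 - c * ρ ^ 2) / 2

/-- `ρ ∂_ρ` of `angSq`. -/
def angSqE (μ c ρ C : ℝ) : ℝ :=
  ((1 - μ) * ρ + μ * (2 * (ρ ^ 2 * invDist ρ C) - (ρ ^ 4 - ρ ^ 3 * C) * invDist ρ C ^ 3)
    + (4 * ρ ^ 4 - 6 * (μ * (ρ ^ 3 * C)) + 2 * (μ ^ 2 * ρ ^ 2)) / 2 - 2 * (c * ρ ^ 2)) / 2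

/-- `ρ ∂_ρ - 2` applied to `angSqE`. -/
def angSqQ (μ ρ C : ℝ) : ℝ :=
  (-((1 - μ) * ρ) + μ * ((3 * (ρ ^ 3 * C) - ρ ^ 4) * invDist ρ C ^ 3
      - 3 * (ρ ^ 4 * (1 - C ^ 2) * invDist ρ C ^ 5))
    + (8 * ρ ^ 4 - 6 * (μ * (ρ ^ 3 * C))) / 2) / 2

/-- The inverse of the modulus of the angular momentum `z × ż` on the zero energy level. -/
def invAng (μ c ρ p C : ℝ) : ℝ := (√(angSq μ c ρ C - p ^ 2))⁻¹

/-- Radial component of the reduced vector field, with the angle as time. -/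
def redR (μ c ρ p C : ℝ) : ℝ := ρ * (p * invAng μ c ρ p C)

/-- Momentum component of the reduced vector field, with the angle as time. -/
def redP (μ c s ρ p C : ℝ) : ℝ := angSqE μ c ρ C * invAng μ c ρ p C / 2 - s * ρ ^ 2

/-- `∂_ρ redR`. -/
def jac11 (μ c ρ p C : ℝ) : ℝ :=
  p * invAng μ c ρ p C * (1 - angSqE μ c ρ C * invAng μ c ρ p C / 2 * invAng μ c ρ p C)

/-- `∂_p redR`. -/
def jac12 (μ c ρ p C : ℝ) : ℝ := ρ * invAng μ c ρ p C * (1 + (p * invAng μ c ρ p C) ^ 2)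

/-- `ρ ∂_ρ redP`. -/
def jac21 (μ c s ρ p C : ℝ) : ℝ :=
  2 * redP μ c s ρ p C
    + (angSqQ μ ρ C / 2 - (angSqE μ c ρ C * invAng μ c ρ p C / 2) ^ 2) * invAng μ c ρ p C

/-- `∂_p redP`. -/
def jac22 (μ c ρ p C : ℝ) : ℝ :=
  p * invAng μ c ρ p C * (angSqE μ c ρ C * invAng μ c ρ p C / 2 * invAng μ c ρ p C)

/-- `∂_C` of `angSq`. -/
def angSqC (μ ρ C : ℝ) : ℝ := μ * ρ ^ 3 * (invDist ρ C ^ 3 - 1) / 2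

/-- `∂_C` of `angSqE`. -/
def angSqEC (μ ρ C : ℝ) : ℝ :=
  μ * ρ ^ 3 * (3 * invDist ρ C ^ 3 - 3 * ρ * (ρ - C) * invDist ρ C ^ 5 - 3) / 2

/-- `∂_C redR`. -/
def jac13 (μ c ρ p C : ℝ) : ℝ := -(ρ * p * invAng μ c ρ p C ^ 3 * angSqC μ ρ C / 2)

/-- `∂_C redP`. -/
def jac23 (μ c ρ p C : ℝ) : ℝ :=
  angSqEC μ ρ C * invAng μ c ρ p C / 2
    - angSqE μ c ρ C * invAng μ c ρ p C ^ 3 * angSqC μ ρ C / 4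

lemma hasDerivAt_inv_sqrt {g : ℝ → ℝ} {g' t : ℝ} (hg : HasDerivAt g g' t) (h0 : 0 < g t) :
    HasDerivAt (fun x => (√(g x))⁻¹) (-(g' * (√(g t))⁻¹ ^ 3 / 2)) t := by
  have hs : √(g t) ≠ 0 := (Real.sqrt_pos.2 h0).ne'
  refine ((hg.sqrt h0.ne').inv hs).congr_deriv ?_
  field_simp

section Derivatives

variable {μ c s : ℝ} {r p C : ℝ → ℝ} {r' p' C' t : ℝ}

lemma hasDerivAt_invDist (hr : HasDerivAt r r' t) (hC : HasDerivAt C C' t)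
    (h0 : 0 < 1 - 2 * r t * C t + r t ^ 2) :
    HasDerivAt (fun x => invDist (r x) (C x))
      (-((r t - C t) * r' - r t * C') * invDist (r t) (C t) ^ 3) t := by
  have h := (((hr.const_mul 2).mul hC).const_sub 1).add (hr.pow 2)
  refine (hasDerivAt_inv_sqrt h h0).congr_deriv ?_
  simp only [invDist, Pi.pow_apply, Pi.mul_apply, Pi.add_apply]
  push_cast
  ring

lemma hasDerivAt_angSq (hr : HasDerivAt r r' t) (hC : HasDerivAt C C' t)
    (h0 : 0 < 1 - 2 * r t * C t + r t ^ 2) (hr0 : r t ≠ 0) :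
    HasDerivAt (fun x => angSq μ c (r x) (C x))
      (angSqE μ c (r t) (C t) / r t * r' + angSqC μ (r t) (C t) * C') t := by
  have hG := hasDerivAt_invDist hr hC h0
  have h := ((((hr.const_mul (1 - μ)).add (((hr.pow 2).mul hG).const_mul μ)).add
    ((((hr.pow 4).sub ((((hr.pow 3).mul hC).const_mul μ).const_mul 2)).add
      ((hr.pow 2).const_mul (μ ^ 2))).div_const 2)).sub ((hr.pow 2).const_mul c)).div_const 2
  refine h.congr_deriv ?_
  simp only [angSqE, angSqC, Pi.pow_apply]
  push_cast
  field_simp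
  ring

lemma hasDerivAt_angSqE (hr : HasDerivAt r r' t) (hC : HasDerivAt C C' t)
    (h0 : 0 < 1 - 2 * r t * C t + r t ^ 2) (hr0 : r t ≠ 0) :
    HasDerivAt (fun x => angSqE μ c (r x) (C x))
      ((2 * angSqE μ c (r t) (C t) + angSqQ μ (r t) (C t)) / r t * r'
        + angSqEC μ (r t) (C t) * C') t := by
  have hG := hasDerivAt_invDist hr hC h0
  have h := ((((hr.const_mul (1 - μ)).add ((((((hr.pow 2).mul hG).const_mul 2)).sub
    (((hr.pow 4).sub ((hr.pow 3).mul hC)).mul (hG.pow 3))).const_mul μ)).add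
    (((((hr.pow 4).const_mul 4).sub ((((hr.pow 3).mul hC).const_mul μ).const_mul 6)).add
      (((hr.pow 2).const_mul (μ ^ 2)).const_mul 2)).div_const 2)).sub
        (((hr.pow 2).const_mul c).const_mul 2)).div_const 2
  have hG2 : invDist (r t) (C t) ^ 2 * (1 - 2 * r t * C t + r t ^ 2) = 1 := by
    rw [invDist, inv_pow, Real.sq_sqrt h0.le, inv_mul_cancel₀ h0.ne']
  refine h.congr_deriv ?_
  simp only [angSqE, angSqEC, angSqQ, Pi.pow_apply, Pi.mul_apply, Pi.sub_apply]
  set G := invDist (r t) (C t)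
  push_cast
  field_simp
  linear_combination (6 * μ * r t ^ 3 * G ^ 3 * r') * hG2

lemma hasDerivAt_invAng (hr : HasDerivAt r r' t) (hp : HasDerivAt p p' t)
    (hC : HasDerivAt C C' t)
    (h0 : 0 < 1 - 2 * r t * C t + r t ^ 2) (hr0 : r t ≠ 0)
    (hl : 0 < angSq μ c (r t) (C t) - p t ^ 2) :
    HasDerivAt (fun x => invAng μ c (r x) (p x) (C x))
      (-((angSqE μ c (r t) (C t) / r t * r' + angSqC μ (r t) (C t) * C' - 2 * p t * p')
        * invAng μ c (r t) (p t) (C t) ^ 3 / 2)) t := by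
  refine (hasDerivAt_inv_sqrt
    ((hasDerivAt_angSq (μ := μ) (c := c) hr hC h0 hr0).sub (hp.pow 2)) hl).congr_deriv ?_
  simp [invAng]

lemma hasDerivAt_redR (hr : HasDerivAt r r' t) (hp : HasDerivAt p p' t) (hC : HasDerivAt C C' t)
    (h0 : 0 < 1 - 2 * r t * C t + r t ^ 2) (hr0 : r t ≠ 0)
    (hl : 0 < angSq μ c (r t) (C t) - p t ^ 2) :
    HasDerivAt (fun x => redR μ c (r x) (p x) (C x))
      (jac11 μ c (r t) (p t) (C t) * r' + jac12 μ c (r t) (p t) (C t) * p'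
        + jac13 μ c (r t) (p t) (C t) * C') t := by
  refine (hr.mul (hp.mul (hasDerivAt_invAng hr hp hC h0 hr0 hl))).congr_deriv ?_
  simp only [jac11, jac12, jac13, Pi.mul_apply]
  field_simp
  ring

lemma hasDerivAt_redP (hr : HasDerivAt r r' t) (hp : HasDerivAt p p' t) (hC : HasDerivAt C C' t)
    (h0 : 0 < 1 - 2 * r t * C t + r t ^ 2) (hr0 : r t ≠ 0)
    (hl : 0 < angSq μ c (r t) (C t) - p t ^ 2) :
    HasDerivAt (fun x => redP μ c s (r x) (p x) (C x))
      (jac21 μ c s (r t) (p t) (C t) / r t * r' + jac22 μ c (r t) (p t) (C t) * p'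
        + jac23 μ c (r t) (p t) (C t) * C') t := by
  refine ((((hasDerivAt_angSqE hr hC h0 hr0).mul
    (hasDerivAt_invAng (μ := μ) (c := c) hr hp hC h0 hr0 hl)).div_const 2).sub
      ((hr.pow 2).const_mul s)).congr_deriv ?_
  simp only [jac21, jac22, jac23, redP]
  push_cast
  field_simp
  ring

end Derivatives

end LCHill

namespace LCHill

/-! ### Global solutions of ordinary differential equations -/

section ODE

open scoped NNReal

variable {E : Type*} [NormedAddCommGroup E] [NormedSpace ℝ E]

lemma exists_solution_of_local {f : ℝ → E → E} {K : ℕ → ℝ≥0}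
    (hK : ∀ n : ℕ, ∀ t : ℝ, |t| ≤ n → LipschitzWith (K n) (f t)) (x₀ : E)
    (hloc : ∀ n : ℕ, ∃ α : ℝ → E, α 0 = x₀ ∧ ∀ t : ℝ, |t| < n → HasDerivAt α (f t (α t)) t) :
    ∃ α : ℝ → E, α 0 = x₀ ∧ ∀ t, HasDerivAt α (f t (α t)) t := by
  choose α h0 hα using hloc
  have key : ∀ m n : ℕ, m ≤ n → ∀ t : ℝ, |t| < m → α m t = α n t := by
    intro m n hmn t ht
    have hm : (0 : ℝ) < m := (abs_nonneg t).trans_lt ht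
    refine ODE_solution_unique_of_mem_Ioo (v := f) (s := fun _ => univ) (K := K m)
      (a := -m) (b := m) (t₀ := 0) (fun t ht => ?_) ⟨by linarith, hm⟩ (fun t ht => ?_)
      (fun t ht => ?_) (by rw [h0, h0]) (abs_lt.1 ht)
    · exact (hK m t (abs_lt.2 ht).le).lipschitzOnWith
    · exact ⟨hα m t (abs_lt.2 ht), mem_univ _⟩
    · exact ⟨hα n t ((abs_lt.2 ht).trans_le (by exact_mod_cast hmn)), mem_univ _⟩
  have key2 : ∀ m : ℕ, ∀ t : ℝ, |t| < m → α (⌈|t|⌉₊ + 1) t = α m t := by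
    intro m t ht
    have h1 : |t| < (⌈|t|⌉₊ + 1 : ℕ) := by
      push_cast; exact (Nat.le_ceil _).trans_lt (lt_add_one _)
    rcases le_total (⌈|t|⌉₊ + 1) m with h | h
    · exact key _ _ h t h1
    · exact (key _ _ h t ht).symm
  refine ⟨fun t => α (⌈|t|⌉₊ + 1) t, h0 _, fun t => ?_⟩
  have h1 : |t| < (⌈|t|⌉₊ + 1 : ℕ) := by
    push_cast; exact (Nat.le_ceil _).trans_lt (lt_add_one _)
  refine (hα _ t h1).congr_of_eventuallyEq ?_
  filter_upwards [continuous_abs.continuousAt.eventually_lt continuousAt_const h1] with s hs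
  exact key2 _ s hs

lemma exists_solution_of_bounded [CompleteSpace E] {f : ℝ → E → E} {K L : ℕ → ℝ≥0}
    (hK : ∀ n : ℕ, ∀ t : ℝ, |t| ≤ n → LipschitzWith (K n) (f t))
    (hL : ∀ n : ℕ, ∀ t : ℝ, |t| ≤ n → ∀ x, ‖f t x‖ ≤ L n)
    (hc : ∀ x, Continuous fun t => f t x) (x₀ : E) :
    ∃ α : ℝ → E, α 0 = x₀ ∧ ∀ t, HasDerivAt α (f t (α t)) t := by
  refine exists_solution_of_local hK x₀ fun n => ?_
  have hn : (0 : ℝ) ≤ n := n.cast_nonneg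
  have hpl : IsPicardLindelof f (⟨0, by simp⟩ : Icc (-(n : ℝ)) n) x₀ (L n * n) 0 (L n) (K n) :=
    { lipschitzOnWith := fun t ht => (hK n t (abs_le.2 ht)).lipschitzOnWith
      continuousOn := fun x _ => (hc x).continuousOn
      norm_le := fun t ht x _ => hL n t (abs_le.2 ht) x
      mul_max_le := by simp }
  obtain ⟨α, h0, hα⟩ := hpl.exists_eq_forall_mem_Icc_hasDerivWithinAt₀
  refine ⟨α, h0, fun t ht => ?_⟩
  have ht' := abs_lt.1 ht
  exact (hα t (abs_le.1 ht.le)).hasDerivAt (Icc_mem_nhds ht'.1 ht'.2)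

lemma norm_le_exp_of_norm_deriv_le {α α' : ℝ → E} {K T : ℝ}
    (hα : ∀ t, HasDerivAt α (α' t) t) (hb : ∀ t, |t| ≤ T → ‖α' t‖ ≤ K * ‖α t‖) {t : ℝ}
    (ht : |t| ≤ T) : ‖α t‖ ≤ ‖α 0‖ * Real.exp (K * |t|) := by
  have hpos : ∀ (β β' : ℝ → E), (∀ t, HasDerivAt β (β' t) t) →
      (∀ t, |t| ≤ T → ‖β' t‖ ≤ K * ‖β t‖) → ∀ t, 0 ≤ t → t ≤ T →
      ‖β t‖ ≤ ‖β 0‖ * Real.exp (K * t) := by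
    intro β β' hβ hb t h0 hT
    have := norm_le_gronwallBound_of_norm_deriv_right_le (f := β) (f' := β') (δ := ‖β 0‖) (K := K)
      (ε := 0) (a := 0) (b := T) (fun s _ => (hβ s).continuousAt.continuousWithinAt)
      (fun s _ => (hβ s).hasDerivWithinAt) le_rfl
      (fun s hs => by simpa using hb s (abs_le.2 ⟨by linarith [hs.1, hs.2], hs.2.le⟩)) t ⟨h0, hT⟩
    rwa [gronwallBound_ε0, sub_zero] at this
  rcases le_total 0 t with h | h
  · rw [abs_of_nonneg h] at ht ⊢
    exact hpos α α' hα hb t h ht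
  · rw [abs_of_nonpos h] at ht ⊢
    have := hpos (fun s => α (-s)) (fun s => -α' (-s))
      (fun s => by simpa [Function.comp_def] using (hα (-s)).scomp s (hasDerivAt_neg s))
      (fun s hs => by simpa using hb (-s) (by simpa using hs)) (-t) (by linarith) ht
    simpa using this

lemma dist_le_exp_of_lipschitz {f : ℝ → E → E} {K : ℝ≥0} (hK : ∀ t, LipschitzWith K (f t))
    {α β : ℝ → E} (hα : ∀ t, HasDerivAt α (f t (α t)) t) (hβ : ∀ t, HasDerivAt β (f t (β t)) t)
    (t : ℝ) : dist (α t) (β t) ≤ dist (α 0) (β 0) * Real.exp (K * |t|) := by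
  have := norm_le_exp_of_norm_deriv_le (α := fun t => α t - β t) (K := K) (T := |t|) (t := t)
    (fun t => (hα t).sub (hβ t))
    (fun s _ => by simpa [dist_eq_norm] using (hK s).dist_le_mul (α s) (β s)) le_rfl
  simpa [dist_eq_norm] using this

lemma solution_unique {f : ℝ → E → E} {K : ℝ≥0} (hK : ∀ t, LipschitzWith K (f t))
    {α β : ℝ → E} (hα : ∀ t, HasDerivAt α (f t (α t)) t) (hβ : ∀ t, HasDerivAt β (f t (β t)) t)
    (h0 : α 0 = β 0) (t : ℝ) : α t = β t := by
  have := dist_le_exp_of_lipschitz hK hα hβ t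
  rw [h0, dist_self, zero_mul] at this
  exact dist_le_zero.1 this

/-- Coordinatewise truncation to `[-R, R]`. -/
def clamp {ι : Type*} (R : ℝ) (x : ι → ℝ) : ι → ℝ := fun i => max (-R) (min R (x i))

lemma lipschitzWith_clamp {ι : Type*} [Fintype ι] (R : ℝ) :
    LipschitzWith 1 (clamp (ι := ι) R) := by
  refine LipschitzWith.of_dist_le_mul fun x y => ?_
  rw [NNReal.coe_one, one_mul]
  refine (dist_pi_le_iff dist_nonneg).2 fun i => ?_
  calc dist (clamp R x i) (clamp R y i) ≤ dist (x i) (y i) := by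
        simp only [clamp, Real.dist_eq]
        refine (abs_max_sub_max_le_max _ _ _ _).trans (max_le (by simp) ?_)
        exact (abs_min_sub_min_le_max _ _ _ _).trans (by simp)
    _ ≤ dist x y := dist_le_pi_dist x y i

lemma abs_clamp_le {ι : Type*} {R : ℝ} (hR : 0 ≤ R) (x : ι → ℝ) (i : ι) : |clamp R x i| ≤ R := by
  refine abs_le.2 ⟨le_max_left _ _, max_le (by linarith) (min_le_left _ _)⟩

lemma abs_clamp_le_abs {ι : Type*} {R : ℝ} (hR : 0 ≤ R) (x : ι → ℝ) (i : ι) :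
    |clamp R x i| ≤ |x i| := by
  refine abs_le.2 ⟨?_, max_le ?_ ?_⟩
  · rcases le_total R (x i) with h | h
    · exact le_max_of_le_right (le_min (by linarith [abs_nonneg (x i)]) (neg_abs_le _))
    · exact le_max_of_le_right (le_min (by linarith [abs_nonneg (x i)]) (neg_abs_le _))
  · linarith [abs_nonneg (x i)]
  · exact (min_le_right _ _).trans (le_abs_self _)

lemma clamp_eq_self {ι : Type*} {R : ℝ} {x : ι → ℝ} (hx : ∀ i, |x i| ≤ R) : clamp R x = x := by
  funext i
  have := abs_le.1 (hx i)
  simp [clamp, this.1, this.2]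

lemma exists_solution_linear {ι : Type*} [Fintype ι] {A : ℝ → (ι → ℝ) →L[ℝ] (ι → ℝ)}
    (hA : Continuous A) (x₀ : ι → ℝ) :
    ∃ α : ℝ → ι → ℝ, α 0 = x₀ ∧ ∀ t, HasDerivAt α (A t (α t)) t := by
  have hb : ∀ n : ℕ, ∃ K : ℝ≥0, ∀ t : ℝ, |t| ≤ n → ‖A t‖ ≤ K := by
    intro n
    obtain ⟨C, hC⟩ := (isCompact_Icc (a := -(n : ℝ)) (b := n)).exists_bound_of_continuousOn
      hA.continuousOn
    exact ⟨C.toNNReal, fun t ht => (hC t (abs_le.1 ht)).trans (Real.le_coe_toNNReal _)⟩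
  choose K hK using hb
  have hlip : ∀ n : ℕ, ∀ t : ℝ, |t| ≤ n → LipschitzWith (K n) (fun x => A t x) := fun n t ht =>
    ContinuousLinearMap.lipschitzWith_of_opNorm_le (hK n t ht)
  refine exists_solution_of_local (K := K) hlip x₀ fun n => ?_
  set R : ℝ≥0 := ⟨‖x₀‖ * Real.exp (K n * n), by positivity⟩ with hR
  have hle : ∀ x : ι → ℝ, ‖clamp (R : ℝ) x‖ ≤ ‖x‖ := fun x =>
    (pi_norm_le_iff_of_nonneg (norm_nonneg _)).2 fun i =>
      (abs_clamp_le_abs R.2 x i).trans (norm_le_pi_norm x i)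
  obtain ⟨α, h0, hα⟩ := exists_solution_of_bounded (f := fun t x => A t (clamp R x)) (K := K)
    (L := fun m => K m * R)
    (fun m t ht => by simpa [Function.comp_def] using (hlip m t ht).comp (lipschitzWith_clamp (R : ℝ)))
    (fun m t ht x => ((A t).le_opNorm _).trans (by
      push_cast
      exact mul_le_mul (hK m t ht) ((pi_norm_le_iff_of_nonneg R.2).2 (abs_clamp_le R.2 x))
        (norm_nonneg _) (K m).2))
    (fun x => hA.clm_apply continuous_const) x₀
  refine ⟨α, h0, fun t ht => ?_⟩
  have hα' := hα t
  have hn : ‖α t‖ ≤ R := by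
    refine (norm_le_exp_of_norm_deriv_le (T := n) hα (K := K n) (fun s hs => ?_) ht.le).trans ?_
    · exact ((A s).le_opNorm _).trans
        (mul_le_mul (hK n s hs) (hle _) (norm_nonneg _) (K n).2)
    · rw [h0, hR]
      exact mul_le_mul_of_nonneg_left
        (Real.exp_le_exp.2 (mul_le_mul_of_nonneg_left ht.le (K n).2)) (norm_nonneg _)
  rwa [clamp_eq_self fun i => (norm_le_pi_norm (α t) i).trans hn] at hα'

end ODE

end LCHill

namespace LCHill

/-! ### Polar angles along plane curves -/

section Polar

lemma exists_primitive_on_Icc {h : ℝ → ℝ} {T : ℝ} (hT : 0 ≤ T) (hh : ContinuousOn h (Icc 0 T))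
    (b₀ : ℝ) : ∃ β : ℝ → ℝ, β 0 = b₀ ∧ ∀ t ∈ Icc 0 T, HasDerivAt β (h t) t := by
  have hc : Continuous (IccExtend hT ((Icc 0 T).domRestrict h)) :=
    (continuousOn_iff_continuous_domRestrict.1 hh).Icc_extend'
  refine ⟨fun t => b₀ + ∫ s in (0 : ℝ)..t, IccExtend hT ((Icc 0 T).domRestrict h) s, by simp,
    fun t ht => ?_⟩
  have := (intervalIntegral.integral_hasDerivAt_right (hc.intervalIntegrable 0 t)
    (hc.stronglyMeasurableAtFilter _ _) hc.continuousAt).const_add b₀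
  rwa [IccExtend_of_mem hT _ ht] at this

lemma const_on_Icc_of_hasDerivAt_zero {f : ℝ → ℝ} {T : ℝ}
    (hf : ∀ t ∈ Icc 0 T, HasDerivAt f 0 t) {t : ℝ} (ht : t ∈ Icc 0 T) : f t = f 0 :=
  constant_of_has_deriv_right_zero (fun s hs => (hf s hs).continuousAt.continuousWithinAt)
    (fun s hs => (hf s (Ico_subset_Icc_self hs)).hasDerivWithinAt) t ht

lemma exists_polar_lift {f g f' g' : ℝ → ℝ} {T : ℝ} (hT : 0 ≤ T)
    (hf : ∀ t ∈ Icc 0 T, HasDerivAt f (f' t) t) (hg : ∀ t ∈ Icc 0 T, HasDerivAt g (g' t) t)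
    (hf' : ContinuousOn f' (Icc 0 T)) (hg' : ContinuousOn g' (Icc 0 T))
    (hne : ∀ t ∈ Icc 0 T, 0 < f t ^ 2 + g t ^ 2) {b₀ : ℝ}
    (hf0 : f 0 = √(f 0 ^ 2 + g 0 ^ 2) * Real.cos b₀)
    (hg0 : g 0 = √(f 0 ^ 2 + g 0 ^ 2) * Real.sin b₀) :
    ∃ β : ℝ → ℝ, β 0 = b₀ ∧
      (∀ t ∈ Icc 0 T, HasDerivAt β ((f t * g' t - g t * f' t) / (f t ^ 2 + g t ^ 2)) t) ∧
      ∀ t ∈ Icc 0 T, f t = √(f t ^ 2 + g t ^ 2) * Real.cos (β t) ∧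
        g t = √(f t ^ 2 + g t ^ 2) * Real.sin (β t) := by
  have hfc : ContinuousOn f (Icc 0 T) := fun t ht => (hf t ht).continuousAt.continuousWithinAt
  have hgc : ContinuousOn g (Icc 0 T) := fun t ht => (hg t ht).continuousAt.continuousWithinAt
  obtain ⟨β, hβ0, hβ⟩ := exists_primitive_on_Icc hT (h := fun t =>
    (f t * g' t - g t * f' t) / (f t ^ 2 + g t ^ 2))
    (((hfc.mul hg').sub (hgc.mul hf')).div ((hfc.pow 2).add (hgc.pow 2))
      fun t ht => (hne t ht).ne') b₀
  refine ⟨β, hβ0, hβ, fun t ht => ?_⟩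
  have hr : ∀ t ∈ Icc 0 T, HasDerivAt (fun t => √(f t ^ 2 + g t ^ 2))
      ((f t * f' t + g t * g' t) / √(f t ^ 2 + g t ^ 2)) t := fun t ht => by
    refine ((((hf t ht).pow 2).add ((hg t ht).pow 2)).sqrt (hne t ht).ne').congr_deriv ?_
    have := Real.sqrt_pos.2 (hne t ht)
    simp only [Pi.add_apply, Pi.pow_apply]
    push_cast
    field_simp
  have hu : ∀ t ∈ Icc 0 T, HasDerivAt (fun t =>
      (f t * Real.cos (β t) + g t * Real.sin (β t)) / √(f t ^ 2 + g t ^ 2)) 0 t := fun t ht => by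
    have hs := Real.sqrt_pos.2 (hne t ht)
    have hs2 := Real.sq_sqrt (hne t ht).le
    refine ((((hf t ht).mul (hβ t ht).cos).add ((hg t ht).mul (hβ t ht).sin)).div (hr t ht)
      hs.ne').congr_deriv ?_
    have h1 := hne t ht
    rw [div_eq_zero_iff]
    left
    simp only [Pi.add_apply, Pi.mul_apply]
    have hb := div_mul_cancel₀ (f t * g' t - g t * f' t) h1.ne'
    generalize (f t * g' t - g t * f' t) / (f t ^ 2 + g t ^ 2) = b at hb ⊢
    generalize √(f t ^ 2 + g t ^ 2) = r at hs hs2 ⊢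
    field_simp
    linear_combination (f' t * Real.cos (β t) + g' t * Real.sin (β t)
      + b * (g t * Real.cos (β t) - f t * Real.sin (β t))) * hs2
      + (g t * Real.cos (β t) - f t * Real.sin (β t)) * hb
  have hv : ∀ t ∈ Icc 0 T, HasDerivAt (fun t =>
      (g t * Real.cos (β t) - f t * Real.sin (β t)) / √(f t ^ 2 + g t ^ 2)) 0 t := fun t ht => by
    have hs := Real.sqrt_pos.2 (hne t ht)
    have hs2 := Real.sq_sqrt (hne t ht).le
    refine ((((hg t ht).mul (hβ t ht).cos).sub ((hf t ht).mul (hβ t ht).sin)).div (hr t ht)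
      hs.ne').congr_deriv ?_
    have h1 := hne t ht
    rw [div_eq_zero_iff]
    left
    simp only [Pi.sub_apply, Pi.mul_apply]
    have hb := div_mul_cancel₀ (f t * g' t - g t * f' t) h1.ne'
    generalize (f t * g' t - g t * f' t) / (f t ^ 2 + g t ^ 2) = b at hb ⊢
    generalize √(f t ^ 2 + g t ^ 2) = r at hs hs2 ⊢
    field_simp
    linear_combination (g' t * Real.cos (β t) - f' t * Real.sin (β t)
      - b * (g t * Real.sin (β t) + f t * Real.cos (β t))) * hs2
      - (g t * Real.sin (β t) + f t * Real.cos (β t)) * hb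
  have hu' := const_on_Icc_of_hasDerivAt_zero hu ht
  have hv' := const_on_Icc_of_hasDerivAt_zero hv ht
  have h00 : (0 : ℝ) ∈ Icc 0 T := ⟨le_rfl, hT⟩
  have hs := Real.sqrt_pos.2 (hne t ht)
  have hs0 := Real.sqrt_pos.2 (hne 0 h00)
  have hu0 : (f 0 * Real.cos (β 0) + g 0 * Real.sin (β 0)) / √(f 0 ^ 2 + g 0 ^ 2) = 1 := by
    rw [hβ0, div_eq_one_iff_eq hs0.ne']
    linear_combination Real.cos b₀ * hf0 + Real.sin b₀ * hg0
      + √(f 0 ^ 2 + g 0 ^ 2) * Real.sin_sq_add_cos_sq b₀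
  have hv0 : (g 0 * Real.cos (β 0) - f 0 * Real.sin (β 0)) / √(f 0 ^ 2 + g 0 ^ 2) = 0 := by
    rw [hβ0, div_eq_zero_iff]
    left
    linear_combination Real.cos b₀ * hg0 - Real.sin b₀ * hf0
  simp only [hu0, hv0] at hu' hv'
  rw [div_eq_one_iff_eq hs.ne'] at hu'
  rw [div_eq_zero_iff, or_iff_left hs.ne'] at hv'
  constructor
  · linear_combination Real.cos (β t) * hu' - Real.sin (β t) * hv'
      - f t * Real.sin_sq_add_cos_sq (β t)
  · linear_combination Real.sin (β t) * hu' + Real.cos (β t) * hv'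
      - g t * Real.sin_sq_add_cos_sq (β t)

lemma exists_polar (x y : ℝ) : ∃ b : ℝ, x = √(x ^ 2 + y ^ 2) * Real.cos b ∧
    y = √(x ^ 2 + y ^ 2) * Real.sin b := by
  refine ⟨Complex.arg ⟨x, y⟩, ?_⟩
  have h : √(x ^ 2 + y ^ 2) = ‖(⟨x, y⟩ : ℂ)‖ := by
    rw [Complex.norm_def, Complex.normSq_mk, sq, sq]
  rw [h]
  exact ⟨(Complex.norm_mul_cos_arg ⟨x, y⟩).symm, (Complex.norm_mul_sin_arg ⟨x, y⟩).symm⟩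

lemma abs_sub_le_of_deriv_near {β ω b o : ℝ → ℝ} {R T : ℝ} (hT : 0 ≤ T)
    (hβ : ∀ t ∈ Icc 0 T, HasDerivAt β (b t) t) (hω : ∀ t ∈ Icc 0 T, HasDerivAt ω (o t) t)
    (hb : ∀ t ∈ Icc 0 T, |b t - o t| ≤ R) :
    |β T - β 0 - (ω T - ω 0)| ≤ R * T := by
  have := (convex_Icc (0 : ℝ) T).norm_image_sub_le_of_norm_hasDerivWithin_le (x := 0) (y := T)
    (f := fun t => β t - ω t) (fun t ht => ((hβ t ht).sub (hω t ht)).hasDerivWithinAt)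
    (fun t ht => hb t ht) ⟨le_rfl, hT⟩ ⟨hT, le_rfl⟩
  rw [Real.norm_eq_abs, Real.norm_eq_abs, sub_zero, abs_of_nonneg hT] at this
  rwa [show β T - β 0 - (ω T - ω 0) = β T - ω T - (β 0 - ω 0) by ring]

end Polar

end LCHill

namespace LCHill

/-! ### Reference data for a tube around an approximate periodic orbit -/

/-- `f` is `2π`-periodic with continuous derivative `f'` and `f (-θ) = σ f θ`. -/
structure IsTrig (σ : ℝ) (f f' : ℝ → ℝ) : Prop where
  hasDerivAt : ∀ θ, HasDerivAt f (f' θ) θ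
  continuous_deriv : Continuous f'
  parity : ∀ θ, f (-θ) = σ * f θ
  periodic : ∀ θ, f (θ + 2 * Real.pi) = f θ

lemma IsTrig.continuous {σ : ℝ} {f f' : ℝ → ℝ} (h : IsTrig σ f f') : Continuous f :=
  continuous_iff_continuousAt.2 fun θ => (h.hasDerivAt θ).continuousAt

lemma IsTrig.parity_deriv {σ : ℝ} {f f' : ℝ → ℝ} (h : IsTrig σ f f') (θ : ℝ) :
    f' (-θ) = -(σ * f' θ) := by
  have h1 : HasDerivAt (fun t => f (-t)) (-f' (-θ)) θ := by
    simpa [Function.comp_def] using (h.hasDerivAt (-θ)).comp θ (hasDerivAt_neg θ)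
  have h2 := (h.hasDerivAt θ).const_mul σ
  rw [← funext h.parity] at h2
  linarith [h1.unique h2]

lemma IsTrig.periodic_deriv {σ : ℝ} {f f' : ℝ → ℝ} (h : IsTrig σ f f') (θ : ℝ) :
    f' (θ + 2 * Real.pi) = f' θ := by
  have h1 : HasDerivAt (fun t => f (t + 2 * Real.pi)) (f' (θ + 2 * Real.pi)) θ :=
    (h.hasDerivAt _).comp_add_const θ _
  rw [funext h.periodic] at h1
  exact h1.unique (h.hasDerivAt θ)

/-- An approximate periodic orbit `(rr, pp)` of the reduced vector field, together with an
approximate Floquet frame `[[al, 0], [be, ka]]`, an angular speed `om` with primitive `Om`,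
and the width `τ` of a tube. -/
structure RefData where
  (rr rr' pp pp' al al' be be' ka ka' om Om : ℝ → ℝ)
  τ : ℝ

namespace RefData

variable (D : RefData) (μ c s : ℝ)

/-- First coordinate of a point of the tube. -/
def rad (θ x : ℝ) : ℝ := D.rr θ + D.τ * D.al θ * x

/-- Second coordinate of a point of the tube. -/
def mom (θ x y : ℝ) : ℝ := D.pp θ + D.τ * (D.be θ * x + D.ka θ * y)

/-- First component of the reduced vector field in tube coordinates. -/
def field₁ (θ x y : ℝ) : ℝ :=
  (redR μ c (D.rad θ x) (D.mom θ x y) (Real.cos θ) - D.rr' θ - D.τ * D.al' θ * x)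
    / (D.τ * D.al θ)

/-- Second component of the reduced vector field in tube coordinates. -/
def field₂ (θ x y : ℝ) : ℝ :=
  (redP μ c s (D.rad θ x) (D.mom θ x y) (Real.cos θ) - D.pp' θ
    - D.τ * (D.be' θ * x + D.be θ * D.field₁ μ c θ x y + D.ka' θ * y)) / (D.τ * D.ka θ)

/-- Derivative of the position field in the position variable, in tube coordinates. -/
def lin₁₁ (θ x y : ℝ) : ℝ :=
  (jac11 μ c (D.rad θ x) (D.mom θ x y) (Real.cos θ) * D.al θ
    + jac12 μ c (D.rad θ x) (D.mom θ x y) (Real.cos θ) * D.be θ - D.al' θ) / D.al θ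

/-- Derivative of the position field in the momentum variable. -/
def lin₁₂ (θ x y : ℝ) : ℝ :=
  jac12 μ c (D.rad θ x) (D.mom θ x y) (Real.cos θ) * D.ka θ / D.al θ

/-- Derivative of the momentum field in the position variable. -/
def lin₂₁ (θ x y : ℝ) : ℝ :=
  (jac21 μ c s (D.rad θ x) (D.mom θ x y) (Real.cos θ) / D.rad θ x * D.al θ
    + jac22 μ c (D.rad θ x) (D.mom θ x y) (Real.cos θ) * D.be θ - D.be' θ
    - D.be θ * D.lin₁₁ μ c θ x y) / D.ka θ

/-- Derivative of the momentum field in the momentum variable. -/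
def lin₂₂ (θ x y : ℝ) : ℝ :=
  (jac22 μ c (D.rad θ x) (D.mom θ x y) (Real.cos θ) * D.ka θ - D.ka' θ
    - D.be θ * D.lin₁₂ μ c θ x y) / D.ka θ

/-- The bounds needed at a point of the tube. -/
structure Good (A B₁ B₂ θ x y : ℝ) : Prop where
  rad_pos : 0 < D.rad θ x
  rad_lt : D.rad θ x < 1
  hill : 0 < 1 - μ - (c - μ) * D.rad θ x
  dist_pos : 0 < 1 - 2 * D.rad θ x * Real.cos θ + D.rad θ x ^ 2
  ang_pos : 0 < angSq μ c (D.rad θ x) (Real.cos θ) - D.mom θ x y ^ 2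
  sense : s * D.rad θ x ^ 2 * invAng μ c (D.rad θ x) (D.mom θ x y) (Real.cos θ) < 2
  abs_lin₁₁ : |D.lin₁₁ μ c θ x y| ≤ A
  abs_lin₂₂ : |D.lin₂₂ μ c θ x y| ≤ A
  abs_lin₁₂ : |D.lin₁₂ μ c θ x y - D.om θ| ≤ B₁
  abs_lin₂₁ : |D.lin₂₁ μ c s θ x y + D.om θ| ≤ B₂

/-- The conditions guaranteeing a true periodic orbit in the tube, whose linearization rotates by
an angle between `k π / 2` and `(k + 1) π / 2` per half turn. -/
structure Valid (k : ℕ) (A B₁ B₂ ε W r₀ σ m R : ℝ) : Prop where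
  rr : IsTrig 1 D.rr D.rr'
  pp : IsTrig (-1) D.pp D.pp'
  al : IsTrig 1 D.al D.al'
  be : IsTrig (-1) D.be D.be'
  ka : IsTrig 1 D.ka D.ka'
  om_cont : Continuous D.om
  Om : ∀ θ, HasDerivAt D.Om (D.om θ) θ
  Om_pi : D.Om Real.pi - D.Om 0 = Real.pi * r₀
  Om_four_pi : D.Om (4 * Real.pi) - D.Om 0 = 4 * Real.pi * r₀
  al_pos : ∀ θ, 0 < D.al θ
  ka_pos : ∀ θ, 0 < D.ka θ
  τ_pos : 0 < D.τ
  abs_om : ∀ θ, |D.om θ| ≤ W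
  good : ∀ θ x y, |x| ≤ 1 → |y| ≤ 1 → D.Good μ c s A B₁ B₂ θ x y
  defect : ∀ θ, D.field₁ μ c θ 0 0 ^ 2 + D.field₂ μ c s θ 0 0 ^ 2 ≤ ε ^ 2
  ε_pos : 0 < ε
  σ_pos : 0 < σ
  m_pos : 0 < m
  upper : σ ^ 2 + (2 * A + B₁ + B₂ + 2 * ε) * Real.pi < 1
  lower : m ^ 2 ≤ σ ^ 2 - (2 * A + B₁ + B₂ + 2 * ε) * Real.pi
  rate₁ : A + B₁ + ε / m ≤ R
  rate₂ : A + B₂ + ε / m ≤ R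
  rot_lower : (k : ℝ) / 2 < r₀ - R
  rot_upper : r₀ + R < ((k : ℝ) + 1) / 2

end RefData

namespace RefData.Valid

variable {D : RefData} {μ c s : ℝ} {k : ℕ} {A B₁ B₂ ε W r₀ σ m R : ℝ}

lemma A_nonneg (Z : D.Valid μ c s k A B₁ B₂ ε W r₀ σ m R) : 0 ≤ A :=
  (abs_nonneg _).trans (Z.good 0 0 0 (by simp) (by simp)).abs_lin₁₁

lemma B₁_nonneg (Z : D.Valid μ c s k A B₁ B₂ ε W r₀ σ m R) : 0 ≤ B₁ :=
  (abs_nonneg _).trans (Z.good 0 0 0 (by simp) (by simp)).abs_lin₁₂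

lemma B₂_nonneg (Z : D.Valid μ c s k A B₁ B₂ ε W r₀ σ m R) : 0 ≤ B₂ :=
  (abs_nonneg _).trans (Z.good 0 0 0 (by simp) (by simp)).abs_lin₂₁

lemma W_nonneg (Z : D.Valid μ c s k A B₁ B₂ ε W r₀ σ m R) : 0 ≤ W :=
  (abs_nonneg _).trans (Z.abs_om 0)

lemma hasDerivAt_fields (Z : D.Valid μ c s k A B₁ B₂ ε W r₀ σ m R) {θ x y dx dy : ℝ} {v : ℝ}
    (hx : |x + v * dx| ≤ 1) (hy : |y + v * dy| ≤ 1) :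
    HasDerivAt (fun u => D.field₁ μ c θ (x + u * dx) (y + u * dy))
      (D.lin₁₁ μ c θ (x + v * dx) (y + v * dy) * dx
        + D.lin₁₂ μ c θ (x + v * dx) (y + v * dy) * dy) v ∧
    HasDerivAt (fun u => D.field₂ μ c s θ (x + u * dx) (y + u * dy))
      (D.lin₂₁ μ c s θ (x + v * dx) (y + v * dy) * dx
        + D.lin₂₂ μ c θ (x + v * dx) (y + v * dy) * dy) v := by
  have hG := Z.good θ _ _ hx hy
  have hX : HasDerivAt (fun u : ℝ => x + u * dx) dx v := by
    simpa using ((hasDerivAt_id v).mul_const dx).const_add x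
  have hY : HasDerivAt (fun u : ℝ => y + u * dy) dy v := by
    simpa using ((hasDerivAt_id v).mul_const dy).const_add y
  have hr : HasDerivAt (fun u => D.rad θ (x + u * dx)) (D.τ * D.al θ * dx) v :=
    (hX.const_mul (D.τ * D.al θ)).const_add _
  have hp : HasDerivAt (fun u => D.mom θ (x + u * dx) (y + u * dy))
      (D.τ * (D.be θ * dx + D.ka θ * dy)) v :=
    (((hX.const_mul (D.be θ)).add (hY.const_mul (D.ka θ))).const_mul D.τ).const_add _
  have hC : HasDerivAt (fun _ : ℝ => Real.cos θ) 0 v := hasDerivAt_const _ _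
  have h1 := hasDerivAt_redR hr hp hC hG.dist_pos hG.rad_pos.ne' hG.ang_pos
  have h2 := hasDerivAt_redP (s := s) hr hp hC hG.dist_pos hG.rad_pos.ne' hG.ang_pos
  have ha := (Z.al_pos θ).ne'
  have hk := (Z.ka_pos θ).ne'
  have ht := Z.τ_pos.ne'
  have hf1 : HasDerivAt (fun u => D.field₁ μ c θ (x + u * dx) (y + u * dy))
      (D.lin₁₁ μ c θ (x + v * dx) (y + v * dy) * dx
        + D.lin₁₂ μ c θ (x + v * dx) (y + v * dy) * dy) v := by
    refine (((h1.sub_const (D.rr' θ)).sub (hX.const_mul (D.τ * D.al' θ))).div_const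
      (D.τ * D.al θ)).congr_deriv ?_
    rw [lin₁₁, lin₁₂]
    field_simp
    ring
  refine ⟨hf1, ?_⟩
  refine (((h2.sub_const (D.pp' θ)).sub ((((hX.const_mul (D.be' θ)).add
    (hf1.const_mul (D.be θ))).add (hY.const_mul (D.ka' θ))).const_mul D.τ)).div_const
      (D.τ * D.ka θ)).congr_deriv ?_
  rw [lin₂₁, lin₂₂]
  field_simp
  ring

/-- The mean value form of the reduced vector field in tube coordinates. -/
lemma exists_mean (Z : D.Valid μ c s k A B₁ B₂ ε W r₀ σ m R) (θ : ℝ) {x y x' y' : ℝ}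
    (hx : |x| ≤ 1) (hy : |y| ≤ 1) (hx' : |x'| ≤ 1) (hy' : |y'| ≤ 1) :
    ∃ a₁₁ a₁₂ a₂₁ a₂₂ : ℝ, |a₁₁| ≤ A ∧ |a₁₂ - D.om θ| ≤ B₁ ∧ |a₂₁ + D.om θ| ≤ B₂ ∧ |a₂₂| ≤ A ∧
      D.field₁ μ c θ x' y' - D.field₁ μ c θ x y = a₁₁ * (x' - x) + a₁₂ * (y' - y) ∧
      D.field₂ μ c s θ x' y' - D.field₂ μ c s θ x y = a₂₁ * (x' - x) + a₂₂ * (y' - y) := by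
  have hin : ∀ {a b v : ℝ}, |a| ≤ 1 → |b| ≤ 1 → v ∈ Icc (0 : ℝ) 1 → |a + v * (b - a)| ≤ 1 := by
    intro a b v ha hb hv
    rw [abs_le] at *
    constructor <;> nlinarith [hv.1, hv.2]
  have hd : ∀ v ∈ Icc (0 : ℝ) 1, _ ∧ _ := fun v hv =>
    Z.hasDerivAt_fields (θ := θ) (hin hx hx' hv) (hin hy hy' hv)
  obtain ⟨v, hv, h1⟩ := exists_hasDerivAt_eq_slope _ _ (zero_lt_one' ℝ)
    (fun v hv => (hd v hv).1.continuousAt.continuousWithinAt)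
    (fun v hv => (hd v (Ioo_subset_Icc_self hv)).1)
  obtain ⟨w, hw, h2⟩ := exists_hasDerivAt_eq_slope _ _ (zero_lt_one' ℝ)
    (fun v hv => (hd v hv).2.continuousAt.continuousWithinAt)
    (fun v hv => (hd v (Ioo_subset_Icc_self hv)).2)
  have hv' := Ioo_subset_Icc_self hv
  have hw' := Ioo_subset_Icc_self hw
  have g1 := Z.good θ _ _ (hin hx hx' hv') (hin hy hy' hv')
  have g2 := Z.good θ _ _ (hin hx hx' hw') (hin hy hy' hw')
  refine ⟨_, _, _, _, g1.abs_lin₁₁, g1.abs_lin₁₂, g2.abs_lin₂₁, g2.abs_lin₂₂, ?_, ?_⟩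
  · simpa using h1.symm
  · simpa using h2.symm

end RefData.Valid

end LCHill

namespace LCHill

/-! ### Shooting for a symmetric periodic orbit of the reduced vector field -/

open scoped NNReal

/-- The reduced vector field in tube coordinates, truncated to the tube. -/
def RefData.truncField (D : RefData) (μ c s θ : ℝ) (v : Fin 2 → ℝ) : Fin 2 → ℝ :=
  ![D.field₁ μ c θ (clamp 1 v 0) (clamp 1 v 1), D.field₂ μ c s θ (clamp 1 v 0) (clamp 1 v 1)]

lemma invAng_neg {μ c r p C : ℝ} : invAng μ c r (-p) C = invAng μ c r p C := by
  simp [invAng]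

namespace RefData.Valid

variable {D : RefData} {μ c s : ℝ} {k : ℕ} {A B₁ B₂ ε W r₀ σ m R : ℝ}

lemma hasDerivAt_rad (Z : D.Valid μ c s k A B₁ B₂ ε W r₀ σ m R) (θ x : ℝ) :
    HasDerivAt (fun θ => D.rad θ x) (D.rr' θ + D.τ * D.al' θ * x) θ :=
  (Z.rr.hasDerivAt θ).add (((Z.al.hasDerivAt θ).const_mul D.τ).mul_const x)

lemma hasDerivAt_mom (Z : D.Valid μ c s k A B₁ B₂ ε W r₀ σ m R) (θ x y : ℝ) :
    HasDerivAt (fun θ => D.mom θ x y) (D.pp' θ + D.τ * (D.be' θ * x + D.ka' θ * y)) θ :=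
  (Z.pp.hasDerivAt θ).add
    ((((Z.be.hasDerivAt θ).mul_const x).add ((Z.ka.hasDerivAt θ).mul_const y)).const_mul D.τ)

lemma continuous_fields (Z : D.Valid μ c s k A B₁ B₂ ε W r₀ σ m R) {x y : ℝ}
    (hx : |x| ≤ 1) (hy : |y| ≤ 1) :
    Continuous (fun θ => D.field₁ μ c θ x y) ∧ Continuous (fun θ => D.field₂ μ c s θ x y) := by
  have h1 : Continuous fun θ => redR μ c (D.rad θ x) (D.mom θ x y) (Real.cos θ) :=
    continuous_iff_continuousAt.2 fun θ =>
      (hasDerivAt_redR (Z.hasDerivAt_rad θ x) (Z.hasDerivAt_mom θ x y) (Real.hasDerivAt_cos θ)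
        (Z.good θ x y hx hy).dist_pos (Z.good θ x y hx hy).rad_pos.ne'
        (Z.good θ x y hx hy).ang_pos).continuousAt
  have h2 : Continuous fun θ => redP μ c s (D.rad θ x) (D.mom θ x y) (Real.cos θ) :=
    continuous_iff_continuousAt.2 fun θ =>
      (hasDerivAt_redP (Z.hasDerivAt_rad θ x) (Z.hasDerivAt_mom θ x y) (Real.hasDerivAt_cos θ)
        (Z.good θ x y hx hy).dist_pos (Z.good θ x y hx hy).rad_pos.ne'
        (Z.good θ x y hx hy).ang_pos).continuousAt
  have hf1 : Continuous (fun θ => D.field₁ μ c θ x y) :=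
    ((h1.sub Z.rr.continuous_deriv).sub
      ((continuous_const.mul Z.al.continuous_deriv).mul continuous_const)).div
      (continuous_const.mul Z.al.continuous) fun θ => (mul_pos Z.τ_pos (Z.al_pos θ)).ne'
  refine ⟨hf1, ?_⟩
  exact ((h2.sub Z.pp.continuous_deriv).sub (continuous_const.mul
    (((Z.be.continuous_deriv.mul continuous_const).add (Z.be.continuous.mul hf1)).add
      (Z.ka.continuous_deriv.mul continuous_const)))).div
      (continuous_const.mul Z.ka.continuous) fun θ => (mul_pos Z.τ_pos (Z.ka_pos θ)).ne'

/-- The Lipschitz constant of the truncated field. -/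
lemma lipschitz_truncField (Z : D.Valid μ c s k A B₁ B₂ ε W r₀ σ m R) (θ : ℝ) :
    LipschitzWith (A + B₁ + B₂ + W).toNNReal (D.truncField μ c s θ) := by
  have hA := Z.A_nonneg
  have h1 := Z.B₁_nonneg
  have h2 := Z.B₂_nonneg
  have hW := Z.W_nonneg
  have hom := abs_le.1 (Z.abs_om θ)
  refine LipschitzWith.of_dist_le_mul fun v w => ?_
  rw [Real.coe_toNNReal _ (by positivity)]
  have hcl : ∀ i, |clamp 1 v i - clamp 1 w i| ≤ dist v w := fun i => by
    have := (dist_le_pi_dist (clamp 1 v) (clamp 1 w) i).trans ((lipschitzWith_clamp 1).dist_le_mul v w)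
    simpa [Real.dist_eq] using this
  obtain ⟨a₁₁, a₁₂, a₂₁, a₂₂, e1, e2, e3, e4, e5, e6⟩ := Z.exists_mean θ
    (abs_clamp_le zero_le_one w 0) (abs_clamp_le zero_le_one w 1)
    (abs_clamp_le zero_le_one v 0) (abs_clamp_le zero_le_one v 1)
  have hbd : ∀ {a b p q : ℝ}, |a| ≤ p → |b| ≤ q → p + q ≤ A + B₁ + B₂ + W →
      |a * (clamp 1 v 0 - clamp 1 w 0) + b * (clamp 1 v 1 - clamp 1 w 1)|
        ≤ (A + B₁ + B₂ + W) * dist v w := by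
    intro a b p q ha hb hpq
    refine (abs_add_le _ _).trans ?_
    rw [abs_mul, abs_mul]
    calc _ ≤ p * dist v w + q * dist v w :=
          add_le_add (mul_le_mul ha (hcl 0) (abs_nonneg _) ((abs_nonneg _).trans ha))
            (mul_le_mul hb (hcl 1) (abs_nonneg _) ((abs_nonneg _).trans hb))
      _ ≤ _ := by rw [← add_mul]; exact mul_le_mul_of_nonneg_right hpq dist_nonneg
  refine (dist_pi_le_iff (by positivity)).2 fun i => ?_
  fin_cases i
  · simp only [truncField, Real.dist_eq, Fin.zero_eta, cons_val_zero]
    rw [e5]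
    refine hbd (q := B₁ + W) e1 ?_ (by linarith)
    rw [abs_le] at *
    constructor <;> linarith [e2.1, e2.2]
  · simp only [truncField, Real.dist_eq, Fin.mk_one, cons_val_one, cons_val_fin_one]
    rw [e6]
    refine hbd (p := B₂ + W) ?_ e4 (by linarith)
    rw [abs_le] at *
    constructor <;> linarith [e3.1, e3.2]

lemma exists_trajectory (Z : D.Valid μ c s k A B₁ B₂ ε W r₀ σ m R) (v₀ : Fin 2 → ℝ) :
    ∃ v : ℝ → Fin 2 → ℝ, v 0 = v₀ ∧ ∀ θ, HasDerivAt v (D.truncField μ c s θ (v θ)) θ := by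
  have hb : ∀ θ, ‖D.truncField μ c s θ 0‖ ≤ ε := fun θ => by
    have h := Z.defect θ
    have h0 : clamp 1 (0 : Fin 2 → ℝ) = 0 := clamp_eq_self (by simp)
    refine (pi_norm_le_iff_of_nonneg Z.ε_pos.le).2 fun i => ?_
    fin_cases i <;> simp only [truncField, h0, Pi.zero_apply] <;>
      exact abs_le_of_sq_le_sq (by simpa using by nlinarith) Z.ε_pos.le
  refine exists_solution_of_bounded (K := fun _ => (A + B₁ + B₂ + W).toNNReal)
    (L := fun _ => (ε + (A + B₁ + B₂ + W).toNNReal).toNNReal)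
    (fun _ t _ => Z.lipschitz_truncField t) (fun _ t _ x => ?_) (fun x => ?_) v₀
  · have h1 := (Z.lipschitz_truncField t).dist_le_mul (clamp 1 x) 0
    have h2 : D.truncField μ c s t (clamp 1 x) = D.truncField μ c s t x := by
      rw [truncField, truncField, clamp_eq_self (abs_clamp_le zero_le_one x)]
    have h3 : ‖clamp 1 x‖ ≤ 1 :=
      (pi_norm_le_iff_of_nonneg zero_le_one).2 fun i => abs_clamp_le zero_le_one x i
    rw [h2, dist_zero_right, dist_eq_norm] at h1
    rw [Real.coe_toNNReal _ (add_nonneg Z.ε_pos.le (NNReal.coe_nonneg _))]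
    calc ‖D.truncField μ c s t x‖
        ≤ ‖D.truncField μ c s t 0‖ + ‖D.truncField μ c s t x - D.truncField μ c s t 0‖ :=
          norm_le_norm_add_norm_sub' _ _ |>.trans (by rw [])
      _ ≤ _ := add_le_add (hb t) (h1.trans (mul_le_of_le_one_right (NNReal.coe_nonneg _) h3))
  · refine continuous_pi fun i => ?_
    have := Z.continuous_fields (abs_clamp_le zero_le_one x 0) (abs_clamp_le zero_le_one x 1)
    fin_cases i
    · exact this.1
    · exact this.2

end RefData.Valid

end LCHill

namespace LCHill

section PlaneBounds

variable {a₁₁ a₁₂ a₂₁ a₂₂ d₁ d₂ o A B₁ B₂ ε x y : ℝ}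

lemma abs_dot_le_mul_sqrt (hε : 0 ≤ ε) (hd : d₁ ^ 2 + d₂ ^ 2 ≤ ε ^ 2) :
    |x * d₁ + y * d₂| ≤ ε * √(x ^ 2 + y ^ 2) := by
  refine abs_le_of_sq_le_sq ?_ (by positivity)
  rw [mul_pow, Real.sq_sqrt (by positivity)]
  nlinarith [sq_nonneg (x * d₂ - y * d₁), mul_le_mul_of_nonneg_right hd (by positivity : 0 ≤ x ^ 2 + y ^ 2)]

lemma abs_radial_le (h₁₁ : |a₁₁| ≤ A) (h₁₂ : |a₁₂ - o| ≤ B₁) (h₂₁ : |a₂₁ + o| ≤ B₂)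
    (h₂₂ : |a₂₂| ≤ A) (hε : 0 ≤ ε) (hd : d₁ ^ 2 + d₂ ^ 2 ≤ ε ^ 2) :
    |2 * (x * (d₁ + (a₁₁ * x + a₁₂ * y)) + y * (d₂ + (a₂₁ * x + a₂₂ * y)))|
      ≤ (2 * A + B₁ + B₂) * (x ^ 2 + y ^ 2) + 2 * (ε * √(x ^ 2 + y ^ 2)) := by
  have h := abs_le.1 (abs_dot_le_mul_sqrt (x := x) (y := y) hε hd)
  rw [abs_le] at *
  have hB : 0 ≤ B₁ + B₂ := by linarith [h₁₂.1, h₁₂.2, h₂₁.1, h₂₁.2]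
  have e : 2 * (x * (d₁ + (a₁₁ * x + a₁₂ * y)) + y * (d₂ + (a₂₁ * x + a₂₂ * y)))
    = 2 * (x * d₁ + y * d₂) + 2 * (a₁₁ * x ^ 2) + 2 * (a₂₂ * y ^ 2)
      + ((a₁₂ - o) + (a₂₁ + o)) * (2 * (x * y)) := by ring
  rw [e]
  have p1 : ∀ {a z : ℝ}, -A ≤ a ∧ a ≤ A → -(A * z ^ 2) ≤ a * z ^ 2 ∧ a * z ^ 2 ≤ A * z ^ 2 :=
    fun {a z} ha => ⟨by linarith [mul_le_mul_of_nonneg_right ha.1 (sq_nonneg z)],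
      mul_le_mul_of_nonneg_right ha.2 (sq_nonneg z)⟩
  have q1 := p1 (z := x) h₁₁
  have q2 := p1 (z := y) h₂₂
  have q3 : |((a₁₂ - o) + (a₂₁ + o)) * (2 * (x * y))| ≤ (B₁ + B₂) * (x ^ 2 + y ^ 2) := by
    rw [abs_mul]
    refine mul_le_mul (abs_le.2 ⟨by linarith [h₁₂.1, h₂₁.1], by linarith [h₁₂.2, h₂₁.2]⟩)
      (abs_le.2 ⟨?_, ?_⟩) (abs_nonneg _) hB
    · nlinarith [sq_nonneg (x + y)]
    · nlinarith [sq_nonneg (x - y)]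
  rw [abs_le] at q3
  constructor <;> linarith [q1.1, q1.2, q2.1, q2.2, q3.1, q3.2, h.1, h.2]

lemma abs_rate_sub_le {m R : ℝ} (h₁₁ : |a₁₁| ≤ A) (h₁₂ : |a₁₂ - o| ≤ B₁) (h₂₁ : |a₂₁ + o| ≤ B₂)
    (h₂₂ : |a₂₂| ≤ A) (hε : 0 ≤ ε) (hd : d₁ ^ 2 + d₂ ^ 2 ≤ ε ^ 2) (hm : 0 < m)
    (hN : m ^ 2 ≤ x ^ 2 + y ^ 2) (hR₁ : A + B₁ + ε / m ≤ R) (hR₂ : A + B₂ + ε / m ≤ R) :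
    |(y * (d₁ + (a₁₁ * x + a₁₂ * y)) - x * (d₂ + (a₂₁ * x + a₂₂ * y))) / (y ^ 2 + x ^ 2) - o|
      ≤ R := by
  have hN0 : 0 < x ^ 2 + y ^ 2 := lt_of_lt_of_le (by positivity) hN
  have h := abs_le.1 (abs_dot_le_mul_sqrt (x := y) (y := -x) hε hd)
  have hs : ε * √(y ^ 2 + (-x) ^ 2) ≤ ε / m * (x ^ 2 + y ^ 2) := by
    rw [show y ^ 2 + (-x) ^ 2 = x ^ 2 + y ^ 2 by ring, div_mul_eq_mul_div, le_div_iff₀ hm, mul_assoc]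
    refine mul_le_mul_of_nonneg_left ?_ hε
    have h1 : m ≤ √(x ^ 2 + y ^ 2) := Real.le_sqrt_of_sq_le hN
    nlinarith [Real.sq_sqrt hN0.le, Real.sqrt_nonneg (x ^ 2 + y ^ 2)]
  rw [div_sub' (by linarith : y ^ 2 + x ^ 2 ≠ 0), abs_div, abs_of_pos (by linarith : 0 < y ^ 2 + x ^ 2),
    div_le_iff₀ (by linarith)]
  have e : y * (d₁ + (a₁₁ * x + a₁₂ * y)) - x * (d₂ + (a₂₁ * x + a₂₂ * y)) - (y ^ 2 + x ^ 2) * o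
      = (y * d₁ + -x * d₂) + (a₁₁ - a₂₂) * (x * y) + (a₁₂ - o) * y ^ 2 - (a₂₁ + o) * x ^ 2 := by
    ring
  rw [e]
  have q : |(a₁₁ - a₂₂) * (x * y)| ≤ A * (x ^ 2 + y ^ 2) := by
    have : |a₁₁ - a₂₂| ≤ 2 * A := by
      rw [abs_le] at *; constructor <;> linarith [h₁₁.1, h₁₁.2, h₂₂.1, h₂₂.2]
    rw [abs_mul]
    have h2 : |x * y| ≤ (x ^ 2 + y ^ 2) / 2 := abs_le.2
      ⟨by nlinarith [sq_nonneg (x + y)], by nlinarith [sq_nonneg (x - y)]⟩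
    calc _ ≤ 2 * A * ((x ^ 2 + y ^ 2) / 2) :=
          mul_le_mul this h2 (abs_nonneg _) ((abs_nonneg _).trans this)
      _ = _ := by ring
  have p1 : ∀ a z B : ℝ, |a| ≤ B → A + B + ε / m ≤ R →
      |a * z ^ 2| ≤ (R - A - ε / m) * z ^ 2 := fun a z B ha hb => by
    rw [abs_mul, abs_of_nonneg (sq_nonneg z)]
    exact mul_le_mul_of_nonneg_right (by linarith) (sq_nonneg z)
  have q1 := abs_le.1 (p1 _ y _ h₁₂ hR₁)
  have q2 := abs_le.1 (p1 _ x _ h₂₁ hR₂)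
  have q' := abs_le.1 q
  have e' : R * (y ^ 2 + x ^ 2) = (R - A - ε / m) * y ^ 2 + (R - A - ε / m) * x ^ 2
      + A * (x ^ 2 + y ^ 2) + ε / m * (x ^ 2 + y ^ 2) := by ring
  rw [e', abs_le]
  constructor <;> linarith [q1.1, q1.2, q2.1, q2.2, q'.1, q'.2, h.1, h.2]

end PlaneBounds

end LCHill

namespace LCHill

namespace RefData.Valid

variable {D : RefData} {μ c s : ℝ} {k : ℕ} {A B₁ B₂ ε W r₀ σ m R : ℝ}

lemma abs_radial_le (Z : D.Valid μ c s k A B₁ B₂ ε W r₀ σ m R) (θ : ℝ) {x y : ℝ}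
    (hN : x ^ 2 + y ^ 2 ≤ 1) :
    |2 * (x * D.field₁ μ c θ x y + y * D.field₂ μ c s θ x y)|
      ≤ (2 * A + B₁ + B₂) * (x ^ 2 + y ^ 2) + 2 * (ε * √(x ^ 2 + y ^ 2)) := by
  have hx : |x| ≤ 1 := (sq_le_one_iff_abs_le_one x).1 (by nlinarith [sq_nonneg y])
  have hy : |y| ≤ 1 := (sq_le_one_iff_abs_le_one y).1 (by nlinarith [sq_nonneg x])
  obtain ⟨a₁₁, a₁₂, a₂₁, a₂₂, e1, e2, e3, e4, e5, e6⟩ := Z.exists_mean θ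
    (x := 0) (y := 0) (by simp) (by simp) hx hy
  have := LCHill.abs_radial_le (x := x) (y := y) e1 e2 e3 e4 Z.ε_pos.le (Z.defect θ)
  rwa [show D.field₁ μ c θ 0 0 + (a₁₁ * x + a₁₂ * y) = D.field₁ μ c θ x y by linarith,
    show D.field₂ μ c s θ 0 0 + (a₂₁ * x + a₂₂ * y) = D.field₂ μ c s θ x y by linarith] at this

lemma abs_rate_sub_le (Z : D.Valid μ c s k A B₁ B₂ ε W r₀ σ m R) (θ : ℝ) {x y : ℝ}
    (hN : x ^ 2 + y ^ 2 ≤ 1) (hm : m ^ 2 ≤ x ^ 2 + y ^ 2) :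
    |(y * D.field₁ μ c θ x y - x * D.field₂ μ c s θ x y) / (y ^ 2 + x ^ 2) - D.om θ| ≤ R := by
  have hx : |x| ≤ 1 := (sq_le_one_iff_abs_le_one x).1 (by nlinarith [sq_nonneg y])
  have hy : |y| ≤ 1 := (sq_le_one_iff_abs_le_one y).1 (by nlinarith [sq_nonneg x])
  obtain ⟨a₁₁, a₁₂, a₂₁, a₂₂, e1, e2, e3, e4, e5, e6⟩ := Z.exists_mean θ
    (x := 0) (y := 0) (by simp) (by simp) hx hy
  have := LCHill.abs_rate_sub_le (x := x) (y := y) e1 e2 e3 e4 Z.ε_pos.le (Z.defect θ) Z.m_pos hm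
    Z.rate₁ Z.rate₂
  rwa [show D.field₁ μ c θ 0 0 + (a₁₁ * x + a₁₂ * y) = D.field₁ μ c θ x y by linarith,
    show D.field₂ μ c s θ 0 0 + (a₂₁ * x + a₂₂ * y) = D.field₂ μ c s θ x y by linarith] at this

lemma growth_pos (Z : D.Valid μ c s k A B₁ B₂ ε W r₀ σ m R) : 0 < 2 * A + B₁ + B₂ + 2 * ε := by
  linarith [Z.A_nonneg, Z.B₁_nonneg, Z.B₂_nonneg, Z.ε_pos]

lemma radial_lt (Z : D.Valid μ c s k A B₁ B₂ ε W r₀ σ m R) (θ : ℝ) {x y : ℝ}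
    (hN : x ^ 2 + y ^ 2 < 1) :
    |2 * (x * D.field₁ μ c θ x y + y * D.field₂ μ c s θ x y)| < 2 * A + B₁ + B₂ + 2 * ε := by
  refine (Z.abs_radial_le θ hN.le).trans_lt ?_
  have h1 : (2 * A + B₁ + B₂) * (x ^ 2 + y ^ 2) ≤ 2 * A + B₁ + B₂ :=
    mul_le_of_le_one_right (by linarith [Z.A_nonneg, Z.B₁_nonneg, Z.B₂_nonneg]) hN.le
  have h2 : √(x ^ 2 + y ^ 2) < 1 := by
    rw [Real.sqrt_lt' one_pos]; simpa using hN
  have h3 : ε * √(x ^ 2 + y ^ 2) < ε := mul_lt_of_lt_one_right Z.ε_pos h2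
  linarith

lemma truncField_eq (v : Fin 2 → ℝ) (hN : v 0 ^ 2 + v 1 ^ 2 ≤ 1) (θ : ℝ) :
    D.truncField μ c s θ v = ![D.field₁ μ c θ (v 0) (v 1), D.field₂ μ c s θ (v 0) (v 1)] := by
  rw [truncField, clamp_eq_self]
  intro i
  refine (sq_le_one_iff_abs_le_one _).1 ?_
  fin_cases i
  · exact le_trans (by simp [sq_nonneg]) hN
  · exact le_trans (by simp [sq_nonneg]) hN

lemma continuous_truncField (Z : D.Valid μ c s k A B₁ B₂ ε W r₀ σ m R) :
    Continuous fun q : ℝ × (Fin 2 → ℝ) => D.truncField μ c s q.1 q.2 := by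
  refine continuous_prod_of_continuous_lipschitzWith' _ _ Z.lipschitz_truncField fun w => ?_
  have := Z.continuous_fields (abs_clamp_le zero_le_one w 0) (abs_clamp_le zero_le_one w 1)
  refine continuous_pi fun i => ?_
  fin_cases i
  · exact this.1
  · exact this.2

section Trajectory

variable {v : ℝ → Fin 2 → ℝ} (hv : ∀ θ, HasDerivAt v (D.truncField μ c s θ (v θ)) θ)
  (h0 : v 0 0 ^ 2 + v 0 1 ^ 2 ≤ σ ^ 2)
include hv

lemma hasDerivAt_sq {θ : ℝ} (hN : v θ 0 ^ 2 + v θ 1 ^ 2 ≤ 1) :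
    HasDerivAt (fun θ => v θ 0 ^ 2 + v θ 1 ^ 2) (2 * (v θ 0 * D.field₁ μ c θ (v θ 0) (v θ 1)
      + v θ 1 * D.field₂ μ c s θ (v θ 0) (v θ 1))) θ := by
  have h := hv θ
  rw [truncField_eq _ hN, hasDerivAt_pi] at h
  refine (((h 0).pow 2).add ((h 1).pow 2)).congr_deriv ?_
  simp
  ring

include h0 in
lemma sq_le (Z : D.Valid μ c s k A B₁ B₂ ε W r₀ σ m R) :
    ∀ θ ∈ Icc 0 Real.pi, v θ 0 ^ 2 + v θ 1 ^ 2 ≤ σ ^ 2 + (2 * A + B₁ + B₂ + 2 * ε) * θ := by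
  have hvi := fun θ => hasDerivAt_pi.1 (hv θ)
  have hcont : Continuous fun θ => v θ 0 ^ 2 + v θ 1 ^ 2 :=
    continuous_iff_continuousAt.2 fun θ =>
      (((hvi θ 0).pow 2).add ((hvi θ 1).pow 2)).continuousAt
  refine fun θ hθ => image_le_of_deriv_right_lt_deriv_boundary' hcont.continuousOn
    (fun θ _ => (((hvi θ 0).pow 2).add ((hvi θ 1).pow 2)).hasDerivWithinAt) (by simpa using h0)
    (B := fun θ => σ ^ 2 + (2 * A + B₁ + B₂ + 2 * ε) * θ)
    (B' := fun _ => 2 * A + B₁ + B₂ + 2 * ε)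
    (by fun_prop) (fun θ _ => by
      simpa using (((hasDerivAt_id θ).const_mul (2 * A + B₁ + B₂ + 2 * ε)).const_add
        (σ ^ 2)).hasDerivWithinAt) (fun θ hθ he => ?_) hθ
  have he : v θ 0 ^ 2 + v θ 1 ^ 2 = σ ^ 2 + (2 * A + B₁ + B₂ + 2 * ε) * θ := he
  have hlt : v θ 0 ^ 2 + v θ 1 ^ 2 < 1 := by
    rw [he]
    exact lt_of_le_of_lt (by linarith [mul_le_mul_of_nonneg_left hθ.2.le Z.growth_pos.le]) Z.upper
  refine lt_of_le_of_lt ?_ ((le_abs_self _).trans_lt (Z.radial_lt θ hlt))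
  rw [truncField_eq _ hlt.le]
  simp
  linarith

include h0 in
lemma sq_lt_one (Z : D.Valid μ c s k A B₁ B₂ ε W r₀ σ m R) {θ : ℝ} (hθ : θ ∈ Icc 0 Real.pi) :
    v θ 0 ^ 2 + v θ 1 ^ 2 < 1 :=
  (sq_le hv h0 Z θ hθ).trans_lt
    (lt_of_le_of_lt (by linarith [mul_le_mul_of_nonneg_left hθ.2 Z.growth_pos.le]) Z.upper)

lemma le_sq (Z : D.Valid μ c s k A B₁ B₂ ε W r₀ σ m R) (h0 : v 0 0 ^ 2 + v 0 1 ^ 2 = σ ^ 2)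
    {θ : ℝ} (hθ : θ ∈ Icc 0 Real.pi) : m ^ 2 ≤ v θ 0 ^ 2 + v θ 1 ^ 2 := by
  have h := (convex_Icc (0 : ℝ) Real.pi).norm_image_sub_le_of_norm_hasDerivWithin_le
    (x := 0) (y := θ) (fun t ht => (hasDerivAt_sq hv (sq_lt_one hv h0.le Z ht).le).hasDerivWithinAt)
    (fun t ht => (Z.radial_lt t (sq_lt_one hv h0.le Z ht)).le) ⟨le_rfl, Real.pi_pos.le⟩ hθ
  rw [Real.norm_eq_abs, Real.norm_eq_abs, sub_zero, abs_of_nonneg hθ.1, h0] at h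
  linarith [(abs_le.1 h).1, Z.lower, mul_le_mul_of_nonneg_left hθ.2 Z.growth_pos.le]

/-- Along a trajectory starting on the circle of radius `σ` at `(σ sin b, σ cos b)`, the angle
increases by an amount in `(k π / 2, (k + 1) π / 2)`. -/
lemma exists_angle (Z : D.Valid μ c s k A B₁ B₂ ε W r₀ σ m R) {b : ℝ}
    (hx : v 0 0 = σ * Real.sin b) (hy : v 0 1 = σ * Real.cos b) :
    ∃ r φ : ℝ, 0 < r ∧ k * (Real.pi / 2) < φ ∧ φ < (k + 1) * (Real.pi / 2) ∧
      v Real.pi 1 = r * Real.cos (b + φ) := by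
  have h0 : v 0 0 ^ 2 + v 0 1 ^ 2 = σ ^ 2 := by
    rw [hx, hy]; linear_combination σ ^ 2 * Real.sin_sq_add_cos_sq b
  have hπ := Real.pi_pos
  have hN := fun θ (hθ : θ ∈ Icc 0 Real.pi) => (sq_lt_one hv h0.le Z hθ).le
  have hm := fun θ (hθ : θ ∈ Icc 0 Real.pi) => le_sq hv Z h0 hθ
  have hpos : ∀ θ ∈ Icc 0 Real.pi, 0 < v θ 1 ^ 2 + v θ 0 ^ 2 := fun θ hθ => by
    linarith [hm θ hθ, pow_pos Z.m_pos 2]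
  have hd : ∀ θ ∈ Icc 0 Real.pi, HasDerivAt (fun θ => v θ 0) (D.field₁ μ c θ (v θ 0) (v θ 1)) θ ∧
      HasDerivAt (fun θ => v θ 1) (D.field₂ μ c s θ (v θ 0) (v θ 1)) θ := fun θ hθ => by
    have h := hv θ
    rw [truncField_eq _ (hN θ hθ), hasDerivAt_pi] at h
    exact ⟨by simpa using h 0, by simpa using h 1⟩
  have hσ : √(v 0 1 ^ 2 + v 0 0 ^ 2) = σ := by
    rw [show v 0 1 ^ 2 + v 0 0 ^ 2 = σ ^ 2 by linarith, Real.sqrt_sq Z.σ_pos.le]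
  have hvc : Continuous v := continuous_iff_continuousAt.2 fun θ => (hv θ).continuousAt
  have htc := continuous_pi_iff.1 (Z.continuous_truncField.comp (continuous_id.prodMk hvc))
  obtain ⟨β, hβ0, hβ, hβ'⟩ := exists_polar_lift hπ.le (fun θ hθ => (hd θ hθ).2)
    (fun θ hθ => (hd θ hθ).1)
    ((htc 1).continuousOn.congr fun θ hθ => by simp [truncField_eq _ (hN θ hθ)])
    ((htc 0).continuousOn.congr fun θ hθ => by simp [truncField_eq _ (hN θ hθ)]) hpos (b₀ := b) (by rw [hσ, hy]) (by rw [hσ, hx])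
  have h1 := abs_sub_le_of_deriv_near hπ.le hβ (fun θ _ => Z.Om θ)
    (fun θ hθ => Z.abs_rate_sub_le θ (hN θ hθ) (hm θ hθ))
  rw [Z.Om_pi, abs_le] at h1
  have hπi : Real.pi ∈ Icc 0 Real.pi := ⟨hπ.le, le_rfl⟩
  refine ⟨_, β Real.pi - b, Real.sqrt_pos.2 (hpos _ hπi), ?_, ?_, ?_⟩
  · nlinarith [Z.rot_lower]
  · nlinarith [Z.rot_upper]
  · rw [add_sub_cancel]
    exact (hβ' _ hπi).1

end Trajectory

end RefData.Valid

end LCHill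

namespace LCHill

/-- The reflection reversing the second coordinate. -/
def planeRefl (w : Fin 2 → ℝ) : Fin 2 → ℝ := ![w 0, -w 1]

lemma planeRefl_planeRefl (w : Fin 2 → ℝ) : planeRefl (planeRefl w) = w := by
  funext i; fin_cases i <;> simp [planeRefl]

lemma clamp_planeRefl (w : Fin 2 → ℝ) : clamp 1 (planeRefl w) = planeRefl (clamp 1 w) := by
  have h : ∀ a : ℝ, max (-1) (min 1 (-a)) = -max (-1) (min 1 a) := fun a => by
    rcases le_total a 1 with h1 | h1 <;> rcases le_total (-1) a with h2 | h2 <;>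
      simp [min_def, max_def] <;> split_ifs <;> linarith
  funext i
  fin_cases i
  · simp [clamp, planeRefl]
  · simpa [clamp, planeRefl] using h (w 1)

lemma hasDerivAt_planeRefl_comp {v : ℝ → Fin 2 → ℝ} {w : Fin 2 → ℝ} {t : ℝ} (a : ℝ)
    (h : HasDerivAt v w (a - t)) : HasDerivAt (fun t => planeRefl (v (a - t))) (-planeRefl w) t := by
  have h1 : HasDerivAt (fun t => v (a - t)) (-w) t :=
    (h.scomp t ((hasDerivAt_id t).const_sub a)).congr_deriv (by simp)
  rw [hasDerivAt_pi] at h1 ⊢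
  intro i
  fin_cases i
  · simpa [planeRefl] using h1 0
  · exact (h1 1).neg

namespace RefData.Valid

variable {D : RefData} {μ c s : ℝ} {k : ℕ} {A B₁ B₂ ε W r₀ σ m R : ℝ}

lemma field₁_parity (Z : D.Valid μ c s k A B₁ B₂ ε W r₀ σ m R) (θ x y : ℝ) :
    D.field₁ μ c (-θ) x (-y) = -D.field₁ μ c θ x y := by
  have h1 : D.rad (-θ) x = D.rad θ x := by simp [rad, Z.rr.parity, Z.al.parity]
  have h2 : D.mom (-θ) x (-y) = -D.mom θ x y := by
    simp only [mom, Z.pp.parity, Z.be.parity, Z.ka.parity]; ring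
  rw [field₁, field₁, h1, h2, Real.cos_neg, redR, redR, invAng_neg, Z.rr.parity_deriv,
    Z.al.parity_deriv, Z.al.parity]
  ring

lemma field₂_parity (Z : D.Valid μ c s k A B₁ B₂ ε W r₀ σ m R) (θ x y : ℝ) :
    D.field₂ μ c s (-θ) x (-y) = D.field₂ μ c s θ x y := by
  have h1 : D.rad (-θ) x = D.rad θ x := by simp [rad, Z.rr.parity, Z.al.parity]
  have h2 : D.mom (-θ) x (-y) = -D.mom θ x y := by
    simp only [mom, Z.pp.parity, Z.be.parity, Z.ka.parity]; ring
  rw [field₂, field₂, Z.field₁_parity, h1, h2, Real.cos_neg, redP, redP, invAng_neg,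
    Z.pp.parity_deriv, Z.be.parity_deriv, Z.be.parity, Z.ka.parity_deriv, Z.ka.parity]
  ring

lemma truncField_neg (Z : D.Valid μ c s k A B₁ B₂ ε W r₀ σ m R) (θ : ℝ) (w : Fin 2 → ℝ) :
    D.truncField μ c s (-θ) (planeRefl w) = -planeRefl (D.truncField μ c s θ w) := by
  rw [truncField, clamp_planeRefl]
  funext i
  fin_cases i
  · simpa [planeRefl, truncField] using Z.field₁_parity _ _ _
  · simpa [planeRefl, truncField] using Z.field₂_parity _ _ _

lemma truncField_periodic (Z : D.Valid μ c s k A B₁ B₂ ε W r₀ σ m R) (θ : ℝ) (w : Fin 2 → ℝ) :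
    D.truncField μ c s (θ + 2 * Real.pi) w = D.truncField μ c s θ w := by
  simp only [truncField, field₁, field₂, rad, mom, Z.rr.periodic, Z.pp.periodic, Z.al.periodic,
    Z.be.periodic, Z.ka.periodic, Z.rr.periodic_deriv, Z.pp.periodic_deriv, Z.al.periodic_deriv,
    Z.be.periodic_deriv, Z.ka.periodic_deriv, Real.cos_add_two_pi]

/-- Shooting: some trajectory starts and ends a half turn on the symmetry axis. -/
lemma exists_symmetric_trajectory (Z : D.Valid μ c s k A B₁ B₂ ε W r₀ σ m R)
    (hk : k = 1 ∨ k = 2) :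
    ∃ v : ℝ → Fin 2 → ℝ, (∀ θ, HasDerivAt v (D.truncField μ c s θ (v θ)) θ) ∧
      v 0 0 ^ 2 + v 0 1 ^ 2 ≤ σ ^ 2 ∧ v 0 1 = 0 ∧ v Real.pi 1 = 0 := by
  have hex := fun u : ℝ => Z.exists_trajectory ![u, 0]
  choose V hV0 hV using hex
  set L := (A + B₁ + B₂ + W).toNNReal
  have hc : Continuous fun u => V u Real.pi 1 := by
    refine LipschitzWith.continuous (K := (Real.exp (L * |Real.pi|)).toNNReal)
      (LipschitzWith.of_dist_le_mul fun u w => ?_)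
    rw [Real.coe_toNNReal _ (Real.exp_pos _).le, mul_comm]
    refine (dist_le_pi_dist (V u Real.pi) (V w Real.pi) 1).trans
      ((dist_le_exp_of_lipschitz Z.lipschitz_truncField (hV u) (hV w) Real.pi).trans ?_)
    rw [hV0, hV0]
    refine mul_le_mul_of_nonneg_right ((dist_pi_le_iff dist_nonneg).2 fun i => ?_)
      (Real.exp_pos _).le
    fin_cases i <;> simp
  obtain ⟨r, φ, hr, h1, h2, h3⟩ := exists_angle (hV σ) Z (b := Real.pi / 2)
    (by simp [hV0]) (by simp [hV0])
  obtain ⟨r', φ', hr', h1', h2', h3'⟩ := exists_angle (hV (-σ)) Z (b := -(Real.pi / 2))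
    (by simp [hV0]) (by simp [hV0])
  rw [Real.cos_add, Real.cos_pi_div_two, Real.sin_pi_div_two] at h3
  rw [Real.cos_add, Real.cos_neg, Real.sin_neg, Real.cos_pi_div_two, Real.sin_pi_div_two] at h3'
  have hz : (0 : ℝ) ∈ uIcc (V (-σ) Real.pi 1) (V σ Real.pi 1) := by
    rw [h3, h3', mem_uIcc]
    have hπ := Real.pi_pos
    rcases hk with rfl | rfl <;> push_cast at *
    · right
      have e1 := mul_pos hr (Real.sin_pos_of_pos_of_lt_pi (x := φ) (by linarith) (by linarith))
      have e2 := mul_pos hr' (Real.sin_pos_of_pos_of_lt_pi (x := φ') (by linarith) (by linarith))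
      constructor <;> linarith
    · left
      have e1 := mul_pos hr (Real.sin_pos_of_pos_of_lt_pi (x := φ - Real.pi) (by linarith)
        (by linarith))
      have e2 := mul_pos hr' (Real.sin_pos_of_pos_of_lt_pi (x := φ' - Real.pi) (by linarith)
        (by linarith))
      rw [Real.sin_sub_pi] at e1 e2
      constructor <;> linarith
  obtain ⟨u, hu, hu0⟩ := intermediate_value_uIcc hc.continuousOn hz
  refine ⟨V u, hV u, ?_, by simp [hV0], hu0⟩
  rw [uIcc_of_le (by linarith [Z.σ_pos])] at hu
  rw [hV0]
  simpa using sq_le_sq' hu.1 hu.2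

/-- A symmetric trajectory extends to a periodic one which stays in the tube. -/
theorem exists_periodic (Z : D.Valid μ c s k A B₁ B₂ ε W r₀ σ m R) (hk : k = 1 ∨ k = 2) :
    ∃ r p : ℝ → ℝ, (∀ θ, HasDerivAt r (redR μ c (r θ) (p θ) (Real.cos θ)) θ) ∧
      (∀ θ, HasDerivAt p (redP μ c s (r θ) (p θ) (Real.cos θ)) θ) ∧
      (∀ θ, r (-θ) = r θ) ∧ (∀ θ, p (-θ) = -p θ) ∧
      (∀ θ, r (θ + 2 * Real.pi) = r θ) ∧ (∀ θ, p (θ + 2 * Real.pi) = p θ) ∧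
      ∀ θ, ∃ x y, |x| ≤ 1 ∧ |y| ≤ 1 ∧ r θ = D.rad θ x ∧ p θ = D.mom θ x y := by
  obtain ⟨v, hv, h0, hv0, hvπ⟩ := Z.exists_symmetric_trajectory hk
  have hrefl : ∀ w : Fin 2 → ℝ, w 1 = 0 → planeRefl w = w := fun w hw => by
    funext i; fin_cases i <;> simp [planeRefl, hw]
  have heven : ∀ θ, v (-θ) = planeRefl (v θ) := fun θ => by
    have := solution_unique Z.lipschitz_truncField hv
      (β := fun θ => planeRefl (v (0 - θ))) (fun θ => by
        have := hasDerivAt_planeRefl_comp 0 (hv (0 - θ))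
        rwa [← Z.truncField_neg, neg_sub, sub_zero] at this) (by simp [hrefl _ hv0]) (-θ)
    simpa using this
  have hshift : ∀ θ, v (Real.pi + θ) = planeRefl (v (Real.pi - θ)) := fun θ => by
    refine solution_unique (f := fun t => D.truncField μ c s (Real.pi + t))
      (α := fun θ => v (Real.pi + θ)) (β := fun θ => planeRefl (v (Real.pi - θ)))
      (fun t => Z.lipschitz_truncField _) (fun t => (hv _).comp_const_add Real.pi t) (fun t => ?_)
      (by simp [hrefl _ hvπ]) θ
    have := hasDerivAt_planeRefl_comp Real.pi (hv (Real.pi - t))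
    rwa [← Z.truncField_neg, ← Z.truncField_periodic,
      show -(Real.pi - t) + 2 * Real.pi = Real.pi + t by ring] at this
  have hper : ∀ θ, v (θ + 2 * Real.pi) = v θ := fun θ => by
    rw [show θ + 2 * Real.pi = Real.pi + (Real.pi + θ) by ring, hshift,
      show Real.pi - (Real.pi + θ) = -θ by ring, heven, planeRefl_planeRefl]
  have hsq : ∀ θ, v θ 0 ^ 2 + v θ 1 ^ 2 < 1 := by
    have hP : Function.Periodic (fun θ => v θ 0 ^ 2 + v θ 1 ^ 2) (2 * Real.pi) := fun θ => by
      simp only [hper]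
    intro θ
    obtain ⟨t, ht, he⟩ := hP.exists_mem_Ico (by linarith [Real.pi_pos]) θ (-Real.pi)
    have he : v θ 0 ^ 2 + v θ 1 ^ 2 = v t 0 ^ 2 + v t 1 ^ 2 := he
    rw [he]
    rcases le_total 0 t with h | h
    · exact sq_lt_one hv h0 Z ⟨h, by linarith [ht.2]⟩
    · have := sq_lt_one hv h0 Z (θ := -t) ⟨by linarith, by linarith [ht.1]⟩
      rw [heven] at this
      simpa [planeRefl] using this
  have hd : ∀ θ, HasDerivAt (fun θ => v θ 0) (D.field₁ μ c θ (v θ 0) (v θ 1)) θ ∧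
      HasDerivAt (fun θ => v θ 1) (D.field₂ μ c s θ (v θ 0) (v θ 1)) θ := fun θ => by
    have h := hv θ
    rw [truncField_eq _ (hsq θ).le, hasDerivAt_pi] at h
    exact ⟨by simpa using h 0, by simpa using h 1⟩
  refine ⟨fun θ => D.rad θ (v θ 0), fun θ => D.mom θ (v θ 0) (v θ 1), fun θ => ?_, fun θ => ?_,
    fun θ => ?_, fun θ => ?_, fun θ => ?_, fun θ => ?_, fun θ => ⟨v θ 0, v θ 1, ?_, ?_, rfl, rfl⟩⟩
  · refine ((Z.rr.hasDerivAt θ).add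
      (((Z.al.hasDerivAt θ).const_mul D.τ).mul (hd θ).1)).congr_deriv ?_
    have h1 := Z.τ_pos.ne'
    have h2 := (Z.al_pos θ).ne'
    simp only [field₁]
    field_simp
    ring
  · refine ((Z.pp.hasDerivAt θ).add ((((Z.be.hasDerivAt θ).mul (hd θ).1).add
      ((Z.ka.hasDerivAt θ).mul (hd θ).2)).const_mul D.τ)).congr_deriv ?_
    have h1 := Z.τ_pos.ne'
    have h2 := (Z.ka_pos θ).ne'
    simp only [field₂]
    field_simp
    ring
  · simp [heven, rad, Z.rr.parity, Z.al.parity, planeRefl]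
  · simp only [heven, mom, Z.pp.parity, Z.be.parity, Z.ka.parity, planeRefl]
    simp
    ring
  · simp only [hper, rad, Z.rr.periodic, Z.al.periodic]
  · simp only [hper, mom, Z.pp.periodic, Z.be.periodic, Z.ka.periodic]
  · exact (sq_le_one_iff_abs_le_one _).1 (by nlinarith [hsq θ, sq_nonneg (v θ 1)])
  · exact (sq_le_one_iff_abs_le_one _).1 (by nlinarith [hsq θ, sq_nonneg (v θ 0)])

end RefData.Valid

end LCHill

namespace LCHill

/-! ### Smoothness of the Levi-Civita Hamiltonian -/

/-- `|2z² - 1|²`. -/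
def sqDist (x : V4) : ℝ := (2 * (x 0 ^ 2 - x 1 ^ 2) - 1) ^ 2 + (4 * x 0 * x 1) ^ 2

/-- `1 / |2z² - 1|`. -/
def invAbs (x : V4) : ℝ := (√(sqDist x))⁻¹

lemma mem_LCDom_iff {x : V4} : x ∈ LCDom ↔ 0 < sqDist x := by
  rw [LCDom, mem_ofPred_eq, lcAbs, ← sqDist, ← Real.sqrt_pos]
  exact ⟨fun h => lt_of_le_of_ne (Real.sqrt_nonneg _) (Ne.symm h), fun h => h.ne'⟩

lemma contDiff_sqDist : ContDiff ℝ 3 sqDist := by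
  unfold sqDist; fun_prop

lemma isOpen_LCDom : IsOpen LCDom := by
  have : LCDom = sqDist ⁻¹' Ioi 0 := by ext x; exact mem_LCDom_iff
  rw [this]
  exact isOpen_Ioi.preimage contDiff_sqDist.continuous

lemma Kham_eq (μ c : ℝ) : Kham μ c = fun x => (1 / 2) * ((x 2) ^ 2 + (x 3) ^ 2)
    + c * ((x 0) ^ 2 + (x 1) ^ 2) - (1 - μ) / 2
    + 2 * ((x 0) ^ 2 + (x 1) ^ 2) * (x 0 * x 3 - x 1 * x 2)
    - μ * (x 0 * x 3 + x 1 * x 2) - μ * ((x 0) ^ 2 + (x 1) ^ 2) * invAbs x := rfl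

lemma contDiffAt_invAbs {x : V4} (hx : x ∈ LCDom) : ContDiffAt ℝ 3 invAbs x := by
  have h := mem_LCDom_iff.1 hx
  exact (contDiff_sqDist.contDiffAt.sqrt h.ne').inv (Real.sqrt_pos.2 h).ne'

lemma contDiffAt_Kham (μ c : ℝ) {x : V4} (hx : x ∈ LCDom) : ContDiffAt ℝ 3 (Kham μ c) x := by
  rw [Kham_eq]
  have := contDiffAt_invAbs hx
  fun_prop

section Curve

variable {x : ℝ → V4} {v : V4} {t : ℝ} (hx : HasDerivAt x v t)
include hx

lemma hasDerivAt_sqDist : HasDerivAt (fun t => sqDist (x t))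
    (2 * ((8 * (x t 0 ^ 2 + x t 1 ^ 2) - 4) * x t 0 * v 0
      + (8 * (x t 0 ^ 2 + x t 1 ^ 2) + 4) * x t 1 * v 1)) t := by
  have h := hasDerivAt_pi.1 hx
  refine (((((((h 0).pow 2).sub ((h 1).pow 2)).const_mul 2).sub_const 1).pow 2).add
    ((((h 0).const_mul 4).mul (h 1)).pow 2)).congr_deriv ?_
  simp only [Pi.sub_apply, Pi.pow_apply, Pi.mul_apply]
  push_cast
  ring

lemma hasDerivAt_invAbs (hD : x t ∈ LCDom) : HasDerivAt (fun t => invAbs (x t))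
    (-(invAbs (x t) ^ 3 * ((8 * (x t 0 ^ 2 + x t 1 ^ 2) - 4) * x t 0 * v 0
      + (8 * (x t 0 ^ 2 + x t 1 ^ 2) + 4) * x t 1 * v 1))) t := by
  have h0 := mem_LCDom_iff.1 hD
  have hs : √(sqDist (x t)) ≠ 0 := (Real.sqrt_pos.2 h0).ne'
  refine (((hasDerivAt_sqDist hx).sqrt h0.ne').inv hs).congr_deriv ?_
  rw [invAbs]
  field_simp

end Curve

/-- The gradient of the Levi-Civita Hamiltonian. -/
def gradK (μ c : ℝ) (x : V4) : V4 :=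
  ![2 * c * x 0 + 4 * x 0 * (x 0 * x 3 - x 1 * x 2) + 2 * (x 0 ^ 2 + x 1 ^ 2) * x 3 - μ * x 3
      - 2 * μ * x 0 * invAbs x
      + μ * (x 0 ^ 2 + x 1 ^ 2) * invAbs x ^ 3 * (8 * (x 0 ^ 2 + x 1 ^ 2) - 4) * x 0,
    2 * c * x 1 + 4 * x 1 * (x 0 * x 3 - x 1 * x 2) - 2 * (x 0 ^ 2 + x 1 ^ 2) * x 2 - μ * x 2
      - 2 * μ * x 1 * invAbs x
      + μ * (x 0 ^ 2 + x 1 ^ 2) * invAbs x ^ 3 * (8 * (x 0 ^ 2 + x 1 ^ 2) + 4) * x 1,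
    x 2 - 2 * (x 0 ^ 2 + x 1 ^ 2) * x 1 - μ * x 1,
    x 3 + 2 * (x 0 ^ 2 + x 1 ^ 2) * x 0 - μ * x 0]

lemma hasDerivAt_Kham {μ c : ℝ} {x : ℝ → V4} {v : V4} {t : ℝ} (hx : HasDerivAt x v t)
    (hD : x t ∈ LCDom) : HasDerivAt (fun t => Kham μ c (x t)) (gradK μ c (x t) ⬝ᵥ v) t := by
  have h := hasDerivAt_pi.1 hx
  have hG := hasDerivAt_invAbs hx hD
  rw [Kham_eq]
  refine ((((((((((h 2).pow 2).add ((h 3).pow 2)).const_mul (1 / 2)).add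
    ((((h 0).pow 2).add ((h 1).pow 2)).const_mul c)).sub_const ((1 - μ) / 2)).add
    (((((h 0).pow 2).add ((h 1).pow 2)).const_mul 2).mul
      (((h 0).mul (h 3)).sub ((h 1).mul (h 2))))).sub
    ((((h 0).mul (h 3)).add ((h 1).mul (h 2))).const_mul μ)).sub
    (((((h 0).pow 2).add ((h 1).pow 2)).const_mul μ).mul hG))).congr_deriv ?_
  simp only [Pi.sub_apply, Pi.add_apply, Pi.pow_apply, Pi.mul_apply, gradK, dotProduct,
    Fin.sum_univ_four, cons_val]
  push_cast
  ring

lemma hasDerivAt_line (x v : V4) (t : ℝ) : HasDerivAt (fun h : ℝ => x + h • v) v t := by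
  simpa using ((hasDerivAt_id t).smul_const v).const_add x

/-- The derivative of a differentiable function along a line. -/
lemma hasDerivAt_comp_line {E : Type*} [NormedAddCommGroup E] [NormedSpace ℝ E] {g : V4 → E}
    {x : V4} (hg : DifferentiableAt ℝ g x) (v : V4) :
    HasDerivAt (fun h : ℝ => g (x + h • v)) (fderiv ℝ g x v) 0 := by
  have h1 : HasFDerivAt g (fderiv ℝ g x) (x + (0 : ℝ) • v) := by simpa using hg.hasFDerivAt
  exact h1.comp_hasDerivAt 0 (hasDerivAt_line x v 0)

lemma fderiv_Kham (μ c : ℝ) {x : V4} (hx : x ∈ LCDom) (v : V4) :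
    fderiv ℝ (Kham μ c) x v = gradK μ c x ⬝ᵥ v := by
  have h1 := hasDerivAt_comp_line ((contDiffAt_Kham μ c hx).differentiableAt (by norm_num)) v
  have h2 := hasDerivAt_Kham (μ := μ) (c := c) (hasDerivAt_line x v 0) (by simpa using hx)
  simpa using h1.unique h2

lemma gradient4_Kham (μ c : ℝ) {x : V4} (hx : x ∈ LCDom) :
    gradient4 (Kham μ c) x = gradK μ c x := by
  funext i
  simp [gradient4, fderiv_Kham μ c hx]

lemma symplGrad_Kham (μ c : ℝ) {x : V4} (hx : x ∈ LCDom) :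
    symplGrad (Kham μ c) x
      = ![gradK μ c x 2, gradK μ c x 3, -gradK μ c x 0, -gradK μ c x 1] := by
  simp [symplGrad, fderiv_Kham μ c hx]

lemma contDiffAt_symplGrad (μ c : ℝ) {x : V4} (hx : x ∈ LCDom) :
    ContDiffAt ℝ 2 (symplGrad (Kham μ c)) x := by
  have h : ContDiffAt ℝ 2 (fderiv ℝ (Kham μ c)) x :=
    (contDiffAt_Kham μ c hx).fderiv_right (by norm_num)
  have h' : ∀ e : V4, ContDiffAt ℝ 2 (fun y => fderiv ℝ (Kham μ c) y e) x :=
    fun e => h.clm_apply contDiffAt_const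
  refine contDiffAt_pi.2 fun i => ?_
  fin_cases i
  · exact h' _
  · exact h' _
  · exact (h' _).neg
  · exact (h' _).neg

/-- Differentiating `DG(γ) v` along an orbit `γ` for a solution `v` of the variational equation. -/
lemma hasDerivAt_fderiv_apply {G : V4 → ℝ} {X : V4 → V4} {γ v : ℝ → V4} {t : ℝ}
    (hG : ContDiffAt ℝ 2 G (γ t)) (hX : DifferentiableAt ℝ X (γ t))
    (hγ : HasDerivAt γ (X (γ t)) t) (hv : HasDerivAt v (fderiv ℝ X (γ t) (v t)) t) :
    HasDerivAt (fun t => fderiv ℝ G (γ t) (v t))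
      (fderiv ℝ (fun x => fderiv ℝ G x (X x)) (γ t) (v t)) t := by
  have hd : DifferentiableAt ℝ (fderiv ℝ G) (γ t) :=
    (hG.fderiv_right (m := 1) (by norm_num)).differentiableAt (by norm_num)
  have h1 := (hd.hasFDerivAt.comp_hasDerivAt t hγ).clm_apply hv
  have h2 := (hd.hasFDerivAt.clm_apply hX.hasFDerivAt).fderiv
  refine h1.congr_deriv ?_
  rw [h2]
  have hs := (hG.isSymmSndFDerivAt (by simp)) (X (γ t)) (v t)
  simp [hs, add_comm]

end LCHill

namespace LCHill

/-! ### From the reduced system back to phase space -/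

/-- The point of phase space with position `(x, y)`, radial momentum `z · ż = p` and angular
momentum `z × ż = l`. -/
def phasePt (μ x y p l : ℝ) : V4 :=
  ![x, y, (p * x - l * y) / (x ^ 2 + y ^ 2) + (2 * (x ^ 2 + y ^ 2) + μ) * y,
    (p * y + l * x) / (x ^ 2 + y ^ 2) + (μ - 2 * (x ^ 2 + y ^ 2)) * x]

section Lift

variable {μ c s x y p l ρ C : ℝ}

lemma sqDist_phasePt (hρ : ρ = 2 * (x ^ 2 + y ^ 2)) (hC : ρ * C = 2 * (x ^ 2 - y ^ 2)) :
    sqDist (phasePt μ x y p l) = 1 - 2 * ρ * C + ρ ^ 2 := by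
  rw [mul_assoc, hC, hρ]
  simp only [sqDist, phasePt, cons_val]
  ring

lemma invAbs_phasePt (hρ : ρ = 2 * (x ^ 2 + y ^ 2)) (hC : ρ * C = 2 * (x ^ 2 - y ^ 2)) :
    invAbs (phasePt μ x y p l) = invDist ρ C := by
  rw [invAbs, sqDist_phasePt hρ hC, invDist]

lemma Kham_phasePt (hρ : ρ = 2 * (x ^ 2 + y ^ 2)) (hC : ρ * C = 2 * (x ^ 2 - y ^ 2))
    (h0 : 0 < ρ) :
    ρ * Kham μ c (phasePt μ x y p l) = l ^ 2 + p ^ 2 - angSq μ c ρ C := by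
  have hN : x ^ 2 + y ^ 2 ≠ 0 := by intro h; rw [h] at hρ; linarith
  have hC' : C = (x ^ 2 - y ^ 2) / (x ^ 2 + y ^ 2) := by
    rw [eq_div_iff hN]; rw [hρ] at hC; linarith
  simp only [Kham_eq, invAbs_phasePt hρ hC]
  simp only [angSq]
  generalize invDist ρ C = G
  subst hρ hC'
  simp only [phasePt, cons_val]
  field_simp
  ring

lemma hasDerivAt_phasePt {x y p l : ℝ → ℝ} {t : ℝ} (hs : s = 1 ∨ s = -1)
    (hρ : ρ = 2 * (x t ^ 2 + y t ^ 2)) (hC : ρ * C = 2 * (x t ^ 2 - y t ^ 2))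
    (h0 : 0 < ρ) (hdist : 0 < 1 - 2 * ρ * C + ρ ^ 2)
    (hE : l t ^ 2 + p t ^ 2 = angSq μ c ρ C)
    (hx : HasDerivAt x ((p t * x t - s * l t * y t) / (ρ / 2)) t)
    (hy : HasDerivAt y ((p t * y t + s * l t * x t) / (ρ / 2)) t)
    (hp : HasDerivAt p (2 * angSqE μ c ρ C / ρ - 4 * s * ρ * l t) t)
    (hl : HasDerivAt l (4 * s * ρ * p t
      - 2 * angSqC μ ρ C * (4 * s * x t * y t / ρ) / ρ) t) :
    HasDerivAt (fun t => phasePt μ (x t) (y t) (p t) (s * l t))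
      (symplGrad (Kham μ c) (phasePt μ (x t) (y t) (p t) (s * l t))) t := by
  have hN : x t ^ 2 + y t ^ 2 ≠ 0 := by intro h; rw [h] at hρ; linarith
  have hC' : C = (x t ^ 2 - y t ^ 2) / (x t ^ 2 + y t ^ 2) := by
    rw [eq_div_iff hN]; rw [hρ] at hC; linarith
  have hmem : phasePt μ (x t) (y t) (p t) (s * l t) ∈ LCDom := by
    rw [mem_LCDom_iff, sqDist_phasePt hρ hC]; exact hdist
  rw [symplGrad_Kham μ c hmem]
  simp only [gradK, invAbs_phasePt hρ hC]
  simp only [angSq, angSqE, angSqC] at hE hp hl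
  have hsl := hl.const_mul s
  have hNd := (hx.pow 2).add (hy.pow 2)
  generalize invDist ρ C = G at *
  subst hρ hC'
  refine hasDerivAt_pi.2 fun i => ?_
  fin_cases i
  · refine hx.congr_deriv ?_
    simp only [phasePt, Fin.zero_eta, cons_val, cons_val_zero]
    field_simp
    ring
  · refine hy.congr_deriv ?_
    simp only [phasePt, Fin.mk_one, cons_val, cons_val_one, cons_val_zero]
    field_simp
    ring
  · refine ((((hp.mul hx).sub (hsl.mul hy)).div hNd hN).add
      (((hNd.const_mul 2).add_const μ).mul hy)).congr_deriv ?_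
    simp only [phasePt, Fin.reduceFinMk, cons_val, Pi.sub_apply, Pi.add_apply, Pi.pow_apply,
      Pi.mul_apply]
    rcases hs with rfl | rfl <;>
    linear_combination (norm := (field_simp; ring)) (-x t / (x t ^ 2 + y t ^ 2) ^ 2) * hE
  · refine ((((hp.mul hy).add (hsl.mul hx)).div hNd hN).add
      (((hNd.const_mul 2).const_sub μ).mul hx)).congr_deriv ?_
    simp only [phasePt, Fin.reduceFinMk, cons_val, Pi.add_apply, Pi.pow_apply,
      Pi.mul_apply]
    rcases hs with rfl | rfl <;>
    linear_combination (norm := (field_simp; ring)) (-y t / (x t ^ 2 + y t ^ 2) ^ 2) * hE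

end Lift

end LCHill

namespace LCHill

/-! ### Time parametrization -/

lemma exists_clock {f : ℝ → ℝ} (hf : Continuous f) (hpos : ∀ θ, 0 < f θ)
    (heven : ∀ θ, f (-θ) = f θ) (hper : ∀ θ, f (θ + 2 * Real.pi) = f θ) :
    ∃ (θ : ℝ → ℝ) (τ : ℝ), 0 < τ ∧ θ 0 = 0 ∧ (∀ t, HasDerivAt θ (f (θ t))⁻¹ t) ∧
      (∀ t, θ (-t) = -θ t) ∧ (∀ t, θ (t + τ) = θ t + 2 * Real.pi) ∧ StrictMono θ := by
  set F : ℝ → ℝ := fun θ => ∫ u in (0 : ℝ)..θ, f u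
  have hF : ∀ θ, HasDerivAt F (f θ) θ := fun θ => (hf.integral_hasStrictDerivAt 0 θ).hasDerivAt
  have hF0 : F 0 = 0 := intervalIntegral.integral_same
  have hmono : StrictMono F := strictMono_of_hasDerivAt_pos hF hpos
  have hodd : ∀ θ, F (-θ) = -F θ := by
    have h : ∀ θ, HasDerivAt (fun θ => F (-θ) + F θ) 0 θ := fun θ => by
      refine (((hF (-θ)).comp θ (hasDerivAt_neg θ)).add (hF θ)).congr_deriv ?_
      rw [heven]; ring
    intro θ
    have := is_const_of_deriv_eq_zero (fun θ => (h θ).differentiableAt) (fun θ => (h θ).deriv) θ 0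
    simp only [neg_zero, hF0] at this
    linarith
  have hadd : ∀ θ, F (θ + 2 * Real.pi) = F θ + F (2 * Real.pi) := by
    have h : ∀ θ, HasDerivAt (fun θ => F (θ + 2 * Real.pi) - F θ) 0 θ := fun θ => by
      refine (((hF _).comp_add_const θ _).sub (hF θ)).congr_deriv ?_
      rw [hper]; ring
    intro θ
    have := is_const_of_deriv_eq_zero (fun θ => (h θ).differentiableAt) (fun θ => (h θ).deriv) θ 0
    simp only [zero_add, hF0] at this
    linarith
  have hτ : 0 < F (2 * Real.pi) := by
    rw [← hF0]; exact hmono (by positivity)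
  have hnat : ∀ n : ℕ, F (n * (2 * Real.pi)) = n * F (2 * Real.pi) := fun n => by
    induction n with
    | zero => simp [hF0]
    | succ n ih => push_cast; rw [add_mul, one_mul, hadd, ih]; ring
  have hsurj : Function.Surjective F := by
    have hcont : Continuous F := continuous_iff_continuousAt.2 fun θ => (hF θ).continuousAt
    intro y
    obtain ⟨n, hn⟩ := exists_nat_gt (|y| / F (2 * Real.pi))
    rw [div_lt_iff₀ hτ, ← hnat] at hn
    have := abs_lt.1 hn
    rw [← hodd] at this
    exact mem_range_of_exists_le_of_exists_ge hcont ⟨_, this.1.le⟩ ⟨_, this.2.le⟩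
  set e := hmono.orderIsoOfSurjective F hsurj
  have he : ∀ θ, e θ = F θ := fun θ => rfl
  have hes : ∀ t, F (e.symm t) = t := fun t => by rw [← he, e.apply_symm_apply]
  refine ⟨e.symm, F (2 * Real.pi), hτ, hmono.injective (by rw [hes, hF0]), fun t => ?_,
    fun t => hmono.injective (by rw [hes, hodd, hes]),
    fun t => hmono.injective (by rw [hes, hadd, hes]), e.symm.strictMono⟩
  exact HasDerivAt.of_local_left_inverse e.symm.continuous.continuousAt (hF _) (hpos _).ne'
    (Filter.Eventually.of_forall hes)

/-- A symmetric periodic solution of the reduced vector field inside the Hill region. -/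
structure IsRedOrbit (μ c s : ℝ) (r p : ℝ → ℝ) : Prop where
  deriv_r : ∀ θ, HasDerivAt r (redR μ c (r θ) (p θ) (Real.cos θ)) θ
  deriv_p : ∀ θ, HasDerivAt p (redP μ c s (r θ) (p θ) (Real.cos θ)) θ
  even : ∀ θ, r (-θ) = r θ
  odd : ∀ θ, p (-θ) = -p θ
  periodic_r : ∀ θ, r (θ + 2 * Real.pi) = r θ
  periodic_p : ∀ θ, p (θ + 2 * Real.pi) = p θ
  pos : ∀ θ, 0 < r θ
  lt_one : ∀ θ, r θ < 1
  hill : ∀ θ, 0 < 1 - μ - (c - μ) * r θ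
  dist_pos : ∀ θ, 0 < 1 - 2 * r θ * Real.cos θ + r θ ^ 2
  ang_pos : ∀ θ, 0 < angSq μ c (r θ) (Real.cos θ) - p θ ^ 2
  sense : ∀ θ, s * r θ ^ 2 * invAng μ c (r θ) (p θ) (Real.cos θ) < 2

/-- The modulus of the angular momentum. -/
def ang (μ c ρ p C : ℝ) : ℝ := √(angSq μ c ρ C - p ^ 2)

/-- The orbit in phase space, as a function of the angle. -/
def liftPt (μ c s : ℝ) (r p : ℝ → ℝ) (θ : ℝ) : V4 :=
  phasePt μ (√(r θ / 2) * Real.cos (θ / 2)) (s * √(r θ / 2) * Real.sin (θ / 2)) (p θ)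
    (s * ang μ c (r θ) (p θ) (Real.cos θ))

namespace IsRedOrbit

variable {μ c s : ℝ} {r p : ℝ → ℝ}

section Angle

variable (O : IsRedOrbit μ c s r p) (θ : ℝ)
include O

lemma ang_gt : 0 < ang μ c (r θ) (p θ) (Real.cos θ) := Real.sqrt_pos.2 (O.ang_pos θ)

lemma ang_sq : ang μ c (r θ) (p θ) (Real.cos θ) ^ 2 + p θ ^ 2 = angSq μ c (r θ) (Real.cos θ) := by
  rw [ang, Real.sq_sqrt (O.ang_pos θ).le]; ring

lemma sqrt_gt : 0 < √(r θ / 2) := Real.sqrt_pos.2 (half_pos (O.pos θ))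

lemma sqrt_sq : √(r θ / 2) ^ 2 = r θ / 2 := Real.sq_sqrt (half_pos (O.pos θ)).le

lemma hasDerivAt_ang : HasDerivAt (fun θ => ang μ c (r θ) (p θ) (Real.cos θ))
    (s * r θ ^ 2 * p θ / ang μ c (r θ) (p θ) (Real.cos θ)
      - angSqC μ (r θ) (Real.cos θ) * Real.sin θ / (2 * ang μ c (r θ) (p θ) (Real.cos θ))) θ := by
  have h := hasDerivAt_angSq (μ := μ) (c := c) (O.deriv_r θ) (Real.hasDerivAt_cos θ) (O.dist_pos θ)
    (O.pos θ).ne'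
  refine ((h.sub ((O.deriv_p θ).pow 2)).sqrt (O.ang_pos θ).ne').congr_deriv ?_
  have hl := O.ang_gt θ
  have hr := O.pos θ
  simp only [redR, redP, invAng, ang, Pi.sub_apply, Pi.pow_apply] at hl ⊢
  field_simp
  ring

end Angle

end IsRedOrbit

end LCHill

namespace LCHill

namespace IsRedOrbit

variable {μ c s : ℝ} {r p : ℝ → ℝ}

section Point

variable (O : IsRedOrbit μ c s r p) (hs : s = 1 ∨ s = -1) (θ : ℝ)
include O hs

lemma lift_rho : r θ = 2 * ((√(r θ / 2) * Real.cos (θ / 2)) ^ 2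
    + (s * √(r θ / 2) * Real.sin (θ / 2)) ^ 2) := by
  have h1 := O.sqrt_sq θ
  have h2 := Real.cos_sq_add_sin_sq (θ / 2)
  have hs2 : s ^ 2 = 1 := by rcases hs with rfl | rfl <;> norm_num
  simp only [mul_pow, h1, hs2]
  linear_combination -(r θ) * h2

lemma lift_cos : r θ * Real.cos θ = 2 * ((√(r θ / 2) * Real.cos (θ / 2)) ^ 2
    - (s * √(r θ / 2) * Real.sin (θ / 2)) ^ 2) := by
  have h1 := O.sqrt_sq θ
  have h2 := Real.cos_sq_add_sin_sq (θ / 2)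
  have h3 := Real.cos_two_mul (θ / 2)
  rw [mul_div_cancel₀ θ (two_ne_zero)] at h3
  have hs2 : s ^ 2 = 1 := by rcases hs with rfl | rfl <;> norm_num
  simp only [mul_pow, h1, hs2, h3]
  linear_combination (r θ) * h2

lemma lift_sin : Real.sin θ = 4 * s * (√(r θ / 2) * Real.cos (θ / 2))
    * (s * √(r θ / 2) * Real.sin (θ / 2)) / r θ := by
  have h1 := O.sqrt_sq θ
  have h3 := Real.sin_two_mul (θ / 2)
  rw [mul_div_cancel₀ θ (two_ne_zero)] at h3
  have hs2 : s ^ 2 = 1 := by rcases hs with rfl | rfl <;> norm_num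
  have hr := (O.pos θ).ne'
  rw [h3]
  field_simp
  linear_combination (-4 * Real.cos (θ / 2) * Real.sin (θ / 2)) * (h1 + √(r θ / 2) ^ 2 * hs2)

lemma liftPt_mem : liftPt μ c s r p θ ∈ LCDom := by
  rw [mem_LCDom_iff, liftPt, sqDist_phasePt (O.lift_rho hs θ) (O.lift_cos hs θ)]
  exact O.dist_pos θ

lemma Kham_liftPt : Kham μ c (liftPt μ c s r p θ) = 0 := by
  have h := Kham_phasePt (μ := μ) (c := c) (p := p θ) (l := s * ang μ c (r θ) (p θ) (Real.cos θ))
    (O.lift_rho hs θ) (O.lift_cos hs θ) (O.pos θ)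
  have hs2 : s ^ 2 = 1 := by rcases hs with rfl | rfl <;> norm_num
  rw [mul_pow, hs2, one_mul, O.ang_sq θ, sub_self] at h
  exact (mul_eq_zero.1 h).resolve_left (O.pos θ).ne'

lemma liftPt_cross : liftPt μ c s r p θ 0 * liftPt μ c s r p θ 3
    - liftPt μ c s r p θ 1 * liftPt μ c s r p θ 2
    = μ * (liftPt μ c s r p θ 0 ^ 2 - liftPt μ c s r p θ 1 ^ 2)
      + (s * ang μ c (r θ) (p θ) (Real.cos θ) - r θ ^ 2 / 2) := by
  have h1 := O.lift_rho hs θ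
  have h0 := O.pos θ
  simp only [liftPt, phasePt]
  generalize √(r θ / 2) * Real.cos (θ / 2) = x at *
  generalize s * √(r θ / 2) * Real.sin (θ / 2) = y at *
  simp only [Matrix.cons_val]
  rw [h1] at h0
  have : x ^ 2 + y ^ 2 ≠ 0 := by linarith
  rw [h1]
  field_simp
  ring

lemma hasDerivAt_liftPt {Θ : ℝ → ℝ} {t : ℝ}
    (hΘ : HasDerivAt Θ (4 * ang μ c (r (Θ t)) (p (Θ t)) (Real.cos (Θ t)) / r (Θ t)) t) :
    HasDerivAt (fun t => liftPt μ c s r p (Θ t))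
      (symplGrad (Kham μ c) (liftPt μ c s r p (Θ t))) t := by
  have hr := O.pos (Θ t)
  have hl := O.ang_gt (Θ t)
  have hq := O.sqrt_gt (Θ t)
  have hq2 := O.sqrt_sq (Θ t)
  have hs2 : s ^ 2 = 1 := by rcases hs with rfl | rfl <;> norm_num
  have hrt := (O.deriv_r (Θ t)).comp t hΘ
  have hsq := (hrt.div_const 2).sqrt (half_pos hr).ne'
  have hh := hΘ.div_const 2
  refine hasDerivAt_phasePt (ρ := r (Θ t)) (C := Real.cos (Θ t)) hs (O.lift_rho hs _)
    (O.lift_cos hs _) hr (O.dist_pos _) (O.ang_sq _) ?_ ?_ ?_ ?_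
  · refine (hsq.mul hh.cos).congr_deriv ?_
    simp only [redR, invAng, Function.comp_apply, ← ang.eq_1]
    generalize √(r (Θ t) / 2) = q at *
    generalize ang μ c (r (Θ t)) (p (Θ t)) (Real.cos (Θ t)) = l at *
    field_simp
    linear_combination (-8 * p (Θ t) * Real.cos (Θ t / 2)) * hq2
      + 8 * l * q ^ 2 * Real.sin (Θ t / 2) * hs2
  · refine ((hsq.const_mul s).mul hh.sin).congr_deriv ?_
    simp only [redR, invAng, Function.comp_apply, ← ang.eq_1]
    generalize √(r (Θ t) / 2) = q at *
    generalize ang μ c (r (Θ t)) (p (Θ t)) (Real.cos (Θ t)) = l at *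
    field_simp
    linear_combination (-8 * s * p (Θ t) * Real.sin (Θ t / 2)) * hq2
  · refine ((O.deriv_p (Θ t)).comp t hΘ).congr_deriv ?_
    simp only [redP, invAng, ← ang.eq_1]
    generalize ang μ c (r (Θ t)) (p (Θ t)) (Real.cos (Θ t)) = l at *
    field_simp
    ring
  · refine ((O.hasDerivAt_ang (Θ t)).comp t hΘ).congr_deriv ?_
    rw [← O.lift_sin hs]
    generalize ang μ c (r (Θ t)) (p (Θ t)) (Real.cos (Θ t)) = l at *
    field_simp
    ring

omit hs in
lemma liftPt_add_two_pi : liftPt μ c s r p (θ + 2 * Real.pi) = -liftPt μ c s r p θ := by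
  have h : (θ + 2 * Real.pi) / 2 = θ / 2 + Real.pi := by ring
  simp only [liftPt, O.periodic_r, O.periodic_p, Real.cos_add_two_pi, h, Real.cos_add_pi,
    Real.sin_add_pi, phasePt, mul_neg, neg_sq]
  ext i
  fin_cases i <;> (simp; try ring)

omit hs in
lemma liftPt_neg : liftPt μ c s r p (-θ) = Rplus (liftPt μ c s r p θ) := by
  simp only [liftPt, O.even, O.odd, Real.cos_neg, neg_div, Real.sin_neg, phasePt, Rplus, mul_neg,
    neg_sq, neg_mul, ang]
  ext i
  fin_cases i <;> (simp; try ring)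

end Point

end IsRedOrbit

end LCHill

namespace LCHill

/-! ### The component of the energy level -/

/-- Square of `w₂ + (2 z₁² - μ) z₁` at the points `(z₁, 0, 0, w₂)` of zero energy. -/
def axisDisc (μ c x : ℝ) : ℝ :=
  (2 * x ^ 2 - μ) ^ 2 * x ^ 2 + (1 - μ) - 2 * c * x ^ 2 + 2 * μ * x ^ 2 / (1 - 2 * x ^ 2)

lemma lcAbs_axis {x : ℝ} (hx : 2 * x ^ 2 < 1) : lcAbs x 0 = 1 - 2 * x ^ 2 := by
  rw [lcAbs, ← Real.sqrt_sq (by linarith : (0 : ℝ) ≤ 1 - 2 * x ^ 2)]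
  congr 1
  ring

lemma Kham_axis (μ c : ℝ) {x w : ℝ} (hx : 2 * x ^ 2 < 1) :
    Kham μ c ![x, 0, 0, w] = ((w + (2 * x ^ 2 - μ) * x) ^ 2 - axisDisc μ c x) / 2 := by
  have h : 1 - 2 * x ^ 2 ≠ 0 := by linarith
  simp only [Kham, axisDisc, Matrix.cons_val, lcAbs_axis hx]
  simp only [ne_eq, OfNat.ofNat_ne_zero, not_false_eq_true, zero_pow, add_zero, zero_add]
  field_simp
  ring

lemma mem_LCDom_axis {x w : ℝ} (hx : 2 * x ^ 2 < 1) : ![x, 0, 0, w] ∈ LCDom := by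
  change lcAbs x 0 ≠ 0
  rw [lcAbs_axis hx]
  linarith

lemma axisDisc_pos {μ c x : ℝ} (hμ : 0 ≤ μ) (hx : 2 * x ^ 2 < 1)
    (h : 0 < 1 - μ - (c - μ) * (2 * x ^ 2)) : 0 < axisDisc μ c x := by
  have h1 : 2 * μ * x ^ 2 ≤ 2 * μ * x ^ 2 / (1 - 2 * x ^ 2) := by
    rw [le_div_iff₀ (by linarith)]
    nlinarith [mul_nonneg (mul_nonneg hμ (sq_nonneg x)) (sq_nonneg x)]
  have h2 : 0 ≤ (2 * x ^ 2 - μ) ^ 2 * x ^ 2 := by positivity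
  rw [axisDisc]
  linarith

lemma mem_SigmaLC_of_isPreconnected {μ c : ℝ} {A : Set V4} {x y : V4} (hA : IsPreconnected A)
    (hsub : A ⊆ {z | z ∈ LCDom ∧ Kham μ c z = 0}) (hx : x ∈ A) (hy : y ∈ A)
    (h : x ∈ SigmaLC μ c) : y ∈ SigmaLC μ c := by
  have h1 := hA.subset_connectedComponentIn hx hsub hy
  rwa [← connectedComponentIn_eq h] at h1

lemma pole_mem_SigmaLC {μ : ℝ} (hμ1 : μ < 1) (c φ : ℝ) :
    ![0, 0, √(1 - μ) * Real.cos φ, √(1 - μ) * Real.sin φ] ∈ SigmaLC μ c := by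
  set g : ℝ → V4 := fun φ => ![0, 0, √(1 - μ) * Real.cos φ, √(1 - μ) * Real.sin φ] with hg
  have hcont : Continuous g := by
    refine continuous_pi fun i => ?_
    fin_cases i <;> simp [hg] <;> fun_prop
  have hsub : ∀ z ∈ range g, z ∈ LCDom ∧ Kham μ c z = 0 := by
    rintro _ ⟨φ, rfl⟩
    have h1 : lcAbs 0 0 = 1 := by simp [lcAbs]
    refine ⟨show lcAbs 0 0 ≠ 0 by simp [h1], ?_⟩
    simp only [Kham, hg, Matrix.cons_val, mul_pow, Real.sq_sqrt (sub_nonneg.2 hμ1.le)]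
    linear_combination (1 - μ) / 2 * Real.cos_sq_add_sin_sq φ
  have h0 : g 0 = ![0, 0, √(1 - μ), 0] := by simp [hg]
  refine mem_SigmaLC_of_isPreconnected (isPreconnected_range hcont) hsub (mem_range_self 0)
    (mem_range_self φ) ?_
  rw [h0, SigmaLC]
  exact mem_connectedComponentIn (h0 ▸ hsub _ (mem_range_self 0))

lemma axis_mem_SigmaLC {μ c s a w : ℝ} (hs : s = 1 ∨ s = -1) (hμ : 0 ≤ μ) (hμ1 : μ < 1)
    (ha : 2 * a ^ 2 < 1) (hill : 0 < 1 - μ - (c - μ) * (2 * a ^ 2))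
    (hK : Kham μ c ![a, 0, 0, w] = 0) (hw : 0 < s * (w + (2 * a ^ 2 - μ) * a)) :
    ![a, 0, 0, w] ∈ SigmaLC μ c := by
  have hs2 : s ^ 2 = 1 := by rcases hs with rfl | rfl <;> norm_num
  set g : ℝ → V4 := fun t =>
    ![t * a, 0, 0, -((2 * (t * a) ^ 2 - μ) * (t * a)) + s * √(axisDisc μ c (t * a))] with hg
  have hlt : ∀ t ∈ Icc (0 : ℝ) 1, 2 * (t * a) ^ 2 < 1 ∧
      0 < 1 - μ - (c - μ) * (2 * (t * a) ^ 2) := fun t ht => by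
    have h1 : t ^ 2 ≤ 1 := pow_le_one₀ ht.1 ht.2
    have h2 := sq_nonneg t
    constructor
    · nlinarith [sq_nonneg a]
    · have : 1 - μ - (c - μ) * (2 * (t * a) ^ 2)
          = (1 - t ^ 2) * (1 - μ) + t ^ 2 * (1 - μ - (c - μ) * (2 * a ^ 2)) := by ring
      rw [this]
      rcases h2.eq_or_lt with h | h
      · rw [← h]; linarith
      · have := mul_pos h hill
        have := mul_nonneg (sub_nonneg.2 h1) (sub_nonneg.2 hμ1.le)
        linarith
  have hcont : ContinuousOn g (Icc 0 1) := by
    have hd : ContinuousOn (fun t => axisDisc μ c (t * a)) (Icc 0 1) := by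
      unfold axisDisc
      refine ContinuousOn.add (by fun_prop) (ContinuousOn.div (by fun_prop) (by fun_prop) ?_)
      intro t ht
      linarith [(hlt t ht).1]
    rw [continuousOn_pi]
    intro i
    fin_cases i
    · exact continuousOn_id.mul continuousOn_const
    · exact continuousOn_const
    · exact continuousOn_const
    · exact ContinuousOn.add (by fun_prop) (continuousOn_const.mul hd.sqrt)
  have hsub : ∀ z ∈ g '' Icc 0 1, z ∈ LCDom ∧ Kham μ c z = 0 := by
    rintro _ ⟨t, ht, rfl⟩
    obtain ⟨h1, h2⟩ := hlt t ht
    refine ⟨mem_LCDom_axis h1, ?_⟩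
    rw [hg, Kham_axis μ c h1]
    have := Real.sq_sqrt (axisDisc_pos hμ h1 h2).le
    linear_combination hs2 / 2 * √(axisDisc μ c (t * a)) ^ 2 + this / 2
  have h1 : g 1 = ![a, 0, 0, w] := by
    rw [Kham_axis μ c ha] at hK
    have hsq : axisDisc μ c a = (s * (w + (2 * a ^ 2 - μ) * a)) ^ 2 := by
      rw [mul_pow, hs2]; linarith
    simp only [hg, one_mul, hsq, Real.sqrt_sq hw.le]
    congr! 4
    linear_combination (w + (2 * a ^ 2 - μ) * a) * hs2
  have h0 : g 0 ∈ SigmaLC μ c := by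
    have hd : axisDisc μ c 0 = 1 - μ := by simp [axisDisc]
    rcases hs with rfl | rfl
    · convert pole_mem_SigmaLC hμ1 c (Real.pi / 2) using 1
      simp [hg, hd]
    · convert pole_mem_SigmaLC hμ1 c (-(Real.pi / 2)) using 1
      simp [hg, hd]
  exact mem_SigmaLC_of_isPreconnected (isPreconnected_Icc.image g hcont) hsub
    (mem_image_of_mem g (left_mem_Icc.2 zero_le_one)) ⟨1, right_mem_Icc.2 zero_le_one, h1⟩ h0

/-! ### The orbit -/

/-- `Θ` is the angle along the orbit of period `T` above the reduced solution `(r, p)`. -/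
structure IsClock (μ c : ℝ) (r p Θ : ℝ → ℝ) (T : ℝ) : Prop where
  period_pos : 0 < T
  zero : Θ 0 = 0
  deriv : ∀ t, HasDerivAt Θ (4 * ang μ c (r (Θ t)) (p (Θ t)) (Real.cos (Θ t)) / r (Θ t)) t
  odd : ∀ t, Θ (-t) = -Θ t
  period : ∀ t, Θ (t + T) = Θ t + 4 * Real.pi
  strictMono : StrictMono Θ

namespace IsRedOrbit

variable {μ c s : ℝ} {r p : ℝ → ℝ}

lemma exists_isClock (O : IsRedOrbit μ c s r p) : ∃ Θ T, IsClock μ c r p Θ T := by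
  have hr : Continuous r := continuous_iff_continuousAt.2 fun θ => (O.deriv_r θ).continuousAt
  have hl : Continuous fun θ => ang μ c (r θ) (p θ) (Real.cos θ) :=
    continuous_iff_continuousAt.2 fun θ => (O.hasDerivAt_ang θ).continuousAt
  obtain ⟨Θ, τ, hτ, h0, hd, hodd, hper, hmono⟩ := exists_clock
    (f := fun θ => r θ / (4 * ang μ c (r θ) (p θ) (Real.cos θ)))
    (hr.div (continuous_const.mul hl) fun θ => by have := O.ang_gt θ; positivity)
    (fun θ => div_pos (O.pos θ) (by have := O.ang_gt θ; positivity))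
    (fun θ => by simp only [O.even, O.odd, Real.cos_neg, ang, neg_sq])
    (fun θ => by simp only [O.periodic_r, O.periodic_p, Real.cos_add_two_pi])
  refine ⟨Θ, 2 * τ, by positivity, h0, fun t => (hd t).congr_deriv (inv_div _ _), hodd,
    fun t => ?_, hmono⟩
  rw [two_mul, ← add_assoc, hper, hper]
  ring

variable {Θ : ℝ → ℝ} {T : ℝ} (O : IsRedOrbit μ c s r p) (Z : IsClock μ c r p Θ T)
  (hs : s = 1 ∨ s = -1)
include O Z

lemma lift_periodic (t : ℝ) : liftPt μ c s r p (Θ (t + T)) = liftPt μ c s r p (Θ t) := by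
  have h : Θ t + 4 * Real.pi = Θ t + 2 * Real.pi + 2 * Real.pi := by ring
  rw [Z.period, h, O.liftPt_add_two_pi, O.liftPt_add_two_pi, neg_neg]

lemma isSymmetricOrbit : IsSymmetricOrbit T fun t => liftPt μ c s r p (Θ t) := by
  refine ⟨0, Or.inl fun t => ?_⟩
  have h : 0 + (T - t) = -t + T := by ring
  change liftPt μ c s r p (Θ (0 + t)) = Rplus (liftPt μ c s r p (Θ (0 + (T - t))))
  rw [h, O.lift_periodic Z, Z.odd, O.liftPt_neg, zero_add]
  ext i
  fin_cases i <;> simp [Rplus]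

include hs

lemma isOrbit : IsOrbit (Kham μ c) LCDom fun t => liftPt μ c s r p (Θ t) :=
  fun t => ⟨O.liftPt_mem hs _, O.hasDerivAt_liftPt hs (Z.deriv t)⟩

lemma isMinimalPeriod : IsMinimalPeriod T fun t => liftPt μ c s r p (Θ t) := by
  refine ⟨Z.period_pos, O.lift_periodic Z, fun T' hT' h => ?_⟩
  have h0 := h 0
  simp only [zero_add, Z.zero] at h0
  have h1 := congrFun h0 0
  have h2 := congrFun h0 1
  have hs0 : s ≠ 0 := by rcases hs with rfl | rfl <;> norm_num
  simp only [liftPt, phasePt, Matrix.cons_val, zero_div, Real.sin_zero, Real.cos_zero, mul_zero,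
    mul_one] at h1 h2
  have hq := O.sqrt_gt (Θ T')
  have hq0 := O.sqrt_gt 0
  have hsin : Real.sin (Θ T' / 2) = 0 := by
    exact (mul_eq_zero.1 h2).resolve_left (mul_ne_zero hs0 hq.ne')
  have hcos : 0 < Real.cos (Θ T' / 2) := pos_of_mul_pos_right (h1 ▸ hq0) hq.le
  have hcos1 : Real.cos (Θ T' / 2) = 1 := by
    rcases Real.sin_eq_zero_iff_cos_eq.1 hsin with h | h
    · exact h
    · linarith
  obtain ⟨n, hn⟩ := (Real.cos_eq_one_iff _).1 hcos1
  have hpos : 0 < Θ T' := Z.zero ▸ Z.strictMono hT'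
  have hpi := Real.pi_pos
  have hn0 : 0 < n := by
    by_contra hcon
    have : (n : ℝ) ≤ 0 := by exact_mod_cast not_lt.1 hcon
    nlinarith
  have hn1 : (1 : ℝ) ≤ n := by exact_mod_cast hn0
  refine (Z.strictMono.le_iff_le).1 ?_
  have := Z.period 0
  rw [zero_add, Z.zero, zero_add] at this
  rw [this]
  nlinarith

lemma isClosedOrbit (hμ : 0 ≤ μ) (hμ1 : μ < 1) :
    IsClosedOrbit μ c T fun t => liftPt μ c s r p (Θ t) := by
  refine ⟨Z.period_pos, O.isOrbit Z hs, O.lift_periodic Z, fun t => ?_⟩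
  have hcont : Continuous fun t => liftPt μ c s r p (Θ t) :=
    continuous_iff_continuousAt.2 fun t => (O.isOrbit Z hs t).2.continuousAt
  refine mem_SigmaLC_of_isPreconnected (isPreconnected_range hcont) ?_ (mem_range_self 0)
    (mem_range_self t) ?_
  · rintro _ ⟨t, rfl⟩
    exact ⟨O.liftPt_mem hs _, O.Kham_liftPt hs _⟩
  · set a := √(r 0 / 2) with ha
    have ha0 : 0 < a := O.sqrt_gt 0
    have ha2 : 2 * a ^ 2 = r 0 := by rw [ha, O.sqrt_sq]; ring
    have hp0 : p 0 = 0 := by have := O.odd 0; rw [neg_zero] at this; linarith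
    have hl := O.ang_gt 0
    obtain ⟨l, hl0⟩ : ∃ l, l = ang μ c (r 0) (p 0) (Real.cos 0) := ⟨_, rfl⟩
    rw [← hl0] at hl
    have hpt : liftPt μ c s r p 0 = ![a, 0, 0, s * l / a + (μ - 2 * a ^ 2) * a] := by
      simp only [liftPt, phasePt, ← ha, zero_div, Real.sin_zero, Real.cos_zero, mul_one,
        mul_zero]
      rw [Real.cos_zero] at hl0
      rw [← hl0, hp0]
      ext i
      fin_cases i <;> simp
      field_simp
    simp only [Z.zero]
    have hK := O.Kham_liftPt hs 0
    rw [hpt] at hK ⊢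
    refine axis_mem_SigmaLC hs hμ hμ1 (ha2 ▸ O.lt_one 0) (ha2 ▸ O.hill 0) hK ?_
    have hs2 : s ^ 2 = 1 := by rcases hs with rfl | rfl <;> norm_num
    have : s * (s * l / a + (μ - 2 * a ^ 2) * a + (2 * a ^ 2 - μ) * a) = l / a := by
      linear_combination l / a * hs2
    rw [this]
    positivity

omit Z in
lemma isRetrograde (h1 : s = 1) : IsRetrograde μ fun t => liftPt μ c s r p (Θ t) := by
  intro t
  have h := O.liftPt_cross hs (Θ t)
  have h2 := O.sense (Θ t)
  have hl := O.ang_gt (Θ t)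
  rw [invAng, ← ang, h1, one_mul, ← div_eq_mul_inv, div_lt_iff₀ hl] at h2
  rw [h1] at h ⊢
  linarith

omit Z in
lemma isDirect (h1 : s = -1) : IsDirect μ fun t => liftPt μ c s r p (Θ t) := by
  intro t
  have h := O.liftPt_cross hs (Θ t)
  have hl := O.ang_gt (Θ t)
  rw [h1] at h ⊢
  nlinarith [sq_nonneg (r (Θ t))]

end IsRedOrbit

end LCHill

namespace LCHill

/-! ### Polar observables -/

/-- `2|z|²`. -/
def obsR (x : V4) : ℝ := 2 * (x 0 ^ 2 + x 1 ^ 2)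

/-- `z · ż`. -/
def obsP (μ : ℝ) (x : V4) : ℝ := x 0 * x 2 + x 1 * x 3 - 2 * μ * (x 0 * x 1)

/-- `z × ż`. -/
def obsL (μ : ℝ) (x : V4) : ℝ :=
  x 0 * x 3 - x 1 * x 2 + 2 * (x 0 ^ 2 + x 1 ^ 2) ^ 2 - μ * (x 0 ^ 2 - x 1 ^ 2)

/-- The cosine of twice the argument of `z`. -/
def obsC (x : V4) : ℝ := 2 * (x 0 ^ 2 - x 1 ^ 2) / obsR x

/-- The sine of twice the argument of `z`. -/
def obsS (x : V4) : ℝ := 4 * (x 0 * x 1) / obsR x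

/-- The differential of `obsR`. -/
def difR (x v : V4) : ℝ := 4 * (x 0 * v 0 + x 1 * v 1)

/-- The differential of `obsP`. -/
def difP (μ : ℝ) (x v : V4) : ℝ :=
  v 0 * x 2 + x 0 * v 2 + v 1 * x 3 + x 1 * v 3 - 2 * μ * (v 0 * x 1 + x 0 * v 1)

/-- The differential of `obsL`. -/
def difL (μ : ℝ) (x v : V4) : ℝ :=
  v 0 * x 3 + x 0 * v 3 - v 1 * x 2 - x 1 * v 2
    + 8 * (x 0 ^ 2 + x 1 ^ 2) * (x 0 * v 0 + x 1 * v 1) - 2 * μ * (x 0 * v 0 - x 1 * v 1)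

/-- The differential of twice the argument of `z`. -/
def difA (x v : V4) : ℝ := 4 * (x 0 * v 1 - x 1 * v 0) / obsR x

/-- The symplectic form. -/
def sympl (v w : V4) : ℝ := v 2 * w 0 + v 3 * w 1 - v 0 * w 2 - v 1 * w 3

section Curve

variable {x : ℝ → V4} {v : V4} {t μ : ℝ}

lemma hasDerivAt_coord (hx : HasDerivAt x v t) (i : Fin 4) :
    HasDerivAt (fun t => x t i) (v i) t := hasDerivAt_pi.1 hx i

lemma hasDerivAt_obsR (hx : HasDerivAt x v t) :
    HasDerivAt (fun t => obsR (x t)) (difR (x t) v) t := by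
  have h := hasDerivAt_coord hx
  refine ((((h 0).pow 2).add ((h 1).pow 2)).const_mul 2).congr_deriv ?_
  simp only [difR]
  push_cast
  ring

lemma hasDerivAt_obsP (hx : HasDerivAt x v t) :
    HasDerivAt (fun t => obsP μ (x t)) (difP μ (x t) v) t := by
  have h := hasDerivAt_coord hx
  refine ((((h 0).mul (h 2)).add ((h 1).mul (h 3))).sub
    (((h 0).mul (h 1)).const_mul (2 * μ))).congr_deriv ?_
  simp only [difP]
  ring

lemma hasDerivAt_obsL (hx : HasDerivAt x v t) :
    HasDerivAt (fun t => obsL μ (x t)) (difL μ (x t) v) t := by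
  have h := hasDerivAt_coord hx
  have h0 := (h 0).pow 2
  have h1 := (h 1).pow 2
  refine (((((h 0).mul (h 3)).sub ((h 1).mul (h 2))).add (((h0.add h1).pow 2).const_mul 2)).sub
    ((h0.sub h1).const_mul μ)).congr_deriv ?_
  simp only [difL, Pi.add_apply, Pi.pow_apply]
  push_cast
  ring

lemma hasDerivAt_obsC (hx : HasDerivAt x v t) (h0 : obsR (x t) ≠ 0) :
    HasDerivAt (fun t => obsC (x t)) (-(obsS (x t) * difA (x t) v)) t := by
  have h := hasDerivAt_coord hx
  refine (((((h 0).pow 2).sub ((h 1).pow 2)).const_mul 2).div (hasDerivAt_obsR hx) h0).congr_deriv ?_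
  have h1 : x t 0 ^ 2 + x t 1 ^ 2 ≠ 0 := fun h => h0 (by rw [obsR, h, mul_zero])
  simp only [obsS, difA, difR, obsR, Pi.sub_apply, Pi.pow_apply]
  push_cast
  field_simp
  ring

end Curve

section Point

variable {μ c : ℝ} {x : V4}

lemma sqDist_obs (h0 : obsR x ≠ 0) : sqDist x = 1 - 2 * obsR x * obsC x + obsR x ^ 2 := by
  simp only [obsC, sqDist]
  field_simp
  simp only [obsR]
  ring

lemma invAbs_obs (h0 : obsR x ≠ 0) : invAbs x = invDist (obsR x) (obsC x) := by
  rw [invAbs, sqDist_obs h0, invDist]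

lemma obs_energy (h0 : obsR x ≠ 0) :
    obsL μ x ^ 2 + obsP μ x ^ 2 = angSq μ c (obsR x) (obsC x) + obsR x * Kham μ c x := by
  simp only [Kham_eq, invAbs_obs h0, angSq]
  generalize invDist (obsR x) (obsC x) = I
  simp only [obsC, obsL, obsP]
  field_simp
  simp only [obsR]
  ring

variable (hx : x ∈ LCDom) (h0 : obsR x ≠ 0)
include hx h0

lemma dist_obs : 0 < 1 - 2 * obsR x * obsC x + obsR x ^ 2 := by
  rw [← sqDist_obs h0]; exact mem_LCDom_iff.1 hx

/-- The linearization of `obs_energy` on the tangent space of the energy level. -/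
lemma dif_energy (hK : Kham μ c x = 0) {v : V4} (hv : gradK μ c x ⬝ᵥ v = 0) :
    2 * obsL μ x * difL μ x v + 2 * obsP μ x * difP μ x v
      = angSqE μ c (obsR x) (obsC x) / obsR x * difR x v
        - angSqC μ (obsR x) (obsC x) * (obsS x * difA x v) := by
  have hl := hasDerivAt_line x v 0
  have e0 : x + (0 : ℝ) • v = x := by simp
  have hR := hasDerivAt_obsR hl
  have hP := hasDerivAt_obsP (μ := μ) hl
  have hL := hasDerivAt_obsL (μ := μ) hl
  have hC := hasDerivAt_obsC hl (by rwa [e0])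
  have hA := hasDerivAt_angSq (μ := μ) (c := c) hR hC (by rw [e0]; exact dist_obs hx h0) (by rwa [e0])
  have hk := hasDerivAt_Kham (μ := μ) (c := c) hl (by rwa [e0])
  have h1 := (hL.pow 2).add (hP.pow 2)
  have h2 := hA.add (hR.mul hk)
  have hne : ∀ᶠ h in nhds (0 : ℝ), obsR (x + h • v) ≠ 0 :=
    hR.continuousAt.eventually_ne (by rwa [e0])
  have h3 := h1.congr_of_eventuallyEq (f₁ := _) (f := _)
    (hne.mono fun h hh => (obs_energy (μ := μ) (c := c) hh).symm)
  have h4 := h3.unique h2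
  simp only [e0, hv, hK] at h4
  push_cast at h4
  linarith

/-- The rate of change of `obsP` along the flow. -/
lemma difP_symplGrad : difP μ x (symplGrad (Kham μ c) x)
    = 2 * Kham μ c x + 2 * (angSqE μ c (obsR x) (obsC x) / obsR x) - 4 * obsR x * obsL μ x := by
  rw [symplGrad_Kham μ c hx]
  simp only [Kham_eq, angSqE, ← invAbs_obs h0, difP, gradK, Matrix.cons_val]
  generalize invAbs x = I
  simp only [obsC, obsL]
  field_simp
  simp only [obsR]
  ring

lemma symplGrad_zero : symplGrad (Kham μ c) x 0
    = 2 * (obsP μ x * x 0 - obsL μ x * x 1) / obsR x := by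
  rw [symplGrad_Kham μ c hx, eq_div_iff h0]
  simp only [gradK, obsP, obsL, obsR, Matrix.cons_val]
  ring

lemma symplGrad_one : symplGrad (Kham μ c) x 1
    = 2 * (obsP μ x * x 1 + obsL μ x * x 0) / obsR x := by
  rw [symplGrad_Kham μ c hx, eq_div_iff h0]
  simp only [gradK, obsP, obsL, obsR, Matrix.cons_val]
  ring

end Point

end LCHill

namespace LCHill

/-! ### The variational equation in polar observables -/

lemma fderiv_obsR (x v : V4) : fderiv ℝ obsR x v = difR x v := by
  have h : DifferentiableAt ℝ obsR x := by unfold obsR; fun_prop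
  simpa using (hasDerivAt_comp_line h v).unique (hasDerivAt_obsR (hasDerivAt_line x v 0))

lemma fderiv_obsP (μ : ℝ) (x v : V4) : fderiv ℝ (obsP μ) x v = difP μ x v := by
  have h : DifferentiableAt ℝ (obsP μ) x := by unfold obsP; fun_prop
  simpa using (hasDerivAt_comp_line h v).unique (hasDerivAt_obsP (hasDerivAt_line x v 0))

/-- `v` solves the variational equation along the orbit `γ`. -/
structure IsVariation (μ c : ℝ) (γ v : ℝ → V4) : Prop where
  orbit : IsOrbit (Kham μ c) LCDom γ
  ne_zero : ∀ t, obsR (γ t) ≠ 0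
  energy : ∀ t, Kham μ c (γ t) = 0
  deriv : ∀ t, HasDerivAt v (fderiv ℝ (symplGrad (Kham μ c)) (γ t) (v t)) t

namespace IsVariation

variable {μ c : ℝ} {γ v : ℝ → V4} (V : IsVariation μ c γ v)
include V

lemma differentiableAt_symplGrad (t : ℝ) : DifferentiableAt ℝ (symplGrad (Kham μ c)) (γ t) :=
  (contDiffAt_symplGrad μ c (V.orbit t).1).differentiableAt (by norm_num)

lemma eventually_mem (t : ℝ) : ∀ᶠ x in nhds (γ t), x ∈ LCDom ∧ obsR x ≠ 0 := by
  have h : Continuous obsR := by unfold obsR; fun_prop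
  have h1 : ∀ᶠ x in nhds (γ t), x ∈ LCDom := isOpen_LCDom.mem_nhds (V.orbit t).1
  exact h1.and (h.continuousAt.eventually_ne (V.ne_zero t))

lemma eventually_mem_line (t : ℝ) (w : V4) :
    ∀ᶠ h in nhds (0 : ℝ), γ t + h • w ∈ LCDom ∧ obsR (γ t + h • w) ≠ 0 := by
  have h : Filter.Tendsto (fun h : ℝ => γ t + h • w) (nhds 0) (nhds (γ t)) := by
    simpa using (hasDerivAt_line (γ t) w 0).continuousAt.tendsto
  exact h.eventually (V.eventually_mem t)

/-- Invariance of the tangent spaces of the energy levels. -/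
lemma hasDerivAt_fderiv_Kham (t : ℝ) :
    HasDerivAt (fun t => fderiv ℝ (Kham μ c) (γ t) (v t)) 0 t := by
  have h := hasDerivAt_fderiv_apply
    ((contDiffAt_Kham μ c (V.orbit t).1).of_le (by norm_num)) (V.differentiableAt_symplGrad t)
    (V.orbit t).2 (V.deriv t)
  refine h.congr_deriv ?_
  have h1 : (fun x => fderiv ℝ (Kham μ c) x (symplGrad (Kham μ c) x)) =ᶠ[nhds (γ t)]
      fun _ => 0 := by
    filter_upwards [V.eventually_mem t] with x hx
    rw [fderiv_Kham μ c hx.1, symplGrad_Kham μ c hx.1]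
    simp only [dotProduct, Fin.sum_univ_four, Matrix.cons_val]
    ring
  rw [h1.fderiv_eq]
  simp

lemma fderiv_Kham_eq (t : ℝ) :
    fderiv ℝ (Kham μ c) (γ t) (v t) = fderiv ℝ (Kham μ c) (γ 0) (v 0) :=
  is_const_of_deriv_eq_zero (fun t => (V.hasDerivAt_fderiv_Kham t).differentiableAt)
    (fun t => (V.hasDerivAt_fderiv_Kham t).deriv) t 0

lemma hasDerivAt_difR (t : ℝ) :
    HasDerivAt (fun t => difR (γ t) (v t)) (4 * difP μ (γ t) (v t)) t := by
  have hG : ContDiff ℝ 2 obsR := by unfold obsR; fun_prop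
  have h := hasDerivAt_fderiv_apply (G := obsR) hG.contDiffAt (V.differentiableAt_symplGrad t)
    (V.orbit t).2 (V.deriv t)
  simp only [fderiv_obsR] at h
  refine h.congr_deriv ?_
  have h1 : (fun x => difR x (symplGrad (Kham μ c) x)) =ᶠ[nhds (γ t)] fun x => 4 * obsP μ x := by
    filter_upwards [V.eventually_mem t] with x hx
    have h2 := hx.2
    rw [difR, symplGrad_zero hx.1 hx.2, symplGrad_one hx.1 hx.2]
    field_simp
    simp only [obsR]
    ring
  have h2 : DifferentiableAt ℝ (obsP μ) (γ t) := by unfold obsP; fun_prop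
  rw [h1.fderiv_eq, fderiv_const_mul h2]
  simp [fderiv_obsP]

lemma hasDerivAt_difP (hv : ∀ t, fderiv ℝ (Kham μ c) (γ t) (v t) = 0) (t : ℝ) :
    HasDerivAt (fun t => difP μ (γ t) (v t))
      (2 * (((angSqQ μ (obsR (γ t)) (obsC (γ t)) + angSqE μ c (obsR (γ t)) (obsC (γ t)))
          / obsR (γ t) * difR (γ t) (v t)
        - angSqEC μ (obsR (γ t)) (obsC (γ t)) * (obsS (γ t) * difA (γ t) (v t))) / obsR (γ t))
        - 4 * (difR (γ t) (v t) * obsL μ (γ t) + obsR (γ t) * difL μ (γ t) (v t))) t := by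
  have hG : ContDiff ℝ 2 (obsP μ) := by unfold obsP; fun_prop
  have h := hasDerivAt_fderiv_apply (G := obsP μ) hG.contDiffAt (V.differentiableAt_symplGrad t)
    (V.orbit t).2 (V.deriv t)
  simp only [fderiv_obsP] at h
  refine h.congr_deriv ?_
  have hd : DifferentiableAt ℝ (fun x => difP μ x (symplGrad (Kham μ c) x)) (γ t) := by
    have h1 := V.differentiableAt_symplGrad t
    have h2 : ∀ i, DifferentiableAt ℝ (fun x => symplGrad (Kham μ c) x i) (γ t) :=
      differentiableAt_pi.1 h1
    have e0 := h2 0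
    have e1 := h2 1
    have e2 := h2 2
    have e3 := h2 3
    unfold difP
    fun_prop
  have hl := hasDerivAt_line (γ t) (v t) 0
  have e0 : γ t + (0 : ℝ) • v t = γ t := by simp
  have h0 := V.ne_zero t
  have hx := (V.orbit t).1
  have hR := hasDerivAt_obsR hl
  have hL := hasDerivAt_obsL (μ := μ) hl
  have hC := hasDerivAt_obsC hl (by rwa [e0])
  have hE := hasDerivAt_angSqE (μ := μ) (c := c) hR hC (by rw [e0]; exact dist_obs hx h0)
    (by rwa [e0])
  have hk := hasDerivAt_Kham (μ := μ) (c := c) hl (by rwa [e0])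
  have h1 := ((hk.const_mul 2).add ((hE.div hR (by rwa [e0])).const_mul 2)).sub
    ((hR.const_mul 4).mul hL)
  have h2 := (hasDerivAt_comp_line hd (v t)).congr_of_eventuallyEq
    ((V.eventually_mem_line t (v t)).mono fun h hh => (difP_symplGrad hh.1 hh.2).symm)
  refine (h2.unique h1).trans ?_
  have hv0 : gradK μ c (γ t) ⬝ᵥ v t = 0 := by rw [← fderiv_Kham μ c hx]; exact hv t
  simp only [zero_smul, add_zero, hv0]
  field_simp
  ring

lemma hasDerivAt_difA (t : ℝ) :
    HasDerivAt (fun t => difA (γ t) (v t))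
      (4 * difL μ (γ t) (v t) / obsR (γ t)
        - 4 * obsL μ (γ t) * difR (γ t) (v t) / obsR (γ t) ^ 2) t := by
  have hx := (V.orbit t).1
  have h0 := V.ne_zero t
  have hl := hasDerivAt_line (γ t) (v t) 0
  have e0 : γ t + (0 : ℝ) • v t = γ t := by simp
  have hR := hasDerivAt_obsR hl
  have hP := hasDerivAt_obsP (μ := μ) hl
  have hL := hasDerivAt_obsL (μ := μ) hl
  have hc := hasDerivAt_coord hl
  have hX := hasDerivAt_pi.1 (hasDerivAt_comp_line (V.differentiableAt_symplGrad t) (v t))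
  have hX0 := ((hX 0).congr_of_eventuallyEq ((V.eventually_mem_line t (v t)).mono fun h hh =>
    (symplGrad_zero (μ := μ) (c := c) hh.1 hh.2).symm)).unique
    ((((hP.mul (hc 0)).sub (hL.mul (hc 1))).const_mul 2).div hR (by rwa [e0]))
  have hX1 := ((hX 1).congr_of_eventuallyEq ((V.eventually_mem_line t (v t)).mono fun h hh =>
    (symplGrad_one (μ := μ) (c := c) hh.1 hh.2).symm)).unique
    ((((hP.mul (hc 1)).add (hL.mul (hc 0))).const_mul 2).div hR (by rwa [e0]))
  have hv := hasDerivAt_coord (V.deriv t)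
  have hγ := hasDerivAt_coord (V.orbit t).2
  have hRt := hasDerivAt_obsR (V.orbit t).2
  refine ((((hγ 0).mul (hv 1)).sub ((hγ 1).mul (hv 0))).const_mul 4 |>.div hRt h0).congr_deriv ?_
  rw [hX0, hX1]
  simp only [zero_smul, add_zero, Pi.zero_apply, difR, symplGrad_zero hx h0, symplGrad_one hx h0, Pi.add_apply, Pi.sub_apply,
    Pi.mul_apply]
  have h1 : γ t 0 ^ 2 + γ t 1 ^ 2 ≠ 0 := fun h => h0 (by rw [obsR, h, mul_zero])
  generalize obsP μ (γ t) = P at *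
  generalize obsL μ (γ t) = L at *
  simp only [obsR]
  field_simp
  ring

/-- Conservation of the symplectic form. -/
lemma sympl_eq {w : ℝ → V4} (W : IsVariation μ c γ w) (t : ℝ) :
    sympl (v t) (w t) = sympl (v 0) (w 0) := by
  have hsym : ∀ t a b, sympl (fderiv ℝ (symplGrad (Kham μ c)) (γ t) a) b
      = -fderiv ℝ (fderiv ℝ (Kham μ c)) (γ t) a b := fun t a b => by
    have hd : DifferentiableAt ℝ (fderiv ℝ (Kham μ c)) (γ t) :=
      ((contDiffAt_Kham μ c (V.orbit t).1).fderiv_right (m := 1) (by norm_num)).differentiableAt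
        (by norm_num)
    have h1 := (hasDerivAt_comp_line hd a).clm_apply (hasDerivAt_const (0 : ℝ) b)
    have hX := hasDerivAt_pi.1 (hasDerivAt_comp_line (V.differentiableAt_symplGrad t) a)
    have h2 := (((hX 2).mul_const (b 0)).add ((hX 3).mul_const (b 1))).sub
      ((hX 0).mul_const (b 2)) |>.sub ((hX 1).mul_const (b 3))
    have h3 := (h1.neg).congr_of_eventuallyEq (f₁ := fun h : ℝ =>
      symplGrad (Kham μ c) (γ t + h • a) 2 * b 0 + symplGrad (Kham μ c) (γ t + h • a) 3 * b 1
      - symplGrad (Kham μ c) (γ t + h • a) 0 * b 2 - symplGrad (Kham μ c) (γ t + h • a) 1 * b 3)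
      ((V.eventually_mem_line t a).mono fun h hh => by
        simp only [Pi.neg_apply]
        rw [fderiv_Kham μ c hh.1, symplGrad_Kham μ c hh.1]
        simp only [dotProduct, Fin.sum_univ_four, Matrix.cons_val]
        ring)
    have h4 := h2.unique h3
    simp only [sympl]
    rw [h4]
    simp
  have hd : ∀ t, HasDerivAt (fun t => sympl (v t) (w t)) 0 t := fun t => by
    have hv := hasDerivAt_coord (V.deriv t)
    have hw := hasDerivAt_coord (W.deriv t)
    refine (((((hv 2).mul (hw 0)).add ((hv 3).mul (hw 1))).sub ((hv 0).mul (hw 2))).sub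
      ((hv 1).mul (hw 3))).congr_deriv ?_
    have h1 := hsym t (v t) (w t)
    have h2 := hsym t (w t) (v t)
    have h3 : fderiv ℝ (fderiv ℝ (Kham μ c)) (γ t) (v t) (w t)
        = fderiv ℝ (fderiv ℝ (Kham μ c)) (γ t) (w t) (v t) :=
      ((contDiffAt_Kham μ c (V.orbit t).1).isSymmSndFDerivAt (by simp; norm_num)) _ _
    simp only [sympl] at h1 h2
    linarith
  exact is_const_of_deriv_eq_zero (fun t => (hd t).differentiableAt) (fun t => (hd t).deriv) t 0

end IsVariation

end LCHill

namespace LCHill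

/-! ### Transverse coordinates -/

/-- Radial transverse coordinate of a tangent vector `v` at `x`. -/
def trR (μ c s : ℝ) (x v : V4) : ℝ :=
  difR x v - s * redR μ c (obsR x) (obsP μ x) (obsC x) * difA x v

/-- Momentum transverse coordinate of a tangent vector `v` at `x`. -/
def trP (μ c s : ℝ) (x v : V4) : ℝ :=
  difP μ x v - s * redP μ c s (obsR x) (obsP μ x) (obsC x) * difA x v

lemma trR_add (μ c s : ℝ) (x v w : V4) : trR μ c s x (v + w) = trR μ c s x v + trR μ c s x w := by
  simp only [trR, difR, difA, Pi.add_apply]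
  ring

lemma trR_smul (μ c s : ℝ) (x v : V4) (a : ℝ) : trR μ c s x (a • v) = a * trR μ c s x v := by
  simp only [trR, difR, difA, Pi.smul_apply, smul_eq_mul]
  ring

lemma trP_add (μ c s : ℝ) (x v w : V4) : trP μ c s x (v + w) = trP μ c s x v + trP μ c s x w := by
  simp only [trP, difP, difA, Pi.add_apply]
  ring

lemma trP_smul (μ c s : ℝ) (x v : V4) (a : ℝ) : trP μ c s x (a • v) = a * trP μ c s x v := by
  simp only [trP, difP, difA, Pi.smul_apply, smul_eq_mul]
  ring

lemma sympl_obs {μ : ℝ} {x : V4} (h0 : obsR x ≠ 0) (v w : V4) :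
    2 * obsR x * sympl v w = difP μ x v * difR x w - difP μ x w * difR x v
      + obsR x * (difL μ x v * difA x w - difL μ x w * difA x v)
      - obsR x ^ 2 * (difR x v * difA x w - difR x w * difA x v) := by
  simp only [difA]
  field_simp
  simp only [sympl, obsR, difP, difL, difR]
  ring

section Point

variable {μ c s l : ℝ} {x : V4}

lemma difR_symplGrad (hx : x ∈ LCDom) (h0 : obsR x ≠ 0) :
    difR x (symplGrad (Kham μ c) x) = 4 * obsP μ x := by
  rw [difR, symplGrad_zero hx h0, symplGrad_one hx h0]
  field_simp
  simp only [obsR]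
  ring

lemma difA_symplGrad (hx : x ∈ LCDom) (h0 : obsR x ≠ 0) :
    difA x (symplGrad (Kham μ c) x) = 4 * obsL μ x / obsR x := by
  have h1 : x 0 ^ 2 + x 1 ^ 2 ≠ 0 := fun h => h0 (by rw [obsR, h, mul_zero])
  simp only [difA, symplGrad_zero hx h0, symplGrad_one hx h0]
  generalize obsP μ x = P at *
  generalize obsL μ x = L at *
  simp only [obsR]
  field_simp
  ring

/-- The symplectic form in transverse coordinates. -/
lemma trP_mul_trR_sub (hx : x ∈ LCDom) (h0 : obsR x ≠ 0) (hK : Kham μ c x = 0)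
    (hs : s = 1 ∨ s = -1) (hl : l ≠ 0) (hL : obsL μ x = s * l)
    (hi : invAng μ c (obsR x) (obsP μ x) (obsC x) = l⁻¹) {v w : V4}
    (hv : gradK μ c x ⬝ᵥ v = 0) (hw : gradK μ c x ⬝ᵥ w = 0) :
    trP μ c s x v * trR μ c s x w - trP μ c s x w * trR μ c s x v
      = 2 * obsR x * sympl v w := by
  have hv' := dif_energy hx h0 hK hv
  have hw' := dif_energy hx h0 hK hw
  rw [sympl_obs (μ := μ) h0]
  simp only [trR, trP, redR, redP, hi]
  rw [hL] at hv' hw'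
  have hs2 : s ^ 2 = 1 := by rcases hs with rfl | rfl <;> norm_num
  have hsl : s * l ≠ 0 := mul_ne_zero (by rcases hs with rfl | rfl <;> norm_num) hl
  have e1 : difL μ x v = s / (2 * l) * (angSqE μ c (obsR x) (obsC x) / obsR x * difR x v
        - angSqC μ (obsR x) (obsC x) * (obsS x * difA x v) - 2 * obsP μ x * difP μ x v) := by
    rw [← hv']; field_simp; linear_combination (-l * difL μ x v) * hs2
  have e2 : difL μ x w = s / (2 * l) * (angSqE μ c (obsR x) (obsC x) / obsR x * difR x w
        - angSqC μ (obsR x) (obsC x) * (obsS x * difA x w) - 2 * obsP μ x * difP μ x w) := by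
    rw [← hw']; field_simp; linear_combination (-l * difL μ x w) * hs2
  rw [e1, e2]
  rcases hs with rfl | rfl
  all_goals
    field_simp
    ring

/-- The vector `K ∇K`. -/
def frameV (g : V4) : V4 := ![-g 3, g 2, -g 1, g 0]

/-- The vector `J ∇K`. -/
def frameU (g : V4) : V4 := ![g 1, -g 0, -g 3, g 2]

lemma trR_frameV (hx : x ∈ LCDom) (h0 : obsR x ≠ 0)
    (hs : s = 1 ∨ s = -1) (hl : l ≠ 0) (hL : obsL μ x = s * l)
    (hi : invAng μ c (obsR x) (obsP μ x) (obsC x) = l⁻¹) :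
    trR μ c s x (frameV (gradK μ c x)) = -(4 * s * (l ^ 2 + obsP μ x ^ 2) / l) := by
  have e0 : gradK μ c x 2 = 2 * (obsP μ x * x 0 - obsL μ x * x 1) / obsR x := by
    rw [← symplGrad_zero hx h0 (c := c), symplGrad_Kham μ c hx]; rfl
  have e1 : gradK μ c x 3 = 2 * (obsP μ x * x 1 + obsL μ x * x 0) / obsR x := by
    rw [← symplGrad_one hx h0 (c := c), symplGrad_Kham μ c hx]; rfl
  have h1 : x 0 ^ 2 + x 1 ^ 2 ≠ 0 := fun h => h0 (by rw [obsR, h, mul_zero])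
  have hs2 : s ^ 2 = 1 := by rcases hs with rfl | rfl <;> norm_num
  simp only [trR, difR, difA, redR, hi, frameV, Matrix.cons_val, e0, e1, hL]
  generalize obsP μ x = P at *
  simp only [obsR]
  rcases hs with rfl | rfl
  all_goals
    field_simp
    ring

lemma trR_symplGrad (hx : x ∈ LCDom) (h0 : obsR x ≠ 0)
    (hs : s = 1 ∨ s = -1) (hl : l ≠ 0) (hL : obsL μ x = s * l)
    (hi : invAng μ c (obsR x) (obsP μ x) (obsC x) = l⁻¹) :
    trR μ c s x (symplGrad (Kham μ c) x) = 0 := by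
  simp only [trR, difR_symplGrad hx h0, difA_symplGrad hx h0, redR, hi, hL]
  rcases hs with rfl | rfl
  all_goals
    field_simp
    ring

lemma trP_symplGrad (hx : x ∈ LCDom) (h0 : obsR x ≠ 0) (hK : Kham μ c x = 0)
    (hs : s = 1 ∨ s = -1) (hl : l ≠ 0) (hL : obsL μ x = s * l)
    (hi : invAng μ c (obsR x) (obsP μ x) (obsC x) = l⁻¹) :
    trP μ c s x (symplGrad (Kham μ c) x) = 0 := by
  simp only [trP, difP_symplGrad hx h0, difA_symplGrad hx h0, redP, hi, hL, hK]
  rcases hs with rfl | rfl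
  all_goals
    field_simp
    ring

end Point

namespace IsVariation

variable {μ c s t : ℝ} {γ v : ℝ → V4} {l : ℝ → ℝ} (V : IsVariation μ c γ v)
  (hs : s = 1 ∨ s = -1) (hv : ∀ t, fderiv ℝ (Kham μ c) (γ t) (v t) = 0)
  (hl : ∀ t, l t = ang μ c (obsR (γ t)) (obsP μ (γ t)) (obsC (γ t)))
  (hl0 : ∀ t, 0 < angSq μ c (obsR (γ t)) (obsC (γ t)) - obsP μ (γ t) ^ 2)
  (hL : ∀ t, obsL μ (γ t) = s * l t)
include V hs hv hl hl0 hL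

lemma hasDerivAt_tr :
    HasDerivAt (fun t => trR μ c s (γ t) (v t)) (4 * l t / obsR (γ t)
      * (jac11 μ c (obsR (γ t)) (obsP μ (γ t)) (obsC (γ t)) * trR μ c s (γ t) (v t)
        + jac12 μ c (obsR (γ t)) (obsP μ (γ t)) (obsC (γ t)) * trP μ c s (γ t) (v t))) t ∧
    HasDerivAt (fun t => trP μ c s (γ t) (v t)) (4 * l t / obsR (γ t)
      * (jac21 μ c s (obsR (γ t)) (obsP μ (γ t)) (obsC (γ t)) / obsR (γ t)
          * trR μ c s (γ t) (v t)
        + jac22 μ c (obsR (γ t)) (obsP μ (γ t)) (obsC (γ t)) * trP μ c s (γ t) (v t))) t := by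
  have hx := (V.orbit t).1
  have h0 := V.ne_zero t
  have hK := V.energy t
  have hlp : 0 < l t := by rw [hl]; exact Real.sqrt_pos.2 (hl0 t)
  have hi : invAng μ c (obsR (γ t)) (obsP μ (γ t)) (obsC (γ t)) = (l t)⁻¹ := by rw [hl]; rfl
  have hv0 : gradK μ c (γ t) ⬝ᵥ v t = 0 := by rw [← fderiv_Kham μ c hx]; exact hv t
  have hE := dif_energy hx h0 hK hv0
  have hRt := hasDerivAt_obsR (V.orbit t).2
  have hPt := hasDerivAt_obsP (μ := μ) (V.orbit t).2
  have hCt := hasDerivAt_obsC (V.orbit t).2 h0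
  have e1 := difR_symplGrad (μ := μ) (c := c) hx h0
  have e2 := difA_symplGrad (μ := μ) (c := c) hx h0
  have e3 := difP_symplGrad (μ := μ) (c := c) hx h0
  have hs2 : s ^ 2 = 1 := by rcases hs with rfl | rfl <;> norm_num
  have e4 : difL μ (γ t) (v t) = s / (2 * l t)
      * (angSqE μ c (obsR (γ t)) (obsC (γ t)) / obsR (γ t) * difR (γ t) (v t)
        - angSqC μ (obsR (γ t)) (obsC (γ t)) * (obsS (γ t) * difA (γ t) (v t))
        - 2 * obsP μ (γ t) * difP μ (γ t) (v t)) := by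
    rw [hL] at hE
    rw [← hE]; field_simp; linear_combination (-l t * difL μ (γ t) (v t)) * hs2
  have hd := dist_obs hx h0
  have hf1 := hasDerivAt_redR (μ := μ) (c := c) hRt hPt hCt hd h0 (hl0 t)
  have hf2 := hasDerivAt_redP (μ := μ) (c := c) (s := s) hRt hPt hCt hd h0 (hl0 t)
  have hA := V.hasDerivAt_difA t
  constructor
  · refine ((V.hasDerivAt_difR t).sub ((hf1.const_mul s).mul hA)).congr_deriv ?_
    rw [e1, e2, e3, hK, e4, hL]
    simp only [trR, trP, redR, redP, jac11, jac12, jac13, hi]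
    rcases hs with rfl | rfl
    all_goals
      field_simp
      ring
  · refine ((V.hasDerivAt_difP hv t).sub ((hf2.const_mul s).mul hA)).congr_deriv ?_
    rw [e1, e2, e3, hK, e4, hL]
    simp only [trR, trP, redR, redP, jac21, jac22, jac23, hi]
    rcases hs with rfl | rfl
    all_goals
      field_simp
      ring

end IsVariation

end LCHill

namespace LCHill

/-! ### Angles along plane curves and the Conley–Zehnder index -/

/-- `φ` is a continuous choice of the polar angle of the plane curve `(f, g)`. -/
def IsLift (T : ℝ) (f g φ : ℝ → ℝ) : Prop :=
  ContinuousOn φ (Icc 0 T) ∧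
    ∀ t ∈ Icc 0 T, ∃ ϱ > 0, f t = ϱ * Real.cos (φ t) ∧ g t = ϱ * Real.sin (φ t)

namespace IsLift

variable {T : ℝ} {f g f₂ g₂ φ φ₂ : ℝ → ℝ}

lemma add_arg (h : IsLift T f g φ) (hf : ContinuousOn f (Icc 0 T))
    (hg : ContinuousOn g (Icc 0 T)) (hf₂ : ContinuousOn f₂ (Icc 0 T))
    (hg₂ : ContinuousOn g₂ (Icc 0 T))
    (hs : ∀ t ∈ Icc 0 T, g₂ t * f t - f₂ t * g t = 0 → 0 < f₂ t * f t + g₂ t * g t) :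
    IsLift T f₂ g₂
      fun t => φ t + Complex.arg ⟨f₂ t * f t + g₂ t * g t, g₂ t * f t - f₂ t * g t⟩ := by
  refine ⟨h.1.add fun t ht => ?_, fun t ht => ?_⟩
  · have hz : ContinuousOn (fun t => (⟨f₂ t * f t + g₂ t * g t, g₂ t * f t - f₂ t * g t⟩ : ℂ))
        (Icc 0 T) :=
      Complex.equivRealProdCLM.symm.continuous.comp_continuousOn
        (((hf₂.mul hf).add (hg₂.mul hg)).prodMk ((hg₂.mul hf).sub (hf₂.mul hg)))
    refine (Complex.continuousAt_arg ?_).comp_continuousWithinAt (hz t ht)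
    rw [Complex.mem_slitPlane_iff]
    by_cases h0 : g₂ t * f t - f₂ t * g t = 0
    · exact Or.inl (hs t ht h0)
    · exact Or.inr h0
  · obtain ⟨ϱ, hϱ, e1, e2⟩ := h.2 t ht
    set z : ℂ := ⟨f₂ t * f t + g₂ t * g t, g₂ t * f t - f₂ t * g t⟩ with hz
    have h1 : ‖z‖ * Real.cos z.arg = f₂ t * f t + g₂ t * g t := Complex.norm_mul_cos_arg z
    have h2 : ‖z‖ * Real.sin z.arg = g₂ t * f t - f₂ t * g t := Complex.norm_mul_sin_arg z
    have hz0 : 0 < ‖z‖ := norm_pos_iff.2 fun hz0 => by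
      rw [hz0] at h1 h2
      simp only [norm_zero, zero_mul] at h1 h2
      exact (hs t ht h2.symm).ne h1
    have h3 := Real.sin_sq_add_cos_sq (φ t)
    refine ⟨‖z‖ / ϱ, div_pos hz0 hϱ, ?_, ?_⟩
    · change f₂ t = ‖z‖ / ϱ * Real.cos (φ t + z.arg)
      rw [Real.cos_add]
      field_simp
      rw [e1, e2] at h1 h2
      linear_combination -ϱ * f₂ t * h3 - Real.cos (φ t) * h1 + Real.sin (φ t) * h2
    · change g₂ t = ‖z‖ / ϱ * Real.sin (φ t + z.arg)
      rw [Real.sin_add]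
      field_simp
      rw [e1, e2] at h1 h2
      linear_combination -ϱ * g₂ t * h3 - Real.sin (φ t) * h1 - Real.cos (φ t) * h2

lemma eq_of_eq (h : IsLift T f g φ) (h₂ : IsLift T f g φ₂) (hT : 0 ≤ T) (h0 : φ 0 = φ₂ 0) :
    φ T = φ₂ T := by
  have hc : ∀ t ∈ Icc 0 T, Real.cos (φ t - φ₂ t) = 1 := fun t ht => by
    obtain ⟨r, hr, e1, e2⟩ := h.2 t ht
    obtain ⟨r', hr', e3, e4⟩ := h₂.2 t ht
    have h1 := Real.sin_sq_add_cos_sq (φ t)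
    have h2 := Real.sin_sq_add_cos_sq (φ₂ t)
    have h3 : r = r' := by
      have : r ^ 2 = r' ^ 2 := by
        rw [e1] at e3
        rw [e2] at e4
        linear_combination r' ^ 2 * h2 - r ^ 2 * h1 + (r * Real.cos (φ t) + r' * Real.cos (φ₂ t)) * e3
          + (r * Real.sin (φ t) + r' * Real.sin (φ₂ t)) * e4
      nlinarith
    subst h3
    have h4 := mul_left_cancel₀ hr.ne' (e1.symm.trans e3)
    have h5 := mul_left_cancel₀ hr.ne' (e2.symm.trans e4)
    rw [Real.cos_sub, h4, h5]
    linarith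
  have hd : ContinuousOn (fun t => φ t - φ₂ t) (Icc 0 T) := h.1.sub h₂.1
  by_contra hne
  have hT' : T ∈ Icc 0 T := ⟨hT, le_rfl⟩
  obtain ⟨n, hn⟩ := (Real.cos_eq_one_iff _).1 (hc T hT')
  have hn0 : n ≠ 0 := by
    rintro rfl
    apply hne
    simp at hn
    linarith
  have hπ := Real.pi_pos
  have key : ∃ t ∈ Icc 0 T, |φ t - φ₂ t| = Real.pi := by
    have h1 : Real.pi ∈ Icc (|φ 0 - φ₂ 0|) (|φ T - φ₂ T|) := by
      rw [h0, sub_self, abs_zero, ← hn, abs_mul, abs_of_pos (by positivity : 0 < 2 * Real.pi)]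
      refine ⟨hπ.le, ?_⟩
      have : (1 : ℝ) ≤ |(n : ℝ)| := by exact_mod_cast Int.one_le_abs hn0
      nlinarith
    exact intermediate_value_Icc hT hd.abs h1
  obtain ⟨t, ht, e⟩ := key
  have := hc t ht
  rw [← Real.cos_abs, e, Real.cos_pi] at this
  norm_num at this

end IsLift

lemma lt_of_sin_pos {x y : ℝ} {n : ℕ} (h : |y - x| < Real.pi) (hs : 0 < Real.sin x → 0 < Real.sin y)
    (hs' : Real.sin x < 0 → Real.sin y < 0) (h1 : 2 * n * Real.pi < x)
    (h2 : x < 2 * (n + 1) * Real.pi) : 2 * n * Real.pi < y ∧ y < 2 * (n + 1) * Real.pi := by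
  obtain ⟨h3, h4⟩ := abs_lt.1 h
  have e : ∀ z : ℝ, Real.sin (z - n * (2 * Real.pi)) = Real.sin z := fun z =>
    Real.sin_sub_nat_mul_two_pi z n
  rw [← e x, ← e y] at hs hs'
  constructor
  · by_contra hy
    have hx : 0 < Real.sin (x - n * (2 * Real.pi)) :=
      Real.sin_pos_of_pos_of_lt_pi (by linarith) (by linarith)
    have := hs hx
    have := Real.sin_nonpos_of_nonpos_of_neg_pi_le (x := y - n * (2 * Real.pi)) (by linarith)
      (by linarith)
    linarith
  · by_contra hy
    have e' : ∀ z : ℝ, Real.sin (z - n * (2 * Real.pi))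
        = Real.sin (z - n * (2 * Real.pi) - 2 * Real.pi) := fun z =>
      (Real.sin_sub_two_pi _).symm
    have hx : Real.sin (x - n * (2 * Real.pi)) < 0 := by
      rw [e']
      exact Real.sin_neg_of_neg_of_neg_pi_lt (by linarith) (by linarith)
    have := hs' hx
    rw [e'] at this
    have := Real.sin_nonneg_of_nonneg_of_le_pi (x := y - n * (2 * Real.pi) - 2 * Real.pi)
      (by linarith) (by linarith)
    linarith

end LCHill

namespace LCHill

/-- The planar curve `(f, g)` turns by an angle strictly between `2kπ` and `2(k+1)π`. -/
def TurnsIn (T : ℝ) (k : ℕ) (f g : ℝ → ℝ) : Prop :=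
  ∃ φ, IsLift T f g φ ∧ 2 * k * Real.pi < φ T - φ 0 ∧ φ T - φ 0 < 2 * (k + 1) * Real.pi

namespace IsLift

variable {T : ℝ} {f g f₂ g₂ φ φ₂ : ℝ → ℝ}

lemma exists_sin_eq (h : IsLift T f g φ) (hT : 0 ≤ T) :
    ∃ ϱ > 0, f 0 * g T - g 0 * f T = ϱ * Real.sin (φ T - φ 0) ∧
      f 0 * f T + g 0 * g T = ϱ * Real.cos (φ T - φ 0) := by
  obtain ⟨r, hr, e1, e2⟩ := h.2 0 ⟨le_rfl, hT⟩
  obtain ⟨r', hr', e3, e4⟩ := h.2 T ⟨hT, le_rfl⟩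
  refine ⟨r * r', mul_pos hr hr', ?_, ?_⟩
  · rw [e1, e2, e3, e4, Real.sin_sub]
    ring
  · rw [e1, e2, e3, e4, Real.cos_sub]
    ring

lemma turn_ne_of_eq_smul (h : IsLift T f g φ) (hT : 0 ≤ T) {lam : ℝ} (hl : 0 < lam)
    (h1 : f T = lam * f 0) (h2 : g T = lam * g 0) (k : ℕ) :
    ¬ (2 * k * Real.pi < φ T - φ 0 ∧ φ T - φ 0 < 2 * (k + 1) * Real.pi) := by
  rintro ⟨h3, h4⟩
  obtain ⟨r, hr, e1, e2⟩ := h.exists_sin_eq hT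
  rw [h1, h2] at e1 e2
  have hπ := Real.pi_pos
  obtain ⟨r', hr', e3, e4⟩ := h.2 0 ⟨le_rfl, hT⟩
  have hs : Real.sin (φ T - φ 0) = 0 := by
    have : r * Real.sin (φ T - φ 0) = 0 := by rw [← e1]; ring
    exact (mul_eq_zero.1 this).resolve_left hr.ne'
  have hc : 0 < Real.cos (φ T - φ 0) := by
    have h5 : f 0 * (lam * f 0) + g 0 * (lam * g 0) = lam * r' ^ 2 := by
      rw [e3, e4]
      linear_combination lam * r' ^ 2 * Real.sin_sq_add_cos_sq (φ 0)
    have h6 : 0 < r * Real.cos (φ T - φ 0) := by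
      rw [← e2, h5]
      positivity
    exact (pos_iff_pos_of_mul_pos h6).1 hr
  have hc1 : Real.cos (φ T - φ 0) = 1 := by
    have := Real.sin_sq_add_cos_sq (φ T - φ 0)
    rw [hs] at this
    nlinarith
  obtain ⟨n, hn⟩ := (Real.cos_eq_one_iff _).1 hc1
  rw [← hn] at h3 h4
  have h5 : (k : ℝ) < n := by
    by_contra hh
    push Not at hh
    nlinarith
  have h6 : (n : ℝ) < k + 1 := by
    by_contra hh
    push Not at hh
    nlinarith
  have h7 : (k : ℤ) < n := by exact_mod_cast h5
  have h8 : n < (k : ℤ) + 1 := by exact_mod_cast h6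
  omega

/-- Two curves that make an acute angle throughout turn by nearly the same angle. -/
lemma exists_near (h : IsLift T f g φ) (hT : 0 ≤ T) (hf : ContinuousOn f (Icc 0 T))
    (hg : ContinuousOn g (Icc 0 T)) (hf₂ : ContinuousOn f₂ (Icc 0 T))
    (hg₂ : ContinuousOn g₂ (Icc 0 T)) (h1 : 0 < f 0) (h2 : g 0 = 0)
    (h4 : g₂ 0 = 0) (hs : ∀ t ∈ Icc 0 T, 0 < f₂ t * f t + g₂ t * g t) :
    ∃ θ, IsLift T f₂ g₂ θ ∧ θ 0 = 0 ∧ |θ T - (φ T - φ 0)| < Real.pi / 2 := by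
  have hl := h.add_arg hf hg hf₂ hg₂ fun t ht _ => hs t ht
  have ha0 : Complex.arg ⟨f₂ 0 * f 0 + g₂ 0 * g 0, g₂ 0 * f 0 - f₂ 0 * g 0⟩ = 0 := by
    rw [Complex.arg_eq_zero_iff]
    exact ⟨(hs 0 ⟨le_rfl, hT⟩).le, by simp [h2, h4]⟩
  obtain ⟨r, hr, e1, e2⟩ := h.2 0 ⟨le_rfl, hT⟩
  have hs0 : Real.sin (φ 0) = 0 := by
    rw [h2] at e2
    exact (mul_eq_zero.1 e2.symm).resolve_left hr.ne'
  have hc0 : Real.cos (φ 0) = 1 := by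
    have h5 := Real.sin_sq_add_cos_sq (φ 0)
    rw [e1] at h1
    have := (pos_iff_pos_of_mul_pos h1).1 hr
    rw [hs0] at h5
    nlinarith
  refine ⟨fun t => φ t + Complex.arg ⟨f₂ t * f t + g₂ t * g t, g₂ t * f t - f₂ t * g t⟩ - φ 0,
    ⟨hl.1.sub continuousOn_const, fun t ht => ?_⟩, ?_, ?_⟩
  · obtain ⟨ϱ, hϱ, e3, e4⟩ := hl.2 t ht
    refine ⟨ϱ, hϱ, ?_, ?_⟩
    · rw [Real.cos_sub, hs0, hc0, mul_zero, add_zero, mul_one]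
      exact e3
    · rw [Real.sin_sub, hs0, hc0, mul_zero, sub_zero, mul_one]
      exact e4
  · simp only [ha0]
    ring
  · have : ∀ z : ℝ, φ T + z - φ 0 - (φ T - φ 0) = z := fun z => by ring
    simp only [this]
    exact Complex.abs_arg_lt_pi_div_two_iff.2 (Or.inl (hs T ⟨hT, le_rfl⟩))

end IsLift

section turn

variable {T : ℝ} {k : ℕ} {x y A C D K : ℝ → ℝ}

/-- The turning interval of a planar curve only depends on its image under a path of matrices
of positive determinant that are diagonal at the end points. -/
lemma TurnsIn.of_frame (hT : 0 ≤ T) (hx : ContinuousOn x (Icc 0 T)) (hy : ContinuousOn y (Icc 0 T))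
    (hA : ContinuousOn A (Icc 0 T)) (hC : ContinuousOn C (Icc 0 T)) (hD : ContinuousOn D (Icc 0 T))
    (hK : ContinuousOn K (Icc 0 T)) (hKp : ∀ t ∈ Icc 0 T, 0 < K t)
    (hdet : ∀ t ∈ Icc 0 T, 0 < C t * K t - D t * A t) (hA0 : A 0 = 0) (hAT : A T = 0)
    (hD0 : D 0 = 0) (hDT : D T = 0) (hCT : C T = C 0) (hKT : K T = K 0)
    (h0 : ∀ t ∈ Icc 0 T, x t ≠ 0 ∨ y t ≠ 0) (hxy : x 0 * y 0 = 0)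
    (h : TurnsIn T k (fun t => C t * x t + D t * y t) fun t => A t * x t + K t * y t) :
    TurnsIn T k x y := by
  obtain ⟨φ, hφ, hk⟩ := h
  have hQ : ContinuousOn (fun t => C t * x t + D t * y t) (Icc 0 T) := (hC.mul hx).add (hD.mul hy)
  have hY : ContinuousOn (fun t => A t * x t + K t * y t) (Icc 0 T) := (hA.mul hx).add (hK.mul hy)
  have hsq : ∀ a b : ℝ, a ≠ 0 ∨ b ≠ 0 → 0 < a * a + b * b := fun a b hab => by
    rcases hab with h | h
    · have := mul_self_pos.2 h
      nlinarith [mul_self_nonneg b]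
    · have := mul_self_pos.2 h
      nlinarith [mul_self_nonneg a]
  have h1 := hφ.add_arg hQ hY hx hY fun t ht hz => by
    have hK' := hKp t ht
    have hd := hdet t ht
    have hz' : (A t * x t + K t * y t) * (C t * x t + D t * y t - x t) = 0 := by
      linear_combination hz
    by_cases hYt : A t * x t + K t * y t = 0
    · have hxt : x t ≠ 0 := fun hx0 => by
        rw [hx0, mul_zero, zero_add] at hYt
        exact (h0 t ht).elim (fun h => h hx0)
          fun h => h ((mul_eq_zero.1 hYt).resolve_left hK'.ne')
      have e : K t * (x t * (C t * x t + D t * y t))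
          = (C t * K t - D t * A t) * (x t * x t) := by
        linear_combination x t * D t * hYt
      have e' : 0 < K t * (x t * (C t * x t + D t * y t)) :=
        e ▸ mul_pos hd (mul_self_pos.2 hxt)
      rw [hYt]
      have := (pos_iff_pos_of_mul_pos e').1 hK'
      linarith
    · have e := (mul_eq_zero.1 hz').resolve_left hYt
      rw [sub_eq_zero.1 e]
      exact hsq _ _ (Or.inr hYt)
  have h2 := h1.add_arg hx hY hx hy fun t ht hz => by
    have hK' := hKp t ht
    have hz' : x t * (y t - (A t * x t + K t * y t)) = 0 := by
      linear_combination hz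
    by_cases hxt : x t = 0
    · have hyt := (h0 t ht).resolve_left (not_not.2 hxt)
      rw [hxt]
      have := mul_pos hK' (mul_self_pos.2 hyt)
      linarith
    · have e := sub_eq_zero.1 ((mul_eq_zero.1 hz').resolve_left hxt)
      rw [← e]
      exact hsq _ _ (Or.inl hxt)
  refine ⟨_, h2, ?_⟩
  have hK0 := hKp 0 ⟨le_rfl, hT⟩
  have hC0 : 0 < C 0 := by
    have := hdet 0 ⟨le_rfl, hT⟩
    rw [hA0, mul_zero, sub_zero] at this
    exact (pos_iff_pos_of_mul_pos this).2 hK0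
  have hargs : ∀ p q : ℝ, 0 < p → q = 0 → Complex.arg ⟨p, q⟩ = 0 := fun p q hp hq => by
    rw [Complex.arg_eq_zero_iff]
    exact ⟨hp.le, hq⟩
  have hargT : ∀ p q : ℝ, 0 < p → |Complex.arg ⟨p, q⟩| < Real.pi / 2 := fun p q hp =>
    Complex.abs_arg_lt_pi_div_two_iff.2 (Or.inl hp)
  have hxy0 := h0 0 ⟨le_rfl, hT⟩
  have hxyT := h0 T ⟨hT, le_rfl⟩
  have hpos : ∀ p q r s : ℝ, 0 < p → 0 < q → r ≠ 0 ∨ s ≠ 0 → 0 < p * (r * r) + q * (s * s) :=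
      fun p q r s hp hq hrs => by
    rcases hrs with h | h
    · have := mul_pos hp (mul_self_pos.2 h)
      nlinarith [mul_nonneg hq.le (mul_self_nonneg s)]
    · have := mul_pos hq (mul_self_pos.2 h)
      nlinarith [mul_nonneg hp.le (mul_self_nonneg r)]
  have a1 := hargs (x 0 * (C 0 * x 0 + D 0 * y 0) + (A 0 * x 0 + K 0 * y 0) * (A 0 * x 0 + K 0 * y 0))
    ((A 0 * x 0 + K 0 * y 0) * (C 0 * x 0 + D 0 * y 0) - x 0 * (A 0 * x 0 + K 0 * y 0))
    (by
      have := hpos (C 0) (K 0 * K 0) (x 0) (y 0) hC0 (mul_pos hK0 hK0) hxy0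
      rw [hA0, hD0]
      linarith)
    (by
      rw [hA0, hD0]
      linear_combination K 0 * (C 0 - 1) * hxy)
  have a2 := hargs (x 0 * x 0 + y 0 * (A 0 * x 0 + K 0 * y 0))
    (y 0 * x 0 - x 0 * (A 0 * x 0 + K 0 * y 0))
    (by
      have := hpos 1 (K 0) (x 0) (y 0) one_pos hK0 hxy0
      rw [hA0]
      linarith)
    (by
      rw [hA0]
      linear_combination (1 - K 0) * hxy)
  have b1 := hargT (x T * (C T * x T + D T * y T) + (A T * x T + K T * y T) * (A T * x T + K T * y T))
    ((A T * x T + K T * y T) * (C T * x T + D T * y T) - x T * (A T * x T + K T * y T))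
    (by
      have := hpos (C 0) (K 0 * K 0) (x T) (y T) hC0 (mul_pos hK0 hK0) hxyT
      rw [hAT, hDT, hCT, hKT]
      linarith)
  have b2 := hargT (x T * x T + y T * (A T * x T + K T * y T))
    (y T * x T - x T * (A T * x T + K T * y T))
    (by
      have := hpos 1 (K 0) (x T) (y T) one_pos hK0 hxyT
      rw [hAT, hKT]
      linarith)
  obtain ⟨r, hr, s1, -⟩ := hφ.exists_sin_eq hT
  obtain ⟨r', hr', s2, -⟩ := h2.exists_sin_eq hT
  simp only [a1, a2, add_zero] at s2 ⊢
  have hCK := mul_pos hC0 hK0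
  have e : r * Real.sin (φ T - φ 0) = C 0 * K 0 * (x 0 * y T - y 0 * x T) := by
    rw [← s1, hA0, hD0, hAT, hDT, hCT, hKT]
    ring
  refine lt_of_sin_pos ?_ (fun h => ?_) (fun h => ?_) hk.1 hk.2
  · rw [abs_lt] at b1 b2 ⊢
    constructor <;> linarith [b1.1, b1.2, b2.1, b2.2]
  · have h3 := (mul_pos hr h)
    rw [e] at h3
    have h4 := (pos_iff_pos_of_mul_pos h3).1 hCK
    rw [s2] at h4
    exact (pos_iff_pos_of_mul_pos h4).1 hr'
  · have h3 := (mul_neg_of_pos_of_neg hr h)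
    rw [e] at h3
    have h4 := neg_of_mul_neg_right h3 hCK.le
    rw [s2] at h4
    exact neg_of_mul_neg_right h4 hr'.le

end turn

end LCHill

namespace LCHill

/-- A path of unimodular matrices all of whose orbits turn by an angle strictly between `2kπ` and
`2(k+1)π`, as seen through a moving frame, has Conley–Zehnder index `2k + 1`. -/
theorem czIndexIs_of_turnsIn {T : ℝ} {k : ℕ} {A C D K : ℝ → ℝ} {ψ : ℝ → M2} (hT : 0 ≤ T)
    (hψ : ∀ i j, ContinuousOn (fun t => ψ t i j) (Icc 0 T)) (hψ0 : ψ 0 = 1)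
    (hψ1 : ∀ t ∈ Icc 0 T, ψ t 0 0 * ψ t 1 1 - ψ t 0 1 * ψ t 1 0 = 1)
    (hA : ContinuousOn A (Icc 0 T)) (hC : ContinuousOn C (Icc 0 T)) (hD : ContinuousOn D (Icc 0 T))
    (hK : ContinuousOn K (Icc 0 T)) (hKp : ∀ t ∈ Icc 0 T, 0 < K t)
    (hdet : ∀ t ∈ Icc 0 T, 0 < C t * K t - D t * A t) (hA0 : A 0 = 0) (hAT : A T = 0)
    (hD0 : D 0 = 0) (hDT : D T = 0) (hCT : C T = C 0) (hKT : K T = K 0)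
    (h : ∀ ξ η : ℝ, ξ ≠ 0 ∨ η ≠ 0 → TurnsIn T k
      (fun t => C t * (ψ t 0 0 * ξ + ψ t 0 1 * η) + D t * (ψ t 1 0 * ξ + ψ t 1 1 * η))
      fun t => A t * (ψ t 0 0 * ξ + ψ t 0 1 * η) + K t * (ψ t 1 0 * ξ + ψ t 1 1 * η)) :
    CZIndexIs T ψ (2 * k + 1) := by
  have hπ := Real.pi_pos
  have m0 : (0 : ℝ) ∈ Icc 0 T := ⟨le_rfl, hT⟩
  have mT : T ∈ Icc 0 T := ⟨hT, le_rfl⟩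
  have hx : ∀ (i : Fin 2) (ξ η : ℝ),
      ContinuousOn (fun t => ψ t i 0 * ξ + ψ t i 1 * η) (Icc 0 T) := fun i ξ η =>
    ((hψ i 0).mul continuousOn_const).add ((hψ i 1).mul continuousOn_const)
  have hne : ∀ ξ η : ℝ, ξ ≠ 0 ∨ η ≠ 0 → ∀ t ∈ Icc 0 T,
      ψ t 0 0 * ξ + ψ t 0 1 * η ≠ 0 ∨ ψ t 1 0 * ξ + ψ t 1 1 * η ≠ 0 := fun ξ η hz t ht => by
    by_contra hh
    push Not at hh
    obtain ⟨e1, e2⟩ := hh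
    have e3 := hψ1 t ht
    rcases hz with hz | hz
    · exact hz (by linear_combination ψ t 1 1 * e1 - ψ t 0 1 * e2 - ξ * e3)
    · exact hz (by linear_combination ψ t 0 0 * e2 - ψ t 1 0 * e1 - η * e3)
  have p00 : ψ 0 0 0 = 1 := by simp [hψ0]
  have p01 : ψ 0 0 1 = 0 := by simp [hψ0]
  have p10 : ψ 0 1 0 = 0 := by simp [hψ0]
  have p11 : ψ 0 1 1 = 1 := by simp [hψ0]
  have turn : ∀ ξ η : ℝ, ξ ≠ 0 ∨ η ≠ 0 → ξ * η = 0 →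
      TurnsIn T k (fun t => ψ t 0 0 * ξ + ψ t 0 1 * η) fun t => ψ t 1 0 * ξ + ψ t 1 1 * η :=
    fun ξ η hz hz' => TurnsIn.of_frame hT (hx 0 ξ η) (hx 1 ξ η) hA hC hD hK hKp hdet hA0 hAT hD0
      hDT hCT hKT (hne ξ η hz) (by rw [p00, p01, p10, p11]; linear_combination hz') (h ξ η hz)
  obtain ⟨φ, hφ, hφ1, hφ2⟩ := turn 1 0 (Or.inl one_ne_zero) (mul_zero _)
  obtain ⟨χ, hχ, hχ1, hχ2⟩ := turn 0 1 (Or.inr one_ne_zero) (zero_mul _)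
  simp only [mul_one, mul_zero, add_zero, zero_add] at hφ hχ
  have hχ' : IsLift T (fun t => ψ t 1 1) (fun t => -ψ t 0 1) fun t => χ t - Real.pi / 2 :=
    ⟨hχ.1.sub continuousOn_const, fun t ht => by
      obtain ⟨r, hr, e1, e2⟩ := hχ.2 t ht
      exact ⟨r, hr, by rw [Real.cos_sub_pi_div_two]; exact e2, by
        rw [Real.sin_sub_pi_div_two]
        linear_combination -e1⟩⟩
  obtain ⟨θ, hθ, hθ0, hθT⟩ := hφ.exists_near (f₂ := fun t => ψ t 0 0 + ψ t 1 1)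
    (g₂ := fun t => ψ t 1 0 - ψ t 0 1) hT (hψ 0 0) (hψ 1 0) ((hψ 0 0).add (hψ 1 1))
    ((hψ 1 0).sub (hψ 0 1)) (by rw [p00]; exact one_pos) p10 (by rw [p01, p10, sub_zero])
    fun t ht => by nlinarith [hψ1 t ht, sq_nonneg (ψ t 0 0), sq_nonneg (ψ t 1 0)]
  obtain ⟨θ', hθ', hθ0', hθT'⟩ := hχ'.exists_near (f₂ := fun t => ψ t 0 0 + ψ t 1 1)
    (g₂ := fun t => ψ t 1 0 - ψ t 0 1) hT (hψ 1 1) (hψ 0 1).neg ((hψ 0 0).add (hψ 1 1))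
    ((hψ 1 0).sub (hψ 0 1)) (by rw [p11]; exact one_pos) (by rw [p01, neg_zero])
    (by rw [p01, p10, sub_zero])
    fun t ht => by nlinarith [hψ1 t ht, sq_nonneg (ψ t 1 1), sq_nonneg (ψ t 0 1)]
  rw [← hθ.eq_of_eq hθ' hT (hθ0.trans hθ0'.symm)] at hθT'
  obtain ⟨r₁, hr₁, e₁, -⟩ := hφ.exists_sin_eq hT
  obtain ⟨r₂, hr₂, e₂, -⟩ := hχ.exists_sin_eq hT
  obtain ⟨r₃, hr₃, -, e₃⟩ := hθ.2 T mT
  rw [p00, p10] at e₁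
  rw [p01, p11] at e₂
  have hθT'' : |θ T - (χ T - χ 0)| < Real.pi / 2 := by
    convert hθT' using 2
    ring
  have per : ∀ z : ℝ, Real.sin (z - k * (2 * Real.pi)) = Real.sin z := fun z =>
    Real.sin_sub_nat_mul_two_pi z k
  have per' : ∀ z : ℝ, Real.sin (z - k * (2 * Real.pi) - 2 * Real.pi) = Real.sin z := fun z => by
    rw [Real.sin_sub_two_pi, per]
  rw [abs_lt] at hθT hθT''
  have hlow : 2 * k * Real.pi < θ T := by
    by_contra hh
    push Not at hh
    have s1 : 0 < Real.sin (φ T - φ 0) := by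
      rw [← per]
      exact Real.sin_pos_of_pos_of_lt_pi (by linarith) (by linarith)
    have s2 : 0 < Real.sin (χ T - χ 0) := by
      rw [← per]
      exact Real.sin_pos_of_pos_of_lt_pi (by linarith) (by linarith)
    have s3 : Real.sin (θ T) ≤ 0 := by
      rw [← per]
      exact Real.sin_nonpos_of_nonpos_of_neg_pi_le (by linarith) (by linarith)
    have := mul_pos hr₁ s1
    have := mul_pos hr₂ s2
    have := mul_nonpos_of_nonneg_of_nonpos hr₃.le s3
    linarith
  have hupp : θ T < 2 * (k + 1) * Real.pi := by
    by_contra hh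
    push Not at hh
    have s1 : Real.sin (φ T - φ 0) < 0 := by
      rw [← per']
      exact Real.sin_neg_of_neg_of_neg_pi_lt (by linarith) (by linarith)
    have s2 : Real.sin (χ T - χ 0) < 0 := by
      rw [← per']
      exact Real.sin_neg_of_neg_of_neg_pi_lt (by linarith) (by linarith)
    have s3 : 0 ≤ Real.sin (θ T) := by
      rw [← per']
      exact Real.sin_nonneg_of_nonneg_of_le_pi (by linarith) (by linarith)
    have := mul_neg_of_pos_of_neg hr₁ s1
    have := mul_neg_of_pos_of_neg hr₂ s2
    have := mul_nonneg hr₃.le s3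
    linarith
  refine ⟨θ, hθ.1, hθ0, fun t ht => ?_, Or.inr ⟨?_, ⟨k, rfl⟩⟩, ?_⟩
  · obtain ⟨r, hr, e1, e2⟩ := hθ.2 t ht
    replace e1 : ψ t 0 0 + ψ t 1 1 = r * Real.cos (θ t) := e1
    replace e2 : ψ t 1 0 - ψ t 0 1 = r * Real.sin (θ t) := e2
    have e3 : ψ t 0 1 - ψ t 1 0 = -(r * Real.sin (θ t)) := by linear_combination -e2
    have e4 : Real.sqrt ((ψ t 0 0 + ψ t 1 1) ^ 2 + (ψ t 0 1 - ψ t 1 0) ^ 2) = r := by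
      rw [e1, e3, Real.sqrt_eq_iff_eq_sq (by positivity) hr.le]
      linear_combination r ^ 2 * Real.sin_sq_add_cos_sq (θ t)
    rw [rho, e4, e1, e3, rotMat]
    ext i j
    fin_cases i <;> fin_cases j <;> simp <;> field_simp
  · rw [Matrix.trace_fin_two]
    by_contra hh
    push Not at hh
    set τ := ψ T 0 0 + ψ T 1 1 with hτ
    have hd := hψ1 T mT
    have hdisc : 0 ≤ τ ^ 2 - 4 := by nlinarith
    set lam := (τ + Real.sqrt (τ ^ 2 - 4)) / 2 with hlam
    have hl : lam ^ 2 - τ * lam + 1 = 0 := by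
      rw [hlam]
      linear_combination Real.sq_sqrt hdisc / 4
    have hl0 : 0 < lam := by
      rw [hlam]
      linarith [Real.sqrt_nonneg (τ ^ 2 - 4)]
    obtain ⟨ξ, η, hz, h1, h2⟩ : ∃ ξ η : ℝ, (ξ ≠ 0 ∨ η ≠ 0) ∧
        ψ T 0 0 * ξ + ψ T 0 1 * η = lam * ξ ∧ ψ T 1 0 * ξ + ψ T 1 1 * η = lam * η := by
      by_cases hb : ψ T 0 1 = 0 ∧ lam - ψ T 0 0 = 0
      · by_cases hc : lam - ψ T 1 1 = 0
        · exact (em (ψ T 1 0 = 0)).elim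
            (fun hc' => ⟨1, 0, Or.inl one_ne_zero, by linear_combination -hb.2,
              by linear_combination hc'⟩)
            (fun hc' => ⟨0, 1, Or.inr one_ne_zero, by linear_combination hb.1,
              by linear_combination -hc⟩)
        · exact ⟨lam - ψ T 1 1, ψ T 1 0, Or.inl hc, by
            linear_combination -(lam - ψ T 1 1) * hb.2 + ψ T 1 0 * hb.1, by ring⟩
      · refine ⟨ψ T 0 1, lam - ψ T 0 0, ?_, by ring, ?_⟩
        · by_contra hh'
          push Not at hh'
          exact hb hh'
        · rw [hτ] at hl
          linear_combination -hl - hd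
    obtain ⟨φ', hφ', hk⟩ := h ξ η hz
    refine hφ'.turn_ne_of_eq_smul hT hl0 ?_ ?_ k hk
    · rw [h1, h2, hDT, hD0, hCT, p00, p01]
      ring
    · rw [h1, h2, hAT, hA0, hKT, p10, p11]
      ring
  · rw [abs_lt]
    push_cast
    have e : θ T / Real.pi - (2 * k + 1) = (θ T - (2 * k + 1) * Real.pi) / Real.pi := by
      field_simp
    rw [e, lt_div_iff₀ hπ, div_lt_iff₀ hπ]
    constructor <;> linarith

end LCHill

namespace LCHill

lemma obsP_phasePt {μ x y p l : ℝ} (h : x ^ 2 + y ^ 2 ≠ 0) : obsP μ (phasePt μ x y p l) = p := by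
  simp only [obsP, phasePt, cons_val]
  field_simp
  ring

lemma obsL_phasePt {μ x y p l : ℝ} (h : x ^ 2 + y ^ 2 ≠ 0) : obsL μ (phasePt μ x y p l) = l := by
  simp only [obsL, phasePt, cons_val]
  field_simp
  ring

namespace IsRedOrbit

variable {μ c s : ℝ} {r p : ℝ → ℝ} (O : IsRedOrbit μ c s r p) (hs : s = 1 ∨ s = -1)
include O hs

lemma obsR_liftPt (θ : ℝ) : obsR (liftPt μ c s r p θ) = r θ := (O.lift_rho hs θ).symm

lemma obsP_liftPt (θ : ℝ) : obsP μ (liftPt μ c s r p θ) = p θ :=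
  obsP_phasePt fun h => (O.pos θ).ne' (by rw [O.lift_rho hs θ, h, mul_zero])

lemma obsL_liftPt (θ : ℝ) :
    obsL μ (liftPt μ c s r p θ) = s * ang μ c (r θ) (p θ) (Real.cos θ) :=
  obsL_phasePt fun h => (O.pos θ).ne' (by rw [O.lift_rho hs θ, h, mul_zero])

lemma obsC_liftPt (θ : ℝ) : obsC (liftPt μ c s r p θ) = Real.cos θ := by
  rw [obsC, O.obsR_liftPt hs, div_eq_iff (O.pos θ).ne', mul_comm _ (r θ), O.lift_cos hs θ]
  rfl

variable {Θ : ℝ → ℝ} {T : ℝ} (Z : IsClock μ c r p Θ T)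


include Z in
lemma isVariation {v : ℝ → V4} (hv : ∀ t, HasDerivAt v
    (fderiv ℝ (symplGrad (Kham μ c)) (liftPt μ c s r p (Θ t)) (v t)) t) :
    IsVariation μ c (fun t => liftPt μ c s r p (Θ t)) v where
  orbit := O.isOrbit Z hs
  ne_zero t := by rw [O.obsR_liftPt hs]; exact (O.pos _).ne'
  energy t := O.Kham_liftPt hs _
  deriv := hv

/-- The linearized reduced system, in terms of the transverse coordinates. -/
lemma hasDerivAt_tr_lift {v : ℝ → V4} (V : IsVariation μ c (fun t => liftPt μ c s r p (Θ t)) v)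
    (h0 : fderiv ℝ (Kham μ c) (liftPt μ c s r p (Θ 0)) (v 0) = 0) (t : ℝ) :
    HasDerivAt (fun t => trR μ c s (liftPt μ c s r p (Θ t)) (v t))
      (4 * ang μ c (r (Θ t)) (p (Θ t)) (Real.cos (Θ t)) / r (Θ t)
      * (jac11 μ c (r (Θ t)) (p (Θ t)) (Real.cos (Θ t)) * trR μ c s (liftPt μ c s r p (Θ t)) (v t)
        + jac12 μ c (r (Θ t)) (p (Θ t)) (Real.cos (Θ t))
          * trP μ c s (liftPt μ c s r p (Θ t)) (v t))) t ∧
    HasDerivAt (fun t => trP μ c s (liftPt μ c s r p (Θ t)) (v t))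
      (4 * ang μ c (r (Θ t)) (p (Θ t)) (Real.cos (Θ t)) / r (Θ t)
      * (jac21 μ c s (r (Θ t)) (p (Θ t)) (Real.cos (Θ t)) / r (Θ t)
          * trR μ c s (liftPt μ c s r p (Θ t)) (v t)
        + jac22 μ c (r (Θ t)) (p (Θ t)) (Real.cos (Θ t))
          * trP μ c s (liftPt μ c s r p (Θ t)) (v t))) t := by
  have h := V.hasDerivAt_tr (l := fun t => ang μ c (r (Θ t)) (p (Θ t)) (Real.cos (Θ t)))
    (t := t) hs
    (fun t => (V.fderiv_Kham_eq t).trans h0)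
    (fun t => by rw [O.obsR_liftPt hs, O.obsP_liftPt hs, O.obsC_liftPt hs])
    (fun t => by rw [O.obsR_liftPt hs, O.obsP_liftPt hs, O.obsC_liftPt hs]; exact O.ang_pos _)
    (fun t => O.obsL_liftPt hs _)
  simpa only [O.obsR_liftPt hs, O.obsP_liftPt hs, O.obsC_liftPt hs] using h

/-- The symplectic form in transverse coordinates along the orbit. -/
lemma trP_mul_trR_lift {v w : V4} (t : ℝ)
    (hv : fderiv ℝ (Kham μ c) (liftPt μ c s r p (Θ t)) v = 0)
    (hw : fderiv ℝ (Kham μ c) (liftPt μ c s r p (Θ t)) w = 0) :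
    trP μ c s (liftPt μ c s r p (Θ t)) v * trR μ c s (liftPt μ c s r p (Θ t)) w
      - trP μ c s (liftPt μ c s r p (Θ t)) w * trR μ c s (liftPt μ c s r p (Θ t)) v
      = 2 * r (Θ t) * sympl v w := by
  have hx := O.liftPt_mem hs (Θ t)
  rw [fderiv_Kham μ c hx] at hv hw
  rw [trP_mul_trR_sub hx (by rw [O.obsR_liftPt hs]; exact (O.pos _).ne') (O.Kham_liftPt hs _) hs
    (O.ang_gt (Θ t)).ne' (O.obsL_liftPt hs _)
    (by rw [O.obsR_liftPt hs, O.obsP_liftPt hs, O.obsC_liftPt hs]; rfl) hv hw, O.obsR_liftPt hs]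

end IsRedOrbit

end LCHill

namespace LCHill

namespace IsRedOrbit

variable {μ c s : ℝ} {r p : ℝ → ℝ} (O : IsRedOrbit μ c s r p)
include O

lemma continuous_r : Continuous r := continuous_iff_continuousAt.2 fun θ => (O.deriv_r θ).continuousAt

lemma continuous_p : Continuous p := continuous_iff_continuousAt.2 fun θ => (O.deriv_p θ).continuousAt

lemma continuous_ang : Continuous fun θ => ang μ c (r θ) (p θ) (Real.cos θ) :=
  continuous_iff_continuousAt.2 fun θ => (O.hasDerivAt_ang θ).continuousAt

lemma continuous_jac :
    (Continuous fun θ => jac11 μ c (r θ) (p θ) (Real.cos θ)) ∧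
    (Continuous fun θ => jac12 μ c (r θ) (p θ) (Real.cos θ)) ∧
    (Continuous fun θ => jac21 μ c s (r θ) (p θ) (Real.cos θ)) ∧
    Continuous fun θ => jac22 μ c (r θ) (p θ) (Real.cos θ) := by
  have hr := O.continuous_r
  have hp := O.continuous_p
  have hG : Continuous fun θ => invDist (r θ) (Real.cos θ) :=
    continuous_iff_continuousAt.2 fun θ =>
      (hasDerivAt_invDist (O.deriv_r θ) (Real.hasDerivAt_cos θ) (O.dist_pos θ)).continuousAt
  have hL : Continuous fun θ => invAng μ c (r θ) (p θ) (Real.cos θ) :=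
    O.continuous_ang.inv₀ fun θ => (O.ang_gt θ).ne'
  have hE : Continuous fun θ => angSqE μ c (r θ) (Real.cos θ) := by
    unfold angSqE; fun_prop
  have hQ : Continuous fun θ => angSqQ μ (r θ) (Real.cos θ) := by
    unfold angSqQ; fun_prop
  unfold jac11 jac12 jac21 jac22 redP
  refine ⟨?_, ?_, ?_, ?_⟩ <;> fun_prop

end IsRedOrbit

end LCHill

namespace LCHill

lemma abs_sub_le_of_rate {β ω Θ b o κ : ℝ → ℝ} {R T : ℝ} (hT : 0 ≤ T)
    (hβ : ∀ t ∈ Icc 0 T, HasDerivAt β (b t) t) (hω : ∀ t ∈ Icc 0 T, HasDerivAt ω (o t) t)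
    (hΘ : ∀ t ∈ Icc 0 T, HasDerivAt Θ (κ t) t) (hb : ∀ t ∈ Icc 0 T, |b t - o t| ≤ R * κ t) :
    |β T - β 0 - (ω T - ω 0)| ≤ R * (Θ T - Θ 0) := by
  have key : ∀ f f' : ℝ → ℝ, (∀ t ∈ Icc 0 T, HasDerivAt f (f' t) t) → (∀ t ∈ Icc 0 T, 0 ≤ f' t) →
      f 0 ≤ f T := fun f f' hf hf' => by
    refine monotoneOn_of_hasDerivWithinAt_nonneg (f' := f') (convex_Icc 0 T)
      (fun t ht => (hf t ht).continuousAt.continuousWithinAt)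
      (fun t ht => (hf t (interior_subset ht)).hasDerivWithinAt)
      (fun t ht => hf' t (interior_subset ht)) ⟨le_rfl, hT⟩ ⟨hT, le_rfl⟩ hT
  have h1 := key (fun t => β t - ω t + R * Θ t) (fun t => b t - o t + R * κ t)
    (fun t ht => ((hβ t ht).sub (hω t ht)).add ((hΘ t ht).const_mul R))
    fun t ht => by linarith [(abs_le.1 (hb t ht)).1]
  have h2 := key (fun t => R * Θ t - (β t - ω t)) (fun t => R * κ t - (b t - o t))
    (fun t ht => ((hΘ t ht).const_mul R).sub ((hβ t ht).sub (hω t ht)))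
    fun t ht => by linarith [(abs_le.1 (hb t ht)).2]
  rw [abs_le]
  constructor <;> linarith

namespace RefData.Valid

variable {D : RefData} {μ c s : ℝ} {k : ℕ} {A B₁ B₂ ε W r₀ σ m R : ℝ} {r p Θ a b : ℝ → ℝ} {T : ℝ}

/-- Solutions of the linearized reduced system rotate by an angle in `(2 k π, 2 (k + 1) π)`. -/
lemma turnsIn (Z : D.Valid μ c s k A B₁ B₂ ε W r₀ σ m R) (hs : s = 1 ∨ s = -1)
    (O : IsRedOrbit μ c s r p)
    (tube : ∀ θ, ∃ x y, |x| ≤ 1 ∧ |y| ≤ 1 ∧ r θ = D.rad θ x ∧ p θ = D.mom θ x y)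
    (Zc : IsClock μ c r p Θ T)
    (ha : ∀ t, HasDerivAt a (4 * ang μ c (r (Θ t)) (p (Θ t)) (Real.cos (Θ t)) / r (Θ t)
      * (jac11 μ c (r (Θ t)) (p (Θ t)) (Real.cos (Θ t)) * a t
        + jac12 μ c (r (Θ t)) (p (Θ t)) (Real.cos (Θ t)) * b t)) t)
    (hb : ∀ t, HasDerivAt b (4 * ang μ c (r (Θ t)) (p (Θ t)) (Real.cos (Θ t)) / r (Θ t)
      * (jac21 μ c s (r (Θ t)) (p (Θ t)) (Real.cos (Θ t)) / r (Θ t) * a t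
        + jac22 μ c (r (Θ t)) (p (Θ t)) (Real.cos (Θ t)) * b t)) t)
    (hne : ∀ t, a t ≠ 0 ∨ b t ≠ 0) :
    TurnsIn T k (fun t => -(s * ((b t - D.be (Θ t) * (a t / D.al (Θ t))) / D.ka (Θ t))))
      fun t => -(s * (a t / D.al (Θ t))) := by
  set κ : ℝ → ℝ := fun t => 4 * ang μ c (r (Θ t)) (p (Θ t)) (Real.cos (Θ t)) / r (Θ t) with hκ
  set u : ℝ → ℝ := fun t => a t / D.al (Θ t) with hu
  set w : ℝ → ℝ := fun t => (b t - D.be (Θ t) * (a t / D.al (Θ t))) / D.ka (Θ t) with hw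
  have hal : ∀ t, D.al (Θ t) ≠ 0 := fun t => (Z.al_pos _).ne'
  have hka : ∀ t, D.ka (Θ t) ≠ 0 := fun t => (Z.ka_pos _).ne'
  have hκ0 : ∀ t, 0 < κ t := fun t => div_pos (by have := O.ang_gt (Θ t); positivity) (O.pos _)
  have hΘc : Continuous Θ := continuous_iff_continuousAt.2 fun t => (Zc.deriv t).continuousAt
  have dal := fun t => (Z.al.hasDerivAt (Θ t)).comp t (Zc.deriv t)
  have dbe := fun t => (Z.be.hasDerivAt (Θ t)).comp t (Zc.deriv t)
  have dka := fun t => (Z.ka.hasDerivAt (Θ t)).comp t (Zc.deriv t)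
  set u' : ℝ → ℝ := fun t => κ t * (((jac11 μ c (r (Θ t)) (p (Θ t)) (Real.cos (Θ t)) * D.al (Θ t)
    + jac12 μ c (r (Θ t)) (p (Θ t)) (Real.cos (Θ t)) * D.be (Θ t) - D.al' (Θ t)) / D.al (Θ t)) * u t
    + jac12 μ c (r (Θ t)) (p (Θ t)) (Real.cos (Θ t)) * D.ka (Θ t) / D.al (Θ t) * w t) with hu'
  set w' : ℝ → ℝ := fun t => κ t * ((jac21 μ c s (r (Θ t)) (p (Θ t)) (Real.cos (Θ t)) / r (Θ t)
      * D.al (Θ t) + jac22 μ c (r (Θ t)) (p (Θ t)) (Real.cos (Θ t)) * D.be (Θ t)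
      - D.be' (Θ t)) / D.ka (Θ t) * u t
      + (jac22 μ c (r (Θ t)) (p (Θ t)) (Real.cos (Θ t)) * D.ka (Θ t) - D.ka' (Θ t))
        / D.ka (Θ t) * w t) - D.be (Θ t) / D.ka (Θ t) * u' t with hw'
  have du : ∀ t, HasDerivAt u (u' t) t := fun t => by
    refine ((ha t).div (dal t) (hal t)).congr_deriv ?_
    have h1 := hal t
    have h2 := hka t
    have h3 := (O.pos (Θ t)).ne'
    simp only [Function.comp_apply, hu', hu, hw, hκ]
    generalize ang μ c _ _ _ = l at *
    field_simp
    ring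
  have dw : ∀ t, HasDerivAt w (w' t) t := fun t => by
    refine (((hb t).sub ((dbe t).mul (du t))).div (dka t) (hka t)).congr_deriv ?_
    have h1 := hal t
    have h2 := hka t
    have h3 := (O.pos (Θ t)).ne'
    simp only [Function.comp_apply, hw', hu, hw, hκ, Pi.sub_apply, Pi.mul_apply]
    generalize ang μ c _ _ _ = l at *
    generalize u' t = q
    field_simp
    ring
  have cu : Continuous u := continuous_iff_continuousAt.2 fun t => (du t).continuousAt
  have cw : Continuous w := continuous_iff_continuousAt.2 fun t => (dw t).continuousAt
  obtain ⟨j1, j2, j3, j4⟩ := O.continuous_jac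
  have hr := O.continuous_r
  have hg := O.continuous_ang
  have hl1 := Z.al.continuous
  have hl2 := Z.be.continuous
  have hl3 := Z.ka.continuous
  have hl4 := Z.al.continuous_deriv
  have hl5 := Z.be.continuous_deriv
  have hl6 := Z.ka.continuous_deriv
  have cκ : Continuous κ := (continuous_const.mul (hg.comp hΘc)).div (hr.comp hΘc)
    fun t => (O.pos _).ne'
  have cu' : Continuous u' := cκ.mul (((((((j1.mul hl1).add (j2.mul hl2)).sub hl4).div hl1
    fun t => (Z.al_pos t).ne').comp hΘc).mul cu).add ((((j2.mul hl3).div hl1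
    fun t => (Z.al_pos t).ne').comp hΘc).mul cw))
  have cw' : Continuous w' := (cκ.mul ((((((((j3.div hr fun t => (O.pos t).ne').mul hl1).add
    (j4.mul hl2)).sub hl5).div hl3 fun t => (Z.ka_pos t).ne').comp hΘc).mul cu).add
    (((((j4.mul hl3).sub hl6).div hl3 fun t => (Z.ka_pos t).ne').comp hΘc).mul cw))).sub
    (((hl2.div hl3 fun t => (Z.ka_pos t).ne').comp hΘc).mul cu')
  have hne' : ∀ t, 0 < w t ^ 2 + u t ^ 2 := fun t => by
    by_contra h
    have e1 : u t = 0 := by nlinarith [sq_nonneg (w t), sq_nonneg (u t)]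
    have e2 : w t = 0 := by nlinarith [sq_nonneg (w t), sq_nonneg (u t)]
    have e3 : a t = 0 := by simpa [hu, hal t] using e1
    have e4 : b t = 0 := by simpa [hw, hka t, e3] using e2
    rcases hne t with h | h
    exacts [h e3, h e4]
  have hrate : ∀ t, |(w t * u' t - u t * w' t) / (w t ^ 2 + u t ^ 2) - κ t * D.om (Θ t)|
      ≤ R * κ t := fun t => by
    obtain ⟨x, y, hx, hy, er, ep⟩ := tube (Θ t)
    have G := Z.good (Θ t) x y hx hy
    have hN : 0 < √(u t ^ 2 + w t ^ 2) := Real.sqrt_pos.2 (by linarith [hne' t])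
    have h := LCHill.abs_rate_sub_le (x := u t) (y := w t) (ε := 0) (d₁ := 0) (d₂ := 0) (R := R)
      G.abs_lin₁₁ G.abs_lin₁₂ G.abs_lin₂₁ G.abs_lin₂₂ le_rfl (by norm_num) hN
      (Real.sq_sqrt (by linarith [hne' t])).le
      (by have := div_pos Z.ε_pos Z.m_pos; rw [zero_div]; linarith [Z.rate₁])
      (by have := div_pos Z.ε_pos Z.m_pos; rw [zero_div]; linarith [Z.rate₂])
    have e1 : u' t = κ t * (0 + (D.lin₁₁ μ c (Θ t) x y * u t + D.lin₁₂ μ c (Θ t) x y * w t)) := by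
      rw [zero_add, lin₁₁, lin₁₂, ← er, ← ep]
    have e2 : w' t = κ t * (0 + (D.lin₂₁ μ c s (Θ t) x y * u t + D.lin₂₂ μ c (Θ t) x y * w t)) := by
      have h2 := hka t
      simp only [zero_add, hw', e1, lin₂₁, lin₂₂]
      rw [← er, ← ep]
      field_simp
      ring
    rw [e1, e2, show ∀ q₁ q₂ q₃ q₄ : ℝ, (q₁ * (κ t * q₂) - q₃ * (κ t * q₄)) / (w t ^ 2 + u t ^ 2)
      - κ t * D.om (Θ t) = κ t * ((q₁ * q₂ - q₃ * q₄) / (w t ^ 2 + u t ^ 2) - D.om (Θ t)) from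
      fun q₁ q₂ q₃ q₄ => by ring, abs_mul, abs_of_pos (hκ0 t), mul_comm]
    exact mul_le_mul_of_nonneg_right h (hκ0 t).le
  obtain ⟨b₀, e1, e2⟩ := exists_polar (w 0) (u 0)
  obtain ⟨β, hβ0, hβ, hβ'⟩ := exists_polar_lift Zc.period_pos.le (fun t _ => dw t) (fun t _ => du t)
    cw'.continuousOn cu'.continuousOn (fun t _ => hne' t) e1 e2
  have h1 := abs_sub_le_of_rate (ω := fun t => D.Om (Θ t)) Zc.period_pos.le hβ
    (fun t _ => ((Z.Om (Θ t)).comp t (Zc.deriv t)).congr_deriv (mul_comm _ _))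
    (fun t _ => Zc.deriv t) (fun t _ => hrate t)
  have hT : Θ T = 4 * Real.pi := by simpa [Zc.zero] using Zc.period 0
  have hπ := Real.pi_pos
  simp only [hT, Zc.zero, Z.Om_four_pi, sub_zero] at h1
  rw [abs_le] at h1
  refine ⟨fun t => β t + (1 + s) / 2 * Real.pi, ⟨fun t ht => ?_, fun t ht => ?_⟩, ?_, ?_⟩
  · exact ((hβ t ht).add_const _).continuousAt.continuousWithinAt
  · refine ⟨_, Real.sqrt_pos.2 (hne' t), ?_⟩
    obtain ⟨q1, q2⟩ := hβ' t ht
    generalize √(w t ^ 2 + u t ^ 2) = n at *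
    simp only [hw, hu] at q1 q2 ⊢
    rcases hs with rfl | rfl
    · rw [show ((1 : ℝ) + 1) / 2 * Real.pi = Real.pi by ring, Real.cos_add_pi, Real.sin_add_pi]
      constructor <;> linarith
    · rw [show ((1 : ℝ) + -1) / 2 * Real.pi = 0 by ring, add_zero]
      constructor <;> linarith
  · simp only
    nlinarith [Z.rot_lower]
  · simp only
    nlinarith [Z.rot_upper]

end RefData.Valid

end LCHill

namespace LCHill

/-- The vector `I ∇K`. -/
def frameX (g : V4) : V4 := ![g 2, g 3, -g 0, -g 1]

lemma sq_smul_eq_frame (g v : V4) : (g ⬝ᵥ g) • v = (g ⬝ᵥ v) • g + (frameX g ⬝ᵥ v) • frameX g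
    + (frameU g ⬝ᵥ v) • frameU g + (frameV g ⬝ᵥ v) • frameV g := by
  ext i
  fin_cases i <;>
  · simp [frameX, frameU, frameV, dotProduct, Fin.sum_univ_four, vecHead, vecTail]
    ring

lemma dotProduct_frameU (g : V4) : g ⬝ᵥ frameU g = 0 := by
  simp [frameU, dotProduct, Fin.sum_univ_four]
  ring

lemma dotProduct_frameV (g : V4) : g ⬝ᵥ frameV g = 0 := by
  simp [frameV, dotProduct, Fin.sum_univ_four]
  ring

lemma frameU_dotProduct (g v : V4) : frameU g ⬝ᵥ v = -sympl (frameV g) v := by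
  simp [frameU, frameV, sympl, dotProduct, Fin.sum_univ_four]
  ring

lemma frameV_dotProduct (g v : V4) : frameV g ⬝ᵥ v = sympl (frameU g) v := by
  simp [frameU, frameV, sympl, dotProduct, Fin.sum_univ_four]
  ring

lemma sympl_frameU_frameV (g : V4) : sympl (frameU g) (frameV g) = g ⬝ᵥ g := by
  rw [← frameV_dotProduct]
  simp [frameV, dotProduct, Fin.sum_univ_four]
  ring

lemma sympl_frameX (g v : V4) : sympl (frameX g) v = -(g ⬝ᵥ v) := by
  simp [frameX, sympl, dotProduct, Fin.sum_univ_four]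
  ring

lemma sympl_self (v : V4) : sympl v v = 0 := by
  simp only [sympl]
  ring

lemma sympl_comm (v w : V4) : sympl v w = -sympl w v := by
  simp only [sympl]
  ring

lemma sympl_add_left (u v w : V4) : sympl (u + v) w = sympl u w + sympl v w := by
  simp only [sympl, Pi.add_apply]
  ring

lemma sympl_smul_left (a : ℝ) (v w : V4) : sympl (a • v) w = a * sympl v w := by
  simp only [sympl, Pi.smul_apply, smul_eq_mul]
  ring

lemma sq_mul_sympl (g v w : V4) (hv : g ⬝ᵥ v = 0) (hw : g ⬝ᵥ w = 0) :
    sympl v w * (g ⬝ᵥ g) = (frameU g ⬝ᵥ v) * (frameV g ⬝ᵥ w) - (frameV g ⬝ᵥ v) * (frameU g ⬝ᵥ w) := by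
  have h := sympl_smul_left (g ⬝ᵥ g) v w
  rw [sq_smul_eq_frame, hv, zero_smul, zero_add, sympl_add_left, sympl_add_left, sympl_smul_left,
    sympl_smul_left, sympl_smul_left, sympl_frameX, hw] at h
  rw [frameV_dotProduct g w, frameU_dotProduct g w]
  linarith

lemma gradient4_dotProduct_self (g : V4) : enorm4 g ^ 2 = g ⬝ᵥ g := by
  rw [enorm4, Real.sq_sqrt (by positivity)]
  simp [dotProduct, Fin.sum_univ_four]
  ring

variable {H : V4 → ℝ} {γ : ℝ → V4} {M : ℝ → Matrix (Fin 4) (Fin 4) ℝ}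

/-- The unit frame vectors. -/
def frameCol (H : V4 → ℝ) (x : V4) (j : Fin 2) : V4 := fun i => frameF H x i j

lemma frameCol_zero (x : V4) :
    frameCol H x 0 = (enorm4 (gradient4 H x))⁻¹ • frameU (gradient4 H x) := by
  ext i
  fin_cases i <;>
  · simp [frameCol, frameF, J4, frameU, mulVec, dotProduct, Fin.sum_univ_four]
    try ring

lemma frameCol_one (x : V4) :
    frameCol H x 1 = (enorm4 (gradient4 H x))⁻¹ • frameV (gradient4 H x) := by
  ext i
  fin_cases i <;>
  · simp [frameCol, frameF, K4, frameV, mulVec, dotProduct, Fin.sum_univ_four]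
    try ring

lemma reducedMonodromy_zero (t : ℝ) (j : Fin 2) : reducedMonodromy H γ M t 0 j
    = -sympl (frameCol H (γ t) 1) (M t *ᵥ frameCol H (γ 0) j) := by
  rw [reducedMonodromy, Matrix.mul_assoc (Omega2ᵀ * (frameF H (γ t))ᵀ * Omega4), Matrix.mul_apply]
  have e : ∀ i, (M t * frameF H (γ 0)) i j = (M t *ᵥ frameCol H (γ 0) j) i := fun i => rfl
  simp only [e]
  generalize M t *ᵥ frameCol H (γ 0) j = v
  simp [Fin.sum_univ_four, Matrix.mul_apply, Omega2, Omega4, I4, sympl, frameCol]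
  ring

lemma reducedMonodromy_one (t : ℝ) (j : Fin 2) : reducedMonodromy H γ M t 1 j
    = sympl (frameCol H (γ t) 0) (M t *ᵥ frameCol H (γ 0) j) := by
  rw [reducedMonodromy, Matrix.mul_assoc (Omega2ᵀ * (frameF H (γ t))ᵀ * Omega4), Matrix.mul_apply]
  have e : ∀ i, (M t * frameF H (γ 0)) i j = (M t *ᵥ frameCol H (γ 0) j) i := fun i => rfl
  simp only [e]
  generalize M t *ᵥ frameCol H (γ 0) j = v
  simp [Fin.sum_univ_four, Matrix.mul_apply, Omega2, Omega4, I4, sympl, frameCol]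
  ring

end LCHill

namespace LCHill

namespace IsRedOrbit

variable {μ c s : ℝ} {r p : ℝ → ℝ} (O : IsRedOrbit μ c s r p) (hs : s = 1 ∨ s = -1) (θ : ℝ)
include O hs

lemma obsR_liftPt_ne : obsR (liftPt μ c s r p θ) ≠ 0 := by
  rw [O.obsR_liftPt hs]
  exact (O.pos θ).ne'

lemma invAng_liftPt : invAng μ c (obsR (liftPt μ c s r p θ)) (obsP μ (liftPt μ c s r p θ))
    (obsC (liftPt μ c s r p θ)) = (ang μ c (r θ) (p θ) (Real.cos θ))⁻¹ := by
  rw [O.obsR_liftPt hs, O.obsP_liftPt hs, O.obsC_liftPt hs]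
  rfl

lemma trR_frameV_liftPt : -(s * trR μ c s (liftPt μ c s r p θ)
    (frameV (gradK μ c (liftPt μ c s r p θ)))) =
      4 * (ang μ c (r θ) (p θ) (Real.cos θ) ^ 2 + p θ ^ 2) / ang μ c (r θ) (p θ) (Real.cos θ) := by
  rw [trR_frameV (O.liftPt_mem hs θ) (O.obsR_liftPt_ne hs θ) hs (O.ang_gt θ).ne'
    (O.obsL_liftPt hs θ) (O.invAng_liftPt hs θ), O.obsP_liftPt hs]
  rcases hs with rfl | rfl <;> ring

lemma trR_frameV_liftPt_pos : 0 < -(s * trR μ c s (liftPt μ c s r p θ)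
    (frameV (gradK μ c (liftPt μ c s r p θ)))) := by
  rw [O.trR_frameV_liftPt hs]
  have := O.ang_gt θ
  positivity

lemma enorm4_gradK_pos : 0 < enorm4 (gradK μ c (liftPt μ c s r p θ)) := by
  refine (Real.sqrt_nonneg _).lt_of_ne' fun h => ?_
  have h1 := gradient4_dotProduct_self (gradK μ c (liftPt μ c s r p θ))
  have h2 := O.trR_frameV_liftPt_pos hs θ
  rw [show enorm4 _ = 0 from h, zero_pow two_ne_zero, eq_comm, dotProduct_self_eq_zero] at h1
  rw [h1] at h2
  simp [frameV, trR, difR, difA] at h2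

lemma gradient4_liftPt : gradient4 (Kham μ c) (liftPt μ c s r p θ)
    = gradK μ c (liftPt μ c s r p θ) := gradient4_Kham μ c (O.liftPt_mem hs θ)

lemma fderiv_frameCol (j : Fin 2) : fderiv ℝ (Kham μ c) (liftPt μ c s r p θ)
    (frameCol (Kham μ c) (liftPt μ c s r p θ) j) = 0 := by
  rw [fderiv_Kham μ c (O.liftPt_mem hs θ)]
  fin_cases j
  · simp only [Fin.zero_eta, frameCol_zero, O.gradient4_liftPt hs, dotProduct_smul,
      dotProduct_frameU, smul_zero]
  · simp only [Fin.mk_one, frameCol_one, O.gradient4_liftPt hs, dotProduct_smul,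
      dotProduct_frameV, smul_zero]

lemma sympl_frameCol : sympl (frameCol (Kham μ c) (liftPt μ c s r p θ) 0)
    (frameCol (Kham μ c) (liftPt μ c s r p θ) 1) = 1 := by
  have h := O.enorm4_gradK_pos hs θ
  rw [frameCol_zero, frameCol_one, O.gradient4_liftPt hs, sympl_smul_left, sympl_comm,
    sympl_smul_left, sympl_comm, sympl_frameU_frameV, ← gradient4_dotProduct_self]
  field_simp

lemma eq_frame {v : V4} (hv : fderiv ℝ (Kham μ c) (liftPt μ c s r p θ) v = 0) :
    ∃ a : ℝ, v = a • symplGrad (Kham μ c) (liftPt μ c s r p θ)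
      + -sympl (frameCol (Kham μ c) (liftPt μ c s r p θ) 1) v
        • frameCol (Kham μ c) (liftPt μ c s r p θ) 0
      + sympl (frameCol (Kham μ c) (liftPt μ c s r p θ) 0) v
        • frameCol (Kham μ c) (liftPt μ c s r p θ) 1 := by
  have h := O.enorm4_gradK_pos hs θ
  have hx := O.liftPt_mem hs θ
  rw [fderiv_Kham μ c hx] at hv
  have e := sq_smul_eq_frame (gradK μ c (liftPt μ c s r p θ)) v
  rw [hv, ← gradient4_dotProduct_self, zero_smul, zero_add, frameU_dotProduct,
    frameV_dotProduct] at e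
  rw [frameCol_zero, frameCol_one, O.gradient4_liftPt hs, symplGrad_Kham μ c hx]
  refine ⟨(frameX (gradK μ c (liftPt μ c s r p θ)) ⬝ᵥ v)
    / enorm4 (gradK μ c (liftPt μ c s r p θ)) ^ 2, ?_⟩
  rw [sympl_smul_left, sympl_smul_left]
  change v = _ • frameX _ + _ + _
  generalize enorm4 _ = n at *
  generalize frameX _ ⬝ᵥ v = q at *
  generalize sympl _ v = q₁ at *
  generalize sympl _ v = q₂ at *
  ext i
  have e := congrFun e i
  simp only [Pi.add_apply, Pi.smul_apply, smul_eq_mul] at e ⊢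
  field_simp
  linarith

lemma tr_eq_frame {v : V4} (hv : fderiv ℝ (Kham μ c) (liftPt μ c s r p θ) v = 0) :
    trR μ c s (liftPt μ c s r p θ) v
      = -sympl (frameCol (Kham μ c) (liftPt μ c s r p θ) 1) v
        * trR μ c s (liftPt μ c s r p θ) (frameCol (Kham μ c) (liftPt μ c s r p θ) 0)
      + sympl (frameCol (Kham μ c) (liftPt μ c s r p θ) 0) v
        * trR μ c s (liftPt μ c s r p θ) (frameCol (Kham μ c) (liftPt μ c s r p θ) 1) ∧
    trP μ c s (liftPt μ c s r p θ) v
      = -sympl (frameCol (Kham μ c) (liftPt μ c s r p θ) 1) v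
        * trP μ c s (liftPt μ c s r p θ) (frameCol (Kham μ c) (liftPt μ c s r p θ) 0)
      + sympl (frameCol (Kham μ c) (liftPt μ c s r p θ) 0) v
        * trP μ c s (liftPt μ c s r p θ) (frameCol (Kham μ c) (liftPt μ c s r p θ) 1) := by
  obtain ⟨a, e⟩ := O.eq_frame hs θ hv
  have hx := O.liftPt_mem hs θ
  have h0 := O.obsR_liftPt_ne hs θ
  have hl := (O.ang_gt θ).ne'
  have hL := O.obsL_liftPt hs θ
  have hi := O.invAng_liftPt hs θ
  have h1 := trR_symplGrad hx h0 hs hl hL hi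
  have h2 := trP_symplGrad hx h0 (O.Kham_liftPt hs θ) hs hl hL hi
  constructor
  · conv_lhs => rw [e, trR_add, trR_add, trR_smul, trR_smul, trR_smul, h1]
    ring
  · conv_lhs => rw [e, trP_add, trP_add, trP_smul, trP_smul, trP_smul, h2]
    ring

lemma sympl_eq_det {v w : V4} (hv : fderiv ℝ (Kham μ c) (liftPt μ c s r p θ) v = 0)
    (hw : fderiv ℝ (Kham μ c) (liftPt μ c s r p θ) w = 0) :
    sympl v w = -sympl (frameCol (Kham μ c) (liftPt μ c s r p θ) 1) v
        * sympl (frameCol (Kham μ c) (liftPt μ c s r p θ) 0) w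
      - -sympl (frameCol (Kham μ c) (liftPt μ c s r p θ) 1) w
        * sympl (frameCol (Kham μ c) (liftPt μ c s r p θ) 0) v := by
  have h := O.enorm4_gradK_pos hs θ
  rw [fderiv_Kham μ c (O.liftPt_mem hs θ)] at hv hw
  have e := sq_mul_sympl _ v w hv hw
  rw [frameU_dotProduct, frameU_dotProduct, frameV_dotProduct, frameV_dotProduct,
    ← gradient4_dotProduct_self] at e
  rw [frameCol_zero, frameCol_one, O.gradient4_liftPt hs, sympl_smul_left, sympl_smul_left,
    sympl_smul_left, sympl_smul_left]
  generalize enorm4 _ = n at *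
  field_simp
  linarith

end IsRedOrbit

end LCHill

namespace LCHill

namespace IsRedOrbit

variable {μ c s : ℝ} {r p Θ : ℝ → ℝ} {T : ℝ}

section

variable (O : IsRedOrbit μ c s r p) (hs : s = 1 ∨ s = -1) (Z : IsClock μ c r p Θ T)
include O hs Z

lemma continuous_lift : Continuous fun t => liftPt μ c s r p (Θ t) :=
  continuous_iff_continuousAt.2 fun t => (O.isOrbit Z hs t).2.continuousAt

lemma exists_isLinearizedFlow :
    ∃ M, IsLinearizedFlow (Kham μ c) (fun t => liftPt μ c s r p (Θ t)) M := by
  have hA : Continuous fun t => fderiv ℝ (symplGrad (Kham μ c)) (liftPt μ c s r p (Θ t)) :=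
    continuous_iff_continuousAt.2 fun t =>
      ((((contDiffAt_symplGrad μ c (O.liftPt_mem hs (Θ t))).fderiv_right (m := 1)
        (by norm_num)).continuousAt).comp (f := fun t => liftPt μ c s r p (Θ t))
          (O.continuous_lift hs Z).continuousAt)
  choose α h0 h1 using fun j : Fin 4 => exists_solution_linear hA (Pi.single j (1 : ℝ))
  refine ⟨fun t => Matrix.of fun i j => α j t i, ?_, fun j t => h1 j t⟩
  ext i j
  simp [h0, Matrix.one_apply, Pi.single_apply]

lemma isVariation_mulVec {M : ℝ → Matrix (Fin 4) (Fin 4) ℝ}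
    (hM : IsLinearizedFlow (Kham μ c) (fun t => liftPt μ c s r p (Θ t)) M) (v : V4) :
    IsVariation μ c (fun t => liftPt μ c s r p (Θ t)) fun t => M t *ᵥ v := by
  refine O.isVariation hs Z fun t => ?_
  have h := HasDerivAt.fun_sum (u := Finset.univ) fun j _ => (hM.2 j t).const_smul (v j)
  have e : ∀ N : Matrix (Fin 4) (Fin 4) ℝ, N *ᵥ v = ∑ j, v j • fun i => N i j := fun N => by
    ext i
    simp [mulVec, dotProduct, mul_comm]
  simp only [e, map_sum, map_smul]
  exact h

omit O hs in
lemma continuous_clock : Continuous Θ :=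
  continuous_iff_continuousAt.2 fun t => (Z.deriv t).continuousAt

lemma continuous_tr {v : ℝ → V4} (hv : Continuous v) :
    Continuous (fun t => trR μ c s (liftPt μ c s r p (Θ t)) (v t)) ∧
    Continuous (fun t => trP μ c s (liftPt μ c s r p (Θ t)) (v t)) := by
  have hΘ := continuous_clock Z
  have hx : ∀ i, Continuous fun t => liftPt μ c s r p (Θ t) i :=
    fun i => (continuous_apply i).comp (O.continuous_lift hs Z)
  have hv : ∀ i, Continuous fun t => v t i := fun i => (continuous_apply i).comp hv
  have hr := O.continuous_r
  have hp := O.continuous_p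
  have hG : Continuous fun θ => invDist (r θ) (Real.cos θ) :=
    continuous_iff_continuousAt.2 fun θ =>
      (hasDerivAt_invDist (O.deriv_r θ) (Real.hasDerivAt_cos θ) (O.dist_pos θ)).continuousAt
  have hL : Continuous fun θ => invAng μ c (r θ) (p θ) (Real.cos θ) :=
    O.continuous_ang.inv₀ fun θ => (O.ang_gt θ).ne'
  have hE : Continuous fun θ => angSqE μ c (r θ) (Real.cos θ) := by
    unfold angSqE; fun_prop
  have hR : Continuous fun θ => redR μ c (r θ) (p θ) (Real.cos θ) := by
    unfold redR; fun_prop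
  have hP : Continuous fun θ => redP μ c s (r θ) (p θ) (Real.cos θ) := by
    unfold redP; fun_prop
  have hA : Continuous fun t => difA (liftPt μ c s r p (Θ t)) (v t) := by
    simp only [difA, O.obsR_liftPt hs]
    exact Continuous.div (by fun_prop) (hr.comp hΘ) fun t => (O.pos _).ne'
  simp only [trR, trP, O.obsR_liftPt hs, O.obsP_liftPt hs, O.obsC_liftPt hs]
  refine ⟨Continuous.sub ?_ (((hR.comp hΘ).const_mul s).mul hA),
    Continuous.sub ?_ (((hP.comp hΘ).const_mul s).mul hA)⟩
  · unfold difR; fun_prop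
  · unfold difP; fun_prop

lemma continuous_frameCol (j : Fin 2) :
    Continuous fun t => frameCol (Kham μ c) (liftPt μ c s r p (Θ t)) j := by
  have h : Continuous fun t => gradK μ c (liftPt μ c s r p (Θ t)) := by
    refine continuous_pi fun i => ?_
    simp only [← O.gradient4_liftPt hs, gradient4]
    refine Continuous.clm_apply (continuous_iff_continuousAt.2 fun t => ?_) continuous_const
    exact (((contDiffAt_Kham μ c (O.liftPt_mem hs (Θ t))).fderiv_right (m := 1)
      (by norm_num)).continuousAt).comp (f := fun t => liftPt μ c s r p (Θ t))
        (O.continuous_lift hs Z).continuousAt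
  have hi : ∀ i, Continuous fun t => gradK μ c (liftPt μ c s r p (Θ t)) i :=
    fun i => (continuous_apply i).comp h
  have hn : Continuous fun t => (enorm4 (gradK μ c (liftPt μ c s r p (Θ t))))⁻¹ := by
    refine Continuous.inv₀ ?_ fun t => (O.enorm4_gradK_pos hs _).ne'
    unfold enorm4
    fun_prop
  fin_cases j
  · simp only [Fin.zero_eta, frameCol_zero, O.gradient4_liftPt hs]
    refine hn.smul (continuous_pi fun i => ?_)
    fin_cases i
    exacts [hi 1, (hi 0).neg, (hi 3).neg, hi 2]
  · simp only [Fin.mk_one, frameCol_one, O.gradient4_liftPt hs]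
    refine hn.smul (continuous_pi fun i => ?_)
    fin_cases i
    exacts [(hi 3).neg, hi 2, (hi 1).neg, hi 0]

end

section

variable (O : IsRedOrbit μ c s r p) (hs : s = 1 ∨ s = -1)
include O hs

lemma tr_frameCol_zero :
    trR μ c s (liftPt μ c s r p 0) (frameCol (Kham μ c) (liftPt μ c s r p 0) 0) = 0 ∧
    trP μ c s (liftPt μ c s r p 0) (frameCol (Kham μ c) (liftPt μ c s r p 0) 1) = 0 := by
  have hp : p 0 = 0 := by
    have := O.odd 0
    rw [neg_zero] at this
    linarith
  have h1 : liftPt μ c s r p 0 1 = 0 := by simp [liftPt, phasePt]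
  have h2 : liftPt μ c s r p 0 2 = 0 := by simp [liftPt, phasePt, hp]
  have hP : obsP μ (liftPt μ c s r p 0) = 0 := (O.obsP_liftPt hs 0).trans hp
  have g1 : gradK μ c (liftPt μ c s r p 0) 1 = 0 := by simp [gradK, h1, h2]
  have g2 : gradK μ c (liftPt μ c s r p 0) 2 = 0 := by simp [gradK, h1, h2]
  rw [frameCol_zero, frameCol_one, O.gradient4_liftPt hs]
  constructor
  · simp [trR, redR, hP, difR, frameU, h1, g1]
  · simp [trP, difP, difA, frameV, h1, h2, g1, g2]

end

end IsRedOrbit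

end LCHill

namespace LCHill

namespace IsRedOrbit

variable {μ c s : ℝ} {r p Θ : ℝ → ℝ} {T : ℝ} (O : IsRedOrbit μ c s r p) (hs : s = 1 ∨ s = -1)
  (Z : IsClock μ c r p Θ T)
include O hs Z

lemma tr_ne_zero {v : ℝ → V4} (V : IsVariation μ c (fun t => liftPt μ c s r p (Θ t)) v)
    (h0 : fderiv ℝ (Kham μ c) (liftPt μ c s r p (Θ 0)) (v 0) = 0)
    (h : sympl (frameCol (Kham μ c) (liftPt μ c s r p (Θ 0)) 1) (v 0) ≠ 0 ∨
      sympl (frameCol (Kham μ c) (liftPt μ c s r p (Θ 0)) 0) (v 0) ≠ 0) (t : ℝ) :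
    trR μ c s (liftPt μ c s r p (Θ t)) (v t) ≠ 0 ∨
      trP μ c s (liftPt μ c s r p (Θ t)) (v t) ≠ 0 := by
  by_contra hh
  push Not at hh
  obtain ⟨M, hM⟩ := O.exists_isLinearizedFlow hs Z
  have key : ∀ j, sympl (frameCol (Kham μ c) (liftPt μ c s r p (Θ 0)) j) (v 0) = 0 := fun j => by
    have W := O.isVariation_mulVec hs Z hM (frameCol (Kham μ c) (liftPt μ c s r p (Θ 0)) j)
    have hw : fderiv ℝ (Kham μ c) (liftPt μ c s r p (Θ 0))
        (M 0 *ᵥ frameCol (Kham μ c) (liftPt μ c s r p (Θ 0)) j) = 0 := by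
      rw [hM.1, one_mulVec, O.fderiv_frameCol hs]
    have e := O.trP_mul_trR_lift hs (Θ := Θ) t ((V.fderiv_Kham_eq t).trans h0)
      ((W.fderiv_Kham_eq t).trans hw)
    rw [hh.1, hh.2, V.sympl_eq W t, hM.1, one_mulVec, sympl_comm] at e
    have hr := O.pos (Θ t)
    have : 2 * r (Θ t) * sympl (frameCol (Kham μ c) (liftPt μ c s r p (Θ 0)) j) (v 0) = 0 := by
      linarith
    simpa [hr.ne'] using this
  rcases h with h | h
  exacts [h (key 1), h (key 0)]

lemma isVariation_det {M : ℝ → Matrix (Fin 4) (Fin 4) ℝ}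
    (hM : IsLinearizedFlow (Kham μ c) (fun t => liftPt μ c s r p (Θ t)) M) (t : ℝ) :
    reducedMonodromy (Kham μ c) (fun t => liftPt μ c s r p (Θ t)) M t 0 0
      * reducedMonodromy (Kham μ c) (fun t => liftPt μ c s r p (Θ t)) M t 1 1
      - reducedMonodromy (Kham μ c) (fun t => liftPt μ c s r p (Θ t)) M t 0 1
      * reducedMonodromy (Kham μ c) (fun t => liftPt μ c s r p (Θ t)) M t 1 0 = 1 := by
  have W := fun j => O.isVariation_mulVec hs Z hM (frameCol (Kham μ c) (liftPt μ c s r p (Θ 0)) j)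
  have hw : ∀ j, fderiv ℝ (Kham μ c) (liftPt μ c s r p (Θ t))
      (M t *ᵥ frameCol (Kham μ c) (liftPt μ c s r p (Θ 0)) j) = 0 := fun j => by
    refine ((W j).fderiv_Kham_eq t).trans ?_
    rw [hM.1, one_mulVec, O.fderiv_frameCol hs]
  have e := O.sympl_eq_det hs (Θ t) (hw 0) (hw 1)
  rw [(W 0).sympl_eq (W 1) t, hM.1, one_mulVec, one_mulVec, O.sympl_frameCol hs] at e
  rw [reducedMonodromy_zero, reducedMonodromy_zero, reducedMonodromy_one, reducedMonodromy_one]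
  linarith

omit Z in
lemma reducedMonodromy_zero_eq {M : ℝ → Matrix (Fin 4) (Fin 4) ℝ}
    (hM : IsLinearizedFlow (Kham μ c) (fun t => liftPt μ c s r p (Θ t)) M) :
    reducedMonodromy (Kham μ c) (fun t => liftPt μ c s r p (Θ t)) M 0 = 1 := by
  have h := O.sympl_frameCol hs (Θ 0)
  ext i j
  fin_cases i <;> fin_cases j
  · simp [reducedMonodromy_zero, hM.1, sympl_comm _ (frameCol _ _ 0), h]
  · simp [reducedMonodromy_zero, hM.1, sympl_self]
  · simp [reducedMonodromy_one, hM.1, sympl_self]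
  · simp [reducedMonodromy_one, hM.1, h]

lemma continuous_reducedMonodromy {M : ℝ → Matrix (Fin 4) (Fin 4) ℝ}
    (hM : IsLinearizedFlow (Kham μ c) (fun t => liftPt μ c s r p (Θ t)) M) (i j : Fin 2) :
    Continuous fun t => reducedMonodromy (Kham μ c) (fun t => liftPt μ c s r p (Θ t)) M t i j := by
  have hv : Continuous fun t => M t *ᵥ frameCol (Kham μ c) (liftPt μ c s r p (Θ 0)) j :=
    continuous_iff_continuousAt.2 fun t =>
      ((O.isVariation_mulVec hs Z hM _).deriv t).continuousAt
  have hv' := fun i => (continuous_apply i).comp hv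
  have hf : ∀ j i, Continuous fun t => frameCol (Kham μ c) (liftPt μ c s r p (Θ t)) j i :=
    fun j i => (continuous_apply i).comp (O.continuous_frameCol hs Z j)
  have hsy : ∀ k, Continuous fun t => sympl (frameCol (Kham μ c) (liftPt μ c s r p (Θ t)) k)
      (M t *ᵥ frameCol (Kham μ c) (liftPt μ c s r p (Θ 0)) j) := fun k => by
    have := hf k
    unfold sympl
    exact ((((this 2).mul (hv' 0)).add ((this 3).mul (hv' 1))).sub ((this 0).mul (hv' 2))).sub
      ((this 1).mul (hv' 3))
  fin_cases i
  · simp only [Fin.zero_eta, reducedMonodromy_zero]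
    exact (hsy 1).neg
  · simpa only [Fin.mk_one, reducedMonodromy_one] using hsy 0

end IsRedOrbit

end LCHill

namespace LCHill

lemma sympl_add_smul (u v w : V4) (ξ η : ℝ) :
    sympl u (ξ • v + η • w) = sympl u v * ξ + sympl u w * η := by
  simp only [sympl, Pi.add_apply, Pi.smul_apply, smul_eq_mul]
  ring

namespace RefData.Valid

variable {D : RefData} {μ c s : ℝ} {k : ℕ} {A B₁ B₂ ε W r₀ σ m R : ℝ} {r p Θ : ℝ → ℝ} {T : ℝ}
  (Z : D.Valid μ c s k A B₁ B₂ ε W r₀ σ m R) (hs : s = 1 ∨ s = -1)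
  (O : IsRedOrbit μ c s r p)
  (tube : ∀ θ, ∃ x y, |x| ≤ 1 ∧ |y| ≤ 1 ∧ r θ = D.rad θ x ∧ p θ = D.mom θ x y)
  (Zc : IsClock μ c r p Θ T)
include Z hs O tube Zc

lemma turnsIn_variation {v : ℝ → V4}
    (V : IsVariation μ c (fun t => liftPt μ c s r p (Θ t)) v)
    (h0 : fderiv ℝ (Kham μ c) (liftPt μ c s r p (Θ 0)) (v 0) = 0)
    (h : sympl (frameCol (Kham μ c) (liftPt μ c s r p (Θ 0)) 1) (v 0) ≠ 0 ∨
      sympl (frameCol (Kham μ c) (liftPt μ c s r p (Θ 0)) 0) (v 0) ≠ 0) :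
    TurnsIn T k (fun t => -(s * ((trP μ c s (liftPt μ c s r p (Θ t)) (v t)
      - D.be (Θ t) * (trR μ c s (liftPt μ c s r p (Θ t)) (v t) / D.al (Θ t))) / D.ka (Θ t))))
      fun t => -(s * (trR μ c s (liftPt μ c s r p (Θ t)) (v t) / D.al (Θ t))) :=
  Z.turnsIn hs O tube Zc (fun t => (O.hasDerivAt_tr_lift hs V h0 t).1)
    (fun t => (O.hasDerivAt_tr_lift hs V h0 t).2) (O.tr_ne_zero hs Zc V h0 h)

omit hs O tube in
lemma frame_period : D.al (Θ T) = D.al (Θ 0) ∧ D.be (Θ T) = D.be (Θ 0) ∧ D.ka (Θ T) = D.ka (Θ 0) := by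
  have hT : Θ T = Θ 0 + 2 * Real.pi + 2 * Real.pi := by
    have := Zc.period 0
    rw [zero_add] at this
    rw [this]
    ring
  rw [hT]
  exact ⟨by rw [Z.al.periodic, Z.al.periodic], by rw [Z.be.periodic, Z.be.periodic],
    by rw [Z.ka.periodic, Z.ka.periodic]⟩

theorem transverseNondeg : TransverseNondeg (Kham μ c) T fun t => liftPt μ c s r p (Θ t) := by
  intro v hv hT h0
  by_cases h : sympl (frameCol (Kham μ c) (liftPt μ c s r p (Θ 0)) 1) (v 0) ≠ 0 ∨
      sympl (frameCol (Kham μ c) (liftPt μ c s r p (Θ 0)) 0) (v 0) ≠ 0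
  · obtain ⟨φ, hφ, h1⟩ := Z.turnsIn_variation hs O tube Zc (O.isVariation hs Zc hv) h0 h
    obtain ⟨e1, e2, e3⟩ := Z.frame_period Zc
    have e4 := O.lift_periodic Zc 0
    rw [zero_add] at e4
    refine absurd h1 (hφ.turn_ne_of_eq_smul Zc.period_pos.le one_pos ?_ ?_ k)
    · simp only [hT, e1, e2, e3, e4, one_mul]
    · simp only [hT, e1, e4, one_mul]
  · push Not at h
    obtain ⟨a, ha⟩ := O.eq_frame hs (Θ 0) h0
    exact ⟨a, by rw [ha, h.1, h.2]; simp⟩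

theorem czIndexIs : ∃ M : ℝ → Matrix (Fin 4) (Fin 4) ℝ,
    IsLinearizedFlow (Kham μ c) (fun t => liftPt μ c s r p (Θ t)) M ∧
    CZIndexIs T (reducedMonodromy (Kham μ c) (fun t => liftPt μ c s r p (Θ t)) M) (2 * k + 1) := by
  obtain ⟨M, hM⟩ := O.exists_isLinearizedFlow hs Zc
  refine ⟨M, hM, ?_⟩
  have cΘ := IsRedOrbit.continuous_clock Zc
  have cal := Z.al.continuous.comp cΘ
  have cbe := Z.be.continuous.comp cΘ
  have cka := Z.ka.continuous.comp cΘ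
  have ctr := fun j => O.continuous_tr hs Zc (O.continuous_frameCol hs Zc j)
  have nal : ∀ t, D.al (Θ t) ≠ 0 := fun t => (Z.al_pos _).ne'
  have nka : ∀ t, D.ka (Θ t) ≠ 0 := fun t => (Z.ka_pos _).ne'
  have cA : ∀ j, Continuous fun t => -(s * (trR μ c s (liftPt μ c s r p (Θ t))
      (frameCol (Kham μ c) (liftPt μ c s r p (Θ t)) j) / D.al (Θ t))) :=
    fun j => (((ctr j).1.div cal nal).const_mul s).neg
  have cC : ∀ j, Continuous fun t => -(s * ((trP μ c s (liftPt μ c s r p (Θ t))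
      (frameCol (Kham μ c) (liftPt μ c s r p (Θ t)) j)
      - D.be (Θ t) * (trR μ c s (liftPt μ c s r p (Θ t))
        (frameCol (Kham μ c) (liftPt μ c s r p (Θ t)) j) / D.al (Θ t))) / D.ka (Θ t))) :=
    fun j => (((((ctr j).2.sub (cbe.mul ((ctr j).1.div cal nal))).div cka nka)).const_mul s).neg
  obtain ⟨e1, e2, e3⟩ := Z.frame_period Zc
  have e4 := O.lift_periodic Zc 0
  rw [zero_add] at e4
  have b0 : D.be (Θ 0) = 0 := by
    have := Z.be.parity 0
    rw [neg_zero] at this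
    rw [Zc.zero]
    linarith
  have z1 : trR μ c s (liftPt μ c s r p (Θ 0))
      (frameCol (Kham μ c) (liftPt μ c s r p (Θ 0)) 0) = 0 := by
    rw [Zc.zero, (O.tr_frameCol_zero hs).1]
  have z2 : trP μ c s (liftPt μ c s r p (Θ 0))
      (frameCol (Kham μ c) (liftPt μ c s r p (Θ 0)) 1) = 0 := by
    rw [Zc.zero, (O.tr_frameCol_zero hs).2]
  refine czIndexIs_of_turnsIn (k := k)
    (A := fun t => -(s * (trR μ c s (liftPt μ c s r p (Θ t))
      (frameCol (Kham μ c) (liftPt μ c s r p (Θ t)) 0) / D.al (Θ t))))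
    (C := fun t => -(s * ((trP μ c s (liftPt μ c s r p (Θ t))
      (frameCol (Kham μ c) (liftPt μ c s r p (Θ t)) 0)
      - D.be (Θ t) * (trR μ c s (liftPt μ c s r p (Θ t))
        (frameCol (Kham μ c) (liftPt μ c s r p (Θ t)) 0) / D.al (Θ t))) / D.ka (Θ t))))
    (D := fun t => -(s * ((trP μ c s (liftPt μ c s r p (Θ t))
      (frameCol (Kham μ c) (liftPt μ c s r p (Θ t)) 1)
      - D.be (Θ t) * (trR μ c s (liftPt μ c s r p (Θ t))
        (frameCol (Kham μ c) (liftPt μ c s r p (Θ t)) 1) / D.al (Θ t))) / D.ka (Θ t))))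
    (K := fun t => -(s * (trR μ c s (liftPt μ c s r p (Θ t))
      (frameCol (Kham μ c) (liftPt μ c s r p (Θ t)) 1) / D.al (Θ t))))
    Zc.period_pos.le (fun i j => (O.continuous_reducedMonodromy hs Zc hM i j).continuousOn)
    (O.reducedMonodromy_zero_eq hs hM) (fun t _ => O.isVariation_det hs Zc hM t)
    (cA 0).continuousOn (cC 0).continuousOn (cC 1).continuousOn (cA 1).continuousOn
    (fun t _ => ?_) (fun t _ => ?_) ?_ ?_ ?_ ?_ ?_ ?_ fun ξ η hz => ?_
  · have h := O.trR_frameV_liftPt_pos hs (Θ t)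
    rw [frameCol_one, O.gradient4_liftPt hs, trR_smul]
    have hn := inv_pos.2 (O.enorm4_gradK_pos hs (Θ t))
    have ha := inv_pos.2 (Z.al_pos (Θ t))
    rw [div_eq_mul_inv]
    calc 0 < _ := mul_pos (mul_pos hn h) ha
      _ = _ := by ring
  · have h := O.trP_mul_trR_lift hs (Θ := Θ) t (O.fderiv_frameCol hs (Θ t) 0)
      (O.fderiv_frameCol hs (Θ t) 1)
    rw [O.sympl_frameCol hs, mul_one] at h
    have ha := Z.al_pos (Θ t)
    have hk := Z.ka_pos (Θ t)
    have hr := O.pos (Θ t)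
    generalize trP μ c s (liftPt μ c s r p (Θ t)) _ = q₁ at *
    generalize trP μ c s (liftPt μ c s r p (Θ t)) _ = q₂ at *
    generalize trR μ c s (liftPt μ c s r p (Θ t)) _ = q₃ at *
    generalize trR μ c s (liftPt μ c s r p (Θ t)) _ = q₄ at *
    calc 0 < 2 * r (Θ t) / (D.al (Θ t) * D.ka (Θ t)) := by positivity
      _ = _ := by
        rw [← h]
        rcases hs with rfl | rfl
        all_goals
          field_simp
          ring
  · simp [z1]
  · simp only [e4, z1, zero_div, mul_zero, neg_zero]
  · simp [z2, b0]
  · simp only [e4, e2, z2, b0, zero_mul, sub_self, zero_div, mul_zero, neg_zero]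
  · simp only [e1, e2, e3, e4]
  · simp only [e1, e4]
  · have W := O.isVariation_mulVec hs Zc hM
      (ξ • frameCol (Kham μ c) (liftPt μ c s r p (Θ 0)) 0
        + η • frameCol (Kham μ c) (liftPt μ c s r p (Θ 0)) 1)
    have h0 : fderiv ℝ (Kham μ c) (liftPt μ c s r p (Θ 0)) (M 0 *ᵥ
        (ξ • frameCol (Kham μ c) (liftPt μ c s r p (Θ 0)) 0
        + η • frameCol (Kham μ c) (liftPt μ c s r p (Θ 0)) 1)) = 0 := by
      rw [hM.1, one_mulVec, map_add, map_smul, map_smul, O.fderiv_frameCol hs,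
        O.fderiv_frameCol hs, smul_zero, smul_zero, add_zero]
    have h := Z.turnsIn_variation hs O tube Zc W h0 (by
      rw [hM.1, one_mulVec, sympl_add_smul, sympl_add_smul, sympl_self, sympl_self,
        O.sympl_frameCol hs, sympl_comm, O.sympl_frameCol hs]
      rcases hz with hz | hz
      · exact Or.inl (by simpa using hz)
      · exact Or.inr (by simpa using hz))
    have e : ∀ t, _ := fun t => O.tr_eq_frame hs (Θ t) ((W.fderiv_Kham_eq t).trans h0)
    have e' : ∀ t j, sympl (frameCol (Kham μ c) (liftPt μ c s r p (Θ t)) j) (M t *ᵥ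
        (ξ • frameCol (Kham μ c) (liftPt μ c s r p (Θ 0)) 0
        + η • frameCol (Kham μ c) (liftPt μ c s r p (Θ 0)) 1))
        = sympl (frameCol (Kham μ c) (liftPt μ c s r p (Θ t)) j)
          (M t *ᵥ frameCol (Kham μ c) (liftPt μ c s r p (Θ 0)) 0) * ξ
        + sympl (frameCol (Kham μ c) (liftPt μ c s r p (Θ t)) j)
          (M t *ᵥ frameCol (Kham μ c) (liftPt μ c s r p (Θ 0)) 1) * η := fun t j => by
      rw [mulVec_add, mulVec_smul, mulVec_smul, sympl_add_smul]
    convert h using 2 with t t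
    all_goals
      rw [(e t).1, e', e']
      try rw [(e t).2, e', e']
      simp only [reducedMonodromy_zero, reducedMonodromy_one]
      ring

end RefData.Valid

end LCHill

namespace LCHill

theorem RefData.Valid.exists_orbit {D : RefData} {μ c s : ℝ} {k : ℕ} {A B₁ B₂ ε W r₀ σ m R : ℝ}
    (Z : D.Valid μ c s k A B₁ B₂ ε W r₀ σ m R) (hk : k = 1 ∨ k = 2) (hs : s = 1 ∨ s = -1)
    (hμ : 0 ≤ μ) (hμ1 : μ < 1) :
    ∃ (T : ℝ) (γ : ℝ → V4), IsClosedOrbit μ c T γ ∧ IsSymmetricOrbit T γ ∧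
      (s = 1 → IsRetrograde μ γ) ∧ (s = -1 → IsDirect μ γ) ∧
      TransverseNondeg (Kham μ c) T γ ∧ IsMinimalPeriod T γ ∧
      ∃ M : ℝ → Matrix (Fin 4) (Fin 4) ℝ, IsLinearizedFlow (Kham μ c) γ M ∧
        CZIndexIs T (reducedMonodromy (Kham μ c) γ M) (2 * k + 1) := by
  obtain ⟨r, p, dr, dp, er, op, pr, pp, tube⟩ := Z.exists_periodic hk
  have hg : ∀ θ, ∃ x y, D.Good μ c s A B₁ B₂ θ x y ∧ r θ = D.rad θ x ∧ p θ = D.mom θ x y :=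
    fun θ => let ⟨x, y, hx, hy, h1, h2⟩ := tube θ; ⟨x, y, Z.good θ x y hx hy, h1, h2⟩
  have O : IsRedOrbit μ c s r p :=
    { deriv_r := dr
      deriv_p := dp
      even := er
      odd := op
      periodic_r := pr
      periodic_p := pp
      pos := fun θ => let ⟨x, y, h, h1, _⟩ := hg θ; h1 ▸ h.rad_pos
      lt_one := fun θ => let ⟨x, y, h, h1, _⟩ := hg θ; h1 ▸ h.rad_lt
      hill := fun θ => let ⟨x, y, h, h1, _⟩ := hg θ; h1 ▸ h.hill
      dist_pos := fun θ => let ⟨x, y, h, h1, _⟩ := hg θ; h1 ▸ h.dist_pos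
      ang_pos := fun θ => let ⟨x, y, h, h1, h2⟩ := hg θ; h1 ▸ h2 ▸ h.ang_pos
      sense := fun θ => let ⟨x, y, h, h1, h2⟩ := hg θ; h1 ▸ h2 ▸ h.sense }
  obtain ⟨Θ, T, Zc⟩ := O.exists_isClock
  exact ⟨T, _, O.isClosedOrbit Zc hs hμ hμ1, O.isSymmetricOrbit Zc, fun h => O.isRetrograde hs h,
    fun h => O.isDirect hs h, Z.transverseNondeg hs O tube Zc, O.isMinimalPeriod Zc hs,
    Z.czIndexIs hs O tube Zc⟩

end LCHill

namespace LCHill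

open Polynomial in
/-- Evaluation of a bivariate polynomial with natural coefficients. -/
def bev {S : Type*} [CommSemiring S] (η ζ : S) : Polynomial (Polynomial ℕ) →+* S :=
  eval₂RingHom (eval₂RingHom (Nat.castRingHom S) η) ζ

section Bivariate

open Polynomial

variable {S : Type*} [CommSemiring S]

lemma bev_X (η ζ : S) : bev η ζ X = ζ := by simp [bev]

lemma bev_C_X (η ζ : S) : bev η ζ (C X) = η := by simp [bev]

lemma bev_induction {P : ℕ[X][X] → Prop} (hadd : ∀ p q, P p → P q → P (p + q))
    (hmon : ∀ i j (a : ℕ), P ((a : ℕ[X][X]) * C X ^ j * X ^ i)) (p : ℕ[X][X]) : P p := by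
  induction p using Polynomial.induction_on' with
  | add p q hp hq => exact hadd p q hp hq
  | monomial i a =>
    induction a using Polynomial.induction_on' with
    | add p q hp hq => rw [map_add]; exact hadd _ _ hp hq
    | monomial j a =>
      convert hmon i j a using 1
      rw [← C_mul_X_pow_eq_monomial, ← C_mul_X_pow_eq_monomial, C_mul, C_pow]
      simp

lemma norm_bev_le {η ζ : ℂ} (hη : ‖η‖ = 1) (hζ : ‖ζ‖ = 1) (p : ℕ[X][X]) :
    ‖bev η ζ p‖ ≤ (bev 1 1 p : ℕ) := by
  induction p using bev_induction with
  | hadd p q hp hq =>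
    rw [map_add, map_add]
    push_cast
    exact (norm_add_le _ _).trans (add_le_add hp hq)
  | hmon i j a => simp [bev_X, bev_C_X, hη, hζ]

/-- The polynomial `p` has at most `M` terms, of degree at most `J` in the inner variable. -/
def PolyBd (p : ℕ[X][X]) (M J : ℕ) : Prop := ∀ y, 1 ≤ y → bev y 1 p ≤ M * y ^ J

lemma PolyBd.add {p q : ℕ[X][X]} {M M' J : ℕ} (hp : PolyBd p M J) (hq : PolyBd q M' J) :
    PolyBd (p + q) (M + M') J := fun y hy => by
  rw [map_add, add_mul]; exact add_le_add (hp y hy) (hq y hy)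

lemma PolyBd.mul {p q : ℕ[X][X]} {M M' J J' : ℕ} (hp : PolyBd p M J) (hq : PolyBd q M' J') :
    PolyBd (p * q) (M * M') (J + J') := fun y hy => by
  rw [map_mul]
  exact (Nat.mul_le_mul (hp y hy) (hq y hy)).trans_eq (by ring)

lemma PolyBd.mono {p : ℕ[X][X]} {M M' J J' : ℕ} (hp : PolyBd p M J) (hM : M ≤ M') (hJ : J ≤ J') :
    PolyBd p M' J' := fun y hy =>
  (hp y hy).trans (Nat.mul_le_mul hM (Nat.pow_le_pow_right hy hJ))

lemma PolyBd.bev_one_le {p : ℕ[X][X]} {M J : ℕ} (hp : PolyBd p M J) : bev 1 1 p ≤ M := by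
  simpa using hp 1 le_rfl

lemma coeff_eq_div_mod {b : ℕ} (n : ℕ) (f : ℕ[X]) (hf : ∀ i, f.coeff i < b) :
    f.coeff n = f.eval b / b ^ n % b := by
  have hb : 0 < b := (Nat.zero_le _).trans_lt (hf 0)
  have h : f.eval b = b * f.divX.eval b + f.coeff 0 := by
    conv_lhs => rw [← divX_mul_X_add f]
    simp [mul_comm]
  induction n generalizing f with
  | zero => rw [h, pow_zero, Nat.div_one, Nat.mul_add_mod, Nat.mod_eq_of_lt (hf 0)]
  | succ n ih =>
    rw [← coeff_divX, ih f.divX (fun i => by rw [coeff_divX]; exact hf _) (by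
      conv_lhs => rw [← divX_mul_X_add f.divX]
      simp [mul_comm]), h, pow_succ', ← Nat.div_div_eq_div_mul, Nat.mul_add_div hb,
      Nat.div_eq_of_lt (hf 0), add_zero]

lemma eq_of_eval_eq {b : ℕ} {f g : ℕ[X]} (hf : ∀ i, f.coeff i < b) (hg : ∀ i, g.coeff i < b)
    (h : f.eval b = g.eval b) : f = g := by
  ext n
  rw [coeff_eq_div_mod n f hf, coeff_eq_div_mod n g hg, h]

lemma coeff_le_eval_one (f : ℕ[X]) (i : ℕ) : f.coeff i ≤ f.eval 1 := by
  rw [eval_eq_sum_range]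
  simp only [one_pow, mul_one]
  by_cases h : i ∈ Finset.range (f.natDegree + 1)
  · exact Finset.single_le_sum (f := fun i => f.coeff i) (fun _ _ => Nat.zero_le _) h
  · rw [coeff_eq_zero_of_natDegree_lt (by simpa using h)]
    exact Nat.zero_le _

lemma bev_eq_eval_map (y x : ℕ) (p : ℕ[X][X]) :
    bev y x p = (p.map (evalRingHom y)).eval x := by
  rw [eval_map]
  rfl

lemma PolyBd.eval_coeff_le {p : ℕ[X][X]} {M J : ℕ} (hp : PolyBd p M J) {y : ℕ} (hy : 1 ≤ y)
    (i : ℕ) : (p.coeff i).eval y ≤ M * y ^ J := by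
  refine le_trans ?_ (hp y hy)
  rw [bev_eq_eval_map]
  simpa using coeff_le_eval_one (p.map (evalRingHom y)) i

lemma PolyBd.eq_of_bev_eq {p q : ℕ[X][X]} {M M' J Y L : ℕ} (hp : PolyBd p M J)
    (hq : PolyBd q M' J) (hM : M < Y) (hM' : M' < Y) (hJ : J < L)
    (h : bev Y (Y ^ L) p = bev Y (Y ^ L) q) : p = q := by
  have hY : 1 ≤ Y := by omega
  have key : ∀ {p : ℕ[X][X]} {M : ℕ}, PolyBd p M J → M < Y → ∀ i,
      (p.map (evalRingHom Y)).coeff i < Y ^ L := fun {p M} hp hM i => by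
    rw [coeff_map]
    refine (hp.eval_coeff_le hY i).trans_lt ?_
    refine lt_of_lt_of_le ?_ (Nat.pow_le_pow_right hY hJ)
    rw [pow_succ']
    exact Nat.mul_lt_mul_of_pos_right hM (by positivity)
  rw [bev_eq_eval_map, bev_eq_eval_map] at h
  have h1 := eq_of_eval_eq (key hp hM) (key hq hM') h
  ext i : 1
  refine eq_of_eval_eq (b := Y) (fun j => ?_) (fun j => ?_) ?_
  · exact ((coeff_le_eval_one _ _).trans (by simpa using hp.eval_coeff_le le_rfl i)).trans_lt hM
  · exact ((coeff_le_eval_one _ _).trans (by simpa using hq.eval_coeff_le le_rfl i)).trans_lt hM'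
  · simpa using congrArg (fun f => f.coeff i) h1

end Bivariate

end LCHill

namespace LCHill

/-- The number with `n` digits equal to `m` in base `D`. -/
def repDigit (D m : ℕ) : ℕ → ℕ
  | 0 => 0
  | n + 1 => repDigit D m n * D + m

lemma land_split {A H m b : ℕ} (hm : m < 2 ^ b) (h : A &&& (H * 2 ^ b + m) = A) :
    A % 2 ^ b &&& m = A % 2 ^ b ∧ A / 2 ^ b &&& H = A / 2 ^ b := by
  have h1 : (H * 2 ^ b + m) % 2 ^ b = m := by
    rw [mul_comm, Nat.mul_add_mod, Nat.mod_eq_of_lt hm]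
  have h2 : (H * 2 ^ b + m) / 2 ^ b = H := by
    rw [mul_comm, Nat.mul_add_div (by positivity), Nat.div_eq_of_lt hm, add_zero]
  constructor
  · conv_rhs => rw [← h, Nat.and_mod_two_pow, h1]
  · conv_rhs => rw [← h, Nat.and_div_two_pow, h2]

lemma repDigit_lt {b m : ℕ} (hm : m < 2 ^ b) (n : ℕ) : repDigit (2 ^ b) m n < 2 ^ (b * n) := by
  induction n with
  | zero => simp [repDigit]
  | succ n ih =>
    rw [repDigit, mul_add, mul_one, pow_add]
    nlinarith

section

open Polynomial

lemma exists_poly_row {b k : ℕ} (hk : k ≤ b) (n A : ℕ)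
    (h : A &&& repDigit (2 ^ b) (2 ^ k - 1) n = A) :
    ∃ p : ℕ[X], p.eval (2 ^ b) = A ∧ (∀ y, 1 ≤ y → p.eval y ≤ p.eval 1 * y ^ n) ∧
      p.eval 1 ≤ n * 2 ^ k := by
  have hk2 : 2 ^ k ≤ 2 ^ b := Nat.pow_le_pow_right two_pos hk
  have hk0 : 0 < 2 ^ k := by positivity
  induction n generalizing A with
  | zero =>
    rw [repDigit, Nat.and_zero] at h
    exact ⟨0, by simp [← h]⟩
  | succ n ih =>
    obtain ⟨h1, h2⟩ := land_split (by omega) h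
    obtain ⟨p, hp, hp1, hp2⟩ := ih _ h2
    have hd : A % 2 ^ b < 2 ^ k := by
      have : A % 2 ^ b &&& (2 ^ k - 1) ≤ 2 ^ k - 1 := Nat.and_le_right
      omega
    refine ⟨p * X + C (A % 2 ^ b), ?_, fun y hy => ?_, ?_⟩
    · simp only [eval_add, eval_mul, eval_X, eval_C, hp]
      exact Nat.div_add_mod' A (2 ^ b)
    · simp only [eval_add, eval_mul, eval_X, eval_C, mul_one, add_mul]
      refine add_le_add ?_ ?_
      · exact (Nat.mul_le_mul_right y (hp1 y hy)).trans_eq (by ring)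
      · exact Nat.le_mul_of_pos_right _ (by positivity)
    · simp only [eval_add, eval_mul, eval_X, eval_C, mul_one]
      rw [add_mul, one_mul]
      exact add_le_add hp2 hd.le

lemma bev_modEq (Y L : ℕ) (hY : 1 ≤ Y) (p : ℕ[X][X]) :
    bev Y (Y ^ L) p ≡ bev 1 1 p [MOD Y - 1] := by
  have h : Y ≡ 1 [MOD Y - 1] := ((Nat.modEq_iff_dvd' hY).2 dvd_rfl).symm
  induction p using bev_induction with
  | hadd p q hp hq => rw [map_add, map_add]; exact hp.add hq
  | hmon i j a =>
    simp only [map_mul, map_natCast, map_pow, bev_X, bev_C_X]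
    have hL := h.pow L
    rw [one_pow] at hL
    exact ((Nat.ModEq.refl _).mul (h.pow j)).mul (hL.pow i)

lemma exists_poly {b k K L R A : ℕ} (hk : k ≤ b) (hKL : K ≤ L)
    (hsmall : R * (K * 2 ^ k) < 2 ^ b - 1)
    (h : A &&& repDigit (2 ^ (b * L)) (repDigit (2 ^ b) (2 ^ k - 1) K) R = A) :
    ∃ p : ℕ[X][X], bev (2 ^ b) ((2 ^ b) ^ L) p = A ∧ PolyBd p (A % (2 ^ b - 1)) K := by
  have hk2 : 2 ^ k ≤ 2 ^ b := Nat.pow_le_pow_right two_pos hk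
  have hk0 : 0 < 2 ^ k := by positivity
  obtain ⟨p, hp, hp1, hp2⟩ : ∃ p : ℕ[X][X], bev (2 ^ b) ((2 ^ b) ^ L) p = A ∧
      PolyBd p (bev 1 1 p) K ∧ bev 1 1 p ≤ R * (K * 2 ^ k) := by
    clear hsmall
    have hrow : repDigit (2 ^ b) (2 ^ k - 1) K < 2 ^ (b * L) :=
      (repDigit_lt (by omega) K).trans_le
        (Nat.pow_le_pow_right two_pos (Nat.mul_le_mul_left b hKL))
    induction R generalizing A with
    | zero =>
      rw [repDigit, Nat.and_zero] at h
      exact ⟨0, by simp [← h], fun y _ => by simp, by simp⟩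
    | succ R ih =>
      obtain ⟨h1, h2⟩ := land_split hrow h
      obtain ⟨p, hp, hp1, hp2⟩ := ih h2
      obtain ⟨q, hq, hq1, hq2⟩ := exists_poly_row hk K _ h1
      have hC : ∀ y z : ℕ, bev y z (C q) = q.eval y := fun y z => by
        rw [bev_eq_eval_map, map_C, eval_C]; rfl
      refine ⟨p * X + C q, ?_, fun y hy => ?_, ?_⟩
      · rw [map_add, map_mul, bev_X, hp, hC, hq, ← pow_mul]
        exact Nat.div_add_mod' A (2 ^ (b * L))
      · rw [map_add, map_mul, bev_X, hC, map_add, map_mul, bev_X, hC, add_mul, mul_one, mul_one]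
        exact add_le_add (hp1 y hy) (hq1 y hy)
      · rw [map_add, map_mul, bev_X, hC, mul_one, add_mul, one_mul]
        exact add_le_add hp2 hq2
  refine ⟨p, hp, hp1.mono ?_ le_rfl⟩
  have := bev_modEq (2 ^ b) L Nat.one_le_two_pow p
  rw [hp] at this
  rw [this, Nat.mod_eq_of_lt (by omega)]

end

end LCHill

namespace LCHill

/-- The size of the window of exponents of a packed Laurent polynomial: the exponents of the
outer variable are at most `N`, those of the inner variable at most `E`. -/
structure Lay where
  (N E : ℕ)
  N_le : N ≤ 20
  E_le : E ≤ 20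

/-- The base in which coefficients are packed. -/
def baseY : ℕ := 2 ^ 128

/-- The sum of the digits of a packed polynomial. -/
def digSum (A : ℕ) : ℕ := A % (2 ^ 128 - 1)

namespace Lay

variable (l : Lay)

/-- The base in which the rows of coefficients are packed. -/
def baseX : ℕ := 2 ^ (128 * (4 * l.E + 4))

/-- The bits that may be set in a packed polynomial. -/
def window : ℕ := repDigit l.baseX (repDigit (2 ^ 128) (2 ^ 60 - 1) (2 * l.E + 1)) (2 * l.N + 1)

/-- The bits that may be set in the residual of a product. -/
def wide : ℕ := repDigit l.baseX (repDigit (2 ^ 128) (2 ^ 112 - 1) (4 * l.E + 1)) (4 * l.N + 1)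

/-- The packed polynomial all of whose coefficients are `1`. -/
def ones : ℕ := repDigit l.baseX (repDigit (2 ^ 128) 1 (4 * l.E + 1)) (4 * l.N + 1)

/-- The digitwise difference of two packed polynomials, shifted so as to be positive. -/
def biased (A B : ℕ) : ℕ := A + l.ones * 2 ^ 124 - B

/-- The positive part encoded by a shifted difference. -/
def unbias (D : ℕ) : ℕ := D &&& (((D >>> 124) &&& l.ones) * (2 ^ 124 - 1))

/-- The monomial by which packed polynomials are shifted. -/
def shift : ℕ := baseY ^ l.E * l.baseX ^ l.N

end Lay

/-- A packed Laurent polynomial with coefficients in units of `2⁻⁴⁴`, written as the difference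
of two polynomials with natural coefficients, with an error bound and a validity flag. -/
structure TM where
  (pos neg err : ℕ)
  ok : Bool

namespace TM

/-- The sum of the moduli of the coefficients. -/
def mass (t : TM) : ℕ := digSum t.pos + digSum t.neg

/-- A bound for the modulus of the enclosed functions. -/
def bd (t : TM) : ℕ := t.mass + t.err

/-- Result of dividing the polynomial `A - B` by the monomial `c`, with certificate. -/
def redCert (l : Lay) (cn c A B M e : ℕ) (o : Bool) (A' B' P Q : ℕ) : TM where
  pos := A'
  neg := B'
  err := (e + digSum P + digSum Q) / cn + 1
  ok := o && (A' &&& l.window == A') && (B' &&& l.window == B') && (P &&& l.wide == P) &&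
    (Q &&& l.wide == Q) && (A + c * B' + Q == B + c * A' + P) &&
    Nat.blt (M + cn * digSum B' + digSum Q) (2 ^ 128) &&
    Nat.blt (M + cn * digSum A' + digSum P) (2 ^ 128)

/-- `redCert` with explicit quotients. -/
def redParts (l : Lay) (cn c A B M e : ℕ) (o : Bool) (P Q A' B' : ℕ) : TM :=
  redCert l cn c A B M e o A' B' (P - c * A') (Q - c * B')

/-- `redCert` with quotients computed from the biased remainders. -/
def redPos (l : Lay) (cn c A B M e : ℕ) (o : Bool) (P Q : ℕ) : TM :=
  redParts l cn c A B M e o P Q ((P / c) &&& l.window) ((Q / c) &&& l.window)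

/-- Division by the monomial `c`. -/
def red (l : Lay) (cn c A B M e : ℕ) (o : Bool) : TM :=
  redPos l cn c A B M e o (l.unbias (l.biased A B)) (l.unbias (l.biased B A))

/-- Enclosure of a product. -/
def mul (l : Lay) (t u : TM) : TM :=
  red l (2 ^ 44) (2 ^ 44 * l.shift) (t.pos * u.pos + t.neg * u.neg)
    (t.pos * u.neg + t.neg * u.pos) (t.mass * u.mass)
    (t.err * u.mass + u.err * t.mass + t.err * u.err) (t.ok && u.ok)

/-- Enclosure of a sum. -/
def add (l : Lay) (t u : TM) : TM :=
  red l 1 1 (t.pos + u.pos) (t.neg + u.neg) (t.mass + u.mass) (t.err + u.err) (t.ok && u.ok)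

/-- Enclosure of the opposite. -/
def opp (t : TM) : TM := ⟨t.neg, t.pos, t.err, t.ok⟩

/-- Enclosure of a difference. -/
def sub (l : Lay) (t u : TM) : TM := add l t u.opp

/-- Enclosure with a larger error. -/
def widen (t : TM) (e : ℕ) : TM := ⟨t.pos, t.neg, t.err + e, t.ok⟩

/-- Enclosure from its packed coefficients. -/
def ofPair (l : Lay) (A B : ℕ) : TM :=
  ⟨A, B, 0, (A &&& l.window == A) && (B &&& l.window == B)⟩

/-- Enclosure of a constant, in units of `2⁻⁴⁴`. -/
def const (l : Lay) (z : ℕ) : TM :=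
  ⟨z * l.shift, 0, 0, (ofPair l (z * l.shift) 0).ok && z.blt (2 ^ 128)⟩

end TM

section

open Polynomial

variable (l : Lay) {η ζ : ℂ}

/-- The packed number `A` encodes the polynomial `p`. -/
def Packs (A : ℕ) (p : ℕ[X][X]) : Prop :=
  bev baseY l.baseX p = A ∧ PolyBd p (digSum A) (2 * l.E + 1)

/-- The complex number `v` is in the enclosure `t` at the point `(ζ, η)`. -/
def Encl (η ζ : ℂ) (t : TM) (v : ℂ) : Prop :=
  t.ok = true → ∃ p q, Packs l t.pos p ∧ Packs l t.neg q ∧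
    ‖2 ^ 44 * (η ^ l.E * ζ ^ l.N) * v - (bev η ζ p - bev η ζ q)‖ ≤ t.err

variable {l}

lemma Lay.baseX_eq : l.baseX = baseY ^ (4 * l.E + 4) := (pow_mul _ _ _)

lemma exists_packs {A : ℕ} (h : A &&& l.window = A) : ∃ p, Packs l A p := by
  have hb : 2 * l.N + 1 ≤ 41 ∧ 2 * l.E + 1 ≤ 41 := by have := l.N_le; have := l.E_le; omega
  have hm := Nat.mul_le_mul hb.1 hb.2
  obtain ⟨p, hp⟩ := exists_poly (b := 128) (k := 60) (K := 2 * l.E + 1) (L := 4 * l.E + 4)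
    (R := 2 * l.N + 1) (by norm_num) (by omega) (by rw [← mul_assoc]; omega) h
  exact ⟨p, by rw [Lay.baseX_eq]; exact hp.1, hp.2⟩

lemma exists_wide {A : ℕ} (h : A &&& l.wide = A) :
    ∃ p, bev baseY l.baseX p = A ∧ PolyBd p (digSum A) (4 * l.E + 1) := by
  have hb : 4 * l.N + 1 ≤ 81 ∧ 4 * l.E + 1 ≤ 81 := by have := l.N_le; have := l.E_le; omega
  have hm := Nat.mul_le_mul hb.1 hb.2
  obtain ⟨p, hp⟩ := exists_poly (b := 128) (k := 112) (K := 4 * l.E + 1) (L := 4 * l.E + 4)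
    (R := 4 * l.N + 1) (by norm_num) (by omega) (by rw [← mul_assoc]; omega) h
  exact ⟨p, by rw [Lay.baseX_eq]; exact hp.1, hp.2⟩

lemma encl_redCert (hη : ‖η‖ = 1) (hζ : ‖ζ‖ = 1) {cn c A B M e : ℕ} {o : Bool} {A' B' P Q : ℕ}
    {C : ℕ[X][X]} {v : ℂ} (hcn : 0 < cn) (hC : bev baseY l.baseX C = c)
    (hCn : ‖bev η ζ C‖ = cn) (hCb : PolyBd C cn l.E)
    (hab : o = true → ∃ a b, bev baseY l.baseX a = A ∧ bev baseY l.baseX b = B ∧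
      PolyBd a M (4 * l.E + 2) ∧ PolyBd b M (4 * l.E + 2) ∧
      ‖bev η ζ C * (2 ^ 44 * (η ^ l.E * ζ ^ l.N) * v) - (bev η ζ a - bev η ζ b)‖ ≤ e) :
    Encl l η ζ (TM.redCert l cn c A B M e o A' B' P Q) v := by
  intro hok
  simp only [TM.redCert, Bool.and_eq_true, beq_iff_eq, Nat.blt_eq] at hok
  obtain ⟨⟨⟨⟨⟨⟨⟨ho, hA'⟩, hB'⟩, hP⟩, hQ⟩, heq⟩, hM1⟩, hM2⟩ := hok
  obtain ⟨a, b, ha, hb, hab, hbb, he⟩ := hab ho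
  obtain ⟨p, hp⟩ := exists_packs hA'
  obtain ⟨q, hq⟩ := exists_packs hB'
  obtain ⟨u, hu⟩ := exists_wide hP
  obtain ⟨w, hw⟩ := exists_wide hQ
  refine ⟨p, q, hp, hq, ?_⟩
  have key : a + C * q + w = b + C * p + u := by
    refine PolyBd.eq_of_bev_eq (Y := baseY) (L := 4 * l.E + 4) (J := 4 * l.E + 2)
      ((hab.add ((hCb.mul hq.2).mono le_rfl (by omega))).add (hw.2.mono le_rfl (by omega)))
      ((hbb.add ((hCb.mul hp.2).mono le_rfl (by omega))).add (hu.2.mono le_rfl (by omega)))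
      hM1 hM2 (by omega) ?_
    simp only [← Lay.baseX_eq, map_add, map_mul, ha, hb, hC, hp.1, hq.1, hu.1, hw.1, heq]
  have key2 := congrArg (bev η ζ) key
  simp only [map_add, map_mul] at key2
  have hun : ‖bev η ζ u‖ ≤ digSum P := (norm_bev_le hη hζ u).trans (by
    exact_mod_cast hu.2.bev_one_le)
  have hwn : ‖bev η ζ w‖ ≤ digSum Q := (norm_bev_le hη hζ w).trans (by
    exact_mod_cast hw.2.bev_one_le)
  set z := 2 ^ 44 * (η ^ l.E * ζ ^ l.N) * v
  have h1 : bev η ζ C * (z - (bev η ζ p - bev η ζ q)) =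
      (bev η ζ C * z - (bev η ζ a - bev η ζ b)) + bev η ζ u - bev η ζ w := by
    linear_combination key2
  have h2 : cn * ‖z - (bev η ζ p - bev η ζ q)‖ ≤ e + digSum P + digSum Q := by
    rw [← hCn, ← norm_mul, h1]
    exact (norm_sub_le _ _).trans (add_le_add ((norm_add_le _ _).trans (add_le_add he hun)) hwn)
  have h3 : e + digSum P + digSum Q ≤ cn * ((e + digSum P + digSum Q) / cn + 1) :=
    (Nat.lt_mul_div_succ _ hcn).le
  have h4 : ((e + digSum P + digSum Q : ℕ) : ℝ) ≤
      cn * (((e + digSum P + digSum Q) / cn + 1 : ℕ) : ℝ) := by exact_mod_cast h3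
  have h5 : (0 : ℝ) < cn := by exact_mod_cast hcn
  push_cast at h4
  exact le_of_mul_le_mul_left (h2.trans (by push_cast [TM.redCert]; exact h4)) h5

end

end LCHill

namespace LCHill

namespace Encl

open Polynomial

variable {l : Lay} {η ζ : ℂ} {t u : TM} {v w : ℂ}

lemma norm_le (hη : ‖η‖ = 1) (hζ : ‖ζ‖ = 1) {p q : ℕ[X][X]} {A B : ℕ} (hp : Packs l A p)
    (hq : Packs l B q) : ‖bev η ζ p - bev η ζ q‖ ≤ digSum A + digSum B :=
  (norm_sub_le _ _).trans (add_le_add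
    ((norm_bev_le hη hζ p).trans (by exact_mod_cast hp.2.bev_one_le))
    ((norm_bev_le hη hζ q).trans (by exact_mod_cast hq.2.bev_one_le)))

lemma norm_shift (hη : ‖η‖ = 1) (hζ : ‖ζ‖ = 1) (l : Lay) : ‖η ^ l.E * ζ ^ l.N‖ = 1 := by
  simp [hη, hζ]

theorem bound (hη : ‖η‖ = 1) (hζ : ‖ζ‖ = 1) (h : Encl l η ζ t v) (hok : t.ok = true) :
    2 ^ 44 * ‖v‖ ≤ t.bd := by
  obtain ⟨p, q, hp, hq, he⟩ := h hok
  have h1 : 2 ^ 44 * ‖v‖ = ‖2 ^ 44 * (η ^ l.E * ζ ^ l.N) * v‖ := by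
    rw [norm_mul, norm_mul, norm_shift hη hζ]; simp
  have h2 := norm_le hη hζ hp hq
  have h3 := norm_le_norm_sub_add (2 ^ 44 * (η ^ l.E * ζ ^ l.N) * v) (bev η ζ p - bev η ζ q)
  rw [h1, TM.bd, TM.mass]
  push_cast
  linarith

theorem opp (h : Encl l η ζ t v) : Encl l η ζ t.opp (-v) := fun hok => by
  obtain ⟨p, q, hp, hq, he⟩ := h hok
  refine ⟨q, p, hq, hp, ?_⟩
  have h1 : 2 ^ 44 * (η ^ l.E * ζ ^ l.N) * -v - (bev η ζ q - bev η ζ p) =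
      -(2 ^ 44 * (η ^ l.E * ζ ^ l.N) * v - (bev η ζ p - bev η ζ q)) := by ring
  rw [h1, norm_neg]
  exact he

theorem widen (h : Encl l η ζ t v) (hη : ‖η‖ = 1) (hζ : ‖ζ‖ = 1) {e : ℕ}
    (hw : t.ok = true → 2 ^ 44 * ‖w - v‖ ≤ e) : Encl l η ζ (t.widen e) w := fun hok => by
  obtain ⟨p, q, hp, hq, he⟩ := h hok
  refine ⟨p, q, hp, hq, ?_⟩
  have h1 : 2 ^ 44 * (η ^ l.E * ζ ^ l.N) * w - (bev η ζ p - bev η ζ q) =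
      (2 ^ 44 * (η ^ l.E * ζ ^ l.N) * v - (bev η ζ p - bev η ζ q)) +
        2 ^ 44 * ((η ^ l.E * ζ ^ l.N) * (w - v)) := by ring
  rw [h1]
  refine (norm_add_le _ _).trans ?_
  have h2 : ‖(2 : ℂ) ^ 44 * ((η ^ l.E * ζ ^ l.N) * (w - v))‖ = 2 ^ 44 * ‖w - v‖ := by
    rw [norm_mul, norm_mul, norm_shift hη hζ, one_mul, norm_pow, Complex.norm_ofNat]
  rw [h2, TM.widen, Nat.cast_add]
  exact add_le_add he (hw hok)

theorem add (h : Encl l η ζ t v) (h' : Encl l η ζ u w) (hη : ‖η‖ = 1) (hζ : ‖ζ‖ = 1) :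
    Encl l η ζ (TM.add l t u) (v + w) := by
  refine encl_redCert hη hζ (C := 1) one_pos (by simp) (by simp)
    (fun y hy => by simpa using Nat.one_le_pow _ _ hy) fun ho => ?_
  rw [Bool.and_eq_true] at ho
  obtain ⟨p, q, hp, hq, he⟩ := h ho.1
  obtain ⟨p', q', hp', hq', he'⟩ := h' ho.2
  refine ⟨p + p', q + q', by rw [map_add, hp.1, hp'.1], by rw [map_add, hq.1, hq'.1], ?_, ?_, ?_⟩
  · refine (hp.2.add hp'.2).mono ?_ (by omega)
    simp only [TM.mass]; omega
  · refine (hq.2.add hq'.2).mono ?_ (by omega)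
    simp only [TM.mass]; omega
  · have h1 : bev η ζ 1 * (2 ^ 44 * (η ^ l.E * ζ ^ l.N) * (v + w)) -
        (bev η ζ (p + p') - bev η ζ (q + q')) =
        (2 ^ 44 * (η ^ l.E * ζ ^ l.N) * v - (bev η ζ p - bev η ζ q)) +
        (2 ^ 44 * (η ^ l.E * ζ ^ l.N) * w - (bev η ζ p' - bev η ζ q')) := by
      simp only [map_add, map_one]; ring
    rw [h1]
    push_cast
    exact (norm_add_le _ _).trans (add_le_add he he')

theorem sub (h : Encl l η ζ t v) (h' : Encl l η ζ u w) (hη : ‖η‖ = 1) (hζ : ‖ζ‖ = 1) :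
    Encl l η ζ (TM.sub l t u) (v - w) := by
  rw [sub_eq_add_neg]
  exact h.add h'.opp hη hζ

lemma polyBd_X : PolyBd X 1 0 := fun y _ => by simp [bev_X]

lemma polyBd_C_X : PolyBd (C X) 1 1 := fun y _ => by simp [bev_C_X]

lemma polyBd_natCast (n : ℕ) : PolyBd (n : ℕ[X][X]) n 0 := fun y _ => by simp

lemma polyBd_pow {p : ℕ[X][X]} {M J : ℕ} (h : PolyBd p M J) (n : ℕ) :
    PolyBd (p ^ n) (M ^ n) (n * J) := fun y hy => by
  rw [map_pow]
  exact (Nat.pow_le_pow_left (h y hy) n).trans_eq (by ring)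

lemma bev_monomial {S : Type*} [CommSemiring S] (y x : S) (n : ℕ) :
    bev y x ((n : ℕ[X][X]) * ((C X) ^ l.E * X ^ l.N)) = n * (y ^ l.E * x ^ l.N) := by
  simp only [map_mul, map_natCast, map_pow, bev_X, bev_C_X]

lemma polyBd_monomial (l : Lay) (n : ℕ) :
    PolyBd ((n : ℕ[X][X]) * ((C X) ^ l.E * X ^ l.N)) n l.E := by
  simpa using (polyBd_natCast n).mul ((polyBd_pow polyBd_C_X l.E).mul (polyBd_pow polyBd_X l.N))

theorem mul (h : Encl l η ζ t v) (h' : Encl l η ζ u w) (hη : ‖η‖ = 1) (hζ : ‖ζ‖ = 1) :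
    Encl l η ζ (TM.mul l t u) (v * w) := by
  refine encl_redCert hη hζ (C := ((2 ^ 44 : ℕ) : ℕ[X][X]) * ((C X) ^ l.E * X ^ l.N))
    (Nat.pow_pos two_pos) (bev_monomial _ _ _) ?_ (polyBd_monomial l _) fun ho => ?_
  · rw [bev_monomial, norm_mul, norm_shift hη hζ, mul_one, Complex.norm_natCast]
  · rw [Bool.and_eq_true] at ho
    obtain ⟨p, q, hp, hq, he⟩ := h ho.1
    obtain ⟨p', q', hp', hq', he'⟩ := h' ho.2
    have hJ : 2 * l.E + 1 + (2 * l.E + 1) ≤ 4 * l.E + 2 := by omega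
    refine ⟨p * p' + q * q', p * q' + q * p', ?_, ?_, ?_, ?_, ?_⟩
    · simp only [map_add, map_mul, hp.1, hp'.1, hq.1, hq'.1]
    · simp only [map_add, map_mul, hp.1, hp'.1, hq.1, hq'.1]
    · refine ((hp.2.mul hp'.2).add (hq.2.mul hq'.2)).mono ?_ hJ
      simp only [TM.mass]; nlinarith
    · refine ((hp.2.mul hq'.2).add (hq.2.mul hp'.2)).mono ?_ hJ
      simp only [TM.mass]; nlinarith
    · have hn := norm_le hη hζ hp hq
      have hn' := norm_le hη hζ hp' hq'
      rw [bev_monomial]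
      simp only [map_add, map_mul]
      set a := bev η ζ p - bev η ζ q
      set b := bev η ζ p' - bev η ζ q'
      set z := 2 ^ 44 * (η ^ l.E * ζ ^ l.N) * v
      set z' := 2 ^ 44 * (η ^ l.E * ζ ^ l.N) * w
      have h1 : ((2 ^ 44 : ℕ) : ℂ) * (η ^ l.E * ζ ^ l.N) *
          (2 ^ 44 * (η ^ l.E * ζ ^ l.N) * (v * w)) -
          (bev η ζ p * bev η ζ p' + bev η ζ q * bev η ζ q' -
            (bev η ζ p * bev η ζ q' + bev η ζ q * bev η ζ p')) =
          (z - a) * b + (z' - b) * a + (z - a) * (z' - b) := by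
        simp only [z, z', a, b]
        push_cast
        ring
      rw [h1]
      refine (norm_add₃_le).trans ?_
      rw [norm_mul, norm_mul, norm_mul]
      simp only [TM.mass]
      push_cast
      gcongr

theorem ofPair {A B : ℕ} {p q : ℕ[X][X]} (hp : bev baseY l.baseX p = A)
    (hq : bev baseY l.baseX q = B) (hpb : ∃ M, M < 2 ^ 128 ∧ PolyBd p M (2 * l.E + 1))
    (hqb : ∃ M, M < 2 ^ 128 ∧ PolyBd q M (2 * l.E + 1))
    (hv : 2 ^ 44 * (η ^ l.E * ζ ^ l.N) * v = bev η ζ p - bev η ζ q) :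
    Encl l η ζ (TM.ofPair l A B) v := fun hok => by
  simp only [TM.ofPair, Bool.and_eq_true, beq_iff_eq] at hok
  have key : ∀ {A : ℕ} {p : ℕ[X][X]}, bev baseY l.baseX p = A →
      (∃ M, M < 2 ^ 128 ∧ PolyBd p M (2 * l.E + 1)) → A &&& l.window = A → Packs l A p := by
    rintro A p hp ⟨M, hM, hpb⟩ hA
    obtain ⟨p', hp'⟩ := exists_packs hA
    have : p = p' := PolyBd.eq_of_bev_eq (Y := baseY) (L := 4 * l.E + 4) hpb hp'.2 hM
      ((Nat.mod_lt _ (by norm_num)).trans (by norm_num [baseY])) (by omega)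
      (by rw [← Lay.baseX_eq, hp, hp'.1])
    exact this ▸ hp'
  refine ⟨p, q, key hp hpb hok.1, key hq hqb hok.2, ?_⟩
  rw [hv]
  simp [TM.ofPair]

end Encl

end LCHill

namespace LCHill

/-- The combination `∑ g (r j) * v (i + j)`. -/
def rowSum {S : Type*} [Semiring S] (g : ℤ → S) (v : ℕ → S) : List ℤ → ℕ → S
  | [], _ => 0
  | d :: r, j => g d * v j + rowSum g v r (j + 1)

/-- The combination `∑ g (T k j) * v j * w (i + k)`. -/
def tabSum {S : Type*} [Semiring S] (g : ℤ → S) (v w : ℕ → S) : List (List ℤ) → ℕ → S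
  | [], _ => 0
  | r :: t, k => rowSum g v r 0 * w k + tabSum g v w t (k + 1)

/-- `rowSum` for natural numbers, without the overhead of type classes. -/
def rowNat (g : ℤ → ℕ) (v : ℕ → ℕ) : List ℤ → ℕ → ℕ
  | [], _ => 0
  | d :: r, j => g d * v j + rowNat g v r (j + 1)

/-- `tabSum` for natural numbers, without the overhead of type classes. -/
def tabNat (g : ℤ → ℕ) (v w : ℕ → ℕ) : List (List ℤ) → ℕ → ℕ
  | [], _ => 0
  | r :: t, k => rowNat g v r 0 * w k + tabNat g v w t (k + 1)

/-- The positive part of an integer, or the negative part. -/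
def intPart (b : Bool) (d : ℤ) : ℕ := bif b then d.toNat else (-d).toNat

namespace TM

/-- The weight of a coefficient of a table in the packed polynomial. -/
def colWeight (l : Lay) (j : ℕ) : ℕ := baseY ^ (l.E + j) + baseY ^ (l.E - j)

/-- The part of the packed polynomial of a table with exponents at least `N` (or at most `N`). -/
def tabPart (l : Lay) (f : ℕ) (m : ℕ → ℕ) (tab : List (List ℤ)) (b up : Bool) : ℕ :=
  f * tabNat (intPart b) (colWeight l)
    (fun k => m k * bif up then l.baseX ^ (l.N + k) else l.baseX ^ (l.N - k)) tab 0

/-- The sum of the moduli of the coefficients of a table. -/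
def tabMass (f : ℕ) (m : ℕ → ℕ) (tab : List (List ℤ)) : ℕ :=
  f * tabNat Int.natAbs (fun _ => 2) (fun k => m k * 2) tab 0

/-- Enclosure of the trigonometric polynomial with coefficients `m k * T k j` in units of
`4 * f * 2⁻⁴⁴`, even or odd in the outer angle. -/
def ofTab (l : Lay) (f : ℕ) (m : ℕ → ℕ) (odd : Bool) (tab : List (List ℤ)) : TM :=
  let t := ofPair l (tabPart l f m tab true true + tabPart l f m tab (!odd) false)
    (tabPart l f m tab false true + tabPart l f m tab odd false)
  ⟨t.pos, t.neg, t.err, t.ok && tab.length.ble (l.N + 1) &&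
    tab.all (fun r => r.length.ble (l.E + 1)) && (tabMass f m tab).blt (2 ^ 128)⟩

/-- A lower bound for the functions enclosed by `t`, where `r` encloses the difference between
them and the constant `z`; it is `0` if `r` is not valid. -/
def lowCert (z : ℕ) (r : TM) : ℕ := bif r.ok then z - r.bd else 0

/-- A lower bound for the enclosed functions, calculated by comparison with the constant `z`. -/
def low (l : Lay) (z : ℕ) (t : TM) : ℕ := lowCert z (sub l t (const l z))

/-- Enlargement of an approximation `g` of an inverse square root of `x`, where `r` encloses
`g² x - 1` and `g ≥ w > 0`. -/
def recipCert (g r : TM) (w : ℕ) : TM :=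
  ⟨g.pos, g.neg, g.err + (6 * r.bd * g.bd / (10 * 2 ^ 44) + 1),
    g.ok && r.ok && Nat.ble (10 * r.bd) (2 ^ 44) && Nat.blt 0 w⟩

/-- Enclosure of the inverse square root of `x`, given an approximation `g`. -/
def recip (l : Lay) (z : ℕ) (g x : TM) : TM :=
  recipCert g (sub l (mul l (mul l g g) x) (const l (2 ^ 44)))
    (low l z g)

end TM

/-- Tables of a reference orbit and of its moving frame for an interval of mass parameters,
together with the constants in the estimates for the linearized flow. -/
structure Slice where
  lay : Lay
  /-- Sense of rotation. -/
  dir : Bool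
  (rr pp gg la al be ka om : List (List ℤ))
  (tn mid rad A B₁ B₂ e₁ e₂ ε σ m R : ℕ)

namespace Slice

variable (S : Slice) (b : Bool)

/-- Enclosure of a constant. -/
def cst (z : ℕ) : TM := TM.const S.lay z

/-- The leading coefficient of a table. -/
def lead (tab : List (List ℤ)) : ℕ := ((tab.headD []).headD 0).toNat

/-- The unit of the tables of fine resolution. -/
def fine : ℕ := 2 ^ 8

/-- The unit of the tables of coarse resolution. -/
def coarse : ℕ := 2 ^ 26

/-- Enclosure of a product. -/
def mul (t u : TM) : TM := TM.mul S.lay t u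
/-- Enclosure of a sum. -/
def add (t u : TM) : TM := TM.add S.lay t u
/-- Enclosure of a difference. -/
def sub (t u : TM) : TM := TM.sub S.lay t u

/-- Enclosure of a table. -/
def tab (f : ℕ) (odd : Bool) (T : List (List ℤ)) : TM := TM.ofTab S.lay f (fun _ => 1) odd T

/-- Enclosure of the derivative of a table. -/
def der (f : ℕ) (odd : Bool) (T : List (List ℤ)) : TM := TM.ofTab S.lay f (fun k => k) odd T

def tal : TM := S.tab coarse false S.al
def tka : TM := S.tab coarse false S.ka
def tom : TM := S.tab coarse false S.om
def tbe : TM := S.tab coarse true S.be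
def tcos : TM := S.tab 1 false [[], [2 ^ 42]]
def tmu : TM := S.tab 1 false [[S.mid, S.rad]]
def tc : TM := (S.cst 36943599489367).widen 8972015
def one : TM := S.cst (2 ^ 44)
def two : TM := S.cst (2 ^ 45)
def three : TM := S.cst (3 * 2 ^ 44)
def four : TM := S.cst (2 ^ 46)
def six : TM := S.cst (6 * 2 ^ 44)
def eight : TM := S.cst (2 ^ 47)
def half : TM := S.cst (2 ^ 43)
def wid₁ : ℕ := S.tn * S.tal.bd / 2 ^ 30 + 1
def wid₂ : ℕ := S.tn * (S.tbe.bd + S.tka.bd) / 2 ^ 30 + 1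
def trr : TM := S.tab fine false S.rr
def tpp : TM := S.tab fine true S.pp
def rho : TM := bif b then S.trr.widen S.wid₁ else S.trr
def mom : TM := bif b then S.tpp.widen S.wid₂ else S.tpp
def rho2 : TM := S.mul (S.rho b) (S.rho b)
def rho3 : TM := S.mul (S.rho2 b) (S.rho b)
def rho4 : TM := S.mul (S.rho2 b) (S.rho2 b)
def dist : TM := S.add (S.sub S.one (S.mul S.two (S.mul (S.rho b) S.tcos))) (S.rho2 b)
def gr : TM := TM.recip S.lay (4 * fine * lead S.gg) (S.tab fine false S.gg) (S.dist b)
def gr2 : TM := S.mul (S.gr b) (S.gr b)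
def gr3 : TM := S.mul (S.gr2 b) (S.gr b)
def gr5 : TM := S.mul (S.gr3 b) (S.gr2 b)
def r3C : TM := S.mul (S.rho3 b) S.tcos
def mr : TM := S.mul S.tmu (S.r3C b)
def mu2r : TM := S.mul (S.mul S.tmu S.tmu) (S.rho2 b)
def onem : TM := S.mul (S.sub S.one S.tmu) (S.rho b)
def cr : TM := S.mul S.tc (S.rho2 b)
def ang : TM := S.mul S.half (S.sub (S.add (S.add (S.onem b) (S.mul S.tmu (S.mul (S.rho2 b)
  (S.gr b)))) (S.mul S.half (S.add (S.sub (S.rho4 b) (S.mul S.two (S.mr b))) (S.mu2r b))))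
  (S.cr b))
def inner : TM := S.sub (S.mul S.two (S.mul (S.rho2 b) (S.gr b)))
  (S.mul (S.sub (S.rho4 b) (S.r3C b)) (S.gr3 b))
def angE : TM := S.mul S.half (S.sub (S.add (S.add (S.onem b) (S.mul S.tmu (S.inner b)))
  (S.mul S.half (S.add (S.sub (S.mul S.four (S.rho4 b)) (S.mul S.six (S.mr b)))
  (S.mul S.two (S.mu2r b))))) (S.mul S.two (S.cr b)))
def lsq : TM := S.add (S.ang b) (S.mul (S.mom b) (S.mom b))
def lam : TM := TM.recip S.lay (4 * fine * lead S.la) (S.tab fine false S.la) (S.lsq b)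
def v : TM := S.mul (S.mom b) (S.lam b)
def u : TM := S.mul S.half (S.mul (S.angE b) (S.lam b))
def f₁ : TM := S.mul (S.rho b) (S.v b)
def f₂ : TM := bif S.dir then S.sub (S.u b) (S.rho2 b) else S.add (S.u b) (S.rho2 b)
def d₁ : TM := S.add (S.f₁ false) (S.der fine true S.rr)
def d₂ : TM := S.sub (S.f₂ false) (S.der fine false S.pp)
def w : TM := S.mul (S.u true) (S.lam true)
def sin2 : TM := S.sub S.one (S.mul S.tcos S.tcos)
def angQ : TM := S.mul S.half (S.add (S.sub (S.mul S.tmu (S.sub (S.mul (S.sub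
  (S.mul S.three (S.r3C true)) (S.rho4 true)) (S.gr3 true)) (S.mul S.three (S.mul (S.mul
  (S.rho4 true) S.sin2) (S.gr5 true))))) (S.onem true)) (S.mul S.half (S.sub
  (S.mul S.eight (S.rho4 true)) (S.mul S.six (S.mr true)))))
def j21 : TM := S.add (S.mul S.two (S.f₂ true)) (S.mul (S.sub (S.mul S.half S.angQ)
  (S.mul (S.u true) (S.u true))) (S.lam true))
def j22 : TM := S.mul (S.v true) S.w
def j11 : TM := S.sub (S.v true) S.j22
def j12 : TM := S.mul (S.mul (S.rho true) (S.lam true))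
  (S.sub S.one (S.mul (S.v true) (S.v true)))
def e11 : TM := S.add (S.add (S.mul S.j11 S.tal) (S.mul S.j12 S.tbe)) (S.der coarse true S.al)
def e12 : TM := S.sub (S.mul S.j12 S.tka) (S.mul S.tom S.tal)
def e22 : TM := S.sub (S.add (S.mul S.j22 S.tka) (S.der coarse true S.ka)) (S.mul S.tbe S.tom)
def e21 : TM := S.add (S.mul S.j21 S.tal) (S.mul (S.rho true) (S.sub (S.sub
  (S.mul S.tom S.tka) (S.mul S.j22 S.tbe)) (S.der coarse false S.be)))
def hill : TM := S.sub (S.sub S.one S.tmu) (S.mul (S.sub S.tc S.tmu) (S.rho true))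
def sense : TM := S.mul (S.rho2 true) (S.lam true)
def rot : TM := S.tab coarse false [S.om.headD []]

/-- The lower bounds. -/
def lrho : ℕ := TM.low S.lay (4 * fine * lead S.rr) (S.rho true)
def lal : ℕ := TM.low S.lay (4 * coarse * lead S.al) S.tal
def lka : ℕ := TM.low S.lay (4 * coarse * lead S.ka) S.tka
def lhill : ℕ := TM.low S.lay (2 * 2 ^ 42) S.hill
def lrot : ℕ := TM.low S.lay (4 * coarse * lead S.om) S.rot
def urot : ℕ := 4 * coarse * lead S.om +
  (S.sub S.rot (S.cst (4 * coarse * lead S.om))).bd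

/-- All enclosures used in the estimates are valid. -/
def checkOk : Bool := S.tal.ok && S.tka.ok && S.tbe.ok && S.tom.ok && (S.rho true).ok &&
  (S.gr true).ok && (S.lam true).ok && S.d₁.ok && S.d₂.ok && S.e11.ok && S.e12.ok && S.e21.ok &&
  S.e22.ok && S.sense.ok

/-- The bounds at the points of the tube. -/
def checkTube : Bool := Nat.blt 0 S.lrho && Nat.blt 0 S.lal && Nat.blt 0 S.lka &&
  Nat.blt 0 S.lhill && Nat.blt (S.rho true).bd (2 ^ 44) && Nat.blt S.sense.bd (2 ^ 45) &&
  Nat.ble (S.e11.bd * 2 ^ 30) (S.A * S.lal) &&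
  Nat.ble (S.e12.bd * 2 ^ 30) (S.B₁ * S.lal) &&
  Nat.ble (S.e22.bd * 2 ^ 30 + S.tbe.bd * S.B₁) (S.A * S.lka) &&
  Nat.ble (S.e21.bd * 2 ^ 74 + S.tbe.bd * S.A * S.lrho) (S.B₂ * S.lka * S.lrho) &&
  Nat.ble (S.d₁.bd * 2 ^ 60) (S.e₁ * (S.tn * S.lal)) &&
  Nat.ble (S.d₂.bd * 2 ^ 60 + S.tn * S.tbe.bd * S.e₁) (S.e₂ * (S.tn * S.lka))

/-- The number of quarter turns of the linearized flow per half turn of the orbit. -/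
def index : ℕ := bif S.dir then 1 else 2

/-- The growth rate of the linearized flow. -/
def rate : ℕ := 2 * S.A + S.B₁ + S.B₂ + 2 * S.ε

/-- The estimates for the linearized flow. -/
def checkFlow : Bool := Nat.blt 0 S.tn && Nat.blt 0 S.ε && Nat.blt 0 S.σ && Nat.blt 0 S.m &&
  Nat.ble (S.e₁ ^ 2 + S.e₂ ^ 2) (S.ε ^ 2) &&
  Nat.blt (S.σ ^ 2 * 10000 + S.rate * 31416 * 2 ^ 30) (10000 * 2 ^ 60) &&
  Nat.ble (S.m ^ 2 * 10000 + S.rate * 31416 * 2 ^ 30) (S.σ ^ 2 * 10000) &&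
  Nat.ble ((S.A + S.B₁) * S.m + S.ε * 2 ^ 30) (S.R * S.m) &&
  Nat.ble ((S.A + S.B₂) * S.m + S.ε * 2 ^ 30) (S.R * S.m) &&
  Nat.blt (S.index * 2 ^ 43 + S.R * 2 ^ 14) S.lrot &&
  Nat.blt (S.urot + S.R * 2 ^ 14) ((S.index + 1) * 2 ^ 43)

/-- The certificate for the orbits of a slice. -/
def check : Bool := S.checkOk && S.checkTube && S.checkFlow

end Slice

end LCHill

namespace LCHill

section

variable {S S' : Type*} [Semiring S] [Semiring S']

lemma map_rowSum (F : S →+* S') (g : ℤ → S) (v : ℕ → S) (r : List ℤ) (j : ℕ) :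
    F (rowSum g v r j) = rowSum (fun d => F (g d)) (fun j => F (v j)) r j := by
  induction r generalizing j with
  | nil => simp [rowSum]
  | cons d r ih => simp [rowSum, ih]

lemma map_tabSum (F : S →+* S') (g : ℤ → S) (v w : ℕ → S) (t : List (List ℤ)) (k : ℕ) :
    F (tabSum g v w t k) =
      tabSum (fun d => F (g d)) (fun j => F (v j)) (fun k => F (w k)) t k := by
  induction t generalizing k with
  | nil => simp [tabSum]
  | cons r t ih => simp [tabSum, ih, map_rowSum]

lemma rowNat_eq (g : ℤ → ℕ) (v : ℕ → ℕ) (r : List ℤ) (j : ℕ) :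
    rowNat g v r j = rowSum g v r j := by
  induction r generalizing j with
  | nil => rfl
  | cons d r ih => simp [rowSum, rowNat, ih]

lemma tabNat_eq (g : ℤ → ℕ) (v w : ℕ → ℕ) (t : List (List ℤ)) (k : ℕ) :
    tabNat g v w t k = tabSum g v w t k := by
  induction t generalizing k with
  | nil => rfl
  | cons r t ih => simp [tabSum, tabNat, ih, rowNat_eq]

lemma rowSum_congr (g : ℤ → S) {v v' : ℕ → S} {J : ℕ} (h : ∀ j < J, v j = v' j) (r : List ℤ)
    (j : ℕ) (hr : j + r.length ≤ J) : rowSum g v r j = rowSum g v' r j := by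
  induction r generalizing j with
  | nil => rfl
  | cons d r ih =>
    simp only [List.length_cons] at hr
    simp [rowSum, ih (j + 1) (by omega), h j (by omega)]

lemma tabSum_congr (g : ℤ → S) {v v' w w' : ℕ → S} {J K : ℕ} (h : ∀ j < J, v j = v' j)
    (hw : ∀ k < K, w k = w' k) (t : List (List ℤ)) (ht : ∀ r ∈ t, r.length ≤ J) (k : ℕ)
    (hk : k + t.length ≤ K) : tabSum g v w t k = tabSum g v' w' t k := by
  induction t generalizing k with
  | nil => rfl
  | cons r t ih =>
    simp only [List.length_cons] at hk
    simp only [List.mem_cons, forall_eq_or_imp] at ht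
    simp [tabSum, ih ht.2 (k + 1) (by omega), hw k (by omega),
      rowSum_congr g h r 0 (by omega)]

lemma rowSum_le {g g' : ℤ → ℕ} (hg : ∀ d, g d ≤ g' d) {v v' : ℕ → ℕ} {J : ℕ}
    (h : ∀ j < J, v j ≤ v' j) (r : List ℤ) (j : ℕ) (hr : j + r.length ≤ J) :
    rowSum g v r j ≤ rowSum g' v' r j := by
  induction r generalizing j with
  | nil => exact le_rfl
  | cons d r ih =>
    simp only [List.length_cons] at hr
    exact add_le_add (Nat.mul_le_mul (hg d) (h j (by omega))) (ih (j + 1) (by omega))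

lemma tabSum_le {g g' : ℤ → ℕ} (hg : ∀ d, g d ≤ g' d) {v v' w w' : ℕ → ℕ} {J : ℕ}
    (h : ∀ j < J, v j ≤ v' j) (hw : ∀ k, w k ≤ w' k) (t : List (List ℤ))
    (ht : ∀ r ∈ t, r.length ≤ J) (k : ℕ) : tabSum g v w t k ≤ tabSum g' v' w' t k := by
  induction t generalizing k with
  | nil => exact le_rfl
  | cons r t ih =>
    simp only [List.mem_cons, forall_eq_or_imp] at ht
    exact add_le_add (Nat.mul_le_mul (rowSum_le hg h r 0 (by omega)) (hw k)) (ih ht.2 (k + 1))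

end

section

variable {S : Type*} [CommRing S]

lemma rowSum_mul (a : S) (g : ℤ → S) (v : ℕ → S) (r : List ℤ) (j : ℕ) :
    rowSum g (fun j => a * v j) r j = a * rowSum g v r j := by
  induction r generalizing j with
  | nil => simp [rowSum]
  | cons d r ih => simp only [rowSum, ih]; ring

lemma tabSum_mul (a b : S) (g : ℤ → S) (v w : ℕ → S) (t : List (List ℤ)) (k : ℕ) :
    tabSum g (fun j => a * v j) (fun k => b * w k) t k = a * b * tabSum g v w t k := by
  induction t generalizing k with
  | nil => simp [tabSum]
  | cons r t ih => simp only [tabSum, ih, rowSum_mul]; ring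

lemma tabSum_add (g : ℤ → S) (v w w' : ℕ → S) (t : List (List ℤ)) (k : ℕ) :
    tabSum g v (fun k => w k + w' k) t k = tabSum g v w t k + tabSum g v w' t k := by
  induction t generalizing k with
  | nil => simp [tabSum]
  | cons r t ih => simp only [tabSum, ih]; ring

lemma rowSum_sub (g g' : ℤ → S) (v : ℕ → S) (r : List ℤ) (j : ℕ) :
    rowSum g v r j - rowSum g' v r j = rowSum (fun d => g d - g' d) v r j := by
  induction r generalizing j with
  | nil => simp [rowSum]
  | cons d r ih => simp only [rowSum, ← ih]; ring

lemma tabSum_sub (g g' : ℤ → S) (v w : ℕ → S) (t : List (List ℤ)) (k : ℕ) :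
    tabSum g v w t k - tabSum g' v w t k = tabSum (fun d => g d - g' d) v w t k := by
  induction t generalizing k with
  | nil => simp [tabSum]
  | cons r t ih => simp only [tabSum, ← ih, ← rowSum_sub]; ring

lemma tabSum_neg (g : ℤ → S) (v w : ℕ → S) (t : List (List ℤ)) (k : ℕ) :
    tabSum g v (fun k => -w k) t k = -tabSum g v w t k := by
  simpa using tabSum_mul 1 (-1) g v w t k

lemma tabSum_eq_zero (g : ℤ → S) (v : ℕ → S) {w : ℕ → S} (hw : ∀ k, 0 < k → w k = 0)
    (t : List (List ℤ)) (k : ℕ) (hk : 0 < k) : tabSum g v w t k = 0 := by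
  induction t generalizing k with
  | nil => simp [tabSum]
  | cons r t ih => simp [tabSum, hw k hk, ih (k + 1) (by omega)]

end

lemma HasDerivAt.tabSum (g : ℤ → ℝ) (v : ℕ → ℝ) {w w' : ℕ → ℝ → ℝ} {θ : ℝ}
    (h : ∀ k, HasDerivAt (w k) (w' k θ) θ) (t : List (List ℤ)) (k : ℕ) :
    HasDerivAt (fun x => LCHill.tabSum g v (fun k => w k x) t k)
      (LCHill.tabSum g v (fun k => w' k θ) t k) θ := by
  induction t generalizing k with
  | nil => exact hasDerivAt_const _ _
  | cons r t ih => exact ((h k).const_mul _).add (ih (k + 1))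

lemma continuous_tabSum (g : ℤ → ℝ) (v : ℕ → ℝ) {w : ℕ → ℝ → ℝ}
    (h : ∀ k, Continuous (w k)) (t : List (List ℤ)) (k : ℕ) :
    Continuous (fun x => tabSum g v (fun k => w k x) t k) := by
  induction t generalizing k with
  | nil => exact continuous_const
  | cons r t ih => exact ((h k).const_mul _).add (ih (k + 1))

/-- The factor `cos (k θ)` or `sin (k θ)`. -/
def trig (odd : Bool) (k : ℕ) (θ : ℝ) : ℝ := bif odd then Real.sin (k * θ) else Real.cos (k * θ)

/-- The trigonometric polynomial with coefficients `m k * T k j` in units of `4 * f * 2⁻⁴⁴`. -/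
def trigVal (f : ℕ) (m : ℕ → ℕ) (odd : Bool) (tab : List (List ℤ)) (φ θ : ℝ) : ℝ :=
  4 * f / 2 ^ 44 * tabSum Int.cast (fun j => Real.cos (j * φ)) (fun k => m k * trig odd k θ) tab 0

/-- The primitive of an even trigonometric polynomial. -/
def trigInt (f : ℕ) (tab : List (List ℤ)) (φ θ : ℝ) : ℝ :=
  4 * f / 2 ^ 44 * tabSum Int.cast (fun j => Real.cos (j * φ))
    (fun k => if k = 0 then θ else Real.sin (k * θ) / k) tab 0

section

variable (f : ℕ) (m : ℕ → ℕ) (tab : List (List ℤ)) (φ θ : ℝ)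

lemma continuous_trigVal (odd : Bool) : Continuous (trigVal f m odd tab φ) :=
  (continuous_tabSum _ _ (fun k => by cases odd <;> simp only [trig, cond] <;> fun_prop)
    tab 0).const_mul _

lemma hasDerivAt_trigVal_even : HasDerivAt (trigVal f (fun _ => 1) false tab φ)
    (-trigVal f (fun k => k) true tab φ θ) θ := by
  have h := (HasDerivAt.tabSum Int.cast (fun j => Real.cos (j * φ))
    (w := fun k x => (1 : ℕ) * trig false k x) (w' := fun k x => -((k : ℝ) * trig true k x))
    (θ := θ) (fun k => ?_) tab 0).const_mul (4 * (f : ℝ) / 2 ^ 44)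
  · exact h.congr_deriv (by rw [tabSum_neg, trigVal]; ring)
  · simp only [trig, cond, Nat.cast_one, one_mul]
    refine ((hasDerivAt_id θ).const_mul (k : ℝ)).cos.congr_deriv ?_
    simp; ring

lemma hasDerivAt_trigVal_odd : HasDerivAt (trigVal f (fun _ => 1) true tab φ)
    (trigVal f (fun k => k) false tab φ θ) θ := by
  refine (HasDerivAt.tabSum Int.cast (fun j => Real.cos (j * φ))
    (w := fun k x => (1 : ℕ) * trig true k x) (w' := fun k x => (k : ℝ) * trig false k x)
    (θ := θ) (fun k => ?_) tab 0).const_mul (4 * (f : ℝ) / 2 ^ 44)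
  simp only [trig, cond, Nat.cast_one, one_mul]
  refine ((hasDerivAt_id θ).const_mul (k : ℝ)).sin.congr_deriv ?_
  simp; ring

lemma trigVal_even_neg : trigVal f m false tab φ (-θ) = trigVal f m false tab φ θ := by
  simp [trigVal, trig]

lemma trigVal_odd_neg : trigVal f m true tab φ (-θ) = -trigVal f m true tab φ θ := by
  simp [trigVal, trig, tabSum_neg]

lemma trigVal_periodic (odd : Bool) :
    Function.Periodic (trigVal f m odd tab φ) (2 * Real.pi) := fun θ => by
  have h : ∀ k : ℕ, trig odd k (θ + 2 * Real.pi) = trig odd k θ := fun k => by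
    cases odd <;> simp [trig, mul_add, Real.cos_add_nat_mul_two_pi, Real.sin_add_nat_mul_two_pi]
  simp only [trigVal, h]

lemma hasDerivAt_trigInt : HasDerivAt (trigInt f tab φ)
    (trigVal f (fun _ => 1) false tab φ θ) θ := by
  refine (HasDerivAt.tabSum Int.cast (fun j => Real.cos (j * φ))
    (w := fun k x => if k = 0 then x else Real.sin (k * x) / k)
    (w' := fun k x => (1 : ℕ) * trig false k x)
    (θ := θ) (fun k => ?_) tab 0).const_mul (4 * (f : ℝ) / 2 ^ 44)
  rcases eq_or_ne k 0 with rfl | hk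
  · simpa [trig] using hasDerivAt_id' θ
  · have hk' : (k : ℝ) ≠ 0 := by exact_mod_cast hk
    simp only [hk, if_false, trig, cond, Nat.cast_one, one_mul]
    refine (((hasDerivAt_id θ).const_mul (k : ℝ)).sin.div_const (k : ℝ)).congr_deriv ?_
    simp; field_simp

lemma trigInt_sub (n : ℕ) : trigInt f tab φ (n * Real.pi) - trigInt f tab φ 0 =
    n * Real.pi * trigVal f (fun _ => 1) false [tab.headD []] φ 0 := by
  have h : ∀ k : ℕ, 0 < k →
      (if k = 0 then (n * Real.pi) else Real.sin (k * (n * Real.pi)) / k) = 0 := fun k hk => by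
    rw [if_neg hk.ne', ← mul_assoc, ← Nat.cast_mul, Real.sin_nat_mul_pi, zero_div]
  have h' : ∀ k : ℕ, 0 < k →
      (if k = 0 then (0 : ℝ) else Real.sin (k * 0) / k) = 0 := fun k hk => by simp
  cases tab with
  | nil => simp [trigInt, trigVal, tabSum, rowSum]
  | cons r t =>
    simp only [trigInt, trigVal, tabSum, List.headD_cons, zero_add,
      tabSum_eq_zero _ _ h t 1 one_pos, tabSum_eq_zero _ _ h' t 1 one_pos, trig]
    simp; ring

end

end LCHill

namespace LCHill

open Polynomial

/-- The polynomial encoded by `TM.tabPart`. -/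
def tabPoly (l : Lay) (f : ℕ) (m : ℕ → ℕ) (tab : List (List ℤ)) (b up : Bool) : ℕ[X][X] :=
  f * tabSum (fun d => (intPart b d : ℕ[X][X]))
    (fun j => (C X) ^ (l.E + j) + (C X) ^ (l.E - j))
    (fun k => (m k : ℕ[X][X]) * bif up then X ^ (l.N + k) else X ^ (l.N - k)) tab 0

section

variable (l : Lay) (f : ℕ) (m : ℕ → ℕ) (tab : List (List ℤ)) (b up : Bool)

lemma bev_tabPoly {S : Type*} [CommSemiring S] (y x : S) : bev y x (tabPoly l f m tab b up) =
    f * tabSum (fun d => (intPart b d : S)) (fun j => y ^ (l.E + j) + y ^ (l.E - j))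
      (fun k => m k * bif up then x ^ (l.N + k) else x ^ (l.N - k)) tab 0 := by
  rw [tabPoly, map_mul, map_natCast, map_tabSum]
  cases up <;> simp [bev_X, bev_C_X]

lemma bev_tabPoly_nat :
    bev baseY l.baseX (tabPoly l f m tab b up) = TM.tabPart l f m tab b up := by
  rw [bev_tabPoly, TM.tabPart, tabNat_eq]
  rfl

lemma intPart_le (d : ℤ) : intPart b d ≤ d.natAbs := by
  cases b <;> simp only [intPart, cond] <;> omega

lemma intPart_sub {S : Type*} [Ring S] (d : ℤ) :
    (intPart true d : S) - (intPart false d : S) = d := by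
  have h : ((intPart true d : ℤ)) - (intPart false d : ℤ) = d := by
    simp only [intPart, cond]; omega
  exact_mod_cast congrArg (Int.cast : ℤ → S) h

lemma polyBd_tabPoly_add (b' up' : Bool) (h : ∀ r ∈ tab, r.length ≤ l.E + 1) :
    PolyBd (tabPoly l f m tab b up + tabPoly l f m tab b' up') (TM.tabMass f m tab)
      (2 * l.E + 1) := by
  have key : ∀ b up, PolyBd (tabPoly l f m tab b up)
      (f * tabSum Int.natAbs (fun _ => 2) (fun k => m k * 1) tab 0) (2 * l.E + 1) := by
    intro b up y hy
    rw [bev_tabPoly]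
    have h1 := tabSum_le (g := fun d => intPart b d) (g' := Int.natAbs)
      (v := fun j => y ^ (l.E + j) + y ^ (l.E - j)) (v' := fun j => y ^ (2 * l.E + 1) * 2)
      (w := fun k => m k * 1) (w' := fun k => 1 * (m k * 1)) (J := l.E + 1)
      (intPart_le b) (fun j hj => ?_) (fun k => by simp) tab h 0
    · have h2 : tabSum Int.natAbs (fun j => y ^ (2 * l.E + 1) * 2) (fun k => 1 * (m k * 1)) tab 0 =
          y ^ (2 * l.E + 1) * tabSum Int.natAbs (fun _ => 2) (fun k => m k * 1) tab 0 := by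
        have := tabSum_mul ((y : ℤ) ^ (2 * l.E + 1)) 1 (fun d => (d.natAbs : ℤ)) (fun _ => 2)
          (fun k => (m k : ℤ) * 1) tab 0
        have e := map_tabSum (Nat.castRingHom ℤ) Int.natAbs (fun j => y ^ (2 * l.E + 1) * 2)
          (fun k => 1 * (m k * 1)) tab 0
        have e' := map_tabSum (Nat.castRingHom ℤ) Int.natAbs (fun _ => 2)
          (fun k => m k * 1) tab 0
        simp only [Nat.coe_castRingHom] at e e'
        push_cast at e e' this
        zify
        rw [e, e', this]
        ring
      rw [h2] at h1
      have h3 : ∀ k, (m k * bif up then 1 ^ (l.N + k) else 1 ^ (l.N - k)) = m k * 1 := fun k => by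
        cases up <;> simp
      simp only [h3, Nat.cast_id]
      calc _ ≤ f * _ := Nat.mul_le_mul le_rfl h1
        _ = _ := by ring
    · have h1 := Nat.pow_le_pow_right hy (show l.E + j ≤ 2 * l.E + 1 by omega)
      have h2 := Nat.pow_le_pow_right hy (show l.E - j ≤ 2 * l.E + 1 by omega)
      show _ ≤ _
      omega
  refine ((key b up).add (key b' up')).mono (le_of_eq ?_) le_rfl
  have e := map_tabSum (Nat.castRingHom ℤ) Int.natAbs (fun _ => 2) (fun k => m k * 1) tab 0
  have e' := map_tabSum (Nat.castRingHom ℤ) Int.natAbs (fun _ => 2) (fun k => m k * 2) tab 0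
  have h1 := tabSum_mul (1 : ℤ) 2 (fun d => (d.natAbs : ℤ)) (fun _ => 2)
    (fun k => (m k : ℤ) * 1) tab 0
  rw [TM.tabMass, tabNat_eq]
  simp only [Nat.coe_castRingHom] at e e'
  push_cast at e e' h1
  zify
  rw [e, e', show (fun k => (m k : ℤ) * 2) = fun k => 2 * ((m k : ℤ) * 1) by ext; ring]
  rw [show (fun _ : ℕ => (2 : ℤ)) = fun _ : ℕ => 1 * (2 : ℤ) by ext; ring] at *
  rw [h1]
  ring

end

/-- The complex value enclosed by a table. -/
def trigC (f : ℕ) (m : ℕ → ℕ) (odd : Bool) (tab : List (List ℤ)) (φ θ : ℝ) : ℂ :=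
  (bif odd then Complex.I else 1) * trigVal f m odd tab φ θ

lemma exp_pow_add {N k : ℕ} (hk : k < N + 1) (θ : ℝ) :
    Complex.exp (θ * Complex.I) ^ (N + k) + Complex.exp (θ * Complex.I) ^ (N - k) =
      Complex.exp (θ * Complex.I) ^ N * (2 * Real.cos (k * θ)) ∧
    Complex.exp (θ * Complex.I) ^ (N + k) - Complex.exp (θ * Complex.I) ^ (N - k) =
      Complex.exp (θ * Complex.I) ^ N * (2 * Complex.I * Real.sin (k * θ)) := by
  have h0 := Complex.exp_ne_zero (θ * Complex.I)
  rw [pow_add, pow_sub₀ _ h0 (by omega), ← Complex.exp_nat_mul _ k, ← Complex.exp_neg]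
  have h1 : (k : ℂ) * (θ * Complex.I) = ((k * θ : ℝ) : ℂ) * Complex.I := by push_cast; ring
  have h2 : -(((k * θ : ℝ) : ℂ) * Complex.I) = ((-(k * θ) : ℝ) : ℂ) * Complex.I := by
    push_cast; ring
  rw [h1, h2, Complex.exp_mul_I ((k * θ : ℝ) : ℂ), Complex.exp_mul_I ((-(k * θ) : ℝ) : ℂ)]
  simp only [← Complex.ofReal_cos, ← Complex.ofReal_sin, Real.cos_neg, Real.sin_neg]
  constructor <;> push_cast <;> ring

variable {l : Lay}

theorem Encl.ofTab (f : ℕ) (m : ℕ → ℕ) (odd : Bool) (tab : List (List ℤ)) (φ θ : ℝ) :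
    Encl l (Complex.exp (φ * Complex.I)) (Complex.exp (θ * Complex.I))
      (TM.ofTab l f m odd tab) (trigC f m odd tab φ θ) := by
  intro hok
  simp only [TM.ofTab, Bool.and_eq_true, Nat.ble_eq, Nat.blt_eq, List.all_eq_true] at hok
  obtain ⟨⟨⟨hok, hN⟩, hE⟩, hM⟩ := hok
  refine Encl.ofPair (p := tabPoly l f m tab true true + tabPoly l f m tab (!odd) false)
    (q := tabPoly l f m tab false true + tabPoly l f m tab odd false)
    (by simp only [map_add, bev_tabPoly_nat]; rfl) (by simp only [map_add, bev_tabPoly_nat]; rfl)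
    ⟨_, hM, polyBd_tabPoly_add l f m tab _ _ _ _ hE⟩
    ⟨_, hM, polyBd_tabPoly_add l f m tab _ _ _ _ hE⟩ ?_ hok
  set η := Complex.exp (φ * Complex.I)
  set ζ := Complex.exp (θ * Complex.I)
  set v : ℕ → ℂ := fun j => η ^ (l.E + j) + η ^ (l.E - j)
  set T : (ℕ → ℂ) → ℂ := fun w => tabSum Int.cast v w tab 0
  have hT : ∀ w, tabSum (fun d => (intPart true d : ℂ)) v w tab 0 -
      tabSum (fun d => (intPart false d : ℂ)) v w tab 0 = T w := fun w => by
    rw [tabSum_sub]; simp only [intPart_sub]; rfl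
  have h1 := hT fun k => m k * ζ ^ (l.N + k)
  have h2 := hT fun k => m k * ζ ^ (l.N - k)
  have hreal : (trigVal f m odd tab φ θ : ℂ) = 4 * f / 2 ^ 44 * tabSum Int.cast
      (fun j => ((Real.cos (j * φ) : ℝ) : ℂ)) (fun k => m k * ((trig odd k θ : ℝ) : ℂ)) tab 0 := by
    have := map_tabSum Complex.ofRealHom Int.cast (fun j : ℕ => Real.cos (j * φ))
      (fun k => m k * trig odd k θ) tab 0
    simp only [Complex.ofRealHom_eq_coe, Complex.ofReal_mul, Complex.ofReal_intCast,
      Complex.ofReal_natCast] at this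
    simp only [trigVal, Complex.ofReal_mul, Complex.ofReal_div, Complex.ofReal_pow,
      Complex.ofReal_natCast, Complex.ofReal_ofNat, this]
  have hv : ∀ w : ℕ → ℂ, ∀ w' : ℕ → ℂ, ∀ a : ℂ, (∀ k < l.N + 1, w k = a * w' k) →
      T w = η ^ l.E * 2 * a *
        tabSum Int.cast (fun j => ((Real.cos (j * φ) : ℝ) : ℂ)) w' tab 0 := fun w w' a h => by
    rw [← tabSum_mul]
    exact tabSum_congr _ (fun j hj => by
      simp only [v]; rw [(exp_pow_add hj φ).1]; push_cast; ring) h tab hE 0 (by omega)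
  simp only [map_add, bev_tabPoly]
  rw [trigC, hreal]
  cases odd
  · have h3 := hv (fun k => m k * ζ ^ (l.N + k) + m k * ζ ^ (l.N - k))
      (fun k => m k * ((trig false k θ : ℝ) : ℂ)) (ζ ^ l.N * 2) (fun k hk => by
        rw [← mul_add, (exp_pow_add hk θ).1]; simp only [trig, cond]; ring)
    have h4 := tabSum_add Int.cast v (fun k => m k * ζ ^ (l.N + k))
      (fun k => m k * ζ ^ (l.N - k)) tab 0
    simp only [cond, Bool.not_false]
    simp only [T] at h1 h2 h3
    linear_combination -(f : ℂ) * h1 - f * h2 - f * h3 + f * h4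
  · have h3 := hv (fun k => m k * ζ ^ (l.N + k) + -(m k * ζ ^ (l.N - k)))
      (fun k => m k * ((trig true k θ : ℝ) : ℂ)) (ζ ^ l.N * 2 * Complex.I) (fun k hk => by
        rw [← sub_eq_add_neg, ← mul_sub, (exp_pow_add hk θ).2]; simp only [trig, cond]; ring)
    have h4 := tabSum_add Int.cast v (fun k => m k * ζ ^ (l.N + k))
      (fun k => -(m k * ζ ^ (l.N - k))) tab 0
    rw [tabSum_neg] at h4
    simp only [cond, Bool.not_true]
    simp only [T] at h1 h2 h3
    linear_combination -(f : ℂ) * h1 + f * h2 - f * h3 + f * h4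

end LCHill

namespace LCHill

open Polynomial

namespace Encl

variable {l : Lay} {η ζ : ℂ} {t u : TM} {v : ℝ}

theorem const (z : ℕ) :
    Encl l η ζ (TM.const l z) ((z / 2 ^ 44 : ℝ) : ℂ) := fun hok => by
  simp only [TM.const, Bool.and_eq_true, Nat.blt_eq] at hok
  refine Encl.ofPair (p := (z : ℕ[X][X]) * ((C X) ^ l.E * X ^ l.N)) (q := 0)
    (bev_monomial _ _ _) (by simp) ⟨z, hok.2, (polyBd_monomial l z).mono le_rfl (by omega)⟩
    ⟨0, by norm_num, fun y _ => by simp⟩ ?_ hok.1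
  rw [bev_monomial, map_zero]
  push_cast
  ring

theorem abs_le (hη : ‖η‖ = 1) (hζ : ‖ζ‖ = 1) (h : Encl l η ζ t v) (hok : t.ok = true) :
    2 ^ 44 * |v| ≤ t.bd := by
  simpa [Complex.norm_real] using h.bound hη hζ hok

lemma lowCert_add {z : ℕ} {r : TM} (h : 0 < TM.lowCert z r) :
    r.ok = true ∧ TM.lowCert z r + r.bd = z := by
  obtain ⟨P, Q, e, o⟩ := r
  generalize hb : TM.bd ⟨P, Q, e, o⟩ = B
  cases o <;> simp only [TM.lowCert, hb, cond] at h ⊢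
  · exact absurd h (lt_irrefl _)
  · exact ⟨trivial, by omega⟩

theorem low_le (hη : ‖η‖ = 1) (hζ : ‖ζ‖ = 1) (h : Encl l η ζ t v) {z : ℕ}
    (hl : 0 < TM.low l z t) : (TM.low l z t : ℝ) ≤ 2 ^ 44 * v := by
  have h1 := h.sub (const z) hη hζ
  rw [← Complex.ofReal_sub] at h1
  obtain ⟨hr, hz⟩ := lowCert_add hl
  have h2 := h1.abs_le hη hζ hr
  have h3 := neg_abs_le (v - z / 2 ^ 44)
  have h4 : (TM.low l z t : ℝ) + (TM.sub l t (TM.const l z)).bd = z := by exact_mod_cast hz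
  linarith

theorem le_up (hη : ‖η‖ = 1) (hζ : ‖ζ‖ = 1) (h : Encl l η ζ t v) {z : ℕ}
    (hr : (TM.sub l t (TM.const l z)).ok = true) :
    2 ^ 44 * v ≤ (z + (TM.sub l t (TM.const l z)).bd : ℕ) := by
  have h1 := h.sub (const z) hη hζ
  rw [← Complex.ofReal_sub] at h1
  have h2 := h1.abs_le hη hζ hr
  have h3 := le_abs_self (v - z / 2 ^ 44)
  push_cast
  linarith

end Encl

lemma abs_inv_sqrt_sub_le {g x a : ℝ} (hg : 0 < g) (ha : a ≤ 0.1) (h : |g * g * x - 1| ≤ a) :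
    0 < x ∧ |(√x)⁻¹ - g| ≤ 0.6 * a * g := by
  have h1 := abs_le.1 h
  have hx : 0 < x := by
    by_contra hx
    have : g * g * x ≤ 0 := mul_nonpos_of_nonneg_of_nonpos (by positivity) (by linarith)
    linarith
  refine ⟨hx, ?_⟩
  have hs := Real.sqrt_pos.2 hx
  have hs2 : √x * √x = x := Real.mul_self_sqrt hx.le
  set t := g * √x with ht
  have ht0 : 0 < t := by positivity
  have ht2 : g * g * x = t * t := by rw [ht]; linear_combination -(g * g) * hs2
  rw [ht2] at h h1
  have ht3 : 0.94 ≤ t := by nlinarith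
  have h2 : (√x)⁻¹ - g = g * ((1 - t) / t) := by rw [ht]; field_simp
  have h3 : |1 - t| * (t + 1) ≤ a := by
    rw [abs_sub_comm, ← abs_of_pos (show 0 < t + 1 by linarith), ← abs_mul]
    rwa [show (t - 1) * (t + 1) = t * t - 1 by ring]
  rw [h2, abs_mul, abs_of_pos hg, abs_div, abs_of_pos ht0, mul_comm]
  refine mul_le_mul_of_nonneg_right ?_ hg.le
  rw [div_le_iff₀ ht0]
  have h4 := abs_nonneg (1 - t)
  nlinarith

lemma Encl.recipCert {l : Lay} {η ζ : ℂ} (hη : ‖η‖ = 1) (hζ : ‖ζ‖ = 1) {t r : TM} {g x : ℝ}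
    {w : ℕ} (hg : Encl l η ζ t g) (hr : Encl l η ζ r ((g * g * x - 1 : ℝ) : ℂ))
    (hw : 0 < w → w ≤ 2 ^ 44 * g) :
    Encl l η ζ (TM.recipCert t r w) (((√x)⁻¹ : ℝ) : ℂ) ∧
      ((TM.recipCert t r w).ok = true → 0 < x) := by
  have key : (TM.recipCert t r w).ok = true → 0 < x ∧ t.ok = true ∧ 2 ^ 44 * |(√x)⁻¹ - g| ≤
      (6 * r.bd * t.bd / (10 * 2 ^ 44) + 1 : ℕ) := fun hok => by
    simp only [TM.recipCert, Bool.and_eq_true, Nat.blt_eq, Nat.ble_eq] at hok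
    obtain ⟨⟨⟨ht, hrok⟩, ha⟩, hl⟩ := hok
    have h2 := hr.abs_le hη hζ hrok
    have h3 := hw hl
    have h4 := hg.abs_le hη hζ ht
    generalize r.bd = R at *
    generalize t.bd = T at *
    have hlr : (0 : ℝ) < w := by exact_mod_cast hl
    have hg0 : 0 < g := by
      have : (0 : ℝ) < 2 ^ 44 := by positivity
      exact pos_of_mul_pos_right (hlr.trans_le h3) this.le
    rw [abs_of_pos hg0] at h4
    have har : (10 * R : ℝ) ≤ 2 ^ 44 := by exact_mod_cast ha
    obtain ⟨hx0, hd⟩ := abs_inv_sqrt_sub_le (x := x) (a := R / 2 ^ 44) hg0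
      (by rw [div_le_iff₀ (by positivity)]; linarith) (by
        rw [le_div_iff₀ (by positivity)]; linarith)
    refine ⟨hx0, ht, ?_⟩
    have h5 := (Nat.lt_mul_div_succ (6 * R * T) (show 0 < 10 * 2 ^ 44 by norm_num)).le
    have h6 : (6 * R * T : ℝ) ≤
        10 * 2 ^ 44 * ((6 * R * T / (10 * 2 ^ 44) + 1 : ℕ) : ℝ) := by exact_mod_cast h5
    have h7 : 0.6 * (R : ℝ) * (2 ^ 44 * g) ≤ 0.6 * R * T := by gcongr
    have h8 : 2 ^ 44 * |(√x)⁻¹ - g| ≤ 0.6 * R * g := by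
      refine (mul_le_mul_of_nonneg_left hd (by positivity)).trans_eq ?_
      field_simp
    generalize ((6 * R * T / (10 * 2 ^ 44) + 1 : ℕ) : ℝ) = y at *
    linarith
  refine ⟨fun hok => ?_, fun hok => (key hok).1⟩
  obtain ⟨p, q, hp, hq, he⟩ := hg.widen hη hζ (w := (((√x)⁻¹ : ℝ) : ℂ)) (fun _ => by
    rw [← Complex.ofReal_sub, Complex.norm_real]
    exact (key hok).2.2) (key hok).2.1
  exact ⟨p, q, hp, hq, he⟩

/-- Enclosure of an inverse square root. -/
theorem Encl.recip {l : Lay} {η ζ : ℂ} (hη : ‖η‖ = 1) (hζ : ‖ζ‖ = 1) {t u : TM} {g x : ℝ} {z : ℕ}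
    (hg : Encl l η ζ t g) (hx : Encl l η ζ u x) :
    Encl l η ζ (TM.recip l z t u) (((√x)⁻¹ : ℝ) : ℂ) ∧
      ((TM.recip l z t u).ok = true → 0 < x) := by
  have h1 := ((hg.mul hg hη hζ).mul hx hη hζ).sub (Encl.const (2 ^ 44)) hη hζ
  have h2 : (((2 ^ 44 : ℕ) : ℝ) / 2 ^ 44) = 1 := by norm_num
  rw [h2, ← Complex.ofReal_mul, ← Complex.ofReal_mul, ← Complex.ofReal_sub] at h1
  exact Encl.recipCert hη hζ hg h1 (hg.low_le hη hζ)

end LCHill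

namespace LCHill

namespace Slice

variable {S : Slice} {φ θ : ℝ}

section

variable {t u : TM} {v w : ℝ}

/-- The function `v` is enclosed by `t` at the angles `(φ, θ)`. -/
def Re (S : Slice) (φ θ : ℝ) (t : TM) (v : ℝ) : Prop :=
  Encl S.lay (Complex.exp (φ * Complex.I)) (Complex.exp (θ * Complex.I)) t v

/-- The function `I * v` is enclosed by `t` at the angles `(φ, θ)`. -/
def Im (S : Slice) (φ θ : ℝ) (t : TM) (v : ℝ) : Prop :=
  Encl S.lay (Complex.exp (φ * Complex.I)) (Complex.exp (θ * Complex.I)) t (Complex.I * v)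

lemma norm_exp (φ : ℝ) : ‖Complex.exp (φ * Complex.I)‖ = 1 := Complex.norm_exp_ofReal_mul_I φ

lemma Re.congr (h : S.Re φ θ t v) (e : v = w) : S.Re φ θ t w := e ▸ h

lemma Im.congr (h : S.Im φ θ t v) (e : v = w) : S.Im φ θ t w := e ▸ h

lemma Re.mul (h : S.Re φ θ t v) (h' : S.Re φ θ u w) : S.Re φ θ (S.mul t u) (v * w) := by
  have := Encl.mul h h' (norm_exp φ) (norm_exp θ)
  rwa [← Complex.ofReal_mul] at this

lemma Re.add (h : S.Re φ θ t v) (h' : S.Re φ θ u w) : S.Re φ θ (S.add t u) (v + w) := by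
  have := Encl.add h h' (norm_exp φ) (norm_exp θ)
  rwa [← Complex.ofReal_add] at this

lemma Re.sub (h : S.Re φ θ t v) (h' : S.Re φ θ u w) : S.Re φ θ (S.sub t u) (v - w) := by
  have := Encl.sub h h' (norm_exp φ) (norm_exp θ)
  rwa [← Complex.ofReal_sub] at this

lemma Re.mulIm (h : S.Re φ θ t v) (h' : S.Im φ θ u w) : S.Im φ θ (S.mul t u) (v * w) := by
  have := Encl.mul h h' (norm_exp φ) (norm_exp θ)
  rwa [mul_left_comm, ← Complex.ofReal_mul] at this

lemma Im.mulRe (h : S.Im φ θ t v) (h' : S.Re φ θ u w) : S.Im φ θ (S.mul t u) (v * w) := by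
  have := Encl.mul h h' (norm_exp φ) (norm_exp θ)
  rwa [mul_assoc, ← Complex.ofReal_mul] at this

lemma Im.mul (h : S.Im φ θ t v) (h' : S.Im φ θ u w) : S.Re φ θ (S.mul t u) (-(v * w)) := by
  have := Encl.mul h h' (norm_exp φ) (norm_exp θ)
  have e : Complex.I * v * (Complex.I * w) = ((-(v * w) : ℝ) : ℂ) := by
    push_cast; linear_combination (v * w : ℂ) * Complex.I_mul_I
  rwa [e] at this

lemma Im.add (h : S.Im φ θ t v) (h' : S.Im φ θ u w) : S.Im φ θ (S.add t u) (v + w) := by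
  have := Encl.add h h' (norm_exp φ) (norm_exp θ)
  rwa [← mul_add, ← Complex.ofReal_add] at this

lemma Im.sub (h : S.Im φ θ t v) (h' : S.Im φ θ u w) : S.Im φ θ (S.sub t u) (v - w) := by
  have := Encl.sub h h' (norm_exp φ) (norm_exp θ)
  rwa [← mul_sub, ← Complex.ofReal_sub] at this

lemma Re.abs_le (h : S.Re φ θ t v) (hok : t.ok = true) : 2 ^ 44 * |v| ≤ t.bd :=
  Encl.abs_le (norm_exp φ) (norm_exp θ) h hok

lemma Im.abs_le (h : S.Im φ θ t v) (hok : t.ok = true) : 2 ^ 44 * |v| ≤ t.bd := by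
  simpa [Complex.norm_real] using Encl.bound (norm_exp φ) (norm_exp θ) h hok

lemma Re.widen (h : S.Re φ θ t v) {e : ℕ} (hw : t.ok = true → 2 ^ 44 * |w - v| ≤ e) :
    S.Re φ θ (t.widen e) w := by
  refine Encl.widen h (norm_exp φ) (norm_exp θ) fun hok => ?_
  rw [← Complex.ofReal_sub, Complex.norm_real]
  exact hw hok

lemma Im.widen (h : S.Im φ θ t v) {e : ℕ} (hw : t.ok = true → 2 ^ 44 * |w - v| ≤ e) :
    S.Im φ θ (t.widen e) w := by
  refine Encl.widen h (norm_exp φ) (norm_exp θ) fun hok => ?_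
  rw [← mul_sub, ← Complex.ofReal_sub, norm_mul, Complex.norm_I, one_mul, Complex.norm_real]
  exact hw hok

end

lemma re_cst (z : ℕ) : S.Re φ θ (S.cst z) (z / 2 ^ 44) := Encl.const z

lemma re_one : S.Re φ θ S.one 1 := (re_cst _).congr (by norm_num)
lemma re_two : S.Re φ θ S.two 2 := (re_cst _).congr (by norm_num)
lemma re_three : S.Re φ θ S.three 3 := (re_cst _).congr (by norm_num)
lemma re_four : S.Re φ θ S.four 4 := (re_cst _).congr (by norm_num)
lemma re_six : S.Re φ θ S.six 6 := (re_cst _).congr (by norm_num)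
lemma re_eight : S.Re φ θ S.eight 8 := (re_cst _).congr (by norm_num)
lemma re_half : S.Re φ θ S.half (1 / 2) := (re_cst _).congr (by norm_num)

lemma re_tab (f : ℕ) (T : List (List ℤ)) :
    S.Re φ θ (S.tab f false T) (trigVal f (fun _ => 1) false T φ θ) := by
  have h := Encl.ofTab (l := S.lay) f (fun _ => 1) false T φ θ
  rw [trigC, cond_false, one_mul] at h
  exact h

lemma im_tab (f : ℕ) (T : List (List ℤ)) :
    S.Im φ θ (S.tab f true T) (trigVal f (fun _ => 1) true T φ θ) :=
  Encl.ofTab f (fun _ => 1) true T φ θ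

lemma re_der (f : ℕ) (T : List (List ℤ)) :
    S.Re φ θ (S.der f false T) (trigVal f (fun k => k) false T φ θ) := by
  have h := Encl.ofTab (l := S.lay) f (fun k => k) false T φ θ
  rw [trigC, cond_false, one_mul] at h
  exact h

lemma im_der (f : ℕ) (T : List (List ℤ)) :
    S.Im φ θ (S.der f true T) (trigVal f (fun k => k) true T φ θ) :=
  Encl.ofTab f (fun k => k) true T φ θ

lemma re_cos : S.Re φ θ S.tcos (Real.cos θ) :=
  (re_tab 1 _).congr (by simp [trigVal, tabSum, rowSum, trig]; ring)

lemma re_mu : S.Re φ θ S.tmu ((4 * S.mid + 4 * S.rad * Real.cos φ) / 2 ^ 44) :=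
  (re_tab 1 _).congr (by simp [trigVal, tabSum, rowSum, trig]; ring)

lemma re_c {c : ℝ} (hc : c ∈ Icc (2.1 : ℝ) (2.1 + 1 / 1000000)) : S.Re φ θ S.tc c := by
  refine (re_cst _).widen fun _ => ?_
  obtain ⟨h1, h2⟩ := hc
  rw [abs_sub_comm, ← abs_of_pos (show (0 : ℝ) < 2 ^ 44 by positivity), ← abs_mul, abs_le]
  constructor <;> norm_num at * <;> linarith

/-- The radius, the momentum and the parameters are enclosed by the tables of the slice. -/
structure At (S : Slice) (b : Bool) (φ θ μ c ρ p : ℝ) : Prop where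
  rho : S.Re φ θ (S.rho b) ρ
  mom : S.Im φ θ (S.mom b) p
  mu : S.Re φ θ S.tmu μ
  en : S.Re φ θ S.tc c

namespace At

variable {b : Bool} {μ c ρ p s : ℝ} (h : S.At b φ θ μ c ρ p)

include h

lemma rho2 : S.Re φ θ (S.rho2 b) (ρ ^ 2) := (h.rho.mul h.rho).congr (by ring)
lemma rho3 : S.Re φ θ (S.rho3 b) (ρ ^ 3) := (h.rho2.mul h.rho).congr (by ring)
lemma rho4 : S.Re φ θ (S.rho4 b) (ρ ^ 4) := (h.rho2.mul h.rho2).congr (by ring)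


lemma dist : S.Re φ θ (S.dist b) (1 - 2 * ρ * Real.cos θ + ρ ^ 2) :=
  ((re_one.sub (re_two.mul (h.rho.mul re_cos))).add h.rho2).congr (by ring)

lemma gr : S.Re φ θ (S.gr b) (invDist ρ (Real.cos θ)) :=
  (Encl.recip (norm_exp φ) (norm_exp θ) (re_tab _ _) h.dist).1

lemma dist_pos (hok : (S.gr b).ok = true) : 0 < 1 - 2 * ρ * Real.cos θ + ρ ^ 2 :=
  (Encl.recip (norm_exp φ) (norm_exp θ) (re_tab _ _) h.dist).2 hok

lemma gr2 : S.Re φ θ (S.gr2 b) (invDist ρ (Real.cos θ) ^ 2) := (h.gr.mul h.gr).congr (by ring)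
lemma gr3 : S.Re φ θ (S.gr3 b) (invDist ρ (Real.cos θ) ^ 3) := (h.gr2.mul h.gr).congr (by ring)
lemma gr5 : S.Re φ θ (S.gr5 b) (invDist ρ (Real.cos θ) ^ 5) := (h.gr3.mul h.gr2).congr (by ring)
lemma r3C : S.Re φ θ (S.r3C b) (ρ ^ 3 * Real.cos θ) := h.rho3.mul re_cos
lemma mr : S.Re φ θ (S.mr b) (μ * (ρ ^ 3 * Real.cos θ)) := h.mu.mul h.r3C

lemma mu2r : S.Re φ θ (S.mu2r b) (μ ^ 2 * ρ ^ 2) :=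
  ((h.mu.mul h.mu).mul h.rho2).congr (by ring)

lemma onem : S.Re φ θ (S.onem b) ((1 - μ) * ρ) := (re_one.sub h.mu).mul h.rho
lemma cr : S.Re φ θ (S.cr b) (c * ρ ^ 2) := h.en.mul h.rho2

lemma ang : S.Re φ θ (S.ang b) (angSq μ c ρ (Real.cos θ)) :=
  (re_half.mul (((h.onem.add (h.mu.mul (h.rho2.mul h.gr))).add
    (re_half.mul ((h.rho4.sub (re_two.mul h.mr)).add h.mu2r))).sub h.cr)).congr
    (by rw [angSq]; ring)

lemma inner : S.Re φ θ (S.inner b) (2 * (ρ ^ 2 * invDist ρ (Real.cos θ))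
    - (ρ ^ 4 - ρ ^ 3 * Real.cos θ) * invDist ρ (Real.cos θ) ^ 3) :=
  (re_two.mul (h.rho2.mul h.gr)).sub ((h.rho4.sub h.r3C).mul h.gr3)

lemma angE : S.Re φ θ (S.angE b) (angSqE μ c ρ (Real.cos θ)) :=
  (re_half.mul (((h.onem.add (h.mu.mul h.inner)).add
    (re_half.mul (((re_four.mul h.rho4).sub (re_six.mul h.mr)).add (re_two.mul h.mu2r)))).sub
    (re_two.mul h.cr))).congr (by rw [angSqE]; ring)

lemma lsq : S.Re φ θ (S.lsq b) (angSq μ c ρ (Real.cos θ) - p ^ 2) :=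
  (h.ang.add (h.mom.mul h.mom)).congr (by ring)

lemma lam : S.Re φ θ (S.lam b) (invAng μ c ρ p (Real.cos θ)) :=
  (Encl.recip (norm_exp φ) (norm_exp θ) (re_tab _ _) h.lsq).1

lemma ang_pos (hok : (S.lam b).ok = true) : 0 < angSq μ c ρ (Real.cos θ) - p ^ 2 :=
  (Encl.recip (norm_exp φ) (norm_exp θ) (re_tab _ _) h.lsq).2 hok

lemma v : S.Im φ θ (S.v b) (p * invAng μ c ρ p (Real.cos θ)) := h.mom.mulRe h.lam

lemma u : S.Re φ θ (S.u b)
    (angSqE μ c ρ (Real.cos θ) * invAng μ c ρ p (Real.cos θ) / 2) :=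
  (re_half.mul (h.angE.mul h.lam)).congr (by ring)

lemma f₁ : S.Im φ θ (S.f₁ b) (redR μ c ρ p (Real.cos θ)) := h.rho.mulIm h.v

lemma f₂ : S.Re φ θ (S.f₂ b) (redP μ c (bif S.dir then 1 else -1) ρ p (Real.cos θ)) := by
  rw [Slice.f₂, redP]
  cases S.dir
  · exact (h.u.add h.rho2).congr (by simp)
  · exact (h.u.sub h.rho2).congr (by simp)

end At

/-- The value of a table. -/
def val (f : ℕ) (odd : Bool) (T : List (List ℤ)) (φ θ : ℝ) : ℝ := trigVal f (fun _ => 1) odd T φ θ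

lemma re_tal : S.Re φ θ S.tal (val coarse false S.al φ θ) := re_tab _ _
lemma re_tka : S.Re φ θ S.tka (val coarse false S.ka φ θ) := re_tab _ _
lemma re_tom : S.Re φ θ S.tom (val coarse false S.om φ θ) := re_tab _ _
lemma im_tbe : S.Im φ θ S.tbe (val coarse true S.be φ θ) := im_tab _ _

namespace At

variable {μ c ρ p : ℝ} (h : S.At true φ θ μ c ρ p)

include h

lemma w : S.Re φ θ S.w (angSqE μ c ρ (Real.cos θ) * invAng μ c ρ p (Real.cos θ) / 2
    * invAng μ c ρ p (Real.cos θ)) := h.u.mul h.lam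

lemma angQ : S.Re φ θ S.angQ (angSqQ μ ρ (Real.cos θ)) :=
  (re_half.mul (((h.mu.mul ((((re_three.mul h.r3C).sub h.rho4).mul h.gr3).sub
    (re_three.mul ((h.rho4.mul (re_one.sub (re_cos.mul re_cos))).mul h.gr5)))).sub h.onem).add
    (re_half.mul ((re_eight.mul h.rho4).sub (re_six.mul h.mr))))).congr
    (by rw [angSqQ]; ring)

lemma j21 : S.Re φ θ S.j21 (jac21 μ c (bif S.dir then 1 else -1) ρ p (Real.cos θ)) :=
  ((re_two.mul h.f₂).add (((re_half.mul h.angQ).sub (h.u.mul h.u)).mul h.lam)).congr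
    (by rw [jac21]; ring)

lemma j22 : S.Im φ θ S.j22 (jac22 μ c ρ p (Real.cos θ)) := h.v.mulRe h.w

lemma j11 : S.Im φ θ S.j11 (jac11 μ c ρ p (Real.cos θ)) :=
  (h.v.sub h.j22).congr (by rw [jac11, jac22]; ring)

lemma j12 : S.Re φ θ S.j12 (jac12 μ c ρ p (Real.cos θ)) :=
  ((h.rho.mul h.lam).mul (re_one.sub (h.v.mul h.v))).congr (by rw [jac12]; ring)

lemma e11 : S.Im φ θ S.e11 (jac11 μ c ρ p (Real.cos θ) * val coarse false S.al φ θ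
    + jac12 μ c ρ p (Real.cos θ) * val coarse true S.be φ θ
    + trigVal coarse (fun k => k) true S.al φ θ) :=
  ((h.j11.mulRe re_tal).add (h.j12.mulIm im_tbe)).add (im_der _ _)

lemma e12 : S.Re φ θ S.e12 (jac12 μ c ρ p (Real.cos θ) * val coarse false S.ka φ θ
    - val coarse false S.om φ θ * val coarse false S.al φ θ) :=
  (h.j12.mul re_tka).sub (re_tom.mul re_tal)

lemma e22 : S.Im φ θ S.e22 (jac22 μ c ρ p (Real.cos θ) * val coarse false S.ka φ θ
    + trigVal coarse (fun k => k) true S.ka φ θ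
    - val coarse true S.be φ θ * val coarse false S.om φ θ) :=
  ((h.j22.mulRe re_tka).add (im_der _ _)).sub (im_tbe.mulRe re_tom)

lemma e21 : S.Re φ θ S.e21 (jac21 μ c (bif S.dir then 1 else -1) ρ p (Real.cos θ)
      * val coarse false S.al φ θ
    + ρ * (val coarse false S.om φ θ * val coarse false S.ka φ θ
      + jac22 μ c ρ p (Real.cos θ) * val coarse true S.be φ θ
      - trigVal coarse (fun k => k) false S.be φ θ)) :=
  ((h.j21.mul re_tal).add (h.rho.mul (((re_tom.mul re_tka).sub (h.j22.mul im_tbe)).sub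
    (re_der _ _)))).congr (by ring)

lemma hill : S.Re φ θ S.hill (1 - μ - (c - μ) * ρ) :=
  (re_one.sub h.mu).sub ((h.en.sub h.mu).mul h.rho)

lemma sense : S.Re φ θ S.sense (ρ ^ 2 * invAng μ c ρ p (Real.cos θ)) := h.rho2.mul h.lam

end At

end Slice

end LCHill

namespace LCHill

namespace Slice

lemma isTrig_even (f : ℕ) (T : List (List ℤ)) (φ : ℝ) :
    IsTrig 1 (val f false T φ) (fun θ => -trigVal f (fun k => k) true T φ θ) where
  hasDerivAt _ := hasDerivAt_trigVal_even _ _ _ _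
  continuous_deriv := (continuous_trigVal _ _ _ _ true).neg
  parity θ := by rw [one_mul]; exact trigVal_even_neg _ _ _ _ _
  periodic θ := trigVal_periodic _ _ _ _ false θ

lemma isTrig_odd (f : ℕ) (T : List (List ℤ)) (φ : ℝ) :
    IsTrig (-1) (val f true T φ) (trigVal f (fun k => k) false T φ) where
  hasDerivAt _ := hasDerivAt_trigVal_odd _ _ _ _
  continuous_deriv := continuous_trigVal _ _ _ _ false
  parity θ := by rw [neg_one_mul]; exact trigVal_odd_neg _ _ _ _ _
  periodic θ := trigVal_periodic _ _ _ _ true θ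

/-- The reference orbit and the moving frame given by the tables of a slice. -/
def ref (S : Slice) (φ : ℝ) : RefData where
  rr := val fine false S.rr φ
  rr' θ := -trigVal fine (fun k => k) true S.rr φ θ
  pp := val fine true S.pp φ
  pp' := trigVal fine (fun k => k) false S.pp φ
  al := val coarse false S.al φ
  al' θ := -trigVal coarse (fun k => k) true S.al φ θ
  be := val coarse true S.be φ
  be' := trigVal coarse (fun k => k) false S.be φ
  ka := val coarse false S.ka φ
  ka' θ := -trigVal coarse (fun k => k) true S.ka φ θ
  om := val coarse false S.om φ
  Om := trigInt coarse S.om φ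
  τ := S.tn / 2 ^ 30

lemma cast_div_le (a b : ℕ) : (a : ℝ) / b ≤ (a / b + 1 : ℕ) := by
  rw [← Nat.floor_div_eq_div (K := ℝ) a b]
  exact_mod_cast (Nat.lt_floor_add_one _).le

lemma abs_mul_le_of_abs_le_one {a x : ℝ} (hx : |x| ≤ 1) : |a * x| ≤ |a| := by
  rw [abs_mul]
  exact mul_le_of_le_one_right (abs_nonneg _) hx

variable {S : Slice} {φ θ μ c : ℝ}

lemma at_false (hμ : μ = (4 * S.mid + 4 * S.rad * Real.cos φ) / 2 ^ 44)
    (hc : c ∈ Icc (2.1 : ℝ) (2.1 + 1 / 1000000)) :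
    S.At false φ θ μ c ((S.ref φ).rr θ) ((S.ref φ).pp θ) where
  rho := re_tab _ _
  mom := im_tab _ _
  mu := hμ ▸ re_mu
  en := re_c hc

lemma widening {x : ℝ} {e B : ℕ} (hx : 2 ^ 44 * |x| ≤ B) (he : e = S.tn * B / 2 ^ 30 + 1) :
    2 ^ 44 * |(S.ref φ).τ * x| ≤ e := by
  refine le_trans ?_ (he ▸ cast_div_le (S.tn * B) (2 ^ 30))
  have h0 : 0 ≤ (S.ref φ).τ := by simp only [ref]; positivity
  have h1 := mul_le_mul_of_nonneg_left hx h0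
  rw [abs_mul, abs_of_nonneg h0]
  simp only [ref] at h1 ⊢
  push_cast
  linarith

lemma at_true (hμ : μ = (4 * S.mid + 4 * S.rad * Real.cos φ) / 2 ^ 44)
    (hc : c ∈ Icc (2.1 : ℝ) (2.1 + 1 / 1000000)) (hal : S.tal.ok = true)
    (hbe : S.tbe.ok = true) (hka : S.tka.ok = true) {x y : ℝ} (hx : |x| ≤ 1) (hy : |y| ≤ 1) :
    S.At true φ θ μ c ((S.ref φ).rad θ x) ((S.ref φ).mom θ x y) where
  rho := by
    refine Re.widen (t := S.trr) (v := (S.ref φ).rr θ) (re_tab _ _) fun _ => ?_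
    rw [RefData.rad, add_sub_cancel_left, mul_assoc]
    refine widening ?_ rfl
    have h1 := re_tal.abs_le (φ := φ) (θ := θ) hal
    have h2 := abs_mul_le_of_abs_le_one (a := val coarse false S.al φ θ) hx
    simp only [ref]
    linarith
  mom := by
    refine Im.widen (t := S.tpp) (v := (S.ref φ).pp θ) (im_tab _ _) fun _ => ?_
    rw [RefData.mom, add_sub_cancel_left]
    refine widening ?_ rfl
    have h1 := im_tbe.abs_le (φ := φ) (θ := θ) hbe
    have h2 := re_tka.abs_le (φ := φ) (θ := θ) hka
    have h3 := abs_mul_le_of_abs_le_one (a := val coarse true S.be φ θ) hx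
    have h4 := abs_mul_le_of_abs_le_one (a := val coarse false S.ka φ θ) hy
    have h5 := abs_add_le (val coarse true S.be φ θ * x) (val coarse false S.ka φ θ * y)
    simp only [ref]
    push_cast
    linarith
  mu := hμ ▸ re_mu
  en := re_c hc

end Slice

end LCHill

namespace LCHill

namespace Slice

lemma abs_div_le {u a n : ℝ} {d A : ℕ} (hu : 2 ^ 44 * |u| ≤ n) (ha : (d : ℝ) ≤ 2 ^ 44 * a)
    (hd : 0 < d) (h : n * 2 ^ 30 ≤ A * d) : |u / a| ≤ A / 2 ^ 30 := by
  have hd' : (0 : ℝ) < d := by exact_mod_cast hd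
  have ha' : 0 < a := by linarith
  rw [abs_div, abs_of_pos ha', div_le_div_iff₀ ha' (by positivity)]
  have h1 : (A : ℝ) * d ≤ A * (2 ^ 44 * a) := by gcongr
  linarith

lemma pos_of_le {a : ℝ} {d : ℕ} (ha : (d : ℝ) ≤ 2 ^ 44 * a) (hd : 0 < d) : 0 < a := by
  have hd' : (0 : ℝ) < d := by exact_mod_cast hd
  linarith

lemma low_le {t : TM} {v φ θ : ℝ} {z : ℕ} (h : Slice.Re S φ θ t v)
    (hl : 0 < TM.low S.lay z t) : (TM.low S.lay z t : ℝ) ≤ 2 ^ 44 * v :=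
  Encl.low_le (norm_exp φ) (norm_exp θ) h hl

variable {S : Slice} {φ θ μ c : ℝ}

lemma good (hμ : μ = (4 * S.mid + 4 * S.rad * Real.cos φ) / 2 ^ 44)
    (hc : c ∈ Icc (2.1 : ℝ) (2.1 + 1 / 1000000)) (ho : S.checkOk = true)
    (ht : S.checkTube = true) {x y : ℝ} (hx : |x| ≤ 1) (hy : |y| ≤ 1) :
    (S.ref φ).Good μ c (bif S.dir then 1 else -1) (S.A / 2 ^ 30) (S.B₁ / 2 ^ 30) (S.B₂ / 2 ^ 30)
      θ x y := by
  simp only [checkOk, Bool.and_eq_true] at ho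
  simp only [checkTube, Bool.and_eq_true, Nat.blt_eq, Nat.ble_eq] at ht
  obtain ⟨⟨⟨⟨⟨⟨⟨⟨⟨⟨⟨⟨⟨oal, oka⟩, obe⟩, oom⟩, orho⟩, ogr⟩, olam⟩, od₁⟩, od₂⟩, o11⟩, o12⟩, o21⟩, o22⟩,
    osense⟩ := ho
  obtain ⟨⟨⟨⟨⟨⟨⟨⟨⟨⟨⟨trho, tal⟩, tka⟩, thill⟩, trho1⟩, tsense⟩, t11⟩, t12⟩, t22⟩, t21⟩, -⟩, -⟩ := ht
  have G := at_true (θ := θ) hμ hc oal obe oka hx hy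
  have lrho := low_le G.rho trho
  have lal := low_le (re_tal (φ := φ) (θ := θ)) tal
  have lka := low_le (re_tka (φ := φ) (θ := θ)) tka
  have hr := pos_of_le lrho trho
  have ha := pos_of_le lal tal
  have hk := pos_of_le lka tka
  have hrho := G.rho.abs_le orho
  have hbe := im_tbe.abs_le (φ := φ) (θ := θ) obe
  have h11 : |(S.ref φ).lin₁₁ μ c θ x y| ≤ S.A / 2 ^ 30 := by
    have := abs_div_le (G.e11.abs_le o11) lal tal (by exact_mod_cast t11)
    rw [RefData.lin₁₁]
    simpa only [ref, sub_neg_eq_add] using this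
  have h12 : |(S.ref φ).lin₁₂ μ c θ x y - (S.ref φ).om θ| ≤ S.B₁ / 2 ^ 30 := by
    have := abs_div_le (G.e12.abs_le o12) lal tal (by exact_mod_cast t12)
    refine le_of_eq_of_le ?_ this
    rw [RefData.lin₁₂]
    congr 1
    simp only [ref]
    field_simp
  have hsense := G.sense.abs_le osense
  refine ⟨hr, ?_, pos_of_le (low_le G.hill thill) thill, G.dist_pos ogr, G.ang_pos olam, ?_,
    h11, ?_, h12, ?_⟩
  · have h1 := le_abs_self ((S.ref φ).rad θ x)
    have h2 : ((S.rho true).bd : ℝ) < 2 ^ 44 := by exact_mod_cast trho1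
    linarith
  · have h2 : (S.sense.bd : ℝ) < 2 ^ 45 := by exact_mod_cast tsense
    have h1 := abs_le.1 (show |(S.ref φ).rad θ x ^ 2 * invAng μ c ((S.ref φ).rad θ x)
      ((S.ref φ).mom θ x y) (Real.cos θ)| ≤ S.sense.bd / 2 ^ 44 by
        rw [le_div_iff₀ (by positivity)]; linarith)
    cases S.dir <;> simp only [cond] <;> linarith
  · have h1 := abs_add_le (jac22 μ c ((S.ref φ).rad θ x) ((S.ref φ).mom θ x y) (Real.cos θ)
      * val coarse false S.ka φ θ + trigVal coarse (fun k => k) true S.ka φ θ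
      - val coarse true S.be φ θ * val coarse false S.om φ θ)
      (-(val coarse true S.be φ θ * ((S.ref φ).lin₁₂ μ c θ x y - (S.ref φ).om θ)))
    have h2 : 2 ^ 44 * (|val coarse true S.be φ θ| *
        |(S.ref φ).lin₁₂ μ c θ x y - (S.ref φ).om θ|) ≤ S.tbe.bd * (S.B₁ / 2 ^ 30) := by
      rw [← mul_assoc]; gcongr
    rw [abs_neg, abs_mul (val coarse true S.be φ θ)] at h1
    have h3 := G.e22.abs_le o22
    have t22' : (S.e22.bd * 2 ^ 30 + S.tbe.bd * S.B₁ : ℝ) ≤ S.A * S.lka := by exact_mod_cast t22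
    refine le_of_eq_of_le ?_ (abs_div_le (n := S.e22.bd + S.tbe.bd * (S.B₁ / 2 ^ 30))
      ((mul_le_mul_of_nonneg_left h1 (by positivity)).trans ?_) lka tka ?_)
    · rw [RefData.lin₂₂]
      congr 2
      simp only [ref]
      ring
    · linarith
    · refine le_trans (le_of_eq ?_) t22'
      ring
  · have h1 := abs_add_le ((jac21 μ c (bif S.dir then 1 else -1) ((S.ref φ).rad θ x)
        ((S.ref φ).mom θ x y) (Real.cos θ) * val coarse false S.al φ θ
      + (S.ref φ).rad θ x * (val coarse false S.om φ θ * val coarse false S.ka φ θ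
        + jac22 μ c ((S.ref φ).rad θ x) ((S.ref φ).mom θ x y) (Real.cos θ)
          * val coarse true S.be φ θ
        - trigVal coarse (fun k => k) false S.be φ θ)) / (S.ref φ).rad θ x)
      (-(val coarse true S.be φ θ * (S.ref φ).lin₁₁ μ c θ x y))
    have h2 : 2 ^ 44 * (|val coarse true S.be φ θ| * |(S.ref φ).lin₁₁ μ c θ x y|)
        ≤ S.tbe.bd * (S.A / 2 ^ 30) := by
      rw [← mul_assoc]; gcongr
    rw [abs_neg, abs_mul (val coarse true S.be φ θ), abs_div _ ((S.ref φ).rad θ x),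
      abs_of_pos hr] at h1
    have trho' : (0 : ℝ) < S.lrho := by exact_mod_cast trho
    have h3 := div_le_div₀ (by positivity) (G.e21.abs_le o21) trho' lrho
    rw [mul_div_mul_left _ _ (by positivity)] at h3
    have t21' : (S.e21.bd * 2 ^ 74 + S.tbe.bd * S.A * S.lrho : ℝ) ≤ S.B₂ * S.lka * S.lrho := by
      exact_mod_cast t21
    refine le_of_eq_of_le ?_ (abs_div_le
      (n := 2 ^ 44 * (S.e21.bd / S.lrho) + S.tbe.bd * (S.A / 2 ^ 30))
      ((mul_le_mul_of_nonneg_left h1 (by positivity)).trans ?_) lka tka ?_)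
    · rw [RefData.lin₂₁]
      congr 1
      have hr' := hr.ne'
      have hk' := hk.ne'
      generalize (S.ref φ).lin₁₁ μ c θ x y = L
      generalize (S.ref φ).rad θ x = r at *
      simp only [ref]
      field_simp
      ring
    · linarith
    · rw [← mul_le_mul_iff_left₀ trho']
      refine le_trans (le_of_eq ?_) t21'
      field_simp

lemma defect (hμ : μ = (4 * S.mid + 4 * S.rad * Real.cos φ) / 2 ^ 44)
    (hc : c ∈ Icc (2.1 : ℝ) (2.1 + 1 / 1000000)) (ho : S.checkOk = true)
    (ht : S.checkTube = true) (htn : 0 < S.tn) :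
    |(S.ref φ).field₁ μ c θ 0 0| ≤ S.e₁ / 2 ^ 30 ∧
    |(S.ref φ).field₂ μ c (bif S.dir then 1 else -1) θ 0 0| ≤ S.e₂ / 2 ^ 30 := by
  simp only [checkOk, Bool.and_eq_true] at ho
  simp only [checkTube, Bool.and_eq_true, Nat.blt_eq, Nat.ble_eq] at ht
  obtain ⟨⟨⟨⟨⟨⟨⟨⟨⟨⟨⟨⟨⟨oal, oka⟩, obe⟩, -⟩, -⟩, -⟩, -⟩, od₁⟩, od₂⟩, -⟩, -⟩, -⟩, -⟩, -⟩ := ho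
  obtain ⟨⟨⟨⟨⟨⟨⟨⟨⟨⟨⟨-, tal⟩, tka⟩, -⟩, -⟩, -⟩, -⟩, -⟩, -⟩, -⟩, t₁⟩, t₂⟩ := ht
  have G := at_false (θ := θ) hμ hc
  have hn : (0 : ℝ) < S.tn := by exact_mod_cast htn
  have lal : (S.tn * S.lal : ℝ) ≤ S.tn * (2 ^ 44 * val coarse false S.al φ θ) :=
    mul_le_mul_of_nonneg_left (low_le re_tal tal) hn.le
  have lka : (S.tn * S.lka : ℝ) ≤ S.tn * (2 ^ 44 * val coarse false S.ka φ θ) :=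
    mul_le_mul_of_nonneg_left (low_le re_tka tka) hn.le
  have hbe := im_tbe.abs_le (φ := φ) (θ := θ) obe
  have hτ : (S.ref φ).τ = S.tn / 2 ^ 30 := rfl
  have d₁ : S.Im φ θ S.d₁ (redR μ c ((S.ref φ).rr θ) ((S.ref φ).pp θ) (Real.cos θ)
    + trigVal fine (fun k => k) true S.rr φ θ) := G.f₁.add (im_der _ _)
  have d₂ : S.Re φ θ S.d₂ (redP μ c (bif S.dir then 1 else -1) ((S.ref φ).rr θ) ((S.ref φ).pp θ)
    (Real.cos θ) - trigVal fine (fun k => k) false S.pp φ θ) := G.f₂.sub (re_der _ _)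
  have h₁ : |(S.ref φ).field₁ μ c θ 0 0| ≤ S.e₁ / 2 ^ 30 := by
    have t₁' : (S.d₁.bd * 2 ^ 60 : ℝ) ≤ S.e₁ * (S.tn * S.lal) := by exact_mod_cast t₁
    have := abs_div_le (n := S.d₁.bd * 2 ^ 30) (d := S.tn * S.lal) (A := S.e₁)
      (u := 2 ^ 30 * (redR μ c ((S.ref φ).rr θ) ((S.ref φ).pp θ) (Real.cos θ)
        + trigVal fine (fun k => k) true S.rr φ θ)) (a := S.tn * val coarse false S.al φ θ)
      (by rw [abs_mul, abs_of_pos (by positivity : (0 : ℝ) < 2 ^ 30)]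
          linarith [d₁.abs_le od₁])
      (by push_cast; linarith) (Nat.mul_pos htn tal) (by push_cast; linarith)
    refine le_of_eq_of_le ?_ this
    rw [RefData.field₁, RefData.rad, RefData.mom, hτ]
    congr 1
    simp only [ref, mul_zero, add_zero, sub_zero, sub_neg_eq_add]
    field_simp
  refine ⟨h₁, ?_⟩
  have t₂' : (S.d₂.bd * 2 ^ 60 + S.tn * S.tbe.bd * S.e₁ : ℝ) ≤ S.e₂ * (S.tn * S.lka) := by
    exact_mod_cast t₂
  have h1 := abs_add_le (2 ^ 30 * (redP μ c (bif S.dir then 1 else -1) ((S.ref φ).rr θ)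
      ((S.ref φ).pp θ) (Real.cos θ) - trigVal fine (fun k => k) false S.pp φ θ))
    (-(S.tn * (val coarse true S.be φ θ * (S.ref φ).field₁ μ c θ 0 0)))
  have h2 : 2 ^ 44 * (|val coarse true S.be φ θ| * |(S.ref φ).field₁ μ c θ 0 0|)
      ≤ S.tbe.bd * (S.e₁ / 2 ^ 30) := by
    rw [← mul_assoc]; gcongr
  have h3 := mul_le_mul_of_nonneg_left h2 hn.le
  rw [abs_neg, abs_mul (S.tn : ℝ), abs_mul (val coarse true S.be φ θ), abs_of_pos hn, abs_mul,
    abs_of_pos (by positivity : (0 : ℝ) < 2 ^ 30)] at h1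
  refine le_of_eq_of_le ?_ (abs_div_le (d := S.tn * S.lka) (A := S.e₂)
    (a := S.tn * val coarse false S.ka φ θ)
    (n := S.d₂.bd * 2 ^ 30 + S.tn * (S.tbe.bd * (S.e₁ / 2 ^ 30)))
    ((mul_le_mul_of_nonneg_left h1 (by positivity)).trans ?_) (by push_cast; linarith)
    (Nat.mul_pos htn tka) ?_)
  · rw [RefData.field₂, RefData.rad, RefData.mom, hτ]
    congr 1
    generalize (S.ref φ).field₁ μ c θ 0 0 = F
    simp only [ref, mul_zero, add_zero, zero_add]
    field_simp
    ring
  · linarith [d₂.abs_le od₂]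
  · push_cast
    refine le_trans (le_of_eq ?_) t₂'
    ring

/-- A slice whose certificate is correct has valid reference data. -/
theorem valid (hμ : μ = (4 * S.mid + 4 * S.rad * Real.cos φ) / 2 ^ 44)
    (hc : c ∈ Icc (2.1 : ℝ) (2.1 + 1 / 1000000)) (h : S.check = true) :
    (S.ref φ).Valid μ c (bif S.dir then 1 else -1) S.index (S.A / 2 ^ 30) (S.B₁ / 2 ^ 30)
      (S.B₂ / 2 ^ 30) (S.ε / 2 ^ 30) (S.tom.bd / 2 ^ 44)
      (trigVal coarse (fun _ => 1) false [S.om.headD []] φ 0) (S.σ / 2 ^ 30) (S.m / 2 ^ 30)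
      (S.R / 2 ^ 30) := by
  simp only [check, Bool.and_eq_true] at h
  obtain ⟨⟨ho, ht⟩, hf⟩ := h
  have oom : S.tom.ok = true := by
    simp only [checkOk, Bool.and_eq_true] at ho
    obtain ⟨⟨⟨⟨⟨⟨⟨⟨⟨⟨⟨⟨⟨-, -⟩, -⟩, oom⟩, -⟩, -⟩, -⟩, -⟩, -⟩, -⟩, -⟩, -⟩, -⟩, -⟩ := ho
    exact oom
  have hak : 0 < S.lal ∧ 0 < S.lka := by
    simp only [checkTube, Bool.and_eq_true, Nat.blt_eq, Nat.ble_eq] at ht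
    obtain ⟨⟨⟨⟨⟨⟨⟨⟨⟨⟨⟨-, tal⟩, tka⟩, -⟩, -⟩, -⟩, -⟩, -⟩, -⟩, -⟩, -⟩, -⟩ := ht
    exact ⟨tal, tka⟩
  simp only [checkFlow, Bool.and_eq_true, Nat.blt_eq, Nat.ble_eq] at hf
  obtain ⟨⟨⟨⟨⟨⟨⟨⟨⟨⟨ftn, fε⟩, fσ⟩, fm⟩, fe⟩, fup⟩, flo⟩, f₁⟩, f₂⟩, rlo⟩, rup⟩ := hf
  have flrot : 0 < S.lrot := (Nat.zero_le _).trans_lt rlo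
  have hrot : S.Re φ 0 S.rot (trigVal coarse (fun _ => 1) false [S.om.headD []] φ 0) := re_tab _ _
  have hlo := low_le hrot flrot
  have hup := Encl.le_up (norm_exp φ) (norm_exp 0) hrot (Encl.lowCert_add flrot).1
  have hn : (0 : ℝ) < S.tn := by exact_mod_cast ftn
  have hm : (0 : ℝ) < S.m := by exact_mod_cast fm
  have hε : (0 : ℝ) < S.ε := by exact_mod_cast fε
  have hσ : (0 : ℝ) < S.σ := by exact_mod_cast fσ
  have hπ : (S.rate : ℝ) * Real.pi ≤ S.rate * 3.1416 := by
    gcongr; exact Real.pi_lt_d4.le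
  have hrate : (2 * (S.A / 2 ^ 30) + S.B₁ / 2 ^ 30 + S.B₂ / 2 ^ 30 + 2 * (S.ε / 2 ^ 30) : ℝ)
      = S.rate / 2 ^ 30 := by rw [rate]; push_cast; ring
  have hR : ∀ B : ℕ, (S.A + B) * S.m + S.ε * 2 ^ 30 ≤ S.R * S.m →
      (S.A / 2 ^ 30 + B / 2 ^ 30 + S.ε / 2 ^ 30 / (S.m / 2 ^ 30) : ℝ) ≤ S.R / 2 ^ 30 := by
    intro B hB
    have hB' : ((S.A + B) * S.m + S.ε * 2 ^ 30 : ℝ) ≤ S.R * S.m := by exact_mod_cast hB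
    rw [div_div_div_cancel_right₀ (by positivity), ← add_div, div_add_div _ _ (by positivity) hm.ne',
      div_le_div_iff₀ (by positivity) (by positivity)]
    nlinarith
  refine
    { rr := isTrig_even _ _ _
      pp := isTrig_odd _ _ _
      al := isTrig_even _ _ _
      be := isTrig_odd _ _ _
      ka := isTrig_even _ _ _
      om_cont := continuous_trigVal _ _ _ _ _
      Om := fun θ => hasDerivAt_trigInt _ _ _ _
      Om_pi := ?_
      Om_four_pi := ?_
      al_pos := fun θ => pos_of_le (low_le (re_tal (φ := φ) (θ := θ)) hak.1) hak.1
      ka_pos := fun θ => pos_of_le (low_le (re_tka (φ := φ) (θ := θ)) hak.2) hak.2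
      τ_pos := div_pos hn (by positivity)
      abs_om := fun θ => ?_
      good := fun θ x y hx hy => good hμ hc ho ht hx hy
      defect := fun θ => ?_
      ε_pos := by positivity
      σ_pos := by positivity
      m_pos := by positivity
      upper := ?_
      lower := ?_
      rate₁ := hR _ f₁
      rate₂ := hR _ f₂
      rot_lower := ?_
      rot_upper := ?_ }
  · have := trigInt_sub coarse S.om φ 1
    rwa [Nat.cast_one, one_mul] at this
  · exact_mod_cast trigInt_sub coarse S.om φ 4
  · rw [le_div_iff₀ (by positivity), mul_comm]
    exact re_tom.abs_le oom
  · obtain ⟨h1, h2⟩ := defect (θ := θ) hμ hc ho ht ftn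
    have h3 := pow_le_pow_left₀ (abs_nonneg _) h1 2
    have h4 := pow_le_pow_left₀ (abs_nonneg _) h2 2
    rw [sq_abs] at h3 h4
    have h5 : (S.e₁ ^ 2 + S.e₂ ^ 2 : ℝ) ≤ S.ε ^ 2 := by exact_mod_cast fe
    rw [div_pow] at h3 h4 ⊢
    linarith
  · have h1 : (S.σ ^ 2 * 10000 + S.rate * 31416 * 2 ^ 30 : ℝ) < 10000 * 2 ^ 60 := by
      exact_mod_cast fup
    rw [hrate, div_pow]
    linarith
  · have h1 : (S.m ^ 2 * 10000 + S.rate * 31416 * 2 ^ 30 : ℝ) ≤ S.σ ^ 2 * 10000 := by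
      exact_mod_cast flo
    rw [hrate, div_pow, div_pow]
    linarith
  · have h1 : (S.index * 2 ^ 43 + S.R * 2 ^ 14 : ℝ) < S.lrot := by exact_mod_cast rlo
    have h2 : (S.lrot : ℝ) ≤ 2 ^ 44 * trigVal coarse (fun _ => 1) false [S.om.headD []] φ 0 := hlo
    linarith
  · have h1 : (S.urot + S.R * 2 ^ 14 : ℝ) < (S.index + 1) * 2 ^ 43 := by exact_mod_cast rup
    have h2 : 2 ^ 44 * trigVal coarse (fun _ => 1) false [S.om.headD []] φ 0 ≤ (S.urot : ℝ) := hup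
    linarith

end Slice

end LCHill

namespace LCHill

namespace Slice

/-- A slice whose certificate is correct yields periodic orbits. -/
theorem exists_orbit (S : Slice) (h : S.check = true) {μ c lo hi : ℝ} (hlo : 0 ≤ lo)
    (hhi : hi < 1) (h₁ : 2 ^ 42 * lo = S.mid - S.rad) (h₂ : 2 ^ 42 * hi = S.mid + S.rad)
    (hμ : μ ∈ Icc lo hi) (hc : c ∈ Icc (2.1 : ℝ) (2.1 + 1 / 1000000)) :
    ∃ T γ, IsClosedOrbit μ c T γ ∧ IsSymmetricOrbit T γ ∧
      (bif S.dir then IsRetrograde μ γ else IsDirect μ γ) ∧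
      TransverseNondeg (Kham μ c) T γ ∧ IsMinimalPeriod T γ ∧
      ∃ M, IsLinearizedFlow (Kham μ c) γ M ∧
        CZIndexIs T (reducedMonodromy (Kham μ c) γ M) (2 * S.index + 1) := by
  obtain ⟨φ, hφ⟩ : ∃ φ, μ = (4 * S.mid + 4 * S.rad * Real.cos φ) / 2 ^ 44 := by
    obtain ⟨hl, hu⟩ := hμ
    rcases eq_or_ne S.rad 0 with h0 | h0
    · refine ⟨0, ?_⟩
      rw [h0] at h₁ h₂ ⊢
      push_cast at h₁ h₂ ⊢
      linarith
    · have h0' : (0 : ℝ) < S.rad := by exact_mod_cast Nat.pos_of_ne_zero h0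
      refine ⟨Real.arccos ((2 ^ 42 * μ - S.mid) / S.rad), ?_⟩
      rw [Real.cos_arccos]
      · field_simp
        ring
      · rw [le_div_iff₀ h0']; linarith
      · rw [div_le_iff₀ h0']; linarith
  obtain ⟨T, γ, h1, h2, h3, h4, h5, h6, M, h7, h8⟩ := (valid hφ hc h).exists_orbit
    (by rw [index]; cases S.dir <;> simp) (by cases S.dir <;> simp)
    (hlo.trans hμ.1) (hμ.2.trans_lt hhi)
  refine ⟨T, γ, h1, h2, ?_, h5, h6, M, h7, h8⟩
  cases hd : S.dir
  · exact h4 (by rw [hd]; rfl)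
  · exact h3 (by rw [hd]; rfl)

end Slice

end LCHill

namespace LCHill

/-- Retrograde orbits for `μ ∈ [0, 1/2]`. -/
def retrograde : Slice where
  lay := ⟨12, 10, by norm_num, by norm_num⟩
  dir := true
  rr :=
    [[2943963195, -449653706, -19176039, -3264691, -384098, -49169, -6331, -823, -108], [-6949185,
      -5126273, 1721214, -88298, 12796, -549, 48, -7, -1], [-3487511, -2956622, 537326, 11570,
      5473, 384, 47, 2], [-208508, -149648, 55480, -2901, 453, -25, 1], [-13186, -4602, 7432,
      -1086, 54, -12], [-1168, -42, 892, -215, 17, -2], [-131, 17, 105, -38, 5], [-16, 4, 13, -6,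
      1], [-2, 1, 2, -1]]
  pp :=
    [[], [7516730, 5057898, -2268549, 174160, -14801, 1272, -39, 12, 1], [7510214, 5909865,
      -1582551, 9264, -8631, -113, -11, 6, 1], [699075, 465733, -217061, 14842, -1307, 131, 1, 2],
      [71204, 31180, -34475, 5186, -318, 45, -1], [8718, 2133, -5259, 1206, -107, 11, -1], [1181,
      102, -793, 251, -32, 3], [168, -11, -120, 49, -8, 1], [25, -5, -18, 9, -2]]
  gg :=
    [[17305730129, -42665362, 959249, -209710, -359, -1091, 0, -1, 1], [2974845456, -467469917,
      -17807285, -3351147, -374314, -49209, -6243, -818, -107, -14, -2], [383675775, -121148173,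
      850336, -530474, -15868, -2676, -49, 6, 4, 1], [53993302, -27382578, 1512914, -96261, 9747,
      265, 120, 11, 2], [8077286, -5584044, 584996, -33087, 3898, -72, 23], [1263739, -1082409,
      167705, -12837, 1220, -80, 5, -1], [204582, -204552, 41757, -4347, 392, -35, 2], [34016,
      -38159, 9590, -1290, 127, -12, 1], [5778, -7074, 2093, -347, 40, -4], [998, -1308, 441, -87,
      12, -1], [175, -242, 91, -21, 3], [31, -45, 18, -5, 1], [6, -8, 4, -1]]
  la :=
    [[91620039333, 23290877874, 3434080688, 562698754, 94464165, 16026218, 2733065, 467308, 80022,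
      13714, 2352], [30889920, 29579455, -1226762, 52787, -34644, -4547, -939, -140, -22, -3],
      [-87166395, -94142978, -7860073, -965052, -87646, -6146, 45, 139, 39, 8, 2], [-12388846,
      -12236425, 144936, 3582, 13081, 2390, 436, 68, 10, 1], [-1498609, -1226479, 276918, 7835,
      3210, 181, 16, -2, -1], [-186466, -115808, 67738, -2524, 344, -57, -6, -2], [-24537, -10395,
      12539, -1511, 72, -20], [-3386, -789, 2109, -451, 32, -5], [-486, -25, 341, -107, 12, -1],
      [-72, 9, 54, -23, 4], [-11, 3, 8, -4, 1]]
  al :=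
    [[65587, 49, -2], [16, 7, -8, 1], [-2057, -1980, 79, 3, 1], [-31, -21, 9, -1], [-16, -18, -2]]
  be :=
    [[], [-167, -122, 42, -3], [4243, 3846, -407, -13, -3], [96, 63, -29, 3], [76, 87, 9, -2], [1,
      0, -1], [3, 3, 1]]
  ka :=
    [[67791, -6519, -424, -20, -2], [-184, -137, 44, -3], [1947, 1769, -183, -6, -1], [21, 11, -9,
      1], [59, 72, 11, -2], [1, 1], [2, 3, 1]]
  om :=
    [[60482, 222, 25, 5, 1], [-327, -267, 58, -2, 1], [3596, 3474, -124, -4, -2], [25, 8, -15, 2],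
      [149, 190, 38, -3], [2, 1, -1], [7, 10, 3]]
  tn := 10737
  mid := 1099511627776
  rad := 1099511627776
  A := 620955
  B₁ := 1015407
  B₂ := 4627056
  e₁ := 455424
  e₂ := 13338830
  ε := 13346603
  σ := 1019634912
  m := 962491144
  R := 20137297

lemma check_retrograde : retrograde.check = true := by decide +kernel

/-- Direct orbits for `μ ∈ [0, 1/4]`. -/
def direct₀ : Slice where
  lay := ⟨16, 12, by norm_num, by norm_num⟩
  dir := false
  rr :=
    [[5189543171, -433582265, -1727904, -481977, -34198, -226, -117, -1], [43728268, 40619357,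
      -3029376, 63622, -16247, -359, -27, -1], [-37601775, -32672366, 4686444, -226572, 15934,
      -469, -8, 1], [-4665578, -4229718, 438901, 2559, -268, 198, -15, 1], [-284522, -94705,
      157108, -29660, 2822, -213, 14, -1], [-9303, 43071, 43003, -8716, 619, -36], [-3685, 6460,
      7465, -2311, 330, -36, 3], [-1601, 279, 1077, -653, 133, -15, 1], [-416, 4, 198, -172, 43,
      -6, 1], [-89, 21, 51, -43, 13, -2], [-19, 10, 13, -11, 4, -1], [-5, 3, 3, -3, 1], [-1, 1, 1,
      -1]]
  pp :=
    [[], [-30339938, -27872262, 2419070, -38951, 9821, 174, 9], [52272086, 44902642, -7009319,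
      338968, -20496, 673, 10, -2], [8926068, 7736859, -1152175, 35698, -1488, -133, 19, -1],
      [1209782, 747956, -397549, 58811, -5095, 351, -20, 1], [208009, 63215, -121078, 21856, -1749,
      107, -4], [50005, 11468, -30193, 7340, -911, 86, -6], [13107, 2875, -7324, 2460, -403, 42,
      -3], [3348, 483, -1900, 788, -156, 19, -2], [844, 16, -517, 244, -57, 9, -1], [216, -25,
      -141, 75, -20, 4], [57, -13, -38, 23, -7, 1], [15, -5, -10, 7, -2, 1], [4, -2, -3, 2, -1],
      [1, -1, -1, 1]]
  gg :=
    [[17610033893, -58238979, 1317062, -145605, -3680, -260, -28, 1], [5372204842, -489188728,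
      1927742, -698284, -26712, -457, -133, 2], [1246586336, -195608950, 3560259, -266730, -8454,
      209, -55, 3], [301574285, -88568478, 4870753, -243231, 8676, -84, -18, 3], [76012016,
      -34233635, 2927356, -159160, 7740, -142, -10, 2], [19890217, -11965020, 1444985, -105308,
      6400, -275, 5], [5364053, -3968860, 632308, -59736, 4246, -237, 8], [1480773, -1281588,
      254084, -29975, 2543, -173, 9], [416485, -407777, 96281, -13755, 1388, -110, 7], [118989,
      -128609, 35045, -5899, 698, -64, 5], [34454, -40342, 12398, -2402, 328, -34, 3], [10093,
      -12614, 4296, -940, 146, -17, 2], [2986, -3937, 1465, -356, 62, -8, 1], [891, -1228, 494,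
      -132, 25, -4], [268, -383, 165, -48, 10, -2], [81, -120, 55, -17, 4, -1], [25, -37, 18, -6,
      1]]
  la :=
    [[81872209010, 8457042653, 514487793, 33870899, 2365313, 165189, 11751, 841, 60, 4],
      [242730827, 238246673, -3846400, 572342, -68925, -3938, -460, -36, -1], [-640015634,
      -618957681, 19768237, -1179041, 114580, 4070, 197, 32, -1], [-133738425, -131026949, 2825250,
      120028, 10717, 4467, 21, 17], [-18484803, -13373557, 4631022, -444989, 32935, -2192, 107,
      -1], [-2803244, -685762, 1918165, -190421, 8306, -625, -31, 4], [-671699, -83230, 494634,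
      -84884, 8140, -763, 46, -3], [-189694, -37171, 112269, -35259, 4589, -380, 26, -1], [-50020,
      -7529, 27912, -12301, 2046, -211, 19, -1], [-12463, 70, 7699, -3872, 839, -111, 11, -1],
      [-3127, 586, 2143, -1191, 321, -52, 6, -1], [-815, 271, 577, -369, 116, -22, 3], [-219, 97,
      152, -114, 40, -9, 1], [-60, 32, 40, -35, 14, -3, 1], [-17, 11, 10, -11, 5, -1], [-5, 3, 3,
      -3, 2], [-1, 1, 1, -1]]
  al :=
    [[65429, -100, 6], [-108, -188, -67, 12, -1], [4815, 4612, -202, 1], [-711, -523, 177, -11],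
      [-457, -537, -67, 12, -1], [11, 14, -2, -5, 1], [30, 45, 15], [-3, -3], [-3, -5, -2], [0, 1],
      [0, 1]]
  be :=
    [[], [678, 716, 27, -11, 1], [-7623, -7165, 456, -3], [1382, 1009, -350, 23], [1111, 1297, 152,
      -32, 2], [-45, -58, 3, 14, -2], [-102, -154, -54, -1, 2], [17, 19, 1, -2], [16, 24, 10, 2],
      [-3, -4, -1], [-2, -4, -2, -1], [1, 1], [0, 1]]
  ka :=
    [[54666, -2848, -210, 21, -1], [468, 488, 12, -7, 1], [-4380, -4077, 303, -1], [508, 329, -168,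
      12], [612, 738, 104, -21, 1], [-63, -70, 4, 10, -1], [-81, -117, -38, -1, 1], [13, 17, 2,
      -2], [13, 19, 8, 2], [-2, -4, -1], [-2, -3, -2], [0, 1], [0, 1]]
  om :=
    [[79285, -1362, -15, 2], [1398, 1413, 8, -7], [-13505, -12814, 675, -14, 2], [1286, 779, -477,
      30], [2248, 2778, 462, -65, 3], [-255, -276, 21, 37, -5], [-367, -531, -178, -9, 5], [60, 76,
      10, -8, -2], [64, 100, 44, 9, -1], [-13, -19, -5, 1, 1], [-11, -19, -10, -3], [3, 4, 2], [2,
      3, 2, 1]]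
  tn := 21475
  mid := 549755813888
  rad := 549755813888
  A := 4982404
  B₁ := 2678896
  B₂ := 18962802
  e₁ := 1268081
  e₂ := 24329101
  ε := 24362127
  σ := 939118936
  m := 781643939
  R := 57411384

lemma check_direct₀ : direct₀.check = true := by decide +kernel

/-- Direct orbits for `μ ∈ [1/4, 3/8]`. -/
def direct₁ : Slice where
  lay := ⟨14, 11, by norm_num, by norm_num⟩
  dir := false
  rr :=
    [[4525953452, -229642213, -1997455, -121584, -3395, -85, -3], [93370576, 11176017, -849587,
      -21753, -1499, -10, 2], [-71067225, -4422602, 835481, -9804, 509, -19], [-9326937, -753739,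
      120440, 1221, 57, -2], [-89802, 159223, -1282, -1088, 61, -2], [136997, 66008, -2842, -476,
      16], [16586, 7725, -685, -46, 3], [-1050, -431, -146, 13, 1], [-553, -236, -25, 5], [-58,
      -13, -2, 1], [4, 7], [2, 2]]
  pp :=
    [[], [-63135836, -6670685, 654281, 11978, 770, -3, -1], [96497015, 4783823, -1208671, 19347,
      -583, 27], [16549344, 772224, -230373, 1813, -82, 6], [1353275, -278934, -15372, 2482, -115,
      4], [42628, -126806, 1975, 1008, -43, 1], [11735, -25074, 1167, 174, -13, 1], [6993, -3356,
      412, 4, -4], [1918, -540, 118, -6, -1], [346, -161, 29, -2], [52, -49, 7, -1], [9, -12, 2],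
      [2, -2, 1], [1]]
  gg :=
    [[17525802622, -27198980, -66298, -27677, -585, -7, 1], [4636720516, -248850925, -1490231,
      -140111, -3134, -85, -2], [963225013, -90807786, 184420, -45954, -552, 4, 1], [184550573,
      -32298250, 773995, -18638, 452, 2, 1], [34109121, -9972104, 462521, -10090, 325, -5],
      [6377426, -2696329, 190882, -6171, 190, -5], [1238329, -664505, 65673, -3165, 106, -3],
      [248430, -155724, 20127, -1336, 55, -2], [50508, -35808, 5691, -486, 25, -1], [10283, -8189,
      1523, -160, 10], [2097, -1862, 393, -49, 4], [431, -419, 99, -14, 1], [90, -94, 24, -4], [19,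
      -21, 6, -1], [4, -5, 1]]
  la :=
    [[96980075330, 6338868048, 249157141, 10664336, 473829, 21331, 972, 45, 2], [588903732,
      110427037, -947610, -114250, -13825, -590, -16], [-1502824479, -258558278, 4076787, 89633,
      14199, 405, 12], [-317376654, -54248742, 1402517, 85033, 5765, 213, 1], [-25216152, 2920465,
      470449, -23907, 758, -23], [1436159, 3323527, 114857, -19042, -159, -20, 1], [321738, 664271,
      258, -4446, 62, -8], [-91637, 44484, -9926, -334, 89, -3], [-40150, -3627, -3488, 107, 31,
      -1], [-6535, 618, -627, 52, 4], [-416, 812, -71, 15], [10, 232, -14, 4], [-10, 35, -6, 1],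
      [-6, 3, -2], [-2, 0, -1]]
  al :=
    [[65299, -34, 1], [-528, -175, 3, 1], [10975, 1697, -54, -1], [-946, 144, 22, -1], [-1391,
      -336, 6, 1], [-9, -32, -4], [147, 58, 1], [0, 6, 1], [-21, -11, -1], [0, -1], [3, 2], [],
      [-1]]
  be :=
    [[], [1750, 327, -12, -1], [-16676, -2229, 114, 1], [1835, -270, -38, 3], [3306, 760, -21, -3],
      [-26, 74, 12], [-507, -200, -3, 1], [22, -17, -5], [100, 52, 3], [-6, 3, 1], [-21, -14, -1],
      [2, -1], [5, 4]]
  ka :=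
    [[49822, -1820, -11, 2], [1182, 212, -9, -1], [-9377, -1149, 72], [507, -191, -15, 1], [1906,
      463, -11, -2], [-84, 45, 9], [-381, -148, -2, 1], [23, -11, -4], [82, 42, 2], [-6, 2, 1],
      [-18, -12, -1], [1], [4, 3]]
  om :=
    [[77209, -701], [3471, 645, -15, -1], [-30275, -4453, 168, 2], [998, -676, -52, 4], [7483,
      2053, -11, -7], [-314, 203, 40, -1], [-1799, -742, -21, 4], [101, -54, -19], [438, 237, 15,
      -1], [-30, 13, 7], [-107, -72, -7], [8, -3, -2], [27, 21, 3]]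
  tn := 21475
  mid := 1374389534720
  rad := 274877906944
  A := 7134196
  B₁ := 3211407
  B₂ := 27200787
  e₁ := 1029147
  e₂ := 22222992
  ε := 22246810
  σ := 923099707
  m := 742498912
  R := 66506519

lemma check_direct₁ : direct₁.check = true := by decide +kernel

/-- Direct orbits for `μ ∈ [3/8, 7/16]`. -/
def direct₂ : Slice where
  lay := ⟨14, 11, by norm_num, by norm_num⟩
  dir := false
  rr :=
    [[4172497417, -122492365, -822161, -21412, -320, -5], [106649575, 2700311, -280329, -4889, -74,
      2], [-74662396, 194028, 192062, -691, 11, -1], [-9990528, 1585, 33342, 187, -3], [134011,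
      64882, -2081, -60, 2], [220565, 19319, -1580, -35, 1], [25198, 1380, -237, -2], [-2070, -458,
      1, 2], [-938, -124, 6, 1], [-76, -3, 1], [15, 4], [4, 1]]
  pp :=
    [[], [-70526909, -1190258, 199608, 2482, 25, -2], [99340264, -1016883, -264312, 1868, -6, 1],
      [16862126, -285075, -54074, 199, 5, 1], [901414, -159622, 482, 174, -4], [-130321, -46906,
      2247, 67, -2], [-19976, -7434, 538, 6, -1], [3428, -544, 74, -3], [1459, -19, 9, -1], [188,
      -22, 2], [-1, -10, 1], [-3, -2]]
  gg :=
    [[17484422754, -14168364, -86320, -4306, -26, 1], [4256154950, -130791527, -733424, -23262,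
      -293, -4], [827169246, -45443073, -63553, -6392, -10, 2], [138812893, -14035984, 157640,
      -1581, 37, 1], [20783107, -3709028, 96794, -823, 16], [2985555, -843945, 35942, -543, 7],
      [455677, -170026, 10456, -270, 4], [77061, -31762, 2622, -102, 2], [13473, -5825, 599, -32,
      1], [2238, -1090, 129, -9], [347, -207, 27, -2], [53, -38, 6], [9, -7, 1], [2, -1]]
  la :=
    [[107562882998, 4075243249, 93912644, 2350605, 60800, 1596, 42, 1], [749128259, 50205352,
      -709096, -42147, -1503, -21], [-1873797704, -115202782, 1429512, 37665, 1375, 20],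
      [-392299635, -21560718, 627998, 21481, 538, 4], [-19315544, 2607100, 72101, -2108, 23, -1],
      [6630013, 1760272, -17186, -2788, -21], [1270583, 279728, -9497, -517, 1], [-62971, -7950,
      -2243, 67, 4], [-56465, -9680, -296, 49, 1], [-7260, -789, -7, 9], [675, 339, 4], [333, 101,
      -1], [26, 5, -1], [-8, -3], [-2, -1]]
  al :=
    [[65252, -14], [-773, -70, 2], [13309, 675, -16], [-664, 121, 2], [-1859, -136, 4], [-70, -25],
      [234, 28, -1], [12, 6], [-38, -6], [-2, -1], [7, 2], [], [-2]]
  be :=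
    [[], [2182, 113, -6], [-19580, -760, 31], [1316, -217, -4], [4340, 286, -11], [122, 63, 1],
      [-804, -94, 2], [-20, -21, -1], [183, 29], [5, 6], [-45, -9], [-1, -2], [11, 3]]
  ka :=
    [[47079, -912, 3], [1461, 73, -3], [-10830, -358, 18], [182, -122], [2541, 178, -6], [12, 43,
      1], [-600, -69, 2], [-6, -15, -1], [149, 23], [3, 5], [-38, -8], [-1, -2], [10, 2]]
  om :=
    [[76160, -348], [4364, 257, -8], [-36291, -1682, 51, 1], [-160, -437, -2, 1], [10440, 904, -19,
      -1], [125, 202, 5], [-2944, -383, 5, 1], [-50, -82, -4], [832, 143], [19, 31, 2], [-235,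
      -50], [-7, -11, -1], [67, 17]]
  tn := 21475
  mid := 1786706395136
  rad := 137438953472
  A := 9023892
  B₁ := 3610871
  B₂ := 31681461
  e₁ := 974796
  e₂ := 20814669
  ε := 20837483
  σ := 912365186
  m := 715471146
  R := 71977162

lemma check_direct₂ : direct₂.check = true := by decide +kernel

/-- Direct orbits for `μ ∈ [7/16, 1/2]`. -/
def direct₃ : Slice where
  lay := ⟨14, 11, by norm_num, by norm_num⟩
  dir := false
  rr :=
    [[3920055127, -130192352, -1113292, -27395, -434, -7], [109610638, 207592, -343957, -5502, 12,
      7], [-72762972, 1698862, 184184, -671, -9, -1], [-9714464, 275904, 35030, 67, -14, -1],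
      [245255, 45929, -2602, -29, 1], [245463, 5328, -1879, -13, 2], [26034, -545, -238, 2],
      [-2899, -351, 25, 2], [-1113, -47, 12], [-73, 6, 1], [22, 3], [5]]
  pp :=
    [[], [-71213804, 528927, 230170, 2461, -36, -4], [95263034, -3041514, -241659, 1976, 21, 2],
      [15868519, -705824, -50797, 381, 19, 1], [591923, -148417, 2228, 122, -2], [-204090, -26392,
      2811, 26, -3], [-30424, -3001, 555, -3, -1], [2803, -115, 33, -3], [1445, -7, -5, -1], [153,
      -15], [-17, -5, 1], [-6, -1]]
  gg :=
    [[17455228545, -15070062, -139288, -4400, 23, 4], [3987760247, -137861340, -1043387, -28614,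
      -379, -5], [735532413, -46257122, -139461, -6095, 57, 5], [111949942, -12839365, 142799,
      -844, 57, 1], [14111035, -2970077, 88348, -593, 13], [1565735, -580836, 29982, -459, 3],
      [189690, -98386, 7544, -219, 3], [30980, -15194, 1570, -74, 2], [5562, -2340, 293, -20, 1],
      [824, -388, 53, -4], [88, -67, 10, -1], [7, -11, 2], [1, -2]]
  la :=
    [[116567529167, 4958756385, 129222894, 3646788, 106083, 3126, 93, 3], [841956958, 42072005,
      -1371272, -68944, -1786, -2, 1], [-2091050209, -101551778, 2027934, 63228, 1837, 26],
      [-429475801, -15356861, 938259, 30171, 512, -8, -1], [-13601916, 3086401, 47868, -2034, -19,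
      -3], [9903393, 1483722, -52425, -3053, -8, 1], [1734778, 179474, -15476, -463, 7, 1],
      [-93638, -21788, -1130, 116, 2], [-76194, -9507, 352, 56], [-8578, -450, 87, 6], [1366, 346,
      -4, -1], [516, 78, -5], [30, -1, -1], [-14, -3], [-3]]
  al :=
    [[65227, -11], [-890, -46, 4], [14520, 533, -20], [-411, 130], [-2092, -95, 6], [-121, -25],
      [284, 22, -1], [25, 6], [-50, -5], [-5, -2], [10, 1], [1], [-2]]
  be :=
    [[], [2358, 61, -7], [-20840, -498, 35], [867, -228, 1], [4810, 181, -15], [250, 63, -1],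
      [-969, -69, 4], [-65, -23], [235, 23, -1], [19, 8], [-61, -8], [-6, -3], [17, 2]]
  ka :=
    [[45295, -869, 8], [1576, 41, -5], [-11398, -209, 19], [-56, -114, 2], [2840, 119, -8], [101,
      45, -1], [-722, -51, 3], [-40, -18], [192, 19, -1], [14, 7], [-52, -7], [-5, -2], [15, 2]]
  om :=
    [[75469, -343, 1], [4803, 178, -12], [-39216, -1235, 62, 1], [-1023, -418, 7, 1], [12054, 698,
      -32, -1], [552, 220, -1, -1], [-3648, -314, 13, 1], [-235, -100], [1104, 125, -4], [92, 42,
      1], [-334, -47, 1], [-34, -16], [101, 17]]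
  tn := 21475
  mid := 2061584302080
  rad := 137438953472
  A := 13460234
  B₁ := 4700750
  B₂ := 44906570
  e₁ := 1078979
  e₂ := 22532436
  ε := 22558255
  σ := 861732423
  m := 576406136
  R := 100388810

lemma check_direct₃ : direct₃.check = true := by decide +kernel

end LCHill

namespace LCHill

/-- Existence of direct orbits for all mass parameters in `[0, 1/2]`. -/
theorem exists_direct {μ c : ℝ} (hμ : μ ∈ Icc (0 : ℝ) 0.5)
    (hc : c ∈ Icc (2.1 : ℝ) (2.1 + 1 / 1000000)) :
    ∃ T γ, IsClosedOrbit μ c T γ ∧ IsSymmetricOrbit T γ ∧ IsDirect μ γ ∧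
      TransverseNondeg (Kham μ c) T γ ∧ IsMinimalPeriod T γ ∧
      ∃ M, IsLinearizedFlow (Kham μ c) γ M ∧
        CZIndexIs T (reducedMonodromy (Kham μ c) γ M) 5 := by
  obtain ⟨h0, h1⟩ := hμ
  rcases le_total μ (1 / 4) with h | h
  · exact direct₀.exists_orbit check_direct₀ (lo := 0) (hi := 1 / 4) (by norm_num) (by norm_num)
      (by norm_num [direct₀]) (by norm_num [direct₀]) ⟨h0, h⟩ hc
  rcases le_total μ (3 / 8) with h' | h'
  · exact direct₁.exists_orbit check_direct₁ (lo := 1 / 4) (hi := 3 / 8) (by norm_num)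
      (by norm_num) (by norm_num [direct₁]) (by norm_num [direct₁]) ⟨h, h'⟩ hc
  rcases le_total μ (7 / 16) with h'' | h''
  · exact direct₂.exists_orbit check_direct₂ (lo := 3 / 8) (hi := 7 / 16) (by norm_num)
      (by norm_num) (by norm_num [direct₂]) (by norm_num [direct₂]) ⟨h', h''⟩ hc
  · exact direct₃.exists_orbit check_direct₃ (lo := 7 / 16) (hi := 0.5) (by norm_num)
      (by norm_num) (by norm_num [direct₃]) (by norm_num [direct₃]) ⟨h'', h1⟩ hc

/-- Existence of retrograde orbits for all mass parameters in `[0, 1/2]`. -/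
theorem exists_retrograde {μ c : ℝ} (hμ : μ ∈ Icc (0 : ℝ) 0.5)
    (hc : c ∈ Icc (2.1 : ℝ) (2.1 + 1 / 1000000)) :
    ∃ T γ, IsClosedOrbit μ c T γ ∧ IsSymmetricOrbit T γ ∧ IsRetrograde μ γ ∧
      TransverseNondeg (Kham μ c) T γ ∧ IsMinimalPeriod T γ ∧
      ∃ M, IsLinearizedFlow (Kham μ c) γ M ∧
        CZIndexIs T (reducedMonodromy (Kham μ c) γ M) 3 :=
  retrograde.exists_orbit check_retrograde (lo := 0) (hi := 0.5) (by norm_num) (by norm_num)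
    (by norm_num [retrograde]) (by norm_num [retrograde]) hμ hc

end LCHill

end

/-- For every `μ ∈ [0,0.5]` and `c ∈ [2.1, 2.1+10⁻⁶]`, there are a
transversely non-degenerate retrograde symmetric periodic orbit `γʳ` and a transversely
non-degenerate direct symmetric periodic orbit `γᵈ` on `Σ_{μ,c}` whose reduced monodromy
paths over their minimal periods have Conley–Zehnder indices `3` and `5`, respectively. -/
theorem statement10 (μ c : ℝ) (hμ : μ ∈ Set.Icc (0:ℝ) 0.5)
    (hc : c ∈ Set.Icc (2.1:ℝ) (2.1 + 1/1000000)) :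
    ∃ (Tr : ℝ) (γr : ℝ → V4) (Td : ℝ) (γd : ℝ → V4),
      IsClosedOrbit μ c Tr γr ∧ IsSymmetricOrbit Tr γr ∧ IsRetrograde μ γr ∧
      TransverseNondeg (Kham μ c) Tr γr ∧ IsMinimalPeriod Tr γr ∧
      (∃ M : ℝ → Matrix (Fin 4) (Fin 4) ℝ, IsLinearizedFlow (Kham μ c) γr M ∧
        CZIndexIs Tr (reducedMonodromy (Kham μ c) γr M) 3) ∧
      IsClosedOrbit μ c Td γd ∧ IsSymmetricOrbit Td γd ∧ IsDirect μ γd ∧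
      TransverseNondeg (Kham μ c) Td γd ∧ IsMinimalPeriod Td γd ∧
      (∃ M : ℝ → Matrix (Fin 4) (Fin 4) ℝ, IsLinearizedFlow (Kham μ c) γd M ∧
        CZIndexIs Td (reducedMonodromy (Kham μ c) γd M) 5) := by
  obtain ⟨Tr, γr, hr⟩ := LCHill.exists_retrograde hμ hc
  obtain ⟨Td, γd, hd⟩ := LCHill.exists_direct hμ hc
  obtain ⟨r1, r2, r3, r4, r5, r6⟩ := hr
  exact ⟨Tr, γr, Td, γd, r1, r2, r3, r4, r5, r6, hd⟩
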